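/- Every planar graph on k vertices has at most 2^{6.24 k} embeddings in the sphere up to homeomorphism. -/

import Mathlib

noncomputable section

/-- The unit sphere `Σ` in `ℝ³`. -/
abbrev Sphere2 : Type := Metric.sphere (0 : EuclideanSpace ℝ (Fin 3)) 1

/-- `A` is a simple arc on the sphere from `x` to `y`. -/
def IsArc (A : Set Sphere2) (x y : Sphere2) : Prop :=
  ∃ f : ℝ → Sphere2, ContinuousOn f (Set.Icc 0 1) ∧ Set.InjOn f (Set.Icc 0 1) ∧
    f 0 = x ∧ f 1 = y ∧ f '' Set.Icc 0 1 = A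

/-- A plane drawing (planar embedding) of a graph `G` in the sphere `Σ`: vertices are
mapped to distinct points, edges to simple arcs between their end vertices, and arcs
do not cross, except in common end vertices. -/
structure SphereEmbedding {V : Type*} (G : SimpleGraph V) where
  pos : V → Sphere2
  arc : Sym2 V → Set Sphere2
  pos_inj : Function.Injective pos
  arc_isArc : ∀ e ∈ G.edgeSet, ∀ v w : V, e = s(v, w) → IsArc (arc e) (pos v) (pos w)
  arc_vertex : ∀ e ∈ G.edgeSet, ∀ v : V, pos v ∈ arc e → v ∈ e
  arc_inter : ∀ e ∈ G.edgeSet, ∀ e' ∈ G.edgeSet, e ≠ e' →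
    arc e ∩ arc e' ⊆ {x | ∃ v : V, v ∈ e ∧ v ∈ e' ∧ pos v = x}

/-- The point set of the drawing. -/
def SphereEmbedding.image {V : Type*} {G : SimpleGraph V} (D : SphereEmbedding G) :
    Set Sphere2 :=
  Set.range D.pos ∪ ⋃ e ∈ G.edgeSet, D.arc e

/-- A planar graph is a graph that admits a plane drawing. -/
def SimpleGraph.IsPlanar {V : Type*} (G : SimpleGraph V) : Prop :=
  Nonempty (SphereEmbedding G)

/-- A face of a plane drawing: a connected region of `Σ` minus the drawing. -/
def SphereEmbedding.IsFace {V : Type*} {G : SimpleGraph V} (D : SphereEmbedding G)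
    (U : Set Sphere2) : Prop :=
  ∃ x ∈ D.imageᶜ, U = connectedComponentIn D.imageᶜ x

/-- Two plane drawings of the same graph are equivalent (homeomorphic) if some
homeomorphism of the sphere maps vertices, edges (and hence faces) of the first
drawing onto vertices and edges of the second. -/
def SphereEmbedding.EquivEmb {V : Type*} {G : SimpleGraph V}
    (D₁ D₂ : SphereEmbedding G) : Prop :=
  ∃ (φ : Sphere2 ≃ₜ Sphere2) (σ : G ≃g G),
    (∀ v, φ (D₁.pos v) = D₂.pos (σ v)) ∧
    ∀ e ∈ G.edgeSet, φ '' D₁.arc e = D₂.arc (e.map σ)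

/-- `G` is 3-connected: it has at least 4 vertices and deleting any at most two
vertices leaves it connected. -/
def ThreeConnected {V : Type*} [Fintype V] (G : SimpleGraph V) : Prop :=
  4 ≤ Fintype.card V ∧
    ∀ s : Set V, s.ncard ≤ 2 → (((⊤ : G.Subgraph).deleteVerts s).coe).Connected

/-- `G` is maximal planar: planar, and no edge can be added keeping planarity. -/
def IsMaximalPlanar {V : Type*} (G : SimpleGraph V) : Prop :=
  G.IsPlanar ∧ ∀ H : SimpleGraph V, G ≤ H → H.IsPlanar → H = G

open Set Metric Filter Topology

/-- `g` has a continuous logarithm on `K`. -/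
def HasLogOn (g : ℂ → ℂ) (K : Set ℂ) : Prop :=
  ∃ F : ℂ → ℂ, ContinuousOn F K ∧ ∀ z ∈ K, Complex.exp (F z) = g z

lemma HasLogOn.mono {g : ℂ → ℂ} {K L : Set ℂ} (h : HasLogOn g L) (hKL : K ⊆ L) :
    HasLogOn g K := by
  obtain ⟨F, hF, hg⟩ := h
  exact ⟨F, hF.mono hKL, fun z hz => hg z (hKL hz)⟩

lemma HasLogOn.congr {g g' : ℂ → ℂ} {K : Set ℂ} (h : HasLogOn g K) (he : EqOn g g' K) :
    HasLogOn g' K := by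
  obtain ⟨F, hF, hg⟩ := h
  exact ⟨F, hF, fun z hz => (hg z hz).trans (he hz)⟩

lemma HasLogOn.mul {g g' : ℂ → ℂ} {K : Set ℂ} (h : HasLogOn g K) (h' : HasLogOn g' K) :
    HasLogOn (fun z => g z * g' z) K := by
  obtain ⟨F, hF, hg⟩ := h
  obtain ⟨F', hF', hg'⟩ := h'
  refine ⟨fun z => F z + F' z, hF.add hF', fun z hz => ?_⟩
  rw [Complex.exp_add, hg z hz, hg' z hz]

lemma HasLogOn.zpow {g : ℂ → ℂ} {K : Set ℂ} (h : HasLogOn g K) (n : ℤ) :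
    HasLogOn (fun z => g z ^ n) K := by
  obtain ⟨F, hF, hg⟩ := h
  refine ⟨fun z => n * F z, continuousOn_const.mul hF, fun z hz => ?_⟩
  simp only [Complex.exp_int_mul, hg z hz]

lemma HasLogOn.inv {g : ℂ → ℂ} {K : Set ℂ} (h : HasLogOn g K) :
    HasLogOn (fun z => (g z)⁻¹) K := by
  obtain ⟨F, hF, hg⟩ := h
  refine ⟨fun z => - F z, hF.neg, fun z hz => ?_⟩
  simp only [Complex.exp_neg, hg z hz]

lemma HasLogOn.div {g g' : ℂ → ℂ} {K : Set ℂ} (h : HasLogOn g K) (h' : HasLogOn g' K) :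
    HasLogOn (fun z => g z / g' z) K := by
  simpa only [div_eq_mul_inv] using h.mul h'.inv

lemma HasLogOn.ne_zero {g : ℂ → ℂ} {K : Set ℂ} (h : HasLogOn g K) {z : ℂ} (hz : z ∈ K) :
    g z ≠ 0 := by
  obtain ⟨F, -, hg⟩ := h
  rw [← hg z hz]
  exact Complex.exp_ne_zero _

/-- Pulling back a logarithm along a continuous map. -/
lemma HasLogOn.comp {g φ : ℂ → ℂ} {K L : Set ℂ} (h : HasLogOn g K) (hφ : ContinuousOn φ L)
    (hm : MapsTo φ L K) : HasLogOn (g ∘ φ) L := by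
  obtain ⟨F, hF, hg⟩ := h
  exact ⟨F ∘ φ, hF.comp hφ hm, fun z hz => hg _ (hm hz)⟩

lemma hasLogOn_of_slitPlane {g : ℂ → ℂ} {K : Set ℂ} (hg : ContinuousOn g K)
    (h : ∀ z ∈ K, g z ∈ Complex.slitPlane) : HasLogOn g K :=
  ⟨fun z => Complex.log (g z), hg.clog h,
    fun z hz => Complex.exp_log (Complex.slitPlane_ne_zero (h z hz))⟩

/-- A function uniformly close to `1` in the multiplicative sense has a logarithm. -/
lemma hasLogOn_of_norm_sub_lt {g : ℂ → ℂ} {K : Set ℂ} (hg : ContinuousOn g K)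
    (h : ∀ z ∈ K, ‖g z - 1‖ < 1) : HasLogOn g K := by
  refine hasLogOn_of_slitPlane hg fun z hz => Or.inl ?_
  have h1 := (Complex.abs_re_le_norm (g z - 1)).trans_lt (h z hz)
  rw [abs_lt, Complex.sub_re, Complex.one_re] at h1
  linarith [h1.1]

/-- Logarithms exist on convex open sets. -/
lemma hasLogOn_of_convex {g : ℂ → ℂ} {U : Set ℂ} (hU : Convex ℝ U) (hne : U.Nonempty)
    (ho : IsOpen U) (hg : ContinuousOn g U) (h0 : ∀ z ∈ U, g z ≠ 0) : HasLogOn g U := by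
  have hc : IsSimplyConnected U := by
    have := hU.contractibleSpace hne
    rw [IsSimplyConnected]
    infer_instance
  obtain ⟨f, hf, hfg⟩ := Complex.exists_continuousOn_eqOn_exp_comp hc ho hg
    (by rintro ⟨z, hz, h⟩; exact h0 z hz h)
  exact ⟨f, hf, fun z hz => hfg hz⟩

/-- Logarithms exist on retracts of the plane. -/
lemma hasLogOn_of_retract {g r : ℂ → ℂ} {K : Set ℂ} (hr : Continuous r)
    (hm : ∀ z, r z ∈ K) (hid : ∀ z ∈ K, r z = z) (hg : ContinuousOn g K)
    (h0 : ∀ z ∈ K, g z ≠ 0) : HasLogOn g K := by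
  have h1 : HasLogOn (g ∘ r) univ :=
    hasLogOn_of_convex convex_univ univ_nonempty isOpen_univ
      ((hg.comp_continuous hr hm).continuousOn) (fun z _ => h0 _ (hm z))
  exact (h1.mono (subset_univ K)).congr fun z hz => by simp [hid z hz]

/-- Radial retraction onto a closed ball around the origin. -/
noncomputable def radialRetract (R : ℝ) (z : ℂ) : ℂ := ((R / max R ‖z‖ : ℝ) : ℂ) * z

lemma continuous_radialRetract {R : ℝ} (hR : 0 < R) : Continuous (radialRetract R) := by
  unfold radialRetract
  refine (Complex.continuous_ofReal.comp (continuous_const.div (by fun_prop) fun z => ?_)).mul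
    continuous_id
  exact (lt_max_of_lt_left hR).ne'

lemma radialRetract_mem {R : ℝ} (hR : 0 < R) (z : ℂ) :
    radialRetract R z ∈ closedBall (0 : ℂ) R := by
  have hm : 0 < max R ‖z‖ := lt_max_of_lt_left hR
  rw [mem_closedBall_zero_iff, radialRetract, norm_mul, Complex.norm_real, Real.norm_of_nonneg
    (by positivity), div_mul_eq_mul_div, div_le_iff₀ hm]
  exact mul_le_mul_of_nonneg_left (le_max_right _ _) hR.le

lemma radialRetract_eq {R : ℝ} (hR : 0 < R) {z : ℂ} (hz : z ∈ closedBall (0 : ℂ) R) :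
    radialRetract R z = z := by
  rw [mem_closedBall_zero_iff] at hz
  simp [radialRetract, max_eq_left hz, hR.ne']

lemma hasLogOn_closedBall {g : ℂ → ℂ} {R : ℝ} (hR : 0 < R)
    (hg : ContinuousOn g (closedBall 0 R)) (h0 : ∀ z ∈ closedBall (0 : ℂ) R, g z ≠ 0) :
    HasLogOn g (closedBall 0 R) :=
  hasLogOn_of_retract (continuous_radialRetract hR) (radialRetract_mem hR)
    (fun _ => radialRetract_eq hR) hg h0

/-- Two logarithms of the same function on a preconnected set differ by a constant. -/
lemma log_sub_const {F G : ℂ → ℂ} {K : Set ℂ} (hK : IsPreconnected K) (hF : ContinuousOn F K)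
    (hG : ContinuousOn G K) (h : ∀ z ∈ K, Complex.exp (F z) = Complex.exp (G z)) :
    ∃ n : ℤ, ∀ z ∈ K, F z = G z + n * (2 * Real.pi * Complex.I) := by
  rcases K.eq_empty_or_nonempty with rfl | ⟨z₀, hz₀⟩
  · exact ⟨0, by simp⟩
  have key : ∀ z ∈ K, ∃ n : ℤ, F z = G z + n * (2 * Real.pi * Complex.I) := fun z hz =>
    Complex.exp_eq_exp_iff_exists_int.1 (h z hz)
  choose! n hn using key
  have hpi : (2 * Real.pi * Complex.I : ℂ) ≠ 0 := Complex.two_pi_I_ne_zero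
  have hcont : ContinuousOn (fun z => ((F z - G z) / (2 * Real.pi * Complex.I)).re) K :=
    Complex.continuous_re.comp_continuousOn ((hF.sub hG).div_const _)
  have hval : ∀ z ∈ K, ((F z - G z) / (2 * Real.pi * Complex.I)).re = (n z : ℝ) := by
    intro z hz
    rw [hn z hz, add_sub_cancel_left, mul_div_cancel_right₀ _ hpi]
    simp
  have hcn : ContinuousOn n K := by
    have h2 : ContinuousOn (fun z => (n z : ℝ)) K := hcont.congr fun z hz => (hval z hz).symm
    exact (Int.isClosedEmbedding_coe_real.isInducing.continuousOn_iff).2 h2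
  refine ⟨n z₀, fun z hz => ?_⟩
  rw [hn z hz, hK.constant hcn hz hz₀]

/-- Gluing of logarithms over two closed sets with connected intersection. -/
lemma HasLogOn.union {g : ℂ → ℂ} {A B : Set ℂ} (hA : IsClosed A) (hB : IsClosed B)
    (hAB : IsPreconnected (A ∩ B)) (h1 : HasLogOn g A) (h2 : HasLogOn g B) :
    HasLogOn g (A ∪ B) := by
  classical
  obtain ⟨F, hF, hFg⟩ := h1
  obtain ⟨G, hG, hGg⟩ := h2
  obtain ⟨n, hn⟩ := log_sub_const hAB (hF.mono inter_subset_left) (hG.mono inter_subset_right)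
    (fun z hz => (hFg z hz.1).trans (hGg z hz.2).symm)
  set G' : ℂ → ℂ := fun z => G z + n * (2 * Real.pi * Complex.I) with hG'
  have hG'c : ContinuousOn G' B := hG.add continuousOn_const
  have heB : EqOn (A.piecewise F G') G' B := fun z hz => by
    by_cases hzA : z ∈ A
    · rw [piecewise_eq_of_mem _ _ _ hzA, hn z ⟨hzA, hz⟩]
    · rw [piecewise_eq_of_notMem _ _ _ hzA]
  have heA : EqOn (A.piecewise F G') F A := piecewise_eqOn _ _ _
  refine ⟨A.piecewise F G', (hF.congr heA).union_of_isClosed (hG'c.congr heB) hA hB, ?_⟩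
  rintro z (hz | hz)
  · rw [heA hz, hFg z hz]
  · rw [heB hz, hG', Complex.exp_add, hGg z hz, Complex.exp_int_mul_two_pi_mul_I, mul_one]

/-- The identity has no continuous logarithm on a circle around a point of the ball. -/
lemma not_hasLogOn_sphere {p : ℂ} (hp : ‖p‖ < 1) : ¬ HasLogOn (fun z => z - p) (sphere 0 1) := by
  intro h
  have h1 : HasLogOn (fun z : ℂ => z) (sphere 0 1) := by
    have h2 : HasLogOn (fun z : ℂ => z / (z - p)) (sphere 0 1) := by
      have h3 : HasLogOn (fun z : ℂ => (z - p) / z) (sphere 0 1) := by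
        refine hasLogOn_of_norm_sub_lt ?_ fun z hz => ?_
        · refine (by fun_prop : ContinuousOn (fun z : ℂ => z - p) _).div continuousOn_id ?_
          intro z hz; exact ne_zero_of_mem_unit_sphere ⟨z, hz⟩
        · have hz0 : z ≠ 0 := ne_zero_of_mem_unit_sphere ⟨z, hz⟩
          rw [mem_sphere_zero_iff_norm] at hz
          rw [sub_div, div_self hz0, sub_sub_cancel_left, norm_neg, norm_div, hz, div_one]
          exact hp
      exact h3.inv.congr fun z _ => by simp
    refine (h2.mul h).congr fun z hz => ?_
    exact div_mul_cancel₀ _ (h.ne_zero hz)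
  obtain ⟨F, hF, hFg⟩ := h1
  have hm : ∀ t : ℝ, Complex.exp (t * Complex.I) ∈ sphere (0 : ℂ) 1 := fun t => by
    rw [mem_sphere_zero_iff_norm, Complex.norm_exp_ofReal_mul_I]
  have hc : Continuous fun t : ℝ => F (Complex.exp (t * Complex.I)) :=
    hF.comp_continuous (by fun_prop) hm
  have hx : ContinuousOn (fun z : ℂ => F (Complex.exp (z.re * Complex.I))) univ :=
    (hc.comp Complex.continuous_re).continuousOn
  obtain ⟨n, hn⟩ := log_sub_const (isPreconnected_univ) hx
    (G := fun z : ℂ => z.re * Complex.I) (by fun_prop) (fun z _ => hFg _ (hm _))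
  have e0 := hn 0 trivial
  have e1 := hn ((2 * Real.pi : ℝ) : ℂ) trivial
  rw [Complex.ofReal_re, show ((2 * Real.pi : ℝ) : ℂ) * Complex.I = 2 * Real.pi * Complex.I by
    push_cast; ring, Complex.exp_two_pi_mul_I] at e1
  simp only [Complex.zero_re, Complex.ofReal_zero, zero_mul, Complex.exp_zero] at e0
  rw [e0] at e1
  exact Complex.two_pi_I_ne_zero (by linear_combination -e1)

/-- Tietze extension for complex functions on closed sets. -/
lemma exists_continuous_eqOn {F : ℂ → ℂ} {K : Set ℂ} (hK : IsClosed K) (hF : ContinuousOn F K) :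
    ∃ G : ℂ → ℂ, Continuous G ∧ EqOn G F K := by
  obtain ⟨g, hg⟩ := ContinuousMap.exists_restrict_eq hK
    ⟨_, continuousOn_iff_continuous_domRestrict.1 hF⟩
  refine ⟨g, g.continuous, fun z hz => ?_⟩
  exact DFunLike.congr_fun hg ⟨z, hz⟩

/-- If `p`, `q` lie in a connected set avoiding `K`, then `(z - p) / (z - q)` has a logarithm
on `K`. -/
lemma hasLogOn_div_of_preconnected {K C : Set ℂ} (hK : IsClosed K) (hC : IsPreconnected C)
    (hCK : Disjoint C K) {p q : ℂ} (hp : p ∈ C) (hq : q ∈ C) :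
    HasLogOn (fun z => (z - p) / (z - q)) K := by
  have hne : ∀ c ∈ C, ∀ z ∈ K, z - c ≠ 0 := fun c hc z hz h =>
    disjoint_left.1 hCK hc (by rwa [← sub_eq_zero.1 h])
  refine hC.induction₂ (fun p q => HasLogOn (fun z => (z - p) / (z - q)) K) ?_ ?_ ?_ hp hq
  · intro x hx
    obtain ⟨ε, hε, hb⟩ := Metric.isOpen_iff.1 hK.isOpen_compl x (disjoint_left.1 hCK hx)
    filter_upwards [self_mem_nhdsWithin, mem_nhdsWithin_of_mem_nhds (ball_mem_nhds x hε)]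
      with y hy hyb
    suffices h : HasLogOn (fun z => (z - y) / (z - x)) K from h.inv.congr fun z _ => by simp
    refine hasLogOn_of_norm_sub_lt ?_ fun z hz => ?_
    · exact (by fun_prop : ContinuousOn (fun z : ℂ => z - y) _).div (by fun_prop) (hne x hx)
    · have h0 := hne x hx z hz
      have hzx : ε ≤ ‖z - x‖ := by
        by_contra! hlt
        exact hb (mem_ball_iff_norm.2 hlt) hz
      rw [div_sub_one h0, norm_div, div_lt_one (norm_pos_iff.2 h0)]
      refine lt_of_lt_of_le ?_ hzx
      rw [sub_sub_sub_cancel_left, ← dist_eq_norm, dist_comm]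
      exact hyb
  · intro x y z hx hy hz h1 h2
    exact (h1.mul h2).congr fun w hw => div_mul_div_cancel₀ (hne y hy w hw)
  · intro x y _ _ h
    exact h.inv.congr fun z _ => by simp

lemma hasLogOn_sub_of_far {K : Set ℂ} {q : ℂ} {R : ℝ} (hR : ∀ z ∈ K, ‖z‖ ≤ R) (hq : R < ‖q‖)
    (hq0 : q ≠ 0) : HasLogOn (fun z => z - q) K := by
  have h1 : HasLogOn (fun z => 1 - z / q) K := by
    refine hasLogOn_of_norm_sub_lt (by fun_prop) fun z hz => ?_
    rw [sub_sub_cancel_left, norm_neg, norm_div, div_lt_one (norm_pos_iff.2 hq0)]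
    exact (hR z hz).trans_lt hq
  have h2 : HasLogOn (fun _ => -q) K :=
    ⟨fun _ => Complex.log (-q), continuousOn_const, fun _ _ => Complex.exp_log (neg_ne_zero.2 hq0)⟩
  refine (h2.mul h1).congr fun z _ => ?_
  field_simp
  ring

lemma hasLogOn_sub_of_unbounded {K C : Set ℂ} (hK : IsCompact K) (hC : IsPreconnected C)
    (hCK : Disjoint C K) (hub : ¬ Bornology.IsBounded C) {p : ℂ} (hp : p ∈ C) :
    HasLogOn (fun z => z - p) K := by
  obtain ⟨R, hR0, hR⟩ := hK.isBounded.exists_pos_norm_le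
  obtain ⟨q, hq, hqR⟩ : ∃ q ∈ C, R < ‖q‖ := by
    by_contra! h
    exact hub ((isBounded_iff_forall_norm_le).2 ⟨R, h⟩)
  have hq0 : q ≠ 0 := norm_pos_iff.1 (hR0.trans hqR)
  have h1 := hasLogOn_sub_of_far hR hqR hq0
  refine ((hasLogOn_div_of_preconnected hK.isClosed hC hCK hp hq).mul h1).congr fun z hz => ?_
  exact div_mul_cancel₀ _ (h1.ne_zero hz)

lemma not_hasLogOn_sphere_of_lt {p : ℂ} {R : ℝ} (hp : ‖p‖ < R) :
    ¬ HasLogOn (fun z => z - p) (sphere 0 R) := by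
  intro h
  have hR : 0 < R := (norm_nonneg p).trans_lt hp
  have hRC : (R : ℂ) ≠ 0 := by exact_mod_cast hR.ne'
  have h1 := h.comp (φ := fun z => R * z) (L := sphere 0 1) (by fun_prop) fun z hz => by
    rw [mem_sphere_zero_iff_norm] at hz ⊢
    rw [norm_mul, hz, mul_one, Complex.norm_real, Real.norm_of_nonneg hR.le]
  have h2 : HasLogOn (fun _ => (R : ℂ)⁻¹) (sphere 0 1) :=
    ⟨fun _ => Complex.log (R : ℂ)⁻¹, continuousOn_const,
      fun _ _ => Complex.exp_log (inv_ne_zero hRC)⟩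
  refine not_hasLogOn_sphere (p := p / R) ?_ ((h2.mul h1).congr fun z _ => ?_)
  · rw [norm_div, Complex.norm_real, Real.norm_of_nonneg hR.le, div_lt_one hR]
    exact hp
  · simp only [Function.comp_apply]
    field_simp

/-- If a bounded open set with frontier in `K` contains `p` but not `q`, then
`(z - p) / (z - q)` has no logarithm on `K`. -/
lemma not_hasLogOn_div {K U : Set ℂ} (hK : IsClosed K)
    (hb : Bornology.IsBounded U) (hfr : frontier U ⊆ K) {p q : ℂ} (hp : p ∈ U) (hqU : q ∉ U) :
    ¬ HasLogOn (fun z => (z - p) / (z - q)) K := by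
  classical
  rintro hlog
  have hqK : q ∉ K := fun h => by
    have := hlog.ne_zero h
    simp at this
  obtain ⟨F, hF, hFg⟩ := hlog
  obtain ⟨F', hF'c, hF'⟩ := exists_continuous_eqOn hK hF
  set G : ℂ → ℂ := U.piecewise (fun z => (z - q) * Complex.exp (F' z)) (fun z => z - p) with hG
  have hGc : Continuous G := by
    refine continuous_piecewise ?_ ?_ ?_
    · grind
    · fun_prop
    · fun_prop
  have hG0 : ∀ z, G z ≠ 0 := by
    intro z
    by_cases hz : z ∈ U
    · rw [hG, piecewise_eq_of_mem _ _ _ hz]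
      refine mul_ne_zero (sub_ne_zero.2 ?_) (Complex.exp_ne_zero _)
      rintro rfl; exact hqU hz
    · rw [hG, piecewise_eq_of_notMem _ _ _ hz]
      refine sub_ne_zero.2 ?_
      rintro rfl; exact hz hp
  have hGlog : HasLogOn G univ := hasLogOn_of_convex convex_univ univ_nonempty isOpen_univ
    hGc.continuousOn (fun z _ => hG0 z)
  obtain ⟨R, hR0, hR⟩ := hb.exists_pos_norm_le
  have hpR : ‖p‖ < R + 1 := (hR p hp).trans_lt (lt_add_one R)
  refine not_hasLogOn_sphere_of_lt hpR ((hGlog.mono (subset_univ _)).congr fun z hz => ?_)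
  rw [hG, piecewise_eq_of_notMem]
  intro hzU
  have := hR z hzU
  rw [mem_sphere_zero_iff_norm] at hz
  linarith

/-- Janiszewski's theorem: two closed sets with connected intersection, neither of which
separates `p` and `q`, do not separate them together. -/
lemma janiszewski {A B U C C' : Set ℂ} (hA : IsClosed A) (hB : IsClosed B)
    (hAB : IsPreconnected (A ∩ B)) (hC : IsPreconnected C) (hCA : Disjoint C A)
    (hC' : IsPreconnected C') (hCB : Disjoint C' B) {p q : ℂ} (hp : p ∈ C) (hq : q ∈ C)
    (hp' : p ∈ C') (hq' : q ∈ C') (hb : Bornology.IsBounded U)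
    (hfr : frontier U ⊆ A ∪ B) (hpU : p ∈ U) : q ∈ U := by
  by_contra hqU
  exact not_hasLogOn_div (hA.union hB) hb hfr hpU hqU
    (HasLogOn.union hA hB hAB (hasLogOn_div_of_preconnected hA hC hCA hp hq)
      (hasLogOn_div_of_preconnected hB hC' hCB hp' hq'))

/-- Continuous functions on compact sets are approximated by globally differentiable ones. -/
lemma exists_differentiable_approx {K : Set ℂ} (hK : IsCompact K) {g : ℂ → ℂ}
    (hg : ContinuousOn g K) {ε : ℝ} (hε : 0 < ε) :
    ∃ P : ℂ → ℂ, Differentiable ℝ P ∧ ∀ z ∈ K, ‖P z - g z‖ < ε := by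
  have : CompactSpace K := isCompact_iff_compactSpace.1 hK
  set f : C(K, ℂ) := ⟨_, continuousOn_iff_continuous_domRestrict.1 hg⟩ with hf
  have hmem : f ∈ (polynomialFunctions K).starClosure.topologicalClosure := by
    rw [polynomialFunctions.starClosure_topologicalClosure]; trivial
  rw [← SetLike.mem_coe, StarSubalgebra.topologicalClosure_coe, Metric.mem_closure_iff] at hmem
  obtain ⟨b, hb, hfb⟩ := hmem ε hε
  have key : ∃ P : ℂ → ℂ, Differentiable ℝ P ∧ ∀ z : K, P z = b z := by
    clear hfb
    rw [SetLike.mem_coe, polynomialFunctions.starClosure_eq_adjoin_X] at hb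
    induction hb using Algebra.adjoin_induction with
    | mem f hf =>
      push _ ∈ _ at hf
      rw [star_eq_iff_star_eq, eq_comm (b := f)] at hf
      obtain (rfl | rfl) := hf
      · exact ⟨id, differentiable_id, fun z => by simp⟩
      · exact ⟨fun z => (starRingEnd ℂ) z, Complex.conjCLE.differentiable, fun z => by simp⟩
    | algebraMap r => exact ⟨fun _ => r, differentiable_const _, fun z => by simp⟩
    | add _ _ _ _ hf hg =>
      obtain ⟨P, hP, h1⟩ := hf
      obtain ⟨Q, hQ, h2⟩ := hg
      exact ⟨fun z => P z + Q z, hP.add hQ, fun z => by simp [h1, h2]⟩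
    | mul _ _ _ _ hf hg =>
      obtain ⟨P, hP, h1⟩ := hf
      obtain ⟨Q, hQ, h2⟩ := hg
      exact ⟨fun z => P z * Q z, hP.mul hQ, fun z => by simp [h1, h2]⟩
  obtain ⟨P, hP, hPb⟩ := key
  refine ⟨P, hP, fun z hz => ?_⟩
  have h1 := (ContinuousMap.dist_lt_iff hε).1 hfb ⟨z, hz⟩
  rw [hPb ⟨z, hz⟩, ← dist_eq_norm, dist_comm]
  exact h1

/-- A regular value exists arbitrarily close to zero, and its fibre consists of isolated points. -/
lemma exists_regular_value {P : ℂ → ℂ} (hP : Differentiable ℝ P) {ε : ℝ} (hε : 0 < ε) :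
    ∃ c : ℂ, ‖c‖ < ε ∧ ∀ z, P z = c → ∀ᶠ w in 𝓝[≠] z, P w ≠ c := by
  set s : Set ℂ := {z | (fderiv ℝ P z).det = 0} with hs
  have hnull : MeasureTheory.volume (P '' s) = 0 :=
    MeasureTheory.addHaar_image_eq_zero_of_det_fderivWithin_eq_zero _
      (fun x _ => (hP x).hasFDerivAt.hasFDerivWithinAt) (fun x hx => hx)
  have hball : MeasureTheory.volume (ball (0 : ℂ) ε) ≠ 0 := (measure_ball_pos _ _ hε).ne'
  obtain ⟨c, hc, hcs⟩ : ∃ c ∈ ball (0 : ℂ) ε, c ∉ P '' s := by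
    by_contra! h
    exact hball (MeasureTheory.measure_mono_null h hnull)
  refine ⟨c, by simpa using hc, fun z hz => ?_⟩
  have hdet : (fderiv ℝ P z).det ≠ 0 := fun h => hcs ⟨z, h, hz⟩
  have hinj : LinearMap.ker (fderiv ℝ P z : ℂ →ₗ[ℝ] ℂ) = ⊥ := by
    exact (LinearMap.isUnit_iff_ker_eq_bot _).1 ((LinearMap.isUnit_iff_isUnit_det _).2
      (isUnit_iff_ne_zero.2 hdet))
  obtain ⟨k, -, hk⟩ := LinearMap.exists_antilipschitzWith _ hinj
  exact (hP z).hasFDerivAt.eventually_ne ⟨k, hk⟩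

/-- A nonvanishing function on a punctured disc is a power times an exponential. -/
lemma exists_zpow_mul_exp {q : ℂ → ℂ} {p : ℂ} {r : ℝ} (hr : 0 < r)
    (hq : ContinuousOn q (ball p r \ {p})) (h0 : ∀ z ∈ ball p r \ {p}, q z ≠ 0) :
    ∃ (n : ℤ) (h : ℂ → ℂ), ContinuousOn h (ball p r \ {p}) ∧
      ∀ z ∈ ball p r \ {p}, q z = (z - p) ^ n * Complex.exp (h z) := by
  set W : Set ℂ := {w | w.re < Real.log r} with hW
  have hWo : IsOpen W := isOpen_lt Complex.continuous_re continuous_const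
  have hWc : Convex ℝ W := convex_halfSpace_re_lt _
  have hWn : W.Nonempty := ⟨((Real.log r - 1 : ℝ) : ℂ), by simp [hW]⟩
  have hmap : MapsTo (fun w => p + Complex.exp w) W (ball p r \ {p}) := by
    intro w hw
    refine ⟨?_, by simp [Complex.exp_ne_zero]⟩
    rw [mem_ball_iff_norm, add_sub_cancel_left, Complex.norm_exp]
    exact (Real.lt_log_iff_exp_lt hr).1 hw
  obtain ⟨H, hH, hHq⟩ := hasLogOn_of_convex (g := fun w => q (p + Complex.exp w)) hWc hWn hWo
    (hq.comp (by fun_prop) hmap) (fun w hw => h0 _ (hmap hw))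
  have hshift : ∀ w ∈ W, w + 2 * Real.pi * Complex.I ∈ W := fun w hw => by
    simpa [hW] using hw
  obtain ⟨n, hn⟩ := log_sub_const hWc.isPreconnected
    (F := fun w => H (w + 2 * Real.pi * Complex.I)) (G := H)
    (hH.comp (by fun_prop) hshift) hH (fun w hw => by
      rw [hHq _ (hshift w hw), hHq _ hw]
      simp only [Complex.exp_periodic w])
  set k : ℂ → ℂ := fun w => H w - n * w with hk
  have hper : ∀ w ∈ W, k (w + 2 * Real.pi * Complex.I) = k w := fun w hw => by
    simp only [hk, hn w hw]; ring
  have hperN : ∀ m : ℕ, ∀ w ∈ W, k (w + m * (2 * Real.pi * Complex.I)) = k w ∧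
      w + m * (2 * Real.pi * Complex.I) ∈ W := by
    intro m w hw
    induction m with
    | zero => simpa using hw
    | succ m ih =>
      have e : w + ((m + 1 : ℕ) : ℂ) * (2 * Real.pi * Complex.I)
        = (w + m * (2 * Real.pi * Complex.I)) + 2 * Real.pi * Complex.I := by push_cast; ring
      rw [e]
      exact ⟨(hper _ ih.2).trans ih.1, hshift _ ih.2⟩
  have hinv : ∀ w ∈ W, ∀ w' ∈ W, Complex.exp w = Complex.exp w' → k w = k w' := by
    intro w hw w' hw' he
    obtain ⟨m, hm⟩ := Complex.exp_eq_exp_iff_exists_int.1 he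
    obtain ⟨j, rfl | rfl⟩ := Int.eq_nat_or_neg m
    · rw [hm]; exact (hperN j w' hw').1
    · have : w' = w + j * (2 * Real.pi * Complex.I) := by rw [hm]; push_cast; ring
      rw [this]; exact (hperN j w hw).1.symm
  have hlogW : ∀ z ∈ ball p r \ {p}, Complex.log (z - p) ∈ W := fun z hz => by
    have hz0 : z - p ≠ 0 := sub_ne_zero.2 hz.2
    simp only [hW, Set.mem_ofPred_eq, Complex.log_re]
    exact Real.log_lt_log (norm_pos_iff.2 hz0) (mem_ball_iff_norm.1 hz.1)
  refine ⟨n, fun z => k (Complex.log (z - p)), ?_, ?_⟩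
  · intro z hz
    have hz0 : z - p ≠ 0 := sub_ne_zero.2 hz.2
    set L : ℂ → ℂ := fun w => Complex.log ((w - p) / (z - p)) + Complex.log (z - p) with hL
    have hLc : ContinuousAt L z := by
      refine ContinuousAt.add ?_ continuousAt_const
      refine ContinuousAt.clog (by fun_prop) ?_
      rw [div_self hz0]; exact Complex.one_mem_slitPlane
    have hLexp : ∀ w ∈ ball p r \ {p}, Complex.exp (L w) = w - p := fun w hw => by
      have hw0 : w - p ≠ 0 := sub_ne_zero.2 hw.2
      rw [hL, Complex.exp_add, Complex.exp_log (div_ne_zero hw0 hz0), Complex.exp_log hz0,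
        div_mul_cancel₀ _ hz0]
    have hLW : ∀ w ∈ ball p r \ {p}, L w ∈ W := fun w hw => by
      have h1 := hLexp w hw
      have h2 : Real.exp (L w).re < r := by
        rw [← Complex.norm_exp, h1]; exact mem_ball_iff_norm.1 hw.1
      exact (Real.lt_log_iff_exp_lt hr).2 h2
    have hkc : ContinuousOn k W := hH.sub (by fun_prop)
    have h3 : ContinuousWithinAt (fun w => k (L w)) (ball p r \ {p}) z :=
      (hkc _ (hLW z hz)).comp hLc.continuousWithinAt hLW
    refine h3.congr (fun w hw => ?_) ?_
    · exact hinv _ (hlogW w hw) _ (hLW w hw) (by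
        rw [hLexp w hw, Complex.exp_log (sub_ne_zero.2 hw.2)])
    · exact hinv _ (hlogW z hz) _ (hLW z hz) (by
        rw [hLexp z hz, Complex.exp_log (sub_ne_zero.2 hz.2)])
  · intro z hz
    have hz0 : z - p ≠ 0 := sub_ne_zero.2 hz.2
    have h1 := hHq _ (hlogW z hz)
    simp only [Complex.exp_log hz0, add_sub_cancel] at h1
    simp only [hk, Complex.exp_sub, Complex.exp_int_mul, Complex.exp_log hz0, h1]
    rw [mul_div_cancel₀ _ (zpow_ne_zero n hz0)]

/-- Removing one zero of a continuous function. -/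
lemma exists_remove_zero {q : ℂ → ℂ} {U C : Set ℂ} (hU : IsOpen U) (hC : IsClosed C)
    (hq : ContinuousOn q U) {p : ℂ} (hp : p ∈ U) (hpC : p ∉ C)
    (hiso : ∀ᶠ w in 𝓝[≠] p, q w ≠ 0) :
    ∃ (n : ℤ) (q₁ : ℂ → ℂ), ContinuousOn q₁ U ∧ (∀ z ∈ U, q₁ z = 0 → q z = 0 ∧ z ≠ p) ∧
      ∀ z ∈ C, q₁ z = q z / (z - p) ^ n := by
  classical
  obtain ⟨r, hr, hrb⟩ : ∃ r > 0, ball p r ⊆ {w | (w ≠ p → q w ≠ 0) ∧ w ∈ U ∧ w ∉ C} := by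
    refine Metric.mem_nhds_iff.1 ?_
    filter_upwards [eventually_nhdsWithin_iff.1 hiso, hU.mem_nhds hp,
      hC.isOpen_compl.mem_nhds hpC] with w h1 h2 h3
    exact ⟨fun h => h1 h, h2, h3⟩
  obtain ⟨n, h, hh, hqh⟩ := exists_zpow_mul_exp (q := q) hr
    (hq.mono fun z hz => (hrb hz.1).2.1) (fun z hz => (hrb hz.1).1 hz.2)
  set χ : ℂ → ℝ := fun z => max 0 (min 1 (3 * ‖z - p‖ / r - 1)) with hχ
  have hχc : Continuous χ := by fun_prop
  have hχ0 : ∀ z ∈ ball p (r / 3), χ z = 0 := fun z hz => by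
    rw [mem_ball_iff_norm] at hz
    have : 3 * ‖z - p‖ / r - 1 ≤ 0 := by
      rw [sub_nonpos, div_le_one hr]; linarith
    simp only [hχ]
    rw [max_eq_left]
    exact (min_le_right _ _).trans this
  have hχ1 : ∀ z, 2 * r / 3 ≤ ‖z - p‖ → χ z = 1 := fun z hz => by
    have : 1 ≤ 3 * ‖z - p‖ / r - 1 := by
      rw [le_sub_iff_add_le, le_div_iff₀ hr]; linarith
    simp only [hχ]
    rw [min_eq_left this, max_eq_right zero_le_one]
  have hkc : ContinuousOn (fun z => (χ z : ℂ) * h z) (ball p r) := by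
    intro z hz
    by_cases hzp : z = p
    · subst hzp
      refine ContinuousAt.continuousWithinAt ?_
      have : (fun z => (χ z : ℂ) * h z) =ᶠ[𝓝 z] fun _ => 0 := by
        filter_upwards [ball_mem_nhds z (by positivity : 0 < r / 3)] with w hw
        rw [hχ0 w hw]; simp
      exact continuousAt_const.congr this.symm
    · have : ball p r \ {p} ∈ 𝓝 z := (isOpen_ball.sdiff isClosed_singleton).mem_nhds ⟨hz, hzp⟩
      exact ((Complex.continuous_ofReal.comp hχc).continuousAt.mul
        (hh.continuousAt this)).continuousWithinAt
  set q₁ : ℂ → ℂ := (ball p r).piecewise (fun z => Complex.exp (χ z * h z))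
    (fun z => q z / (z - p) ^ n) with hq₁
  have hin : ∀ z ∈ ball p r, q₁ z = Complex.exp (χ z * h z) := fun z hz =>
    piecewise_eq_of_mem _ _ _ hz
  have hout : ∀ z, 2 * r / 3 ≤ ‖z - p‖ → q₁ z = q z / (z - p) ^ n := fun z hz => by
    by_cases hzb : z ∈ ball p r
    · have hz0 : z - p ≠ 0 := norm_pos_iff.1 (lt_of_lt_of_le (by positivity) hz)
      rw [hin z hzb, hχ1 z hz, hqh z ⟨hzb, sub_ne_zero.1 hz0⟩,
        mul_div_cancel_left₀ _ (zpow_ne_zero n hz0)]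
      simp
    · exact piecewise_eq_of_notMem _ _ _ hzb
  refine ⟨n, q₁, ?_, ?_, ?_⟩
  · intro z hz
    by_cases hzb : z ∈ ball p r
    · refine ContinuousAt.continuousWithinAt ?_
      have hbn : ball p r ∈ 𝓝 z := isOpen_ball.mem_nhds hzb
      have : q₁ =ᶠ[𝓝 z] fun z => Complex.exp (χ z * h z) := by
        filter_upwards [hbn] with w hw using hin w hw
      exact (hkc.continuousAt hbn).cexp.congr this.symm
    · have hlt : 2 * r / 3 < ‖z - p‖ := by
        rw [mem_ball_iff_norm, not_lt] at hzb; linarith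
      have hz0 : z - p ≠ 0 := norm_pos_iff.1 (lt_trans (by positivity) hlt)
      have : q₁ =ᶠ[𝓝[U] z] fun z => q z / (z - p) ^ n := by
        refine eventually_nhdsWithin_of_eventually_nhds ?_
        have hc : ContinuousAt (fun w => ‖w - p‖) z := by fun_prop
        filter_upwards [hc.eventually (lt_mem_nhds hlt)] with w hw using hout w hw.le
      refine ContinuousWithinAt.congr_of_eventuallyEq ?_ this (hout z hlt.le)
      exact (hq z hz).div ((by fun_prop : ContinuousWithinAt (fun z => z - p) U z).zpow₀ n
        (Or.inl hz0)) (zpow_ne_zero n hz0)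
  · intro z _ hz0
    by_cases hzb : z ∈ ball p r
    · rw [hin z hzb] at hz0; exact absurd hz0 (Complex.exp_ne_zero _)
    · have hlt : 2 * r / 3 < ‖z - p‖ := by
        rw [mem_ball_iff_norm, not_lt] at hzb; linarith
      have hzp : z - p ≠ 0 := norm_pos_iff.1 (lt_trans (by positivity) hlt)
      rw [hout z hlt.le, div_eq_zero_iff, or_iff_left (zpow_ne_zero n hzp)] at hz0
      exact ⟨hz0, sub_ne_zero.1 hzp⟩
  · intro z hz
    exact piecewise_eq_of_notMem _ _ _ fun hb => (hrb hb).2.2 hz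

lemma hasLogOn_of_finite_zeros {R : ℝ} (hR : 0 < R) {C : Set ℂ} (hC : IsClosed C)
    (hCR : C ⊆ ball 0 R) (Z : Finset ℂ) : ∀ q : ℂ → ℂ, ContinuousOn q (ball 0 R) →
    (∀ z ∈ ball (0 : ℂ) R, q z = 0 → z ∈ Z ∧ HasLogOn (fun w => w - z) C) → HasLogOn q C := by
  classical
  induction Z using Finset.induction_on with
  | empty =>
    intro q hq h
    exact (hasLogOn_of_convex (convex_ball _ _) (nonempty_ball.2 hR) isOpen_ball hq
      (fun z hz h0 => by simpa using (h z hz h0).1)).mono hCR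
  | insert p Z hpZ ih =>
    intro q hq h
    by_cases hp : p ∈ ball (0 : ℂ) R ∧ q p = 0
    · obtain ⟨hpR, hp0⟩ := hp
      have hlog := (h p hpR hp0).2
      have hpC : p ∉ C := fun hpC => by simpa using hlog.ne_zero hpC
      have hiso : ∀ᶠ w in 𝓝[≠] p, q w ≠ 0 := by
        have hfin : ((Z : Set ℂ))ᶜ ∈ 𝓝 p := Z.finite_toSet.isClosed.isOpen_compl.mem_nhds hpZ
        filter_upwards [mem_nhdsWithin_of_mem_nhds (isOpen_ball.mem_nhds hpR),
          mem_nhdsWithin_of_mem_nhds hfin, self_mem_nhdsWithin] with w h1 h2 h3 h4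
        rcases Finset.mem_insert.1 (h w h1 h4).1 with h5 | h5
        · exact h3 h5
        · exact h2 h5
      obtain ⟨n, q₁, hq₁, hz, hqC⟩ := exists_remove_zero isOpen_ball hC hq hpR hpC hiso
      have h1 : HasLogOn q₁ C := ih q₁ hq₁ fun z hzR hz0 => by grind
      refine (h1.mul (hlog.zpow n)).congr fun z hz => ?_
      simp only [hqC z hz]
      exact div_mul_cancel₀ _ ((hlog.zpow n).ne_zero hz)
    · grind

/-- If every `z - p` with `p ∉ K` has a logarithm on `C ⊆ K`, then so does every
nonvanishing continuous function on `K`. -/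
theorem hasLogOn_of_forall_sub {K C : Set ℂ} (hK : IsCompact K) (hC : IsClosed C) (hCK : C ⊆ K)
    (h : ∀ p ∉ K, HasLogOn (fun z => z - p) C) {g : ℂ → ℂ} (hg : ContinuousOn g K)
    (h0 : ∀ z ∈ K, g z ≠ 0) : HasLogOn g C := by
  rcases C.eq_empty_or_nonempty with rfl | hne
  · exact ⟨0, by simp, by simp⟩
  obtain ⟨z₀, hz₀, hmin⟩ := hK.exists_isMinOn (hne.mono hCK) hg.norm
  set m := ‖g z₀‖ with hm
  have hmpos : 0 < m := norm_pos_iff.2 (h0 z₀ hz₀)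
  have hmle : ∀ z ∈ K, m ≤ ‖g z‖ := fun z hz => hmin hz
  obtain ⟨P, hP, hPg⟩ := exists_differentiable_approx hK hg (half_pos hmpos)
  obtain ⟨c, hc, hiso⟩ := exists_regular_value hP (half_pos hmpos)
  obtain ⟨R, hR0, hR⟩ := hK.isBounded.exists_pos_norm_lt
  set q : ℂ → ℂ := fun z => P z - c with hqdef
  have hqc : Continuous q := hP.continuous.sub continuous_const
  have hclose : ∀ z ∈ K, ‖q z - g z‖ < ‖g z‖ := fun z hz => by
    calc ‖q z - g z‖ = ‖(P z - g z) - c‖ := by rw [hqdef]; ring_nf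
      _ ≤ ‖P z - g z‖ + ‖c‖ := norm_sub_le _ _
      _ < m / 2 + m / 2 := add_lt_add (hPg z hz) hc
      _ = m := add_halves m
      _ ≤ ‖g z‖ := hmle z hz
  have hfin : {z ∈ closedBall (0 : ℂ) R | q z = 0}.Finite := by
    by_contra hinf
    obtain ⟨z, -, hz⟩ := Set.Infinite.exists_accPt_of_subset_isCompact hinf
      (isCompact_closedBall (0 : ℂ) R) (fun z hz => hz.1)
    have hclosed : IsClosed {z | q z = 0} := isClosed_eq hqc continuous_const
    have hfr := accPt_iff_frequently_nhdsNE.1 hz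
    have hz0 : q z = 0 := by
      have := hclosed.mem_of_frequently_of_tendsto (f := id) (b := 𝓝[≠] z)
        (hfr.mono fun w hw => hw.2) (tendsto_id.mono_left nhdsWithin_le_nhds)
      exact this
    refine hfr ?_
    filter_upwards [hiso z (sub_eq_zero.1 hz0)] with w hw hw'
    exact hw (sub_eq_zero.1 hw'.2)
  have hq : HasLogOn q C := by
    refine hasLogOn_of_finite_zeros hR0 hC (fun z hz => by simpa using hR z (hCK hz))
      hfin.toFinset q hqc.continuousOn fun z hz hz0 => ?_
    refine ⟨hfin.mem_toFinset.2 ⟨ball_subset_closedBall hz, hz0⟩, h z fun hzK => ?_⟩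
    have := hclose z hzK
    rw [hz0, zero_sub, norm_neg] at this
    exact lt_irrefl _ this
  have h2 : HasLogOn (fun z => q z / g z) C := by
    refine hasLogOn_of_norm_sub_lt (hqc.continuousOn.div (hg.mono hCK)
      fun z hz => h0 z (hCK hz)) fun z hz => ?_
    have hz0 := h0 z (hCK hz)
    rw [div_sub_one hz0, norm_div, div_lt_one (norm_pos_iff.2 hz0)]
    exact hclose z (hCK hz)
  refine (hq.div h2).congr fun z hz => ?_
  exact div_div_cancel₀ (hq.ne_zero hz)

/-- An open set with a bounded nonempty closure equal to itself does not exist in the plane. -/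
lemma not_frontier_subset_self {W : Set ℂ} (hW : IsOpen W) (hne : W.Nonempty)
    (hb : Bornology.IsBounded W) : ¬ frontier W ⊆ W := by
  intro h
  have hcl : IsClosed W := by
    rw [← closure_subset_iff_isClosed, closure_eq_self_union_frontier]
    exact union_subset subset_rfl h
  rcases isClopen_iff.1 (⟨hcl, hW⟩ : IsClopen W) with h1 | h1
  · exact hne.ne_empty h1
  · rw [h1] at hb
    exact NormedSpace.unbounded_univ ℝ ℂ hb

/-- A connected set meeting a set and its complement meets the frontier. -/
lemma IsPreconnected.nonempty_inter_frontier {X : Type*} [TopologicalSpace X] {S U : Set X}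
    (hS : IsPreconnected S) (h1 : (S ∩ U).Nonempty) (h2 : (S ∩ Uᶜ).Nonempty) :
    (S ∩ frontier U).Nonempty := by
  by_contra h
  have hn : ∀ z ∈ S, z ∉ frontier U := fun z hz hf => h ⟨z, hz, hf⟩
  obtain ⟨x, hx, hxU⟩ := h1
  obtain ⟨y, hy, hyU⟩ := h2
  obtain ⟨z, -, hz1, hz2⟩ := hS (interior U) (closure U)ᶜ isOpen_interior
    isClosed_closure.isOpen_compl (fun z hz => by
      by_cases hc : z ∈ closure U
      · exact Or.inl (by_contra fun hi => hn z hz ⟨hc, hi⟩)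
      · exact Or.inr hc)
    ⟨x, hx, by_contra fun hi => hn x hx ⟨subset_closure hxU, hi⟩⟩
    ⟨y, hy, fun hc => hn y hy ⟨hc, fun hi => hyU (interior_subset hi)⟩⟩
  exact hz2 (subset_closure (interior_subset hz1))

lemma frontier_connectedComponentIn_subset {J : Set ℂ} (hJ : IsClosed J) {p : ℂ} :
    frontier (connectedComponentIn Jᶜ p) ⊆ J := by
  intro x hx
  by_contra hxJ
  have hxJ' : x ∈ Jᶜ := hxJ
  have ho : IsOpen (connectedComponentIn Jᶜ x) := hJ.isOpen_compl.connectedComponentIn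
  have ho' : IsOpen (connectedComponentIn Jᶜ p) := hJ.isOpen_compl.connectedComponentIn
  obtain ⟨y, hy, hy'⟩ := mem_closure_iff.1 (frontier_subset_closure hx) _ ho
    (mem_connectedComponentIn hxJ')
  have h1 := connectedComponentIn_eq hy
  have h2 := connectedComponentIn_eq hy'
  have : x ∈ connectedComponentIn Jᶜ p := by
    rw [h2, ← h1]; exact mem_connectedComponentIn hxJ'
  rw [ho'.frontier_eq] at hx
  exact hx.2 this

/-- The inverse of a continuous injection on a compact set is continuous on the image. -/
lemma continuousOn_invFunOn {X Y : Type*} [TopologicalSpace X] [Nonempty X] [TopologicalSpace Y]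
    [T2Space Y] {K : Set X} (hK : IsCompact K) {f : X → Y} (hf : ContinuousOn f K)
    (hi : InjOn f K) : ContinuousOn (Function.invFunOn f K) (f '' K) := by
  have := isCompact_iff_compactSpace.1 hK
  rw [continuousOn_iff_isClosed]
  intro t ht
  refine ⟨f '' (t ∩ K), ?_, ?_⟩
  · rw [inter_comm]
    exact ((hK.inter_right ht).image_of_continuousOn (hf.mono inter_subset_left)).isClosed
  · ext y
    constructor
    · rintro ⟨h1, x, hx, rfl⟩
      refine ⟨⟨x, ⟨?_, hx⟩, rfl⟩, ⟨x, hx, rfl⟩⟩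
      rwa [mem_preimage, hi.leftInvOn_invFunOn hx] at h1
    · rintro ⟨⟨x, ⟨hx, hxK⟩, rfl⟩, h2⟩
      refine ⟨?_, h2⟩
      rwa [mem_preimage, hi.leftInvOn_invFunOn hxK]

lemma exists_not_hasLogOn_of_jordan {γ : ℂ → ℂ} (hγ : ContinuousOn γ (sphere 0 1))
    (hi : InjOn γ (sphere 0 1)) :
    ∃ p ∉ γ '' sphere 0 1, ¬ HasLogOn (fun z => z - p) (γ '' sphere 0 1) := by
  by_contra! h
  have hc : IsCompact (γ '' sphere 0 1) := (isCompact_sphere _ _).image_of_continuousOn hγ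
  have hg := continuousOn_invFunOn (isCompact_sphere (0 : ℂ) 1) hγ hi
  have h1 := hasLogOn_of_forall_sub hc hc.isClosed subset_rfl h hg (by
    rintro _ ⟨z, hz, rfl⟩ h0
    rw [hi.leftInvOn_invFunOn hz] at h0
    simp [h0] at hz)
  have h2 := h1.comp hγ (mapsTo_image _ _)
  refine not_hasLogOn_sphere (p := 0) (by simp) (h2.congr fun z hz => ?_)
  simp [hi.leftInvOn_invFunOn hz]

/-- Points outside a domain bounded by a connected set do not wind around compact subsets. -/
lemma hasLogOn_sub_of_notMem {U J C : Set ℂ} (hU : IsOpen U)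
    (hUb : Bornology.IsBounded U) (hJ : IsPreconnected J) (hfr : frontier U ⊆ J)
    (hUJ : Disjoint U J) (hC : IsCompact C) (hCU : C ⊆ U) {p : ℂ} (hp : p ∉ U) : HasLogOn (fun z => z - p) C := by
  have hpC : p ∈ Cᶜ := fun h => hp (hCU h)
  set S := connectedComponentIn Cᶜ p with hS
  have hpS : p ∈ S := mem_connectedComponentIn hpC
  have hSo : IsOpen S := hC.isClosed.isOpen_compl.connectedComponentIn
  have hSC : S ⊆ Cᶜ := connectedComponentIn_subset _ _
  have hSfr : frontier S ⊆ C := frontier_connectedComponentIn_subset hC.isClosed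
  have hScon : IsPreconnected S := isPreconnected_connectedComponentIn
  refine hasLogOn_sub_of_unbounded hC hScon
    (disjoint_left.2 fun z hz hzC => hSC hz hzC) (fun hSb => ?_) hpS
  by_cases hSJ : (S ∩ J).Nonempty
  · obtain ⟨x, hxS, hxJ⟩ := hSJ
    have hJS : J ⊆ S := by
      have : S = connectedComponentIn Cᶜ x := connectedComponentIn_eq hxS
      rw [this]
      exact hJ.subset_connectedComponentIn hxJ fun z hz hzC =>
        disjoint_left.1 hUJ (hCU hzC) hz
    refine not_frontier_subset_self (hSo.union hU) ⟨p, Or.inl hpS⟩ (hSb.union hUb) ?_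
    refine (frontier_union_subset _ _).trans ?_
    rintro z (hz | hz)
    · exact Or.inr (hCU (hSfr hz.1))
    · exact Or.inl (hJS (hfr hz.2))
  · have hfrne : (frontier S).Nonempty := by
      by_contra h
      rw [not_nonempty_iff_eq_empty] at h
      exact not_frontier_subset_self hSo ⟨p, hpS⟩ hSb (by rw [h]; exact empty_subset _)
    obtain ⟨x, hx⟩ := hfrne
    obtain ⟨y, hyU, hyS⟩ := mem_closure_iff.1 (frontier_subset_closure hx) U hU (hCU (hSfr hx))
    have hsub : S ⊆ U := by
      intro z hz
      by_contra hzU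
      have := IsPreconnected.nonempty_inter_frontier hScon ⟨y, hyS, hyU⟩ ⟨z, hz, hzU⟩
      obtain ⟨w, hw, hw'⟩ := this
      exact hSJ ⟨w, hw, hfr hw'⟩
    exact hp (hsub hpS)

lemma isOpen_setOf_hasLogOn_sub {C : Set ℂ} (hC : IsCompact C) :
    IsOpen {p | p ∉ C ∧ HasLogOn (fun z => z - p) C} := by
  rw [Metric.isOpen_iff]
  rintro p ⟨hp, hl⟩
  obtain ⟨r, hr, hrb⟩ := Metric.isOpen_iff.1 hC.isClosed.isOpen_compl p hp
  refine ⟨r, hr, fun q hq => ⟨hrb hq, ?_⟩⟩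
  have h1 := hasLogOn_div_of_preconnected hC.isClosed (convex_ball p r).isPreconnected
    (disjoint_left.2 fun z hz hzC => hrb hz hzC) hq (mem_ball_self hr)
  refine (h1.mul hl).congr fun z hz => ?_
  exact div_mul_cancel₀ _ (hl.ne_zero hz)

lemma hasLogOn_compact_subset {U J C : Set ℂ} (hU : IsOpen U)
    (hUb : Bornology.IsBounded U) (hJ : IsPreconnected J) (hfr : frontier U ⊆ J)
    (hUJ : Disjoint U J) (hC : IsCompact C) (hCU : C ⊆ U) {g : ℂ → ℂ} (hg : ContinuousOn g U)
    (h0 : ∀ z ∈ U, g z ≠ 0) : HasLogOn g C := by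
  set K : Set ℂ := {p | p ∉ C ∧ HasLogOn (fun z => z - p) C}ᶜ with hKdef
  have hKU : K ⊆ U := fun p hp => by
    by_contra hpU
    exact hp ⟨fun h => hpU (hCU h), hasLogOn_sub_of_notMem hU hUb hJ hfr hUJ hC hCU hpU⟩
  have hK : IsCompact K := Metric.isCompact_of_isClosed_isBounded
    (isOpen_setOf_hasLogOn_sub hC).isClosed_compl (hUb.subset hKU)
  refine hasLogOn_of_forall_sub hK hC.isClosed (fun z hz h => h.1 hz) (fun p hp => ?_)
    (hg.mono hKU) fun z hz => h0 z (hKU hz)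
  exact (not_not.1 hp).2

/-- Logarithms on compact subsets glue to a logarithm on the domain. -/
lemma hasLogOn_of_forall_compact {U : Set ℂ} (hU : IsOpen U) (hUc : IsConnected U) {g : ℂ → ℂ}
    (h : ∀ C ⊆ U, IsCompact C → HasLogOn g C) : HasLogOn g U := by
  obtain ⟨z₀, hz₀⟩ := hUc.nonempty
  have hg0 : g z₀ ≠ 0 :=
    (h {z₀} (by simpa using hz₀) isCompact_singleton).ne_zero (mem_singleton _)
  have key : ∀ C : Set ℂ, C ⊆ U → IsCompact C → z₀ ∈ C → ∃ F : ℂ → ℂ, ContinuousOn F C ∧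
      (∀ z ∈ C, Complex.exp (F z) = g z) ∧ F z₀ = Complex.log (g z₀) := by
    intro C hCU hC hz
    obtain ⟨F, hF, hFg⟩ := h C hCU hC
    refine ⟨fun z => F z + (Complex.log (g z₀) - F z₀), hF.add continuousOn_const, ?_, by ring⟩
    intro w hw
    rw [Complex.exp_add, Complex.exp_sub, hFg w hw, hFg _ hz, Complex.exp_log hg0,
      div_self hg0, mul_one]
  choose! F hFc hFe hF0 using key
  have huniq : ∀ C D : Set ℂ, C ⊆ U → IsCompact C → z₀ ∈ C → D ⊆ U → IsCompact D →
      IsPreconnected C → C ⊆ D → EqOn (F C) (F D) C := by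
    intro C D hCU hC hzC hDU hD hCp hCD z hz
    obtain ⟨n, hn⟩ := log_sub_const hCp (hFc C hCU hC hzC) ((hFc D hDU hD (hCD hzC)).mono hCD)
      fun w hw => by rw [hFe C hCU hC hzC w hw, hFe D hDU hD (hCD hzC) w (hCD hw)]
    have e := hn z₀ hzC
    rw [hF0 C hCU hC hzC, hF0 D hDU hD (hCD hzC), left_eq_add] at e
    rw [hn z hz, e, add_zero]
  have hpath : ∀ z ∈ U, ∃ C ⊆ U, IsCompact C ∧ IsPreconnected C ∧ z₀ ∈ C ∧ z ∈ C := by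
    intro z hz
    obtain ⟨γ, hγ⟩ := (hU.isConnected_iff_isPathConnected.1 hUc).joinedIn z₀ hz₀ z hz
    exact ⟨range γ, range_subset_iff.2 hγ, isCompact_range γ.continuous,
      isPreconnected_range γ.continuous, ⟨0, γ.source⟩, ⟨1, γ.target⟩⟩
  choose! C hCU hC hCp hCz hCm using hpath
  have hval : ∀ z ∈ U, ∀ D ⊆ U, IsCompact D → IsPreconnected D → z₀ ∈ D → z ∈ D →
      F (C z) z = F D z := by
    intro z hz D hDU hD hDp hzD hz'
    have hEU : C z ∪ D ⊆ U := union_subset (hCU z hz) hDU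
    have hE : IsCompact (C z ∪ D) := (hC z hz).union hD
    rw [huniq (C z) (C z ∪ D) (hCU z hz) (hC z hz) (hCz z hz) hEU hE (hCp z hz)
      subset_union_left (hCm z hz), huniq D (C z ∪ D) hDU hD hzD hEU hE hDp
      subset_union_right hz']
  refine ⟨fun z => F (C z) z, fun z hz => ContinuousAt.continuousWithinAt ?_, fun z hz =>
    hFe (C z) (hCU z hz) (hC z hz) (hCz z hz) z (hCm z hz)⟩
  obtain ⟨r, hr, hrU⟩ := Metric.nhds_basis_closedBall.mem_iff.1 (hU.mem_nhds hz)
  set D := C z ∪ closedBall z r with hD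
  have hDU : D ⊆ U := union_subset (hCU z hz) hrU
  have hDc : IsCompact D := (hC z hz).union (isCompact_closedBall _ _)
  have hDp : IsPreconnected D := (hCp z hz).union z (hCm z hz) (mem_closedBall_self hr.le)
    (convex_closedBall z r).isPreconnected
  have hzD : z₀ ∈ D := Or.inl (hCz z hz)
  have hDn : D ∈ 𝓝 z := mem_of_superset (closedBall_mem_nhds z hr) subset_union_right
  have : (fun z => F (C z) z) =ᶠ[𝓝 z] F D := by
    filter_upwards [hDn] with w hw using hval w (hDU hw) D hDU hDc hDp hzD hw
  exact ((hFc D hDU hDc hzD).continuousAt hDn).congr this.symm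

lemma isPreconnected_circle : IsPreconnected (sphere (0 : ℂ) 1) :=
  isPreconnected_sphere (by simp [Complex.rank_real_complex]) 0 1

/-- A Jordan curve has a bounded complementary component, and continuous nonvanishing functions
on it have logarithms. -/
theorem exists_jordan_domain {γ : ℂ → ℂ} (hγ : ContinuousOn γ (sphere 0 1))
    (hi : InjOn γ (sphere 0 1)) :
    ∃ U : Set ℂ, IsOpen U ∧ IsConnected U ∧ Bornology.IsBounded U ∧
      frontier U ⊆ γ '' sphere 0 1 ∧ Disjoint U (γ '' sphere 0 1) ∧
      ∀ g : ℂ → ℂ, ContinuousOn g U → (∀ z ∈ U, g z ≠ 0) → HasLogOn g U := by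
  obtain ⟨p, hp, hlog⟩ := exists_not_hasLogOn_of_jordan hγ hi
  set J := γ '' sphere 0 1 with hJ
  have hJc : IsCompact J := (isCompact_sphere _ _).image_of_continuousOn hγ
  have hJp : IsPreconnected J := isPreconnected_circle.image _ hγ
  have hU : IsOpen (connectedComponentIn Jᶜ p) := hJc.isClosed.isOpen_compl.connectedComponentIn
  have hUc : IsConnected (connectedComponentIn Jᶜ p) := isConnected_connectedComponentIn_iff.2 hp
  have hUJ : Disjoint (connectedComponentIn Jᶜ p) J :=
    disjoint_left.2 fun z hz => connectedComponentIn_subset _ _ hz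
  have hUb : Bornology.IsBounded (connectedComponentIn Jᶜ p) := by
    by_contra hub
    exact hlog (hasLogOn_sub_of_unbounded hJc hUc.isPreconnected hUJ hub
      (mem_connectedComponentIn hp))
  have hfr := frontier_connectedComponentIn_subset hJc.isClosed (p := p)
  refine ⟨_, hU, hUc, hUb, hfr, hUJ, fun g hg h0 => ?_⟩
  exact hasLogOn_of_forall_compact hU hUc fun C hCU hC =>
    hasLogOn_compact_subset hU hUb hJp hfr hUJ hC hCU hg h0

/-- Bounded holomorphic functions are locally uniformly Lipschitz. -/
lemma exists_lipschitz_of_bounded {U : Set ℂ} (hU : IsOpen U) {z : ℂ} (hz : z ∈ U) :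
    ∃ r > 0, ball z r ⊆ U ∧ ∀ f : ℂ → ℂ, DifferentiableOn ℂ f U → (∀ w ∈ U, ‖f w‖ ≤ 1) →
      ∀ w ∈ ball z r, ‖deriv f w‖ ≤ 1 / r ∧ ‖f w - f z‖ ≤ 1 / r * ‖w - z‖ := by
  obtain ⟨R, hR, hRU⟩ := Metric.nhds_basis_closedBall.mem_iff.1 (hU.mem_nhds hz)
  have hr : 0 < R / 2 := half_pos hR
  refine ⟨R / 2, hr, (ball_subset_closedBall.trans
    (closedBall_subset_closedBall (by linarith))).trans hRU, fun f hf hb => ?_⟩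
  have hsub : ∀ w ∈ ball z (R / 2), closedBall w (R / 2) ⊆ U := fun w hw y hy => hRU (by
    rw [mem_closedBall] at hy ⊢
    rw [mem_ball] at hw
    linarith [dist_triangle y w z])
  have hd : ∀ w ∈ ball z (R / 2), ‖deriv f w‖ ≤ 1 / (R / 2) := fun w hw => by
    refine Complex.norm_deriv_le_of_forall_mem_sphere_norm_le hr ?_ fun y hy =>
      hb y (hsub w hw (sphere_subset_closedBall hy))
    refine (hf.mono ?_).diffContOnCl
    exact closure_ball_subset_closedBall.trans (hsub w hw)
  intro w hw
  refine ⟨hd w hw, ?_⟩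
  exact (convex_ball z (R / 2)).norm_image_sub_le_of_norm_deriv_le
    (fun y hy => hf.differentiableAt (hU.mem_nhds (hsub y hy (mem_closedBall_self hr.le)))) hd
    (mem_ball_self hr) hw

/-- Montel's theorem along an ultrafilter. -/
lemma exists_tendstoLocallyUniformlyOn {ι : Type*} (l : Ultrafilter ι) {U : Set ℂ} (hU : IsOpen U)
    {F : ι → ℂ → ℂ} (hF : ∀ i, DifferentiableOn ℂ (F i) U) (hb : ∀ i, ∀ z ∈ U, ‖F i z‖ ≤ 1) :
    ∃ f : ℂ → ℂ, TendstoLocallyUniformlyOn F f l U := by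
  have hlim : ∀ z ∈ U, ∃ y, Tendsto (fun i => F i z) l (𝓝 y) := fun z hz => by
    obtain ⟨y, -, hy⟩ := (isCompact_closedBall (0 : ℂ) 1).ultrafilter_le_nhds
      (l.map fun i => F i z) (by
        rw [le_principal_iff]
        exact Ultrafilter.mem_coe.2 (Ultrafilter.mem_map.2
          (univ_mem' fun i => by simpa using hb i z hz)))
    exact ⟨y, hy⟩
  choose! f hf using hlim
  refine ⟨f, Metric.tendstoLocallyUniformlyOn_iff.2 fun ε hε z hz => ?_⟩
  obtain ⟨r, hr, hrU, hlip⟩ := exists_lipschitz_of_bounded hU hz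
  refine ⟨ball z (min r (r * (ε / 4))), mem_nhdsWithin_of_mem_nhds
    (ball_mem_nhds _ (by positivity)), ?_⟩
  have hlipF : ∀ i, ∀ w ∈ ball z (min r (r * (ε / 4))), ‖F i w - F i z‖ ≤ ε / 4 := by
    intro i w hw
    have hw' : w ∈ ball z r := ball_subset_ball (min_le_left _ _) hw
    refine (hlip (F i) (hF i) (hb i) w hw').2.trans ?_
    have : ‖w - z‖ ≤ r * (ε / 4) := by
      rw [mem_ball_iff_norm] at hw; exact hw.le.trans (min_le_right _ _)
    rw [div_mul_eq_mul_div, one_mul, div_le_iff₀ hr]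
    linarith
  have hlipf : ∀ w ∈ ball z (min r (r * (ε / 4))), ‖f w - f z‖ ≤ ε / 4 := fun w hw => by
    have hw' : w ∈ U := hrU (ball_subset_ball (min_le_left _ _) hw)
    exact le_of_tendsto ((hf w hw').sub (hf z hz)).norm (Eventually.of_forall fun i => hlipF i w hw)
  filter_upwards [(Metric.tendsto_nhds.1 (hf z hz)) (ε / 4) (by positivity)] with i hi w hw
  rw [dist_eq_norm] at hi ⊢
  calc ‖f w - F i w‖ = ‖(f w - f z) - (F i z - f z) - (F i w - F i z)‖ := by congr 1; ring
    _ ≤ ‖f w - f z‖ + ‖F i z - f z‖ + ‖F i w - F i z‖ :=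
      (norm_sub_le _ _).trans (add_le_add_left (norm_sub_le _ _) _)
    _ < ε := by linarith [hlipf w hw, hlipF i w hw]

/-- Hurwitz's theorem. -/
lemma hurwitz {ι : Type*} {l : Filter ι} [l.NeBot] {U : Set ℂ} (hU : IsOpen U)
    (hUc : IsPreconnected U) {F : ι → ℂ → ℂ} {f : ℂ → ℂ} (hF : ∀ i, DifferentiableOn ℂ (F i) U)
    (hlim : TendstoLocallyUniformlyOn F f l U) {b : ℂ} (hb : b ∈ U)
    (hnz : ∀ᶠ w in 𝓝 b, ∀ i, F i w ≠ 0) (hne : ∃ z ∈ U, f z ≠ 0) : f b ≠ 0 := by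
  intro hfb
  have hfd : DifferentiableOn ℂ f U := hlim.differentiableOn (Eventually.of_forall hF) hU
  have hfa : AnalyticOnNhd ℂ f U := hfd.analyticOnNhd hU
  have hiso : ∀ᶠ w in 𝓝[≠] b, f w ≠ 0 := by
    rcases (hfa b hb).eventually_eq_zero_or_eventually_ne_zero with h | h
    · obtain ⟨z, hz, hz0⟩ := hne
      exact absurd (hfa.eqOn_zero_of_preconnected_of_eventuallyEq_zero hUc hb h hz) hz0
    · exact h
  obtain ⟨r, hr, hrb⟩ : ∃ r > 0, closedBall b r ⊆
      {w | (w ≠ b → f w ≠ 0) ∧ w ∈ U ∧ ∀ i, F i w ≠ 0} := by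
    refine Metric.nhds_basis_closedBall.mem_iff.1 ?_
    filter_upwards [eventually_nhdsWithin_iff.1 hiso, hU.mem_nhds hb, hnz] with w h1 h2 h3
    exact ⟨fun h => h1 h, h2, h3⟩
  have hsU : closedBall b r ⊆ U := fun w hw => (hrb hw).2.1
  obtain ⟨z₁, hz₁, hmin⟩ := (isCompact_sphere b r).exists_isMinOn
    (NormedSpace.sphere_nonempty.2 hr.le)
    ((hfd.continuousOn.mono (sphere_subset_closedBall.trans hsU)).norm)
  have hm : 0 < ‖f z₁‖ := norm_pos_iff.2
    ((hrb (sphere_subset_closedBall hz₁)).1 (by rintro rfl; simp at hz₁; exact hr.ne hz₁))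
  have hunif : TendstoUniformlyOn F f l (closedBall b r) :=
    (tendstoLocallyUniformlyOn_iff_forall_isCompact hU).1 hlim _ hsU (isCompact_closedBall _ _)
  obtain ⟨i, hi⟩ := (Metric.tendstoUniformlyOn_iff.1 hunif (‖f z₁‖ / 2) (half_pos hm)).exists
  have hsphere : ∀ w ∈ sphere b r, ‖(F i w)⁻¹‖ ≤ (‖f z₁‖ / 2)⁻¹ := fun w hw => by
    rw [norm_inv]
    refine inv_anti₀ (half_pos hm) ?_
    have h1 := hi w (sphere_subset_closedBall hw)
    have h2 : ‖f z₁‖ ≤ ‖f w‖ := hmin hw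
    rw [dist_eq_norm] at h1
    linarith [norm_sub_norm_le (f w) (F i w)]
  have hdiff : DifferentiableOn ℂ (fun w => (F i w)⁻¹) (closedBall b r) :=
    ((hF i).mono hsU).inv fun w hw => (hrb hw).2.2 i
  have hmax := Complex.norm_le_of_forall_mem_frontier_norm_le (isBounded_ball (x := b) (r := r))
    (f := fun w => (F i w)⁻¹) (hdiff.mono closure_ball_subset_closedBall).diffContOnCl
    (fun w hw => hsphere w (by rwa [frontier_ball b hr.ne'] at hw))
    (subset_closure (mem_ball_self hr))
  have h3 := hi b (mem_closedBall_self hr.le)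
  rw [hfb, dist_eq_norm, zero_sub, norm_neg] at h3
  have hpos : 0 < ‖F i b‖ := norm_pos_iff.2 ((hrb (mem_closedBall_self hr.le)).2.2 i)
  rw [norm_inv] at hmax
  exact absurd ((inv_le_inv₀ hpos (half_pos hm)).1 hmax) (not_le.2 h3)

/-- The Möbius transformation of the disc taking `w` to `0`. -/
noncomputable def discMap (w z : ℂ) : ℂ := (z - w) / (1 - (starRingEnd ℂ) w * z)

lemma one_sub_conj_mul_ne_zero {w z : ℂ} (hw : ‖w‖ < 1) (hz : ‖z‖ ≤ 1) :
    1 - (starRingEnd ℂ) w * z ≠ 0 := by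
  intro h
  have h1 : ‖(starRingEnd ℂ) w * z‖ = 1 := by rw [← sub_eq_zero.1 h]; simp
  rw [norm_mul, RCLike.norm_conj] at h1
  nlinarith [norm_nonneg w, norm_nonneg z]

lemma normSq_discMap_aux (w z : ℂ) : Complex.normSq (1 - (starRingEnd ℂ) w * z) -
    Complex.normSq (z - w) = (1 - Complex.normSq w) * (1 - Complex.normSq z) := by
  simp only [Complex.normSq_apply, Complex.sub_re, Complex.sub_im, Complex.mul_re, Complex.mul_im,
    Complex.conj_re, Complex.conj_im, Complex.one_re, Complex.one_im]
  ring

lemma norm_discMap_lt {w z : ℂ} (hw : ‖w‖ < 1) (hz : ‖z‖ < 1) : ‖discMap w z‖ < 1 := by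
  have h0 := one_sub_conj_mul_ne_zero hw hz.le
  rw [discMap, norm_div, div_lt_one (norm_pos_iff.2 h0)]
  refine lt_of_pow_lt_pow_left₀ 2 (norm_nonneg _) ?_
  rw [← Complex.normSq_eq_norm_sq, ← Complex.normSq_eq_norm_sq, ← sub_pos, normSq_discMap_aux,
    Complex.normSq_eq_norm_sq, Complex.normSq_eq_norm_sq]
  have h1 : ‖w‖ ^ 2 < 1 := by nlinarith [norm_nonneg w]
  have h2 : ‖z‖ ^ 2 < 1 := by nlinarith [norm_nonneg z]
  exact mul_pos (by linarith) (by linarith)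

lemma norm_discMap_eq {w z : ℂ} (hw : ‖w‖ < 1) (hz : ‖z‖ = 1) : ‖discMap w z‖ = 1 := by
  have h0 := one_sub_conj_mul_ne_zero hw hz.le
  rw [discMap, norm_div, div_eq_one_iff_eq (norm_ne_zero_iff.2 h0)]
  refine (pow_left_inj₀ (norm_nonneg _) (norm_nonneg _) two_ne_zero).1 ?_
  have := normSq_discMap_aux w z
  rw [Complex.normSq_eq_norm_sq, Complex.normSq_eq_norm_sq, Complex.normSq_eq_norm_sq z, hz] at this
  linarith

lemma discMap_neg_discMap {w z : ℂ} (hw : ‖w‖ < 1) (hz : ‖z‖ ≤ 1) :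
    discMap (-w) (discMap w z) = z := by
  have h0 := one_sub_conj_mul_ne_zero hw hz
  have h1 : 1 - (starRingEnd ℂ) w * w ≠ 0 := one_sub_conj_mul_ne_zero hw hw.le
  simp only [discMap, map_neg]
  generalize (starRingEnd ℂ) w = c at h0 h1
  have h2 : 1 - -c * ((z - w) / (1 - c * z)) = (1 - c * w) / (1 - c * z) := by
    rw [eq_div_iff h0, sub_mul, mul_assoc, div_mul_cancel₀ _ h0]; ring
  have h3 : (z - w) / (1 - c * z) - -w = z * (1 - c * w) / (1 - c * z) := by
    rw [eq_div_iff h0, sub_mul, div_mul_cancel₀ _ h0]; ring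
  rw [h2, h3, div_div_div_cancel_right₀ h0, mul_div_cancel_right₀ _ h1]

lemma injOn_discMap {w : ℂ} (hw : ‖w‖ < 1) : InjOn (discMap w) (closedBall 0 1) := by
  intro x hx y hy h
  rw [mem_closedBall_zero_iff] at hx hy
  rw [← discMap_neg_discMap hw hx, h, discMap_neg_discMap hw hy]

lemma hasDerivAt_discMap {w z : ℂ} (hw : ‖w‖ < 1) (hz : ‖z‖ ≤ 1) :
    HasDerivAt (discMap w) ((1 - (starRingEnd ℂ) w * w) / (1 - (starRingEnd ℂ) w * z) ^ 2) z := by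
  have h0 := one_sub_conj_mul_ne_zero hw hz
  have h1 : HasDerivAt (fun z => z - w) 1 z := (hasDerivAt_id z).sub_const w
  have h2 : HasDerivAt (fun z => 1 - (starRingEnd ℂ) w * z) (-((starRingEnd ℂ) w * 1)) z :=
    ((hasDerivAt_id z).const_mul _).const_sub 1
  have h3 := h1.fun_div h2 h0
  rw [show (1 * (1 - (starRingEnd ℂ) w * z) - (z - w) * -((starRingEnd ℂ) w * 1)) =
    1 - (starRingEnd ℂ) w * w by ring] at h3
  exact h3

/-- Conformal maps of `U` into the unit disc sending `z₀` to `0`. -/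
structure IsDiscEmbedding (U : Set ℂ) (z₀ : ℂ) (f : ℂ → ℂ) : Prop where
  diff : DifferentiableOn ℂ f U
  mapsTo : MapsTo f U (ball 0 1)
  inj : InjOn f U
  zero : f z₀ = 0
  deriv_ne : ∀ z ∈ U, deriv f z ≠ 0

lemma exists_isDiscEmbedding_extremal {U : Set ℂ} (hU : IsOpen U) (hUc : IsPreconnected U)
    {z₀ : ℂ} (hz₀ : z₀ ∈ U) (hne : ∃ f, IsDiscEmbedding U z₀ f) :
    ∃ f, IsDiscEmbedding U z₀ f ∧ ∀ g, IsDiscEmbedding U z₀ g → ‖deriv g z₀‖ ≤ ‖deriv f z₀‖ := by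
  set S : Set ℝ := (fun g => ‖deriv g z₀‖) '' {g | IsDiscEmbedding U z₀ g} with hS
  obtain ⟨r, hr, hrU, hlip⟩ := exists_lipschitz_of_bounded hU hz₀
  have hbd : ∀ g, IsDiscEmbedding U z₀ g → ∀ z ∈ U, ‖g z‖ ≤ 1 := fun g hg z hz => by
    have := hg.mapsTo hz
    rw [mem_ball_zero_iff] at this
    exact this.le
  have hSb : BddAbove S := by
    refine ⟨1 / r, ?_⟩
    rintro _ ⟨g, hg, rfl⟩
    exact (hlip g hg.diff (hbd g hg) z₀ (mem_ball_self hr)).1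
  have hSn : S.Nonempty := hne.imp' _ fun f hf => ⟨f, hf, rfl⟩
  obtain ⟨u, -, hu, huS⟩ := exists_seq_tendsto_sSup hSn hSb
  choose F hF hFu using huS
  have hF' : ∀ n, IsDiscEmbedding U z₀ (F n) := hF
  obtain ⟨f, hf⟩ := exists_tendstoLocallyUniformlyOn (hyperfilter ℕ) hU (fun n => (hF' n).diff)
    (fun n => hbd _ (hF' n))
  have hpt : ∀ z ∈ U, Tendsto (fun n => F n z) (hyperfilter ℕ) (𝓝 (f z)) := fun z hz =>
    hf.tendsto_at hz
  have hdf : DifferentiableOn ℂ f U :=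
    hf.differentiableOn (Eventually.of_forall fun n => (hF' n).diff) hU
  have hder := hf.deriv (Eventually.of_forall fun n => (hF' n).diff) hU
  have hderz : ‖deriv f z₀‖ = sSup S := by
    have h1 : Tendsto (fun n => ‖deriv (F n) z₀‖) (hyperfilter ℕ) (𝓝 ‖deriv f z₀‖) :=
      (hder.tendsto_at hz₀).norm
    have h2 : Tendsto (fun n => ‖deriv (F n) z₀‖) (hyperfilter ℕ) (𝓝 (sSup S)) := by
      simp only [hFu]
      exact hu.mono_left Nat.hyperfilter_le_atTop
    exact tendsto_nhds_unique h1 h2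
  have hge : ∀ g, IsDiscEmbedding U z₀ g → ‖deriv g z₀‖ ≤ ‖deriv f z₀‖ := fun g hg => by
    rw [hderz]; exact le_csSup hSb ⟨g, hg, rfl⟩
  have hd0 : deriv f z₀ ≠ 0 := by
    obtain ⟨g, hg⟩ := hne
    have := hge g hg
    have h2 := norm_pos_iff.2 (hg.deriv_ne z₀ hz₀)
    exact norm_pos_iff.1 (h2.trans_le this)
  have hnc : ∀ c, ∃ z ∈ U, f z ≠ c := by
    intro c
    by_contra! h
    have : f =ᶠ[𝓝 z₀] fun _ => c := by
      filter_upwards [hU.mem_nhds hz₀] with z hz using h z hz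
    exact hd0 (by rw [this.deriv_eq]; simp)
  refine ⟨f, ⟨hdf, ?_, ?_, ?_, ?_⟩, hge⟩
  · have hle : ∀ z ∈ U, f z ∈ closedBall (0 : ℂ) 1 := fun z hz =>
      isClosed_closedBall.mem_of_tendsto (hpt z hz)
        (Eventually.of_forall fun n => by simpa using hbd _ (hF' n) z hz)
    rcases (hdf.analyticOnNhd hU).is_constant_or_isOpen hUc with ⟨c, hc⟩ | ho
    · obtain ⟨z, hz, h⟩ := hnc c
      exact absurd (hc z hz) h
    · have h1 : f '' U ⊆ interior (closedBall (0 : ℂ) 1) :=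
        interior_maximal (image_subset_iff.2 hle) (ho U subset_rfl hU)
      rw [interior_closedBall _ one_ne_zero] at h1
      exact image_subset_iff.1 h1
  · intro a ha b hb hab
    by_contra hne'
    obtain ⟨z, hz, hzne⟩ := hnc (f a)
    refine hurwitz hU hUc (l := hyperfilter ℕ) (F := fun n z => F n z - F n a)
      (f := fun z => f z - f a) (fun n => (hF' n).diff.sub_const _) ?_ hb ?_
      ⟨z, hz, sub_ne_zero.2 hzne⟩ (sub_eq_zero.2 hab.symm)
    · have hconst : TendstoLocallyUniformlyOn (fun n (_ : ℂ) => F n a) (fun _ => f a)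
          (hyperfilter ℕ) U := by
        rw [Metric.tendstoLocallyUniformlyOn_iff]
        intro ε hε x hx
        refine ⟨U, self_mem_nhdsWithin, ?_⟩
        filter_upwards [Metric.tendsto_nhds.1 (hpt a ha) ε hε] with n hn y _
        rwa [dist_comm]
      rw [Metric.tendstoLocallyUniformlyOn_iff] at hf hconst ⊢
      intro ε hε x hx
      obtain ⟨t, ht, h1⟩ := hf (ε / 2) (half_pos hε) x hx
      obtain ⟨t', ht', h2⟩ := hconst (ε / 2) (half_pos hε) x hx
      refine ⟨t ∩ t', inter_mem ht ht', ?_⟩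
      filter_upwards [h1, h2] with n h1 h2 y hy
      have := dist_sub_sub_le (f y) (f a) (F n y) (F n a)
      linarith [h1 y hy.1, h2 y hy.2]
    · filter_upwards [hU.mem_nhds hb, isOpen_ne.mem_nhds (Ne.symm hne')] with w hw hwa n h
      exact hwa ((hF' n).inj hw ha (sub_eq_zero.1 h))
  · refine tendsto_nhds_unique (hpt z₀ hz₀) ?_
    simp only [(hF' _).zero]
    exact tendsto_const_nhds
  · intro z hz
    refine hurwitz hU hUc (l := hyperfilter ℕ) (F := deriv ∘ F)
      (fun n => (hF' n).diff.deriv hU) hder hz ?_ ⟨z₀, hz₀, hd0⟩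
    filter_upwards [hU.mem_nhds hz] with w hw n using (hF' n).deriv_ne w hw

/-- A continuous square root of a holomorphic function is holomorphic. -/
lemma hasDerivAt_of_sq_eq {g h : ℂ → ℂ} {g' z : ℂ} (hg : HasDerivAt g g' z)
    (hh : ContinuousAt h z) (hsq : ∀ᶠ w in 𝓝 z, h w ^ 2 = g w) (h0 : h z ≠ 0) :
    HasDerivAt h (g' / (2 * h z)) z := by
  rw [hasDerivAt_iff_tendsto_slope] at hg ⊢
  have h1 : Tendsto (fun w => h w + h z) (𝓝[≠] z) (𝓝 (2 * h z)) := by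
    rw [two_mul]
    exact (hh.tendsto.mono_left nhdsWithin_le_nhds).add tendsto_const_nhds
  have h2 : (2 * h z) ≠ 0 := mul_ne_zero two_ne_zero h0
  refine (hg.div h1 h2).congr' ?_
  filter_upwards [mem_nhdsWithin_of_mem_nhds hsq, h1.eventually_ne h2] with w hw hw2
  have hw' : h w ^ 2 = g w := hw
  simp only [slope_def_field, Pi.div_apply, ← hw', ← hsq.self_of_nhds]
  rw [show h w ^ 2 - h z ^ 2 = (h w - h z) * (h w + h z) by ring, mul_div_right_comm,
    mul_div_cancel_right₀ _ hw2]

lemma IsDiscEmbedding.surj {U : Set ℂ} (hU : IsOpen U) {z₀ : ℂ} (hz₀ : z₀ ∈ U)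
    (hlog : ∀ g : ℂ → ℂ, ContinuousOn g U → (∀ z ∈ U, g z ≠ 0) → HasLogOn g U) {f : ℂ → ℂ}
    (hf : IsDiscEmbedding U z₀ f)
    (hmax : ∀ g, IsDiscEmbedding U z₀ g → ‖deriv g z₀‖ ≤ ‖deriv f z₀‖) :
    f '' U = ball 0 1 := by
  refine subset_antisymm (image_subset_iff.2 hf.mapsTo) fun w hw => ?_
  by_contra hwU
  have hw1 : ‖w‖ < 1 := by simpa using hw
  have hfb : ∀ z ∈ U, ‖f z‖ < 1 := fun z hz => by simpa using hf.mapsTo hz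
  have hfd : ∀ z ∈ U, HasDerivAt f (deriv f z) z := fun z hz =>
    (hf.diff.differentiableAt (hU.mem_nhds hz)).hasDerivAt
  set g : ℂ → ℂ := fun z => discMap w (f z) with hg
  have hw0 : discMap w w = 0 := by simp [discMap]
  have hgd : ∀ z ∈ U, HasDerivAt g ((1 - (starRingEnd ℂ) w * w) /
      (1 - (starRingEnd ℂ) w * f z) ^ 2 * deriv f z) z := fun z hz =>
    (hasDerivAt_discMap hw1 (hfb z hz).le).comp z (hfd z hz)
  have hg0 : ∀ z ∈ U, g z ≠ 0 := fun z hz h => hwU ⟨z, hz, by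
    refine injOn_discMap hw1 ?_ ?_ ((h : discMap w (f z) = 0).trans hw0.symm)
    · simpa using (hfb z hz).le
    · simpa using hw1.le⟩
  obtain ⟨L, hL, hLg⟩ := hlog g (fun z hz => (hgd z hz).continuousAt.continuousWithinAt) hg0
  set h : ℂ → ℂ := fun z => Complex.exp (L z / 2) with hh
  have hsq : ∀ z ∈ U, h z ^ 2 = g z := fun z hz => by
    rw [hh, ← hLg z hz, ← Complex.exp_nat_mul]
    congr 1; push_cast; ring
  have hh0 : ∀ z, h z ≠ 0 := fun z => Complex.exp_ne_zero _
  have hhd : ∀ z ∈ U, HasDerivAt h ((1 - (starRingEnd ℂ) w * w) /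
      (1 - (starRingEnd ℂ) w * f z) ^ 2 * deriv f z / (2 * h z)) z := fun z hz =>
    hasDerivAt_of_sq_eq (hgd z hz) (((hL.continuousAt (hU.mem_nhds hz)).div_const 2).cexp)
      (by filter_upwards [hU.mem_nhds hz] with y hy using hsq y hy) (hh0 z)
  have hhb : ∀ z ∈ U, ‖h z‖ < 1 := fun z hz => by
    have h1 : ‖h z‖ ^ 2 < 1 := by
      rw [← norm_pow, hsq z hz]; exact norm_discMap_lt hw1 (hfb z hz)
    nlinarith [norm_nonneg (h z)]
  set c := h z₀ with hc
  have hc1 : ‖c‖ < 1 := hhb z₀ hz₀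
  have hFd : ∀ z ∈ U, HasDerivAt (fun z => discMap c (h z)) ((1 - (starRingEnd ℂ) c * c) /
      (1 - (starRingEnd ℂ) c * h z) ^ 2 * ((1 - (starRingEnd ℂ) w * w) /
      (1 - (starRingEnd ℂ) w * f z) ^ 2 * deriv f z / (2 * h z))) z := fun z hz =>
    (hasDerivAt_discMap hc1 (hhb z hz).le).comp z (hhd z hz)
  have hF : IsDiscEmbedding U z₀ (fun z => discMap c (h z)) := by
    refine ⟨fun z hz => (hFd z hz).differentiableAt.differentiableWithinAt, fun z hz => ?_, ?_,
      by simp [discMap, hc], fun z hz => ?_⟩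
    · simpa using norm_discMap_lt hc1 (hhb z hz)
    · intro x hx y hy hxy
      have h1 : h x = h y := injOn_discMap hc1 (by simpa using (hhb x hx).le)
        (by simpa using (hhb y hy).le) hxy
      have h2 : g x = g y := by rw [← hsq x hx, ← hsq y hy, h1]
      exact hf.inj hx hy (injOn_discMap hw1 (by simpa using (hfb x hx).le)
        (by simpa using (hfb y hy).le) h2)
    · rw [(hFd z hz).deriv]
      have e1 := one_sub_conj_mul_ne_zero hc1 hc1.le
      have e2 := one_sub_conj_mul_ne_zero hc1 (hhb z hz).le
      have e3 := one_sub_conj_mul_ne_zero hw1 hw1.le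
      have e4 := one_sub_conj_mul_ne_zero hw1 (hfb z hz).le
      have e5 := hf.deriv_ne z hz
      exact mul_ne_zero (div_ne_zero e1 (pow_ne_zero 2 e2)) (div_ne_zero (mul_ne_zero
        (div_ne_zero e3 (pow_ne_zero 2 e4)) e5) (mul_ne_zero two_ne_zero (hh0 z)))
  have hle := hmax _ hF
  rw [(hFd z₀ hz₀).deriv, hf.zero] at hle
  have hcw : ‖c‖ ^ 2 = ‖w‖ := by
    rw [← norm_pow, hc, hsq z₀ hz₀, hg]
    simp [hf.zero, discMap]
  have hcpos : 0 < ‖c‖ := norm_pos_iff.2 (hh0 z₀)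
  have hconj : ∀ v : ℂ, ‖v‖ < 1 → ‖1 - (starRingEnd ℂ) v * v‖ = 1 - ‖v‖ ^ 2 := fun v hv => by
    rw [mul_comm, Complex.mul_conj, Complex.normSq_eq_norm_sq, ← Complex.ofReal_one,
      ← Complex.ofReal_sub, Complex.norm_real, Real.norm_of_nonneg]
    nlinarith [norm_nonneg v]
  have hdpos : 0 < ‖deriv f z₀‖ := norm_pos_iff.2 (hf.deriv_ne z₀ hz₀)
  have hcc : 0 < 1 - ‖c‖ ^ 2 := by nlinarith
  simp only [mul_zero, sub_zero, one_pow, div_one, norm_mul, norm_div, norm_pow, hconj w hw1,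
    ← hc, hconj c hc1, ← hcw, RCLike.norm_ofNat] at hle
  have e : (1 - ‖c‖ ^ 2) / (1 - ‖c‖ ^ 2) ^ 2 * ((1 - (‖c‖ ^ 2) ^ 2) * ‖deriv f z₀‖ / (2 * ‖c‖)) =
      (1 + ‖c‖ ^ 2) / (2 * ‖c‖) * ‖deriv f z₀‖ := by
    field_simp
    ring
  rw [e] at hle
  have h2 : 1 < (1 + ‖c‖ ^ 2) / (2 * ‖c‖) := by
    rw [lt_div_iff₀ (by positivity)]
    nlinarith [sq_nonneg (1 - ‖c‖), mul_self_pos.2 (sub_ne_zero.2 hc1.ne')]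
  nlinarith

/-- The Riemann mapping theorem for bounded domains carrying logarithms. -/
theorem exists_riemann_map {U : Set ℂ} (hU : IsOpen U) (hUc : IsConnected U)
    (hUb : Bornology.IsBounded U)
    (hlog : ∀ g : ℂ → ℂ, ContinuousOn g U → (∀ z ∈ U, g z ≠ 0) → HasLogOn g U) :
    ∃ f : ℂ → ℂ, DifferentiableOn ℂ f (ball 0 1) ∧ InjOn f (ball 0 1) ∧ f '' ball 0 1 = U := by
  obtain ⟨z₀, hz₀⟩ := hUc.nonempty
  obtain ⟨R, hR⟩ := hUb.subset_ball z₀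
  have hRpos : 0 < R := by simpa using hR hz₀
  have hRC : (R : ℂ) ≠ 0 := by exact_mod_cast hRpos.ne'
  have hne : IsDiscEmbedding U z₀ fun z => (z - z₀) / R := by
    have hd : ∀ z : ℂ, HasDerivAt (fun z : ℂ => (z - z₀) / R) (1 / R) z := fun z =>
      ((hasDerivAt_id z).sub_const z₀).div_const _
    refine ⟨fun z _ => (hd z).differentiableAt.differentiableWithinAt, fun z hz => ?_, ?_, by simp,
      fun z _ => by rw [(hd z).deriv]; exact one_div_ne_zero hRC⟩
    · rw [mem_ball_zero_iff, norm_div, Complex.norm_real, Real.norm_of_nonneg hRpos.le,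
        div_lt_one hRpos]
      exact mem_ball_iff_norm.1 (hR hz)
    · intro x _ y _ hxy
      simpa [hRC] using hxy
  obtain ⟨f, hf, hmax⟩ := exists_isDiscEmbedding_extremal hU hUc.isPreconnected hz₀ ⟨_, hne⟩
  have hsurj := hf.surj hU hz₀ hlog hmax
  set φ := Function.invFunOn f U with hφ
  have hleft : ∀ z ∈ U, φ (f z) = z := fun z hz => hf.inj.leftInvOn_invFunOn hz
  refine ⟨φ, ?_, ?_, ?_⟩
  · rw [← hsurj]
    rintro _ ⟨z, hz, rfl⟩
    have hs : HasStrictDerivAt f (deriv f z) z :=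
      ((hf.diff.analyticOnNhd hU) z hz).hasStrictDerivAt
    have hs' := hs.to_localInverse (hf.deriv_ne z hz)
    have hmap := hs.map_nhds_eq (hf.deriv_ne z hz)
    refine (hs'.hasDerivAt.congr_of_eventuallyEq ?_).differentiableAt.differentiableWithinAt
    rw [← hmap, EventuallyEq, eventually_map]
    have hcont := hs.eventually_left_inverse (hf.deriv_ne z hz)
    filter_upwards [hU.mem_nhds hz, hcont] with y hy hy2
    rw [hleft y hy]
    exact hy2.symm
  · rw [← hsurj]
    rintro _ ⟨x, hx, rfl⟩ _ ⟨y, hy, rfl⟩ h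
    rw [hleft x hx, hleft y hy] at h
    rw [h]
  · rw [← hsurj, image_image]
    exact (image_congr hleft).trans (image_id' U)

open MeasureTheory

theorem lintegral_inv_Ioo_eq_top {ρ : ℝ} (hρ : 0 < ρ) :
    ∫⁻ r in Ioo 0 ρ, ENNReal.ofReal r⁻¹ = ⊤ := by
  by_contra hne
  have h1 : IntegrableOn (fun r : ℝ => r⁻¹) (Ioo 0 ρ) := by
    refine ⟨measurable_inv.aestronglyMeasurable, ?_⟩
    rw [hasFiniteIntegral_iff_enorm]
    refine lt_of_le_of_lt (le_of_eq ?_) (lt_top_iff_ne_top.2 hne)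
    refine setLIntegral_congr_fun measurableSet_Ioo fun r hr => ?_
    rw [Real.enorm_eq_ofReal (inv_nonneg.2 hr.1.le)]
  have h2 := intervalIntegrable_inv_iff (a := 0) (b := ρ)
  rw [intervalIntegrable_iff_integrableOn_Ioo_of_le hρ.le] at h2
  rcases h2.1 h1 with h | h
  · exact hρ.ne h
  · exact h left_mem_uIcc

theorem lintegral_enorm_deriv_sq {g : ℂ → ℂ} {B : Set ℂ} (hB : IsOpen B)
    (hg : DifferentiableOn ℂ g B) (hi : InjOn g B) :
    ∫⁻ w in B, ENNReal.ofReal (‖deriv g w‖ ^ 2) = volume (g '' B) := by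
  rw [← lintegral_abs_det_fderiv_eq_addHaar_image volume hB.measurableSet
    (f' := fun w => (ContinuousLinearMap.toSpanSingleton ℂ (deriv g w)).restrictScalars ℝ)
    (fun w hw => ?_) hi]
  · congr 1
    funext w
    congr 1
    have : ((ContinuousLinearMap.toSpanSingleton ℂ (deriv g w)).restrictScalars ℝ).det
        = Complex.normSq (deriv g w) := by
      rw [← Algebra.norm_complex_apply]
      change LinearMap.det (((ContinuousLinearMap.toSpanSingleton ℂ (deriv g w) : ℂ →L[ℂ] ℂ) :
        ℂ →ₗ[ℂ] ℂ).restrictScalars ℝ) = _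
      rw [LinearMap.det_restrictScalars]
      congr 1
      simp
    rw [this, Complex.normSq_eq_norm_sq, abs_of_nonneg (by positivity)]
  · have := ((hg.differentiableAt (hB.mem_nhds hw)).hasDerivAt.hasFDerivAt).restrictScalars ℝ
    exact this.hasFDerivWithinAt

theorem exists_small_circle_energy {J : ℂ → ENNReal} (hJ : Measurable J)
    (hfin : ∫⁻ w, J w ≠ ⊤) {δ ρ : ℝ} (hδ : 0 < δ) (hρ : 0 < ρ) :
    ∃ r, 0 < r ∧ r < ρ ∧
      ∫⁻ θ in Ioo (-Real.pi) Real.pi, ENNReal.ofReal (r ^ 2) *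
        J (r * Complex.exp (θ * Complex.I)) ≤ ENNReal.ofReal δ := by
  by_contra! hcon
  apply hfin
  rw [← Complex.lintegral_comp_polarCoord_symm]
  have hm : Measurable fun p : ℝ × ℝ => ENNReal.ofReal p.1 • J (Complex.polarCoord.symm p) := by
    have : (fun p : ℝ × ℝ => Complex.polarCoord.symm p) =
        fun p : ℝ × ℝ => (p.1 : ℂ) * ((Real.cos p.2 : ℂ) + (Real.sin p.2 : ℂ) * Complex.I) :=
      funext Complex.polarCoord_symm_apply
    have h2 : Measurable fun p : ℝ × ℝ => Complex.polarCoord.symm p := by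
      rw [this]; exact (by fun_prop : Continuous _).measurable
    exact (ENNReal.measurable_ofReal.comp measurable_fst).smul (hJ.comp h2)
  rw [show polarCoord.target = Ioi 0 ×ˢ Ioo (-Real.pi) Real.pi from rfl, Measure.volume_eq_prod,
    setLIntegral_prod _ hm.aemeasurable, eq_top_iff]
  calc (⊤ : ENNReal) = ENNReal.ofReal δ * ∫⁻ r in Ioo 0 ρ, ENNReal.ofReal r⁻¹ := by
        rw [lintegral_inv_Ioo_eq_top hρ, ENNReal.mul_top (by simpa using hδ)]
    _ = ∫⁻ r in Ioo 0 ρ, ENNReal.ofReal δ * ENNReal.ofReal r⁻¹ := by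
        rw [lintegral_const_mul _ (by fun_prop)]
    _ ≤ ∫⁻ r in Ioo 0 ρ, ∫⁻ θ in Ioo (-Real.pi) Real.pi,
          ENNReal.ofReal r • J (Complex.polarCoord.symm (r, θ)) := by
        refine setLIntegral_mono' measurableSet_Ioo fun r hr => ?_
        have h := (hcon r hr.1 hr.2).le
        have hr0 : ENNReal.ofReal r⁻¹ * ENNReal.ofReal (r ^ 2) = ENNReal.ofReal r := by
          rw [← ENNReal.ofReal_mul (inv_nonneg.2 hr.1.le)]
          congr 1
          have := hr.1.ne'
          field_simp
        calc _ = ENNReal.ofReal r⁻¹ * ENNReal.ofReal δ := mul_comm _ _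
          _ ≤ ENNReal.ofReal r⁻¹ * ∫⁻ θ in Ioo (-Real.pi) Real.pi, ENNReal.ofReal (r ^ 2) *
                J (r * Complex.exp (θ * Complex.I)) := by gcongr
          _ = _ := by
            rw [← lintegral_const_mul']
            · congr 1
              funext θ
              rw [← mul_assoc, hr0, Complex.polarCoord_symm_apply, Complex.exp_mul_I]
              simp
            · exact ENNReal.ofReal_ne_top
    _ ≤ _ := lintegral_mono_set Ioo_subset_Ioi_self

/-- Length–area estimate: a univalent function of finite area has small oscillation on
suitable small circular cross-cuts at a boundary point. -/
theorem exists_small_crosscut {g : ℂ → ℂ} (hg : DifferentiableOn ℂ g (ball 1 1))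
    (hi : InjOn g (ball 1 1)) (hfin : volume (g '' ball 1 1) ≠ ⊤) {ε ρ : ℝ} (hε : 0 < ε)
    (hρ : 0 < ρ) :
    ∃ r, 0 < r ∧ r < ρ ∧ ∀ w₁ ∈ ball (1 : ℂ) 1, ∀ w₂ ∈ ball (1 : ℂ) 1, ‖w₁‖ = r → ‖w₂‖ = r →
      ‖g w₁ - g w₂‖ ≤ ε := by
  have hpi := Real.pi_pos
  obtain ⟨t, ht, htε⟩ : ∃ t : ℝ, 0 < t ∧ 2 * Real.pi * t = ε / 2 :=
    ⟨ε / 2 / (2 * Real.pi), by positivity, by field_simp⟩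
  set J : ℂ → ENNReal := (ball (1 : ℂ) 1).indicator fun w => ENNReal.ofReal (‖deriv g w‖ ^ 2)
  have hJ : Measurable J := by
    refine Measurable.indicator ?_ measurableSet_ball
    exact ENNReal.measurable_ofReal.comp ((measurable_deriv g).norm.pow_const 2)
  have hJfin : ∫⁻ w, J w ≠ ⊤ := by
    rw [lintegral_indicator measurableSet_ball, lintegral_enorm_deriv_sq isOpen_ball hg hi]
    exact hfin
  obtain ⟨r, hr, hrρ, hE⟩ := exists_small_circle_energy hJ hJfin
    (show 0 < t * (ε / 2) by positivity) hρ
  refine ⟨r, hr, hrρ, ?_⟩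
  have hmem : ∀ θ : ℝ, (r : ℂ) * Complex.exp (θ * Complex.I) ∈ ball (1 : ℂ) 1 ↔
      r < 2 * Real.cos θ := by
    intro θ
    rw [mem_ball, dist_eq_norm, ← sq_lt_one_iff₀ (norm_nonneg _), ← Complex.normSq_eq_norm_sq,
      Complex.exp_mul_I, Complex.normSq_apply]
    have hre : ((r : ℂ) * (Complex.cos θ + Complex.sin θ * Complex.I) - 1).re
        = r * Real.cos θ - 1 := by
      simp [Complex.cos_ofReal_re, Complex.sin_ofReal_re]
    have him : ((r : ℂ) * (Complex.cos θ + Complex.sin θ * Complex.I) - 1).im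
        = r * Real.sin θ := by
      simp [Complex.cos_ofReal_re, Complex.sin_ofReal_re]
    have hex : (r * Real.cos θ - 1) * (r * Real.cos θ - 1) + r * Real.sin θ * (r * Real.sin θ)
        = 1 + r * (r - 2 * Real.cos θ) := by
      linear_combination r ^ 2 * Real.sin_sq_add_cos_sq θ
    rw [hre, him, hex]
    have := Real.sin_sq_add_cos_sq θ
    constructor <;> intro h <;> nlinarith
  have key : ∀ a b : ℝ, -Real.pi < a → a ≤ b → b < Real.pi → r < 2 * Real.cos a →
      r < 2 * Real.cos b → ‖g (r * Complex.exp (b * Complex.I)) -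
        g (r * Complex.exp (a * Complex.I))‖ ≤ ε := by
    intro a b ha hab hb hca hcb
    have hmid : ∀ θ ∈ Icc a b, r < 2 * Real.cos θ := by
      intro θ hθ
      rcases le_total 0 θ with h0 | h0
      · have := Real.cos_le_cos_of_nonneg_of_le_pi h0 hb.le hθ.2
        linarith
      · have := Real.cos_le_cos_of_nonneg_of_le_pi (neg_nonneg.2 h0) (by linarith : -a ≤ Real.pi)
          (neg_le_neg hθ.1)
        rw [Real.cos_neg, Real.cos_neg] at this
        linarith
    set φ : ℝ → ℂ := fun θ => r * Complex.exp (θ * Complex.I)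
    have hφ : ∀ θ, HasDerivAt φ (φ θ * Complex.I) θ := by
      intro θ
      have h1 : HasDerivAt (fun θ : ℝ => (θ : ℂ) * Complex.I) Complex.I θ := by
        simpa using (Complex.ofRealCLM.hasDerivAt (x := θ)).mul_const Complex.I
      have := (h1.cexp).const_mul (r : ℂ)
      simpa [φ, mul_assoc] using this
    have hd : ∀ θ ∈ uIcc a b, HasDerivAt (fun θ => g (φ θ)) (deriv g (φ θ) * (φ θ * Complex.I)) θ := by
      intro θ hθ
      rw [uIcc_of_le hab] at hθ
      have hB : φ θ ∈ ball (1 : ℂ) 1 := (hmem θ).2 (hmid θ hθ)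
      exact HasDerivAt.comp θ
        ((hg.differentiableAt (isOpen_ball.mem_nhds hB)).hasDerivAt) (hφ θ)
    have hφc : Continuous φ := continuous_iff_continuousAt.2 fun θ => (hφ θ).continuousAt
    have hdc : ContinuousOn (deriv g) (ball (1 : ℂ) 1) :=
      (hg.deriv isOpen_ball).continuousOn
    have hinter : IntervalIntegrable (fun θ => deriv g (φ θ) * (φ θ * Complex.I)) volume a b := by
      apply ContinuousOn.intervalIntegrable
      refine ContinuousOn.mul (hdc.comp hφc.continuousOn fun θ hθ => ?_)
        (by fun_prop)
      rw [uIcc_of_le hab] at hθ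
      exact (hmem θ).2 (hmid θ hθ)
    have hFTC := intervalIntegral.integral_eq_sub_of_hasDerivAt hd hinter
    have hnφ : ∀ θ, ‖φ θ‖ = r := fun θ => by
      simp [φ, Complex.norm_exp_ofReal_mul_I, abs_of_pos hr]
    rw [intervalIntegral.integral_of_le hab] at hFTC
    rw [show g (r * Complex.exp (b * Complex.I)) - g (r * Complex.exp (a * Complex.I))
      = _ from hFTC.symm]
    rw [← ENNReal.ofReal_le_ofReal_iff hε.le, ofReal_norm]
    refine (enorm_integral_le_lintegral_enorm _).trans ?_
    calc ∫⁻ θ in Ioc a b, ‖deriv g (φ θ) * (φ θ * Complex.I)‖ₑ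
        ≤ ∫⁻ θ in Ioc a b, (ENNReal.ofReal t + ENNReal.ofReal t⁻¹ * (ENNReal.ofReal (r ^ 2) * J (φ θ))) := by
          refine setLIntegral_mono' measurableSet_Ioc fun θ hθ => ?_
          have hB : φ θ ∈ ball (1 : ℂ) 1 := (hmem θ).2 (hmid θ ⟨hθ.1.le, hθ.2⟩)
          simp only [J, indicator_of_mem hB]
          rw [← ofReal_norm, ← ENNReal.ofReal_mul (by positivity),
            ← ENNReal.ofReal_mul (by positivity), ← ENNReal.ofReal_add ht.le (by positivity)]
          apply ENNReal.ofReal_le_ofReal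
          rw [norm_mul, norm_mul, hnφ, Complex.norm_I, mul_one]
          have : t + t⁻¹ * (r ^ 2 * ‖deriv g (φ θ)‖ ^ 2) - ‖deriv g (φ θ)‖ * r
              = t⁻¹ * ((t - ‖deriv g (φ θ)‖ * r / 2) ^ 2 + 3 / 4 * (‖deriv g (φ θ)‖ * r) ^ 2) := by
            field_simp
            ring
          have h2 : 0 ≤ t⁻¹ * ((t - ‖deriv g (φ θ)‖ * r / 2) ^ 2 + 3 / 4 * (‖deriv g (φ θ)‖ * r) ^ 2) := by
            positivity
          linarith
      _ ≤ ∫⁻ θ in Ioo (-Real.pi) Real.pi, (ENNReal.ofReal t + ENNReal.ofReal t⁻¹ * (ENNReal.ofReal (r ^ 2) * J (φ θ))) :=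
          lintegral_mono_set fun θ hθ => ⟨ha.trans hθ.1, hθ.2.trans_lt hb⟩
      _ = ENNReal.ofReal t * ENNReal.ofReal (2 * Real.pi) + ENNReal.ofReal t⁻¹ *
            ∫⁻ θ in Ioo (-Real.pi) Real.pi, ENNReal.ofReal (r ^ 2) * J (φ θ) := by
          rw [lintegral_add_left measurable_const, lintegral_const_mul' _ _ ENNReal.ofReal_ne_top]
          congr 1
          rw [lintegral_const, Measure.restrict_apply MeasurableSet.univ, univ_inter,
            Real.volume_Ioo]
          ring_nf
      _ ≤ ENNReal.ofReal t * ENNReal.ofReal (2 * Real.pi) + ENNReal.ofReal t⁻¹ *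
            ENNReal.ofReal (t * (ε / 2)) := by gcongr
      _ = ENNReal.ofReal ε := by
          rw [← ENNReal.ofReal_mul ht.le, ← ENNReal.ofReal_mul (by positivity),
            ← ENNReal.ofReal_add (by positivity) (by positivity)]
          congr 1
          have : t⁻¹ * (t * (ε / 2)) = ε / 2 := by field_simp
          linarith
  intro w₁ h₁ w₂ h₂ hn₁ hn₂
  have hw : ∀ w : ℂ, w ∈ ball (1 : ℂ) 1 → ‖w‖ = r →
      w = r * Complex.exp (w.arg * Complex.I) ∧ -Real.pi < w.arg ∧ w.arg < Real.pi ∧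
        r < 2 * Real.cos w.arg := by
    intro w hw hn
    have e : w = r * Complex.exp (w.arg * Complex.I) := by
      rw [← hn, Complex.norm_mul_exp_arg_mul_I]
    have hc := (hmem w.arg).1 (e ▸ hw)
    refine ⟨e, Complex.neg_pi_lt_arg w, lt_of_le_of_ne (Complex.arg_le_pi w) fun h => ?_, hc⟩
    rw [h, Real.cos_pi] at hc
    linarith
  obtain ⟨e₁, a₁, b₁, c₁⟩ := hw w₁ h₁ hn₁
  obtain ⟨e₂, a₂, b₂, c₂⟩ := hw w₂ h₂ hn₂
  rcases le_total w₁.arg w₂.arg with h | h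
  · have := key _ _ a₁ h b₂ c₁ c₂
    rwa [← e₁, ← e₂, norm_sub_rev] at this
  · grind

lemma isPreconnected_compl_closedBall (x : ℂ) {η : ℝ} (hη : 0 ≤ η) :
    IsPreconnected (closedBall x η)ᶜ := by
  have : (closedBall x η)ᶜ = (fun p : ℝ × ℂ => x + p.1 * p.2) '' (Ioi η ×ˢ sphere (0 : ℂ) 1) := by
    ext z
    simp only [mem_compl_iff, mem_closedBall, not_le, mem_image, Prod.exists, mem_prod, mem_Ioi,
      mem_sphere_zero_iff_norm]
    constructor
    · intro h
      rw [dist_eq_norm] at h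
      have h0 : (‖z - x‖ : ℂ) ≠ 0 := by exact_mod_cast (hη.trans_lt h).ne'
      refine ⟨‖z - x‖, (z - x) / ‖z - x‖, ⟨h, ?_⟩, ?_⟩
      · rw [norm_div, Complex.norm_real, norm_norm, div_self (hη.trans_lt h).ne']
      · field_simp
        ring
    · rintro ⟨a, b, ⟨ha, hb⟩, rfl⟩
      rw [dist_eq_norm]
      simp only [add_sub_cancel_left, norm_mul, hb, Complex.norm_real, mul_one]
      exact ha.trans_le (le_abs_self a)
  rw [this]
  exact (isPreconnected_Ioi.prod isPreconnected_circle).image _ (by fun_prop)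

lemma isPreconnected_circle_inter_re (c : ℝ) :
    IsPreconnected (sphere (0 : ℂ) 1 ∩ {z | c ≤ z.re}) := by
  rcases lt_or_ge 1 c with h1 | h1
  · convert isPreconnected_empty
    ext z
    simp only [mem_inter_iff, mem_sphere_zero_iff_norm, mem_ofPred_eq, mem_empty_iff_false, iff_false,
      not_and, not_le]
    intro hz
    have := Complex.re_le_norm z
    linarith
  have : sphere (0 : ℂ) 1 ∩ {z | c ≤ z.re} = (fun θ : ℝ => Complex.exp (θ * Complex.I)) ''
      Icc (-Real.arccos c) (Real.arccos c) := by
    ext z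
    simp only [mem_inter_iff, mem_sphere_zero_iff_norm, mem_ofPred_eq, mem_image]
    constructor
    · rintro ⟨hz, hc⟩
      have e : z = Complex.exp (z.arg * Complex.I) := by
        have := Complex.norm_mul_exp_arg_mul_I z
        rw [hz] at this
        simpa using this.symm
      refine ⟨z.arg, ?_, e.symm⟩
      rw [mem_Icc, ← abs_le]
      rw [show z.re = Real.cos z.arg by rw [← Complex.exp_ofReal_mul_I_re, ← e]] at hc
      rw [← Real.cos_abs] at hc
      rw [← Real.arccos_cos (abs_nonneg z.arg) (Complex.abs_arg_le_pi z)]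
      exact Real.arccos_le_arccos hc
    · rintro ⟨θ, hθ, rfl⟩
      rw [mem_Icc, ← abs_le] at hθ
      refine ⟨Complex.norm_exp_ofReal_mul_I θ, ?_⟩
      rw [Complex.exp_ofReal_mul_I_re, ← Real.cos_abs]
      rcases lt_or_ge c (-1) with h2 | h2
      · linarith [Real.neg_one_le_cos |θ|]
      · rw [← Real.cos_arccos h2 h1]
        exact Real.cos_le_cos_of_nonneg_of_le_pi (abs_nonneg _) (Real.arccos_le_pi c) hθ
  rw [this]
  exact isPreconnected_Icc.image _ (by fun_prop)

lemma isPreconnected_circle_inter_closedBall {s : ℂ} (hs : ‖s‖ = 1) {a : ℝ} (ha : 0 ≤ a) :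
    IsPreconnected (sphere (0 : ℂ) 1 ∩ closedBall s a) := by
  have hs0 : s ≠ 0 := by rintro rfl; simp at hs
  have : sphere (0 : ℂ) 1 ∩ closedBall s a =
      (fun z => s * z) '' (sphere (0 : ℂ) 1 ∩ {z | 1 - a ^ 2 / 2 ≤ z.re}) := by
    have key : ∀ z : ℂ, ‖z‖ = 1 → (‖s * z - s‖ ≤ a ↔ 1 - a ^ 2 / 2 ≤ z.re) := by
      intro z hz
      have h1 : ‖s * z - s‖ = ‖z - 1‖ := by
        rw [show s * z - s = s * (z - 1) by ring, norm_mul, hs, one_mul]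
      have h2 : z.re * z.re + z.im * z.im = 1 := by
        rw [← Complex.normSq_apply, Complex.normSq_eq_norm_sq, hz]; norm_num
      rw [h1, ← sq_le_sq₀ (norm_nonneg _) ha, ← Complex.normSq_eq_norm_sq, Complex.normSq_apply]
      simp only [Complex.sub_re, Complex.one_re, Complex.sub_im, Complex.one_im, sub_zero]
      constructor <;> intro h <;> nlinarith
    ext w
    simp only [mem_inter_iff, mem_sphere_zero_iff_norm, mem_closedBall, dist_eq_norm, mem_image,
      mem_ofPred_eq]
    constructor
    · rintro ⟨h1, h2⟩
      have hw : ‖w / s‖ = 1 := by rw [norm_div, h1, hs, div_one]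
      have e : s * (w / s) = w := by field_simp
      exact ⟨w / s, ⟨hw, (key _ hw).1 (by rwa [e])⟩, e⟩
    · rintro ⟨z, ⟨h1, h2⟩, rfl⟩
      exact ⟨by rw [norm_mul, hs, h1, one_mul], (key z h1).2 h2⟩
  rw [this]
  exact (isPreconnected_circle_inter_re _).image _ (by fun_prop)

lemma exists_small_connected_of_jordan {γ : ℂ → ℂ} (hγ : ContinuousOn γ (sphere 0 1))
    (hi : InjOn γ (sphere 0 1)) {η : ℝ} (hη : 0 < η) :
    ∃ δ > 0, ∀ S ⊆ γ '' sphere 0 1, ∀ x, S ⊆ closedBall x δ →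
      ∃ J' ⊆ γ '' sphere 0 1, IsClosed J' ∧ IsPreconnected J' ∧ S ⊆ J' ∧ J' ⊆ closedBall x η := by
  have hcpt : IsCompact (sphere (0 : ℂ) 1) := isCompact_sphere _ _
  have huc := hcpt.uniformContinuousOn_of_continuous hγ
  rw [Metric.uniformContinuousOn_iff] at huc
  obtain ⟨a, ha, hua⟩ := huc (η / 2) (by linarith)
  have hinv := continuousOn_invFunOn hcpt hγ hi
  have huc2 := (hcpt.image_of_continuousOn hγ).uniformContinuousOn_of_continuous hinv
  rw [Metric.uniformContinuousOn_iff] at huc2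
  obtain ⟨b, hb, hub⟩ := huc2 (a / 2) (by linarith)
  refine ⟨min (b / 3) (η / 2), by positivity, fun S hS x hx => ?_⟩
  rcases S.eq_empty_or_nonempty with rfl | ⟨y, hy⟩
  · exact ⟨∅, empty_subset _, isClosed_empty, isPreconnected_empty, empty_subset _, empty_subset _⟩
  obtain ⟨s, hs, rfl⟩ := hS hy
  have hδ1 : min (b / 3) (η / 2) ≤ b / 3 := min_le_left _ _
  have hδ2 : min (b / 3) (η / 2) ≤ η / 2 := min_le_right _ _
  refine ⟨γ '' (sphere 0 1 ∩ closedBall s (a / 2)), image_mono inter_subset_left, ?_, ?_, ?_, ?_⟩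
  · exact ((hcpt.inter_right isClosed_closedBall).image_of_continuousOn
      (hγ.mono inter_subset_left)).isClosed
  · exact (isPreconnected_circle_inter_closedBall (by simpa using hs) (by linarith)).image _
      (hγ.mono inter_subset_left)
  · intro y' hy'
    obtain ⟨t, ht, rfl⟩ := hS hy'
    refine ⟨t, ⟨ht, ?_⟩, rfl⟩
    have h1 := hx hy
    have h2 := hx hy'
    rw [mem_closedBall] at h1 h2 ⊢
    have := hub (γ t) ⟨t, ht, rfl⟩ (γ s) ⟨s, hs, rfl⟩ (by
      have := dist_triangle_right (γ t) (γ s) x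
      linarith)
    rw [hi.leftInvOn_invFunOn ht, hi.leftInvOn_invFunOn hs] at this
    exact this.le
  · rintro _ ⟨t, ⟨ht, hta⟩, rfl⟩
    have h1 := hx hy
    rw [mem_closedBall] at h1 hta ⊢
    have := hua t ht s hs (by linarith)
    have h3 := dist_triangle (γ t) (γ s) x
    linarith

lemma isOpen_image_of_injOn {f : ℂ → ℂ} {U : Set ℂ} (hU : IsOpen U)
    (hf : DifferentiableOn ℂ f U) (hi : InjOn f U) : IsOpen (f '' U) := by
  rw [isOpen_iff_mem_nhds]
  rintro _ ⟨z, hz, rfl⟩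
  rcases (hf.analyticAt (hU.mem_nhds hz)).eventually_constant_or_nhds_le_map_nhds with h | h
  · exfalso
    obtain ⟨r, hr, hball⟩ := Metric.eventually_nhds_iff_ball.1 (h.and (hU.mem_nhds hz))
    have hmem : z + (r / 2 : ℝ) ∈ ball z r := by
      rw [mem_ball, dist_eq_norm, add_sub_cancel_left, Complex.norm_real, Real.norm_eq_abs,
        abs_of_pos (by linarith)]
      linarith
    have := hi (hball _ hmem).2 hz (hball _ hmem).1
    have h3 : ((r / 2 : ℝ) : ℂ) = 0 := by simpa using this
    have : r / 2 = 0 := by exact_mod_cast h3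
    linarith
  · exact h (image_mem_map (hU.mem_nhds hz))

section Caratheodory

variable {γ : ℂ → ℂ} {U : Set ℂ} {f : ℂ → ℂ}

lemma exists_image_subset_closedBall (hγ : ContinuousOn γ (sphere 0 1))
    (hi : InjOn γ (sphere 0 1)) (hUb : Bornology.IsBounded U)
    (hUc : IsPreconnected U) (hfr : frontier U ⊆ γ '' sphere 0 1)
    (hdisj : Disjoint U (γ '' sphere 0 1)) {g : ℂ → ℂ}
    (hg : DifferentiableOn ℂ g (ball 1 1)) (hgi : InjOn g (ball 1 1)) (hgU : g '' ball 1 1 = U)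
    {η : ℝ} (hη : 0 < η) :
    ∃ r > 0, ∃ x, g '' (ball 1 1 ∩ ball 0 r) ⊆ closedBall x η := by
  have m1 : (1 : ℂ) ∈ ball (1 : ℂ) 1 := mem_ball_self one_pos
  have m2 : (3 / 2 : ℂ) ∈ ball (1 : ℂ) 1 := by
    rw [mem_ball, dist_eq_norm]; norm_num
  have hne : g 1 ≠ g (3 / 2) := fun h => by
    have := hgi m1 m2 h
    norm_num at this
  set d := dist (g 1) (g (3 / 2)) with hd
  have hdpos : 0 < d := dist_pos.2 hne
  set η' := min η (d / 3) with hη'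
  have hη'pos : 0 < η' := by positivity
  obtain ⟨δ, hδ, hsmall⟩ := exists_small_connected_of_jordan hγ hi hη'pos
  obtain ⟨r, hr, hr1, hosc⟩ := exists_small_crosscut hg hgi
    (by rw [hgU]; exact hUb.measure_lt_top.ne) (lt_min hδ hη'pos) one_pos
  have mr : (r : ℂ) ∈ ball (1 : ℂ) 1 := by
    rw [mem_ball, dist_eq_norm, ← Complex.ofReal_one, ← Complex.ofReal_sub, Complex.norm_real,
      Real.norm_eq_abs, abs_lt]
    constructor <;> linarith
  set x := g r
  set X := closure (g '' (ball 1 1 ∩ sphere 0 r))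
  have hX : X ⊆ closedBall x (min δ η') := by
    refine closure_minimal ?_ isClosed_closedBall
    rintro _ ⟨w, ⟨hw, hwr⟩, rfl⟩
    rw [mem_closedBall, dist_eq_norm]
    exact hosc w hw r mr (by simpa using hwr) (by simp [abs_of_pos hr])
  set J := γ '' sphere 0 1
  have hJ : IsClosed J := ((isCompact_sphere _ _).image_of_continuousOn hγ).isClosed
  obtain ⟨J', hJ'J, hJ'c, hJ'p, hSJ', hJ'b⟩ := hsmall (X ∩ J) inter_subset_right x
    (inter_subset_left.trans (hX.trans (closedBall_subset_closedBall (min_le_left _ _))))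
  set N := g '' (ball 1 1 ∩ ball 0 r)
  have hNU : N ⊆ U := by rw [← hgU]; exact image_mono inter_subset_left
  have hop : ∀ O : Set ℂ, IsOpen O → IsOpen (g '' (ball 1 1 ∩ O)) := fun O hO =>
    isOpen_image_of_injOn (isOpen_ball.inter hO) (hg.mono inter_subset_left)
      (hgi.mono inter_subset_left)
  have hNfr : frontier N ⊆ J ∪ (X ∪ J') := by
    intro p hp
    rw [frontier, (hop _ isOpen_ball).interior_eq] at hp
    by_cases hpJ : p ∈ J
    · exact Or.inl hpJ
    right; left
    have hpU : p ∈ U := by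
      by_contra hpU
      refine hpJ (hfr ⟨closure_mono hNU hp.1, fun h => hpU (interior_subset h)⟩)
    rw [← hgU] at hpU
    obtain ⟨w, hw, rfl⟩ := hpU
    rcases lt_trichotomy ‖w‖ r with h | h | h
    · exact absurd ⟨w, ⟨hw, by simpa using h⟩, rfl⟩ hp.2
    · exact subset_closure ⟨w, ⟨hw, by simpa using h⟩, rfl⟩
    · exfalso
      have hO : IsOpen {w : ℂ | r < ‖w‖} := isOpen_lt continuous_const continuous_norm
      obtain ⟨_, ⟨w', ⟨hw', hr'⟩, rfl⟩, ⟨w'', ⟨hw'', hr''⟩, he⟩⟩ :=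
        mem_closure_iff.1 hp.1 _ (hop _ hO) ⟨w, ⟨hw, h⟩, rfl⟩
      have := hgi hw'' hw' he
      subst this
      have h1 : r < ‖w''‖ := hr'
      have h2 : ‖w''‖ < r := by simpa using hr''
      linarith
  have hAB : J ∩ (X ∪ J') = J' := by grind
  have hB : X ∪ J' ⊆ closedBall x η' :=
    union_subset (hX.trans (closedBall_subset_closedBall (min_le_right _ _))) hJ'b
  refine ⟨r, hr, x, ?_⟩
  suffices N ⊆ closedBall x η' from this.trans (closedBall_subset_closedBall (min_le_left _ _))
  intro p hp
  by_contra hpb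
  have hout : ∀ w ∈ ball (1 : ℂ) 1, r ≤ ‖w‖ → g w ∈ closedBall x η' := by
    intro w hw hwr
    by_contra hwb
    have hmem : g w ∈ N := janiszewski (A := J) (B := X ∪ J') (C := U) (C' := (closedBall x η')ᶜ)
      hJ (isClosed_closure.union hJ'c) (by rw [hAB]; exact hJ'p) hUc hdisj
      (isPreconnected_compl_closedBall x hη'pos.le) (disjoint_compl_left_iff_subset.2 hB)
      (hNU hp) (by rw [← hgU]; exact ⟨w, hw, rfl⟩) hpb hwb (hUb.subset hNU) hNfr hp
    obtain ⟨w', ⟨hw', hr'⟩, he⟩ := hmem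
    have := hgi hw' hw he
    subst this
    have h2 : ‖w'‖ < r := by simpa using hr'
    linarith
  have h1 := hout 1 m1 (by simpa using hr1.le)
  have h2 := hout (3 / 2) m2 (by norm_num; linarith)
  rw [mem_closedBall] at h1 h2
  have h3 := dist_triangle_right (g 1) (g (3 / 2)) x
  have h4 : η' ≤ d / 3 := min_le_right _ _
  linarith

/-- Carathéodory's theorem, continuity part. -/
theorem exists_boundary_extension (hγ : ContinuousOn γ (sphere 0 1))
    (hi : InjOn γ (sphere 0 1)) (hUb : Bornology.IsBounded U)
    (hUc : IsPreconnected U) (hfr : frontier U ⊆ γ '' sphere 0 1)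
    (hdisj : Disjoint U (γ '' sphere 0 1))
    (hf : DifferentiableOn ℂ f (ball 0 1)) (hfi : InjOn f (ball 0 1)) (hfU : f '' ball 0 1 = U) :
    ∃ F : ℂ → ℂ, ContinuousOn F (closedBall 0 1) ∧ EqOn F f (ball 0 1) ∧
      MapsTo F (sphere 0 1) (γ '' sphere 0 1) := by
  have hcl : closure (ball (0 : ℂ) 1) = closedBall 0 1 := closure_ball _ one_ne_zero
  have hlim : ∀ ζ ∈ closedBall (0 : ℂ) 1, ∃ y, Tendsto f (𝓝[ball 0 1] ζ) (𝓝 y) := by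
    intro ζ hζ
    rcases (mem_closedBall_zero_iff.1 hζ).lt_or_eq with h | h
    · exact ⟨f ζ, hf.continuousOn ζ (by simpa using h)⟩
    have hζ0 : ζ ≠ 0 := by rintro rfl; simp at h
    have : (𝓝[ball (0 : ℂ) 1] ζ).NeBot := mem_closure_iff_nhdsWithin_neBot.1 (hcl ▸ hζ)
    have hnorm : ∀ w : ℂ, ‖ζ * (1 - w)‖ = ‖w - 1‖ := fun w => by
      rw [norm_mul, h, one_mul, norm_sub_rev]
    have hmaps : MapsTo (fun w => ζ * (1 - w)) (ball (1 : ℂ) 1) (ball 0 1) := fun w hw => by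
      rw [mem_ball_zero_iff, hnorm]
      rwa [mem_ball, dist_eq_norm] at hw
    have hgU : (fun w => f (ζ * (1 - w))) '' ball 1 1 = U := by
      rw [← hfU]
      ext p
      constructor
      · rintro ⟨w, hw, rfl⟩
        exact ⟨_, hmaps hw, rfl⟩
      · rintro ⟨z, hz, rfl⟩
        have e : ζ * (1 - (1 - z / ζ)) = z := by field_simp; ring
        refine ⟨1 - z / ζ, ?_, by simp only [e]⟩
        rw [mem_ball, dist_eq_norm, ← hnorm, e]
        simpa using hz
    have hgi : InjOn (fun w => f (ζ * (1 - w))) (ball 1 1) := by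
      intro w hw w' hw' he
      have := hfi (hmaps hw) (hmaps hw') he
      have := mul_left_cancel₀ hζ0 this
      linear_combination -this
    have hg : DifferentiableOn ℂ (fun w => f (ζ * (1 - w))) (ball 1 1) :=
      hf.comp (by fun_prop) hmaps
    have hC : Cauchy (map f (𝓝[ball 0 1] ζ)) := by
      rw [Metric.cauchy_iff]
      refine ⟨inferInstance, fun ε hε => ?_⟩
      obtain ⟨r, hr, x, hx⟩ := exists_image_subset_closedBall hγ hi hUb hUc hfr hdisj hg hgi hgU
        (show 0 < ε / 3 by linarith)
      refine ⟨closedBall x (ε / 3), ?_, fun a ha b hb => ?_⟩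
      · rw [mem_map, mem_nhdsWithin]
        refine ⟨ball ζ r, isOpen_ball, mem_ball_self hr, ?_⟩
        rintro z ⟨hz, hz1⟩
        apply hx
        have e : ζ * (1 - (1 - z / ζ)) = z := by field_simp; ring
        refine ⟨1 - z / ζ, ⟨?_, ?_⟩, by simp only [e]⟩
        · rw [mem_ball, dist_eq_norm, ← hnorm, e]
          simpa using hz1
        · rw [mem_ball_zero_iff, show 1 - z / ζ = (ζ - z) / ζ by field_simp, norm_div, h, div_one,
            norm_sub_rev, ← dist_eq_norm]
          exact hz
      · have := dist_triangle_right a b x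
        rw [mem_closedBall] at ha hb
        linarith
    obtain ⟨y, hy⟩ := CompleteSpace.complete hC
    exact ⟨y, hy⟩
  have hFc : ContinuousOn (extendFrom (ball 0 1) f) (closedBall 0 1) :=
    continuousOn_extendFrom hcl.ge hlim
  refine ⟨extendFrom (ball 0 1) f, hFc, extendFrom_extends hf.continuousOn, ?_⟩
  intro ζ hζ
  have hζ1 : ‖ζ‖ = 1 := by simpa using hζ
  obtain ⟨y, hy⟩ := hlim ζ (sphere_subset_closedBall hζ)
  rw [extendFrom_eq (hcl.ge (sphere_subset_closedBall hζ)) hy]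
  have : (𝓝[ball (0 : ℂ) 1] ζ).NeBot :=
    mem_closure_iff_nhdsWithin_neBot.1 (hcl ▸ sphere_subset_closedBall hζ)
  have hycl : y ∈ closure U := mem_closure_of_tendsto hy
    (eventually_mem_nhdsWithin.mono fun z hz => hfU ▸ ⟨z, hz, rfl⟩)
  refine hfr ⟨hycl, fun hyU => ?_⟩
  have hyU := interior_subset hyU
  rw [← hfU] at hyU
  obtain ⟨z, hz, rfl⟩ := hyU
  have hz1 : ‖z‖ < 1 := by simpa using hz
  obtain ⟨s, hs1, hs2⟩ := exists_between hz1
  have hsub : ball (0 : ℂ) s ⊆ ball 0 1 := ball_subset_ball hs2.le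
  have hO : IsOpen (f '' ball 0 s) := isOpen_image_of_injOn isOpen_ball (hf.mono hsub) (hfi.mono hsub)
  have ev := hy.eventually (hO.mem_nhds ⟨z, by simpa using hs1, rfl⟩)
  have ev2 : ∀ᶠ w in 𝓝[ball (0 : ℂ) 1] ζ, s < ‖w‖ :=
    nhdsWithin_le_nhds ((isOpen_lt continuous_const continuous_norm).mem_nhds
      (show s < ‖ζ‖ by rw [hζ1]; exact hs2))
  obtain ⟨w, ⟨⟨w', hw', he⟩, hw2⟩, hw3⟩ := ((ev.and ev2).and eventually_mem_nhdsWithin).exists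
  have := hfi (hsub hw') hw3 he
  subst this
  have : ‖w'‖ < s := by simpa using hw'
  linarith

end Caratheodory

lemma not_injOn_circle {q : ℂ → ℝ} (hq : ContinuousOn q (sphere 0 1)) :
    ¬ InjOn q (sphere (0 : ℂ) 1) := fun hi => by
  have hneg : MapsTo (fun z : ℂ => -z) (sphere 0 1) (sphere 0 1) := fun z hz => by simpa using hz
  have h1 : (1 : ℂ) ∈ sphere (0 : ℂ) 1 := by simp
  have hc : ContinuousOn (fun z => q z - q (-z)) (sphere 0 1) := hq.sub (hq.comp (by fun_prop) hneg)
  have key : ∃ z ∈ sphere (0 : ℂ) 1, q z - q (-z) = 0 := by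
    rcases le_total (q 1 - q (-1)) 0 with h | h
    · exact isPreconnected_circle.intermediate_value h1 (hneg h1) hc ⟨h, by simp; linarith⟩
    · exact isPreconnected_circle.intermediate_value (hneg h1) h1 hc ⟨by simp; linarith, h⟩
  obtain ⟨z, hz, h0⟩ := key
  have := hi hz (hneg hz) (sub_eq_zero.1 h0)
  simp [self_eq_neg.1 this] at hz

lemma surjOn_circle_of_injOn {α : ℂ → ℂ} (hα : ContinuousOn α (sphere 0 1))
    (hm : MapsTo α (sphere 0 1) (sphere 0 1)) (hi : InjOn α (sphere 0 1)) :
    SurjOn α (sphere 0 1) (sphere 0 1) := by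
  intro s hs
  by_contra hns
  have hs1 : ‖s‖ = 1 := by simpa using hs
  have hs0 : s ≠ 0 := by rintro rfl; simp at hs1
  have hunit : ∀ z ∈ sphere (0 : ℂ) 1, ‖-α z / s‖ = 1 := fun z hz => by
    rw [norm_div, norm_neg, hs1, div_one]; simpa using hm hz
  have hslit : ∀ z ∈ sphere (0 : ℂ) 1, -α z / s ∈ Complex.slitPlane := by
    intro z hz
    rw [Complex.mem_slitPlane_iff_arg]
    have hne : -α z / s ≠ 0 := by
      intro h
      have := hunit z hz
      rw [h] at this
      simp at this
    refine ⟨fun h => hns ⟨z, hz, ?_⟩, hne⟩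
    have h1 := Complex.norm_mul_exp_arg_mul_I (-α z / s)
    rw [hunit z hz, h, Complex.exp_pi_mul_I] at h1
    field_simp at h1
    simpa using h1.symm
  set φ : ℂ → ℝ := fun z => (-α z / s).arg
  have hφ : ContinuousOn φ (sphere 0 1) := fun z hz =>
    ContinuousAt.comp_continuousWithinAt (g := Complex.arg) (f := fun z => -α z / s)
      (Complex.continuousAt_arg (hslit z hz)) ((hα z hz).neg.div_const s)
  refine not_injOn_circle hφ fun z hz w hw h => hi hz hw ?_
  have h1 := Complex.ext_norm_arg ((hunit z hz).trans (hunit w hw).symm) h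
  field_simp at h1
  simpa using h1

lemma isPreconnected_circle_diff_singleton {s : ℂ} (hs : ‖s‖ = 1) :
    IsPreconnected (sphere (0 : ℂ) 1 \ {s}) := by
  have hs0 : s ≠ 0 := by rintro rfl; simp at hs
  have : sphere (0 : ℂ) 1 \ {s} =
      (fun θ : ℝ => -s * Complex.exp (θ * Complex.I)) '' Ioo (-Real.pi) Real.pi := by
    ext z
    simp only [Set.mem_sdiff, mem_sphere_zero_iff_norm, mem_singleton_iff, mem_image]
    constructor
    · rintro ⟨hz, hzs⟩
      have hn : ‖-z / s‖ = 1 := by rw [norm_div, norm_neg, hz, hs, div_one]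
      have h1 := Complex.norm_mul_exp_arg_mul_I (-z / s)
      rw [hn] at h1
      refine ⟨(-z / s).arg, ⟨Complex.neg_pi_lt_arg _, lt_of_le_of_ne (Complex.arg_le_pi _) ?_⟩, ?_⟩
      · intro h
        rw [h, Complex.exp_pi_mul_I] at h1
        field_simp at h1
        exact hzs (by simpa using h1.symm)
      · rw [Complex.ofReal_one, one_mul] at h1
        rw [h1]; field_simp
    · rintro ⟨θ, hθ, rfl⟩
      refine ⟨by rw [norm_mul, norm_neg, hs, Complex.norm_exp_ofReal_mul_I, one_mul], fun h => ?_⟩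
      have h2 : Complex.exp (θ * Complex.I) = -1 := by
        apply mul_left_cancel₀ hs0
        linear_combination -h
      have h3 := Complex.arg_exp_mul_I θ
      rw [h2, Complex.arg_neg_one, toIocMod_eq_self Real.two_pi_pos |>.2
        ⟨hθ.1, by linarith [hθ.2, Real.pi_pos]⟩] at h3
      linarith [hθ.2]
  rw [this]
  exact isPreconnected_Ioo.image _ (by fun_prop)

/-- A holomorphic function continuous up to the boundary circle which is constant on a nonempty
relatively open part of the circle takes that value at the centre. -/
lemma eq_center_of_eqOn_arc {F : ℂ → ℂ} (hF : ContinuousOn F (closedBall 0 1))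
    (hd : DifferentiableOn ℂ F (ball 0 1)) {O : Set ℂ} (hO : IsOpen O) {s p : ℂ} (hs : ‖s‖ = 1)
    (hsO : s ∈ O) (hp : ∀ z ∈ sphere (0 : ℂ) 1 ∩ O, F z = p) : F 0 = p := by
  have hs0 : s ≠ 0 := by rintro rfl; simp at hs
  obtain ⟨t, ht⟩ := (isCompact_sphere (0 : ℂ) 1).elim_finite_subcover
    (fun u : sphere (0 : ℂ) 1 => {z : ℂ | (u : ℂ) * z ∈ O})
    (fun u => hO.preimage (by fun_prop)) (by
      intro z hz
      have hz1 : ‖z‖ = 1 := by simpa using hz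
      have hz0 : z ≠ 0 := by rintro rfl; simp at hz1
      refine mem_iUnion.2 ⟨⟨s / z, by simp [hs, hz1]⟩, ?_⟩
      change s / z * z ∈ O
      rwa [div_mul_cancel₀ _ hz0])
  set P : ℂ → ℂ := fun z => ∏ u ∈ t, (F (u * z) - p)
  have hun : ∀ u : sphere (0 : ℂ) 1, ‖(u : ℂ)‖ = 1 := fun u => by simp
  have hPd : DiffContOnCl ℂ P (ball 0 1) := by
    constructor
    · refine DifferentiableOn.fun_finsetProd fun u _ => ?_
      refine DifferentiableOn.sub_const (hd.comp (by fun_prop) fun z hz => ?_) _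
      simpa [hun] using hz
    · rw [closure_ball _ one_ne_zero]
      refine continuousOn_finsetProd _ fun u _ => ?_
      refine ContinuousOn.sub (hF.comp (by fun_prop) fun z hz => ?_) continuousOn_const
      simpa [hun] using hz
  have hz : ‖P 0‖ ≤ 0 := by
    refine Complex.norm_le_of_forall_mem_frontier_norm_le isBounded_ball hPd (fun z hz => ?_)
      (subset_closure (mem_ball_self one_pos))
    rw [frontier_ball _ one_ne_zero] at hz
    obtain ⟨u, hu⟩ := mem_iUnion.1 (ht hz)
    obtain ⟨hut, hu⟩ := mem_iUnion.1 hu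
    rw [norm_le_zero_iff]
    refine Finset.prod_eq_zero hut ?_
    rw [hp _ ⟨?_, hu⟩, sub_self]
    simpa [hun] using hz
  rw [norm_le_zero_iff] at hz
  obtain ⟨u, _, hu⟩ := Finset.prod_eq_zero_iff.1 hz
  rw [mul_zero] at hu
  exact sub_eq_zero.1 hu

section Chord

variable {a b : ℂ}

lemma chord_identity (ha : ‖a‖ = 1) (hb : ‖b‖ = 1) (hab : a ≠ b) {z : ℂ}
    (hz : ((z - a) / (b - a)).im = 0) :
    ‖z‖ ^ 2 = 1 - ((z - a) / (b - a)).re * (1 - ((z - a) / (b - a)).re) * ‖b - a‖ ^ 2 := by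
  have hd : b - a ≠ 0 := sub_ne_zero.2 hab.symm
  set t := ((z - a) / (b - a)).re
  have hzt : z = a + t * (b - a) := by
    have : (z - a) / (b - a) = t := by
      apply Complex.ext <;> simp [t, hz]
    field_simp at this
    linear_combination this
  have ha2 : a.re * a.re + a.im * a.im = 1 := by
    rw [← Complex.normSq_apply, Complex.normSq_eq_norm_sq, ha]; norm_num
  have hb2 : b.re * b.re + b.im * b.im = 1 := by
    rw [← Complex.normSq_apply, Complex.normSq_eq_norm_sq, hb]; norm_num
  rw [← Complex.normSq_eq_norm_sq, ← Complex.normSq_eq_norm_sq, hzt, Complex.normSq_apply,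
    Complex.normSq_apply]
  simp
  linear_combination (1 - t) * ha2 + t * hb2

lemma exists_mem_circle_chord_pos (ha : ‖a‖ = 1) (hb : ‖b‖ = 1) (hab : a ≠ b) :
    ∃ u : ℂ, ‖u‖ = 1 ∧ 0 < ((u - a) / (b - a)).im := by
  have hd : b - a ≠ 0 := sub_ne_zero.2 hab.symm
  have hdn : (0 : ℝ) < ‖b - a‖ := norm_pos_iff.2 hd
  have hdn' : (‖b - a‖ : ℂ) ≠ 0 := by exact_mod_cast hdn.ne'
  refine ⟨Complex.I * (b - a) / ‖b - a‖, ?_, ?_⟩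
  · rw [norm_div, norm_mul, Complex.norm_I, Complex.norm_real, norm_norm, one_mul, div_self hdn.ne']
  have e : (Complex.I * (b - a) / ‖b - a‖ - a) / (b - a) =
      ((‖b - a‖⁻¹ : ℝ) : ℂ) * Complex.I - a / (b - a) := by
    push_cast
    field_simp
  rw [e]
  simp only [Complex.sub_im, Complex.mul_im, Complex.ofReal_re, Complex.I_im, mul_one,
    Complex.ofReal_im, Complex.I_re, mul_zero, add_zero]
  rw [sub_pos]
  have h1 : Complex.normSq (a / (b - a)) = ‖b - a‖⁻¹ ^ 2 := by
    rw [Complex.normSq_eq_norm_sq, norm_div, ha, one_div]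
  have h2 : Complex.normSq (a / (b - a) + 1) = ‖b - a‖⁻¹ ^ 2 := by
    rw [show a / (b - a) + 1 = b / (b - a) by field_simp; ring, Complex.normSq_eq_norm_sq,
      norm_div, hb, one_div]
  rw [Complex.normSq_apply] at h1 h2
  simp only [Complex.add_re, Complex.one_re, Complex.add_im, Complex.one_im, add_zero] at h2
  have hpos : 0 < ‖b - a‖⁻¹ := by positivity
  apply lt_of_pow_lt_pow_left₀ 2 hpos.le
  nlinarith

end Chord

lemma chord_side_const {γ F : ℂ → ℂ} {U : Set ℂ} (hγ : ContinuousOn γ (sphere 0 1))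
    (hi : InjOn γ (sphere 0 1)) (hUb : Bornology.IsBounded U)
    (hUc : IsPreconnected U) (hfr : frontier U ⊆ γ '' sphere 0 1)
    (hdisj : Disjoint U (γ '' sphere 0 1)) (hF : ContinuousOn F (closedBall 0 1))
    (hd : DifferentiableOn ℂ F (ball 0 1)) (hFi : InjOn F (ball 0 1)) (hFU : F '' ball 0 1 = U)
    (hFJ : MapsTo F (sphere 0 1) (γ '' sphere 0 1)) {a b : ℂ} (ha : ‖a‖ = 1) (hb : ‖b‖ = 1)
    (hab : a ≠ b) (hFab : F a = F b) {s s' : ℂ} (hs : ‖s‖ = 1) (hs' : ‖s'‖ = 1)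
    (hspos : 0 < ((s - a) / (b - a)).im) (hsneg : ((s' - a) / (b - a)).im < 0)
    (hFs : F s ≠ F a) (hFs' : F s' ≠ F a) : False := by
  set J := γ '' sphere 0 1
  set ℓ : ℂ → ℝ := fun z => ((z - a) / (b - a)).im
  have hℓ : Continuous ℓ := by fun_prop
  have hd0 : b - a ≠ 0 := sub_ne_zero.2 hab.symm
  have hlin : ∀ x y : ℂ, ∀ t u : ℝ, t + u = 1 → ℓ (t • x + u • y) = t * ℓ x + u * ℓ y := by
    intro x y t u htu
    have e : (t • x + u • y - a) / (b - a) = (t : ℂ) * ((x - a) / (b - a)) +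
        (u : ℂ) * ((y - a) / (b - a)) := by
      have : (t : ℂ) + u = 1 := by exact_mod_cast htu
      simp only [Complex.real_smul]
      field_simp
      linear_combination a * this
    simp only [ℓ]
    rw [e, Complex.add_im, Complex.im_ofReal_mul, Complex.im_ofReal_mul]
  set T := closedBall (0 : ℂ) 1 ∩ {z | ℓ z = 0}
  have hTconv : Convex ℝ T := by
    refine (convex_closedBall _ _).inter ?_
    intro x hx y hy t u _ _ htu
    have hx : ℓ x = 0 := hx
    have hy : ℓ y = 0 := hy
    change ℓ _ = 0
    rw [hlin x y t u htu, hx, hy]; ring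
  have hTcpt : IsCompact T := (isCompact_closedBall _ _).inter_right
    (isClosed_eq hℓ continuous_const)
  have hFT : ContinuousOn F T := hF.mono inter_subset_left
  have hTend : ∀ z ∈ T, ‖z‖ = 1 → F z = F a := by
    intro z hz h1
    have h2 := chord_identity ha hb hab hz.2
    rw [h1] at h2
    have h3 : ‖b - a‖ ^ 2 ≠ 0 := pow_ne_zero _ (norm_ne_zero_iff.2 hd0)
    have h4 : ((z - a) / (b - a)).re * (1 - ((z - a) / (b - a)).re) = 0 := by grind
    have hz0 : ((z - a) / (b - a)).im = 0 := hz.2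
    rcases mul_eq_zero.1 h4 with h | h
    · have : (z - a) / (b - a) = 0 := Complex.ext h hz0
      rw [div_eq_zero_iff, or_iff_left hd0, sub_eq_zero] at this
      rw [this]
    · have : (z - a) / (b - a) = 1 := Complex.ext (by simpa using (sub_eq_zero.1 h).symm) hz0
      rw [div_eq_one_iff_eq hd0] at this
      rw [show z = b by linear_combination this, hFab]
  set p := F a
  have haT : a ∈ T := ⟨by simp [ha], by simp [ℓ]⟩
  have hpJ : p ∈ J := hFJ (by simpa using ha)
  have hFball : ∀ z ∈ ball (0 : ℂ) 1, F z ∈ U := fun z hz => hFU ▸ ⟨z, hz, rfl⟩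
  have hUJ : ∀ z ∈ U, z ∉ J := fun z hz h => hdisj.le_bot ⟨hz, h⟩
  have hcases : ∀ z ∈ closedBall (0 : ℂ) 1, z ∈ ball (0 : ℂ) 1 ∨ ‖z‖ = 1 := fun z hz => by
    rcases (mem_closedBall_zero_iff.1 hz).lt_or_eq with h | h
    · left; simpa using h
    · exact Or.inr h
  have hAB : J ∩ F '' T = {p} := by grind
  -- the two sides of the chord
  have side : ∀ (ε : ℝ) (s : ℂ), ‖s‖ = 1 → 0 < ε * ℓ s →
      IsPreconnected (F '' insert s (ball (0 : ℂ) 1 ∩ {z | 0 < ε * ℓ z})) ∧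
      (ball (0 : ℂ) 1 ∩ {z | 0 < ε * ℓ z}).Nonempty := by
    intro ε s hs hεs
    have hO : IsOpen {z | 0 < ε * ℓ z} := isOpen_lt continuous_const (continuous_const.mul hℓ)
    have hcl : s ∈ closure (ball (0 : ℂ) 1 ∩ {z | 0 < ε * ℓ z}) := by
      apply hO.closure_inter
      refine ⟨?_, hεs⟩
      rw [closure_ball _ one_ne_zero]
      simp [hs]
    have hconv : Convex ℝ (ball (0 : ℂ) 1 ∩ {z | 0 < ε * ℓ z}) := by
      refine (convex_ball _ _).inter ?_
      intro x hx y hy t u ht hu htu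
      have hx : 0 < ε * ℓ x := hx
      have hy : 0 < ε * ℓ y := hy
      change 0 < ε * ℓ _
      rw [hlin x y t u htu]
      rcases ht.eq_or_lt with h | h
      · have : u = 1 := by linarith
        rw [← h, this]; linarith
      · nlinarith [mul_pos h hx, mul_nonneg hu hy.le]
    refine ⟨(hconv.isPreconnected.subset_closure (subset_insert _ _)
      (insert_subset hcl subset_closure)).image _ (hF.mono (insert_subset (by simp [hs]) ?_)),
      closure_nonempty_iff.1 ⟨s, hcl⟩⟩
    exact inter_subset_left.trans ball_subset_closedBall
  obtain ⟨hc1, z1, hz1b, hz1p⟩ := side 1 s hs (by simpa using hspos)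
  obtain ⟨hc2, z2, hz2b, hz2p⟩ := side (-1) s' hs' (by simpa using hsneg)
  have hz1p : 0 < ℓ z1 := by simpa using hz1p
  have hz2p : ℓ z2 < 0 := by simpa using hz2p
  obtain ⟨q, hq, hqp⟩ := hpJ
  have hJp : IsPreconnected (J \ {p}) := by
    have : J \ {p} = γ '' (sphere 0 1 \ {q}) := by
      ext x
      constructor
      · grind
      · rintro ⟨t, ⟨ht, hne⟩, rfl⟩
        exact ⟨⟨t, ht, rfl⟩, fun h => hne (hi ht hq (h.trans hqp.symm))⟩
    rw [this]
    exact (isPreconnected_circle_diff_singleton (by simpa using hq)).image _ (hγ.mono sdiff_subset)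
  have hsJ : F s ∈ J \ {p} := ⟨hFJ (by simpa using hs), hFs⟩
  have hsJ' : F s' ∈ J \ {p} := ⟨hFJ (by simpa using hs'), hFs'⟩
  set C' := (F '' insert s (ball (0 : ℂ) 1 ∩ {z | 0 < 1 * ℓ z})) ∪ (J \ {p}) ∪
    (F '' insert s' (ball (0 : ℂ) 1 ∩ {z | 0 < -1 * ℓ z}))
  have hC' : IsPreconnected C' := by
    refine IsPreconnected.union (F s') (Or.inr hsJ') ⟨s', mem_insert _ _, rfl⟩ ?_ hc2
    exact IsPreconnected.union (F s) ⟨s, mem_insert _ _, rfl⟩ hsJ hc1 hJp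
  have hballT : ∀ z ∈ ball (0 : ℂ) 1, ℓ z ≠ 0 → F z ∉ F '' T := by
    rintro z hz hne ⟨w, hw, he⟩
    rcases hcases w hw.1 with h | h
    · have := hFi h hz he
      rw [← this] at hne
      exact hne hw.2
    · grind
  have hJT : ∀ x ∈ J \ {p}, x ∉ F '' T := fun x hx h => hx.2 (hAB ▸ ⟨hx.1, h⟩ : x ∈ ({p} : Set ℂ))
  have hC'T : Disjoint C' (F '' T) := by
    rw [Set.disjoint_left]
    rintro x ((⟨z, hz, rfl⟩ | hx) | ⟨z, hz, rfl⟩)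
    · rcases hz with rfl | hz
      · exact hJT _ hsJ
      · have h : 0 < 1 * ℓ z := hz.2
        exact hballT z hz.1 (by linarith)
    · exact hJT x hx
    · grind
  set N := F '' (ball (0 : ℂ) 1 ∩ {z | 0 < ℓ z})
  have hop : ∀ O : Set ℂ, IsOpen O → IsOpen (F '' (ball 0 1 ∩ O)) := fun O hO =>
    isOpen_image_of_injOn (isOpen_ball.inter hO) (hd.mono inter_subset_left)
      (hFi.mono inter_subset_left)
  have hNU : N ⊆ U := by rw [← hFU]; exact image_mono inter_subset_left
  have hNfr : frontier N ⊆ J ∪ F '' T := by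
    intro x hx
    rw [frontier, (hop _ (isOpen_lt continuous_const hℓ)).interior_eq] at hx
    by_cases hxJ : x ∈ J
    · exact Or.inl hxJ
    right
    have hxU : x ∈ U := by
      by_contra hxU
      exact hxJ (hfr ⟨closure_mono hNU hx.1, fun h => hxU (interior_subset h)⟩)
    rw [← hFU] at hxU
    obtain ⟨w, hw, rfl⟩ := hxU
    rcases lt_trichotomy 0 (ℓ w) with h | h | h
    · exact absurd ⟨w, ⟨hw, h⟩, rfl⟩ hx.2
    · exact ⟨w, ⟨ball_subset_closedBall hw, h.symm⟩, rfl⟩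
    · exfalso
      obtain ⟨_, ⟨w', ⟨hw', hr'⟩, rfl⟩, ⟨w'', ⟨hw'', hr''⟩, he⟩⟩ :=
        mem_closure_iff.1 hx.1 _ (hop {w | ℓ w < 0} (isOpen_lt hℓ continuous_const)) ⟨w, ⟨hw, h⟩, rfl⟩
      have := hFi hw'' hw' he
      subst this
      have h1 : ℓ w'' < 0 := hr'
      have h2 : 0 < ℓ w'' := hr''
      linarith
  have hJc : IsClosed J := ((isCompact_sphere _ _).image_of_continuousOn hγ).isClosed
  have hmem : F z2 ∈ N := janiszewski (A := J) (B := F '' T) (C := U) (C' := C') (p := F z1) hJc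
    (hTcpt.image_of_continuousOn hFT).isClosed (by rw [hAB]; exact isPreconnected_singleton)
    hUc hdisj hC' hC'T (hFball z1 hz1b) (hFball z2 hz2b)
    (Or.inl (Or.inl ⟨z1, Or.inr ⟨hz1b, by simpa using hz1p⟩, rfl⟩))
    (Or.inr ⟨z2, Or.inr ⟨hz2b, by simpa using hz2p⟩, rfl⟩) (hUb.subset hNU) hNfr
    ⟨z1, ⟨hz1b, hz1p⟩, rfl⟩
  obtain ⟨w, ⟨hw, hw2⟩, he⟩ := hmem
  have := hFi hw hz2b he
  subst this
  have hw2 : 0 < ℓ w := hw2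
  linarith

lemma injOn_circle_of_boundary_extension {γ F : ℂ → ℂ} {U : Set ℂ}
    (hγ : ContinuousOn γ (sphere 0 1))
    (hi : InjOn γ (sphere 0 1)) (hUb : Bornology.IsBounded U)
    (hUc : IsPreconnected U) (hfr : frontier U ⊆ γ '' sphere 0 1)
    (hdisj : Disjoint U (γ '' sphere 0 1)) (hF : ContinuousOn F (closedBall 0 1))
    (hd : DifferentiableOn ℂ F (ball 0 1)) (hFi : InjOn F (ball 0 1)) (hFU : F '' ball 0 1 = U)
    (hFJ : MapsTo F (sphere 0 1) (γ '' sphere 0 1)) : InjOn F (sphere 0 1) := by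
  intro a ha b hb hFab
  by_contra hab
  have hFJ' := hFJ ha
  rw [mem_sphere_zero_iff_norm] at ha hb
  have hconst : ∀ a b : ℂ, ‖a‖ = 1 → ‖b‖ = 1 → a ≠ b → F a ∈ γ '' sphere 0 1 →
      ∃ s, ‖s‖ = 1 ∧ 0 < ((s - a) / (b - a)).im ∧ F s ≠ F a := by
    intro a b ha hb hab hFJ
    by_contra! h
    obtain ⟨u, hu, hupos⟩ := exists_mem_circle_chord_pos ha hb hab
    have h0 : F 0 = F a := eq_center_of_eqOn_arc hF hd
      (O := {z | 0 < ((z - a) / (b - a)).im}) (isOpen_lt continuous_const (by fun_prop)) hu hupos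
      (fun z hz => h z (by simpa using hz.1) hz.2)
    exact hdisj.le_bot ⟨(hFU ▸ ⟨0, mem_ball_self one_pos, rfl⟩ : F 0 ∈ U), h0 ▸ hFJ⟩
  obtain ⟨s, hs, hspos, hFs⟩ := hconst a b ha hb hab hFJ'
  obtain ⟨s', hs', hspos', hFs'⟩ := hconst b a hb ha (Ne.symm hab) (hFab ▸ hFJ')
  refine chord_side_const hγ hi hUb hUc hfr hdisj hF hd hFi hFU hFJ ha hb hab hFab hs hs' hspos ?_
    hFs (hFab ▸ hFs')
  have hd0 : b - a ≠ 0 := sub_ne_zero.2 (Ne.symm hab)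
  have hd1 : a - b ≠ 0 := sub_ne_zero.2 hab
  have e : (s' - a) / (b - a) = 1 - (s' - b) / (a - b) := by
    rw [← neg_sub b a]
    field_simp
    ring
  rw [e]
  simpa using hspos'

/-- The radial extension of a self-map of the unit circle. -/
noncomputable def circleCone (β : ℂ → ℂ) (z : ℂ) : ℂ := ‖z‖ * β (z / ‖z‖)

lemma norm_div_norm_mem_circle {z : ℂ} (hz : z ≠ 0) : z / ‖z‖ ∈ sphere (0 : ℂ) 1 := by
  simp [hz]

lemma norm_circleCone {β : ℂ → ℂ} (hm : MapsTo β (sphere 0 1) (sphere 0 1)) (z : ℂ) :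
    ‖circleCone β z‖ = ‖z‖ := by
  by_cases hz : z = 0
  · simp [circleCone, hz]
  · have : ‖β (z / ‖z‖)‖ = 1 := by simpa using hm (norm_div_norm_mem_circle hz)
    simp [circleCone, this]

lemma circleCone_of_mem {β : ℂ → ℂ} {z : ℂ} (hz : z ∈ sphere (0 : ℂ) 1) :
    circleCone β z = β z := by
  have : ‖z‖ = 1 := by simpa using hz
  simp [circleCone, this]

lemma continuous_circleCone {β : ℂ → ℂ} (hβ : ContinuousOn β (sphere 0 1))
    (hm : MapsTo β (sphere 0 1) (sphere 0 1)) : Continuous (circleCone β) := by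
  rw [continuous_iff_continuousAt]
  intro z
  by_cases hz : z = 0
  · subst hz
    have h0 : circleCone β 0 = 0 := by simp [circleCone]
    rw [ContinuousAt, h0, tendsto_zero_iff_norm_tendsto_zero]
    simp only [norm_circleCone hm]
    simpa using (continuous_norm (E := ℂ)).tendsto 0
  · have hO : IsOpen {z : ℂ | z ≠ 0} := isOpen_ne
    have : ContinuousOn (circleCone β) {z : ℂ | z ≠ 0} := by
      refine ContinuousOn.mul (by fun_prop) (hβ.comp ?_ fun w hw => norm_div_norm_mem_circle hw)
      refine ContinuousOn.div continuousOn_id (by fun_prop) fun w hw => ?_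
      have hw : w ≠ 0 := hw
      simpa using hw
    exact this.continuousAt (hO.mem_nhds hz)

lemma injective_circleCone {β : ℂ → ℂ} (hm : MapsTo β (sphere 0 1) (sphere 0 1))
    (hi : InjOn β (sphere 0 1)) : Function.Injective (circleCone β) := by
  intro z w h
  have hn : ‖z‖ = ‖w‖ := by rw [← norm_circleCone hm, h, norm_circleCone hm]
  by_cases hz : z = 0
  · rw [hz, norm_zero] at hn
    rw [hz, norm_eq_zero.1 hn.symm]
  have hw : w ≠ 0 := by
    rintro rfl
    rw [norm_zero, norm_eq_zero] at hn
    exact hz hn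
  have hz' : (‖z‖ : ℂ) ≠ 0 := by simpa using hz
  simp only [circleCone, ← hn] at h
  have h2 := hi (norm_div_norm_mem_circle hz) (hn ▸ norm_div_norm_mem_circle hw)
    (mul_left_cancel₀ hz' h)
  exact (div_left_inj' hz').1 h2

lemma exists_circleCone_eq {β : ℂ → ℂ} (hs : SurjOn β (sphere 0 1) (sphere 0 1)) (w : ℂ) :
    ∃ z, circleCone β z = w ∧ ‖z‖ = ‖w‖ := by
  by_cases hw : w = 0
  · exact ⟨0, by simp [circleCone, hw], by simp [hw]⟩
  have hw' : (‖w‖ : ℂ) ≠ 0 := by simpa using hw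
  obtain ⟨s, hs, he⟩ := hs (norm_div_norm_mem_circle hw)
  have hs1 : ‖s‖ = 1 := by simpa using hs
  have hn : ‖(‖w‖ : ℂ) * s‖ = ‖w‖ := by simp [hs1]
  refine ⟨‖w‖ * s, ?_, hn⟩
  rw [circleCone, hn, mul_div_cancel_left₀ _ hw', he]
  field_simp

/-- The Jordan–Schoenflies theorem: every Jordan curve bounds a closed topological disc. -/
theorem schoenflies {γ : ℂ → ℂ} (hγ : ContinuousOn γ (sphere 0 1)) (hi : InjOn γ (sphere 0 1)) :
    ∃ h : ℂ → ℂ, ContinuousOn h (closedBall 0 1) ∧ InjOn h (closedBall 0 1) ∧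
      EqOn h γ (sphere 0 1) ∧ IsOpen (h '' ball 0 1) := by
  obtain ⟨U, hU, hUc, hUb, hfr, hdisj, hlog⟩ := exists_jordan_domain hγ hi
  obtain ⟨f, hf, hfi, hfU⟩ := exists_riemann_map hU hUc hUb hlog
  obtain ⟨F, hF, hFf, hFJ⟩ := exists_boundary_extension hγ hi hUb hUc.isPreconnected hfr hdisj hf
    hfi hfU
  have hFi : InjOn F (ball 0 1) := hFf.injOn_iff.2 hfi
  have hFU : F '' ball 0 1 = U := by rw [hFf.image_eq, hfU]
  have hd : DifferentiableOn ℂ F (ball 0 1) := hf.congr hFf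
  have hFs := injOn_circle_of_boundary_extension hγ hi hUb hUc.isPreconnected hfr hdisj hF hd hFi
    hFU hFJ
  have hcl : closedBall (0 : ℂ) 1 = ball 0 1 ∪ sphere 0 1 := ball_union_sphere.symm
  have hFinj : InjOn F (closedBall 0 1) := by
    rw [hcl, injOn_union (disjoint_left.2 fun z h1 h2 => ?_)]
    · refine ⟨hFi, hFs, fun z hz w hw h => ?_⟩
      exact hdisj.le_bot ⟨(hFU ▸ ⟨z, hz, rfl⟩ : F z ∈ U), h ▸ hFJ hw⟩
    · exact (mem_ball.1 h1).ne (mem_sphere.1 h2)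
  have hsub : sphere (0 : ℂ) 1 ⊆ closedBall 0 1 := sphere_subset_closedBall
  set α : ℂ → ℂ := fun z => Function.invFunOn γ (sphere 0 1) (F z)
  have hγα : ∀ z ∈ sphere (0 : ℂ) 1, γ (α z) = F z := fun z hz => Function.invFunOn_eq (hFJ hz)
  have hαm : MapsTo α (sphere 0 1) (sphere 0 1) := fun z hz => Function.invFunOn_mem (hFJ hz)
  have hα : ContinuousOn α (sphere 0 1) :=
    (continuousOn_invFunOn (isCompact_sphere _ _) hγ hi).comp (hF.mono hsub) hFJ
  have hαi : InjOn α (sphere 0 1) := fun z hz w hw h => by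
    apply hFs hz hw
    rw [← hγα z hz, ← hγα w hw, h]
  have hαs := surjOn_circle_of_injOn hα hαm hαi
  set β : ℂ → ℂ := Function.invFunOn α (sphere 0 1)
  have hβm : MapsTo β (sphere 0 1) (sphere 0 1) := fun z hz => Function.invFunOn_mem (hαs hz)
  have hαβ : ∀ z ∈ sphere (0 : ℂ) 1, α (β z) = z := fun z hz => Function.invFunOn_eq (hαs hz)
  have hβ : ContinuousOn β (sphere 0 1) :=
    (continuousOn_invFunOn (isCompact_sphere _ _) hα hαi).mono hαs
  have hβi : InjOn β (sphere 0 1) := fun z hz w hw h => by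
    rw [← hαβ z hz, ← hαβ w hw, h]
  have hβs := surjOn_circle_of_injOn hβ hβm hβi
  have hcm : ∀ r, MapsTo (circleCone β) (closedBall 0 r) (closedBall 0 r) := fun r z hz => by
    rw [mem_closedBall_zero_iff, norm_circleCone hβm]; simpa using hz
  refine ⟨F ∘ circleCone β, hF.comp (continuous_circleCone hβ hβm).continuousOn (hcm 1),
    hFinj.comp (injective_circleCone hβm hβi).injOn (hcm 1), fun z hz => ?_, ?_⟩
  · rw [Function.comp_apply, circleCone_of_mem hz, ← hγα _ (hβm hz), hαβ z hz]
  · have : circleCone β '' ball 0 1 = ball 0 1 := by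
      ext w
      constructor
      · rintro ⟨z, hz, rfl⟩
        rw [mem_ball_zero_iff, norm_circleCone hβm]; simpa using hz
      · intro hw
        obtain ⟨z, rfl, hz⟩ := exists_circleCone_eq hβs w
        refine ⟨z, ?_, rfl⟩
        rw [mem_ball_zero_iff] at hw ⊢
        rwa [hz]
    rw [image_comp, this, hFU]
    exact hU

/-- A map of the closed unit disc onto a closed topological disc in the plane. -/
structure IsDisc (h : ℂ → ℂ) : Prop where
  continuousOn : ContinuousOn h (closedBall 0 1)
  injOn : InjOn h (closedBall 0 1)
  isOpen : IsOpen (h '' ball 0 1)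

namespace IsDisc
variable {h : ℂ → ℂ}

lemma image_closedBall (h : ℂ → ℂ) :
    h '' closedBall 0 1 = h '' ball 0 1 ∪ h '' sphere 0 1 := by
  rw [← image_union, ball_union_sphere]

lemma isCompact (hh : IsDisc h) : IsCompact (h '' closedBall 0 1) :=
  (isCompact_closedBall 0 1).image_of_continuousOn hh.continuousOn

lemma isCompact_boundary (hh : IsDisc h) : IsCompact (h '' sphere 0 1) :=
  (isCompact_sphere 0 1).image_of_continuousOn (hh.continuousOn.mono sphere_subset_closedBall)

lemma ball_subset (h : ℂ → ℂ) : h '' ball 0 1 ⊆ h '' closedBall 0 1 :=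
  image_mono ball_subset_closedBall

lemma sphere_subset (h : ℂ → ℂ) : h '' sphere 0 1 ⊆ h '' closedBall 0 1 :=
  image_mono sphere_subset_closedBall

lemma isBounded (hh : IsDisc h) : Bornology.IsBounded (h '' ball 0 1) :=
  hh.isCompact.isBounded.subset (ball_subset h)

lemma isConnected (hh : IsDisc h) : IsConnected (h '' ball 0 1) :=
  ((convex_ball (0 : ℂ) 1).isConnected ⟨0, by simp⟩).image _
    (hh.continuousOn.mono ball_subset_closedBall)

lemma disjoint (hh : IsDisc h) : Disjoint (h '' ball 0 1) (h '' sphere 0 1) := by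
  rw [disjoint_left]
  rintro _ ⟨z, hz, rfl⟩ ⟨w, hw, hwz⟩
  have := hh.injOn (sphere_subset_closedBall hw) (ball_subset_closedBall hz) hwz
  subst this
  exact (mem_ball.1 hz).ne (mem_sphere.1 hw)

lemma closure_eq (hh : IsDisc h) : closure (h '' ball 0 1) = h '' closedBall 0 1 := by
  apply subset_antisymm (closure_minimal (ball_subset h) hh.isCompact.isClosed)
  have : ContinuousOn h (closure (ball 0 1)) := by
    rw [closure_ball _ one_ne_zero]; exact hh.continuousOn
  have h2 := this.image_closure
  rwa [closure_ball _ one_ne_zero] at h2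

lemma frontier_eq (hh : IsDisc h) : frontier (h '' ball 0 1) = h '' sphere 0 1 := by
  rw [hh.isOpen.frontier_eq, hh.closure_eq, image_closedBall, union_sdiff_left]
  exact hh.disjoint.symm.sdiff_eq_left

lemma continuousOn_inv (hh : IsDisc h) :
    ContinuousOn (Function.invFunOn h (closedBall 0 1)) (h '' closedBall 0 1) :=
  continuousOn_invFunOn (isCompact_closedBall _ _) hh.continuousOn hh.injOn

lemma inv_apply (hh : IsDisc h) {z : ℂ} (hz : z ∈ closedBall (0 : ℂ) 1) :
    Function.invFunOn h (closedBall 0 1) (h z) = z :=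
  hh.injOn.leftInvOn_invFunOn hz

lemma inv_mem {w : ℂ} (hw : w ∈ h '' closedBall 0 1) :
    Function.invFunOn h (closedBall 0 1) w ∈ closedBall (0 : ℂ) 1 := Function.invFunOn_mem hw

lemma apply_inv {w : ℂ} (hw : w ∈ h '' closedBall 0 1) :
    h (Function.invFunOn h (closedBall 0 1) w) = w := Function.invFunOn_eq hw

lemma hasLogOn (hh : IsDisc h) {g : ℂ → ℂ} (hg : ContinuousOn g (h '' closedBall 0 1))
    (h0 : ∀ z ∈ h '' closedBall 0 1, g z ≠ 0) : HasLogOn g (h '' closedBall 0 1) := by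
  have h1 := hasLogOn_closedBall one_pos (hg.comp hh.continuousOn (mapsTo_image _ _))
    fun z hz => h0 _ ⟨z, hz, rfl⟩
  exact (h1.comp hh.continuousOn_inv fun w hw => inv_mem hw).congr fun w hw => by
    simp [apply_inv hw]

end IsDisc

/-- A bounded set whose frontier lies in a compact set supporting a logarithm of `z - p` does not
contain `p`. -/
lemma not_hasLogOn_of_frontier {K V : Set ℂ} (hK : IsCompact K) (hb : Bornology.IsBounded V)
    (hfr : frontier V ⊆ K) {p : ℂ} (hp : p ∈ V) : ¬ HasLogOn (fun z => z - p) K := by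
  intro hl
  obtain ⟨R, hR0, hR⟩ := (hK.isBounded.union hb).exists_pos_norm_le
  have hn : ‖((R + 1 : ℝ) : ℂ)‖ = R + 1 := by
    rw [Complex.norm_real, Real.norm_of_nonneg (by positivity)]
  have hq : ((R + 1 : ℝ) : ℂ) ∉ V := fun h => by
    have := hR _ (Or.inr h)
    linarith
  refine not_hasLogOn_div hK.isClosed hb hfr hp hq (hl.div (hasLogOn_sub_of_far
    (fun z hz => hR z (Or.inl hz)) (by linarith) fun h => ?_))
  rw [h, norm_zero] at hn
  linarith

lemma not_hasLogOn_sphere_center {x : ℂ} {r : ℝ} (hr : 0 < r) :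
    ¬ HasLogOn (fun z => z - x) (sphere x r) :=
  not_hasLogOn_of_frontier (isCompact_sphere x r) isBounded_ball
    (frontier_ball x hr.ne').subset (mem_ball_self hr)

namespace IsDisc
variable {h : ℂ → ℂ}

lemma subset_of_frontier (hh : IsDisc h) {V : Set ℂ} (hb : Bornology.IsBounded V)
    (hfr : frontier V ⊆ h '' closedBall 0 1) : V ⊆ h '' closedBall 0 1 := fun p hp => by
  by_contra hpD
  exact not_hasLogOn_of_frontier hh.isCompact hb hfr hp (hh.hasLogOn (by fun_prop) fun z hz h0 =>
    hpD (by rwa [← sub_eq_zero.1 h0]))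

/-- A boundary point of a disc is not an interior point. -/
lemma open_subset (hh : IsDisc h) {V : Set ℂ} (hV : IsOpen V) (hVD : V ⊆ h '' closedBall 0 1) :
    V ⊆ h '' ball 0 1 := by
  intro x hx
  have hxD := hVD hx
  rw [image_closedBall] at hxD
  refine hxD.resolve_right ?_
  rintro ⟨ζ, hζ, rfl⟩
  obtain ⟨r, hr, hrV⟩ := nhds_basis_closedBall.mem_iff.1 (hV.mem_nhds hx)
  refine not_hasLogOn_sphere_center (x := h ζ) hr ?_
  have huc := (isCompact_closedBall (0 : ℂ) 1).uniformContinuousOn_of_continuous hh.continuousOn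
  obtain ⟨δ, hδ, hδh⟩ := Metric.uniformContinuousOn_iff.1 huc r hr
  set s : ℝ := 1 - min (δ / 2) (1 / 2)
  have hm : 0 < min (δ / 2) (1 / 2) := by positivity
  have hm2 : min (δ / 2) (1 / 2) ≤ 1 / 2 := min_le_right _ _
  have hm1 : min (δ / 2) (1 / 2) ≤ δ / 2 := min_le_left _ _
  have hs0 : 0 < s := by simp only [s]; linarith
  have hs1 : s < 1 := by simp only [s]; linarith
  have hsb : ∀ w ∈ closedBall (0 : ℂ) 1, (s : ℂ) * w ∈ ball (0 : ℂ) 1 := fun w hw => by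
    rw [mem_ball_zero_iff, norm_mul, Complex.norm_real, Real.norm_of_nonneg hs0.le]
    rw [mem_closedBall_zero_iff] at hw
    nlinarith [norm_nonneg w]
  have hne : ∀ w ∈ closedBall (0 : ℂ) 1, h (s * w) - h ζ ≠ 0 := fun w hw h0 => by
    have := hh.injOn (ball_subset_closedBall (hsb w hw)) (sphere_subset_closedBall hζ)
      (sub_eq_zero.1 h0)
    have h1 := hsb w hw
    rw [this] at h1
    exact (mem_ball.1 h1).ne (mem_sphere.1 hζ)
  set i := Function.invFunOn h (closedBall 0 1)
  have hSD : sphere (h ζ) r ⊆ h '' closedBall 0 1 :=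
    sphere_subset_closedBall.trans (hrV.trans hVD)
  have h1 : HasLogOn (fun z => h (s * i z) - h ζ) (sphere (h ζ) r) := by
    refine (hh.hasLogOn (g := fun z => h (s * i z) - h ζ) ?_ fun z hz => hne _ (inv_mem hz)).mono
      hSD
    refine ContinuousOn.sub ?_ continuousOn_const
    exact hh.continuousOn.comp (continuousOn_const.mul hh.continuousOn_inv) fun z hz =>
      ball_subset_closedBall (hsb _ (inv_mem hz))
  have hzne : ∀ z ∈ sphere (h ζ) r, z - h ζ ≠ 0 := fun z hz h0 => by
    rw [sub_eq_zero.1 h0, mem_sphere, dist_self] at hz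
    exact hr.ne hz
  have h2 : HasLogOn (fun z => (h (s * i z) - h ζ) / (z - h ζ)) (sphere (h ζ) r) := by
    refine hasLogOn_of_norm_sub_lt ?_ fun z hz => ?_
    · refine ContinuousOn.div ?_ (by fun_prop) hzne
      refine ContinuousOn.sub ?_ continuousOn_const
      exact hh.continuousOn.comp (continuousOn_const.mul (hh.continuousOn_inv.mono hSD))
        fun z hz => ball_subset_closedBall (hsb _ (inv_mem (hSD hz)))
    · have hz0 := hzne z hz
      have hiz := inv_mem (hSD hz)
      have h3 := hδh _ (ball_subset_closedBall (hsb _ hiz)) _ hiz (by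
        rw [dist_eq_norm]
        have : (s : ℂ) * i z - i z = ((s - 1 : ℝ) : ℂ) * i z := by push_cast; ring
        rw [this, norm_mul, Complex.norm_real, Real.norm_of_nonpos (by linarith)]
        have hiz' : ‖i z‖ ≤ 1 := by simpa using hiz
        have : -(s - 1) ≤ δ / 2 := by simp only [s]; linarith
        nlinarith [norm_nonneg (i z)])
      rw [apply_inv (hSD hz), dist_eq_norm] at h3
      rw [div_sub_one hz0, norm_div, div_lt_one (norm_pos_iff.2 hz0), sub_sub_sub_cancel_right]
      rwa [← dist_eq_norm z, mem_sphere.1 hz]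
  refine (h1.div h2).congr fun z hz => ?_
  have hz0 := hzne z hz
  have hz1 := hne _ (inv_mem (hSD hz))
  simp only
  rw [div_div_cancel₀ hz1]

lemma ball_subset_of_frontier (hh : IsDisc h) {V : Set ℂ} (hV : IsOpen V)
    (hb : Bornology.IsBounded V) (hfr : frontier V ⊆ h '' closedBall 0 1) :
    V ⊆ h '' ball 0 1 :=
  hh.open_subset hV (hh.subset_of_frontier hb hfr)

end IsDisc

/-- Two discs whose boundary curves form a theta curve with that of a third disc tile it. -/
structure IsTiling (h h₁ h₂ : ℂ → ℂ) : Prop where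
  left_subset : h₁ '' ball 0 1 ⊆ h '' ball 0 1
  right_subset : h₂ '' ball 0 1 ⊆ h '' ball 0 1
  disjoint : Disjoint (h₁ '' ball 0 1) (h₂ '' ball 0 1)
  union : h₁ '' closedBall 0 1 ∪ h₂ '' closedBall 0 1 = h '' closedBall 0 1

lemma isTiling_of_theta {h h₁ h₂ : ℂ → ℂ} (hh : IsDisc h) (hh₁ : IsDisc h₁) (hh₂ : IsDisc h₂)
    (hA : IsPreconnected (h₁ '' sphere 0 1 ∩ h₂ '' sphere 0 1))
    (hs₁ : h₁ '' sphere 0 1 ⊆ h '' closedBall 0 1) (hs₂ : h₂ '' sphere 0 1 ⊆ h '' closedBall 0 1)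
    (hc : h '' sphere 0 1 ⊆ h₁ '' sphere 0 1 ∪ h₂ '' sphere 0 1)
    (ho₁ : h₁ '' sphere 0 1 ⊆ h '' sphere 0 1 ∪ h₂ '' sphere 0 1)
    (ho₂ : h₂ '' sphere 0 1 ⊆ h '' sphere 0 1 ∪ h₁ '' sphere 0 1)
    (hne : h₁ '' sphere 0 1 ≠ h₂ '' sphere 0 1) : IsTiling h h₁ h₂ := by
  have hl := hh.ball_subset_of_frontier hh₁.isOpen hh₁.isBounded (hh₁.frontier_eq ▸ hs₁)
  have hr := hh.ball_subset_of_frontier hh₂.isOpen hh₂.isBounded (hh₂.frontier_eq ▸ hs₂)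
  have hx₁ : Disjoint (h₁ '' ball 0 1) (h₂ '' sphere 0 1) :=
    disjoint_left.2 fun z hz hz' => (ho₂ hz').elim (fun h' => hh.disjoint.le_bot ⟨hl hz, h'⟩)
      fun h' => hh₁.disjoint.le_bot ⟨hz, h'⟩
  have hx₂ : Disjoint (h₂ '' ball 0 1) (h₁ '' sphere 0 1) :=
    disjoint_left.2 fun z hz hz' => (ho₁ hz').elim (fun h' => hh.disjoint.le_bot ⟨hr hz, h'⟩)
      fun h' => hh₂.disjoint.le_bot ⟨hz, h'⟩
  have hd : Disjoint (h₁ '' ball 0 1) (h₂ '' ball 0 1) := by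
    by_contra hnd
    obtain ⟨z, hz₁, hz₂⟩ := not_disjoint_iff.1 hnd
    have key : ∀ {f g : ℂ → ℂ}, IsDisc f → IsDisc g → Disjoint (f '' ball 0 1) (g '' sphere 0 1) →
        z ∈ f '' ball 0 1 → z ∈ g '' ball 0 1 → f '' ball 0 1 ⊆ g '' ball 0 1 := by
      intro f g hf hg hfg hzf hzg w hw
      by_contra hwg
      obtain ⟨y, hy, hy'⟩ := hf.isConnected.isPreconnected.nonempty_inter_frontier
        ⟨z, hzf, hzg⟩ ⟨w, hw, hwg⟩
      rw [hg.frontier_eq] at hy'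
      exact hfg.le_bot ⟨hy, hy'⟩
    have heq := (key hh₁ hh₂ hx₁ hz₁ hz₂).antisymm (key hh₂ hh₁ hx₂ hz₂ hz₁)
    rw [← hh₁.frontier_eq, ← hh₂.frontier_eq, heq] at hne
    exact hne rfl
  refine ⟨hl, hr, hd, ?_⟩
  have hinter : h₁ '' closedBall 0 1 ∩ h₂ '' closedBall 0 1
      = h₁ '' sphere 0 1 ∩ h₂ '' sphere 0 1 := by
    rw [IsDisc.image_closedBall, IsDisc.image_closedBall]
    ext z
    constructor
    · grind
    · exact fun hz => ⟨Or.inr hz.1, Or.inr hz.2⟩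
  apply subset_antisymm
  · rw [IsDisc.image_closedBall h₁, IsDisc.image_closedBall h₂]
    exact union_subset (union_subset (hl.trans (IsDisc.ball_subset h)) hs₁)
      (union_subset (hr.trans (IsDisc.ball_subset h)) hs₂)
  · intro p hp
    by_contra hpn
    have hcl : h '' sphere 0 1 ⊆ h₁ '' closedBall 0 1 ∪ h₂ '' closedBall 0 1 :=
      hc.trans (union_subset_union (IsDisc.sphere_subset _) (IsDisc.sphere_subset _))
    have hpU : p ∈ h '' ball 0 1 := by
      rw [IsDisc.image_closedBall] at hp
      exact hp.resolve_right fun h' => hpn (hcl h')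
    refine not_hasLogOn_of_frontier hh.isCompact_boundary hh.isBounded hh.frontier_eq.subset hpU ?_
    refine (HasLogOn.union hh₁.isCompact.isClosed hh₂.isCompact.isClosed (hinter ▸ hA) ?_ ?_).mono
      hcl
    · exact hh₁.hasLogOn (by fun_prop) fun z hz h0 =>
        hpn (Or.inl (by rwa [← sub_eq_zero.1 h0]))
    · exact hh₂.hasLogOn (by fun_prop) fun z hz h0 =>
        hpn (Or.inr (by rwa [← sub_eq_zero.1 h0]))

/-- A continuous map constant on the fibres of a map from a compact set factors continuously. -/
lemma exists_continuousOn_factor {X Y Z : Type*} [TopologicalSpace X] [TopologicalSpace Y]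
    [TopologicalSpace Z] [T2Space Y] [Nonempty X] {K : Set X} (hK : IsCompact K) {f : X → Y}
    {g : X → Z} (hf : ContinuousOn f K) (hg : ContinuousOn g K)
    (hfg : ∀ s ∈ K, ∀ t ∈ K, f s = f t → g s = g t) :
    ∃ γ : Y → Z, ContinuousOn γ (f '' K) ∧ ∀ s ∈ K, γ (f s) = g s := by
  have hγ : ∀ s ∈ K, g (Function.invFunOn f K (f s)) = g s := fun s hs =>
    hfg _ (Function.invFunOn_mem ⟨s, hs, rfl⟩) _ hs (Function.invFunOn_eq ⟨s, hs, rfl⟩)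
  refine ⟨g ∘ Function.invFunOn f K, ?_, hγ⟩
  rw [continuousOn_iff_isClosed]
  intro t ht
  obtain ⟨u, hu, hut⟩ := continuousOn_iff_isClosed.1 hg t ht
  refine ⟨f '' (u ∩ K), ((hK.inter_left hu).image_of_continuousOn
    (hf.mono inter_subset_right)).isClosed, ?_⟩
  rw [← hut]
  ext y
  constructor
  · grind
  · grind

/-- The parametrization of the unit circle with period `L`. -/
noncomputable def circlePt (L t : ℝ) : ℂ := Complex.exp ((t / L * (2 * Real.pi) : ℝ) * Complex.I)

section circlePt
variable {L : ℝ}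

lemma norm_circlePt (L t : ℝ) : ‖circlePt L t‖ = 1 := Complex.norm_exp_ofReal_mul_I _

lemma circlePt_mem_sphere (L t : ℝ) : circlePt L t ∈ sphere (0 : ℂ) 1 := by
  simp [norm_circlePt]

lemma circlePt_mem_closedBall (L t : ℝ) : circlePt L t ∈ closedBall (0 : ℂ) 1 :=
  sphere_subset_closedBall (circlePt_mem_sphere L t)

lemma circlePt_zero (L : ℝ) : circlePt L 0 = 1 := by simp [circlePt]

lemma continuous_circlePt (L : ℝ) : Continuous (circlePt L) := by
  unfold circlePt; fun_prop

lemma circlePt_add (L s t : ℝ) : circlePt L (s + t) = circlePt L s * circlePt L t := by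
  rw [circlePt, circlePt, circlePt, ← Complex.exp_add]
  congr 1
  push_cast
  ring

lemma circlePt_self (hL : 0 < L) : circlePt L L = 1 := by
  rw [circlePt, div_self hL.ne', one_mul]
  push_cast
  exact Complex.exp_two_pi_mul_I

lemma circlePt_add_self (hL : 0 < L) (t : ℝ) : circlePt L (t + L) = circlePt L t := by
  rw [circlePt_add, circlePt_self hL, mul_one]

lemma circlePt_ne_zero (L t : ℝ) : circlePt L t ≠ 0 := Complex.exp_ne_zero _

lemma circlePt_eq_iff (hL : 0 < L) {s t : ℝ} :
    circlePt L s = circlePt L t ↔ ∃ n : ℤ, s = t + n * L := by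
  rw [circlePt, circlePt, Complex.exp_eq_exp_iff_exists_int]
  refine exists_congr fun n => ?_
  have h2 : (2 * (Real.pi : ℂ) * Complex.I) ≠ 0 := Complex.two_pi_I_ne_zero
  have hL' : (L : ℂ) ≠ 0 := by exact_mod_cast hL.ne'
  have hpi : (Real.pi : ℂ) ≠ 0 := by exact_mod_cast Real.pi_ne_zero
  constructor
  · intro h
    have h3 : ((s / L : ℝ) : ℂ) * (2 * Real.pi * Complex.I)
        = ((t / L + n : ℝ) : ℂ) * (2 * Real.pi * Complex.I) := by
      push_cast at h ⊢
      linear_combination h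
    have h4 : s / L = t / L + n := by exact_mod_cast mul_right_cancel₀ h2 h3
    field_simp at h4
    linarith
  · rintro rfl
    push_cast
    field_simp

lemma circlePt_injOn (hL : 0 < L) (a : ℝ) : InjOn (circlePt L) (Ico a (a + L)) := by
  intro s hs t ht h
  obtain ⟨n, hn⟩ := (circlePt_eq_iff hL).1 h
  have h1 : (n : ℝ) * L < 1 * L := by linarith [hs.2, ht.1]
  have h2 : (-1 : ℝ) * L < n * L := by linarith [hs.1, ht.2]
  have h3 : n < 1 := by exact_mod_cast lt_of_mul_lt_mul_right h1 hL.le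
  have h4 : -1 < n := by exact_mod_cast lt_of_mul_lt_mul_right h2 hL.le
  have : n = 0 := by omega
  simpa [this] using hn

lemma exists_circlePt (hL : 0 < L) (a : ℝ) {z : ℂ} (hz : z ∈ sphere (0 : ℂ) 1) :
    ∃ t ∈ Ico a (a + L), circlePt L t = z := by
  rw [mem_sphere_zero_iff_norm] at hz
  have h1 : circlePt L (Complex.arg z / (2 * Real.pi) * L) = z := by
    rw [circlePt, mul_div_cancel_right₀ _ hL.ne', div_mul_cancel₀ _ (by positivity)]
    have := Complex.norm_mul_exp_arg_mul_I z
    rwa [hz, Complex.ofReal_one, one_mul] at this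
  set t := Complex.arg z / (2 * Real.pi) * L
  refine ⟨toIcoMod hL a t, toIcoMod_mem_Ico hL a t, ?_⟩
  rw [← h1, circlePt_eq_iff hL]
  refine ⟨-toIcoDiv hL a t, ?_⟩
  have := toIcoMod_add_toIcoDiv_zsmul hL a t
  rw [zsmul_eq_mul] at this
  push_cast
  linarith

lemma circlePt_image_Icc (hL : 0 < L) (a : ℝ) : circlePt L '' Icc a (a + L) = sphere 0 1 := by
  apply subset_antisymm
  · rintro _ ⟨t, -, rfl⟩
    exact circlePt_mem_sphere L t
  · intro z hz
    obtain ⟨t, ht, rfl⟩ := exists_circlePt hL a hz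
    exact ⟨t, Ico_subset_Icc_self ht, rfl⟩

end circlePt

/-- Rotating the parametrization of a disc. -/
lemma IsDisc.rotate {h : ℂ → ℂ} (hh : IsDisc h) {c : ℂ} (hc : ‖c‖ = 1) :
    IsDisc (fun z => h (c * z)) ∧ (fun z => h (c * z)) '' ball 0 1 = h '' ball 0 1 ∧
      (fun z => h (c * z)) '' closedBall 0 1 = h '' closedBall 0 1 ∧
      (fun z => h (c * z)) '' sphere 0 1 = h '' sphere 0 1 := by
  have hc0 : c ≠ 0 := fun h0 => by simp [h0] at hc
  have key : ∀ S : Set ℂ, (∀ z, z ∈ S ↔ c * z ∈ S) → (fun z => h (c * z)) '' S = h '' S := by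
    intro S hS
    ext w
    constructor
    · rintro ⟨z, hz, rfl⟩
      exact ⟨_, (hS z).1 hz, rfl⟩
    · rintro ⟨z, hz, rfl⟩
      have : c * (c⁻¹ * z) = z := mul_inv_cancel_left₀ hc0 z
      exact ⟨c⁻¹ * z, (hS _).2 (this.symm ▸ hz), by simp only [this]⟩
  have hb := key (ball 0 1) fun z => by simp [hc]
  have hcb := key (closedBall 0 1) fun z => by simp [hc]
  refine ⟨⟨?_, ?_, hb ▸ hh.isOpen⟩, hb, hcb, key _ fun z => by simp [hc]⟩
  · exact hh.continuousOn.comp (by fun_prop) fun z hz => by simpa [hc] using hz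
  · intro z hz w hw hzw
    exact mul_left_cancel₀ hc0 (hh.injOn (by simpa [hc] using hz) (by simpa [hc] using hw) hzw)

lemma exists_isDisc_of_loop {Γ : ℝ → ℂ} {L : ℝ} (hL : 0 < L) (hΓ : ContinuousOn Γ (Icc 0 L))
    (hi : InjOn Γ (Ico 0 L)) (h0 : Γ L = Γ 0) :
    ∃ h, IsDisc h ∧ ∀ t ∈ Icc 0 L, h (circlePt L t) = Γ t := by
  have hfib : ∀ s ∈ Icc 0 L, ∃ s' ∈ Ico 0 L, circlePt L s' = circlePt L s ∧ Γ s' = Γ s := by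
    intro s hs
    rcases hs.2.lt_or_eq with h | h
    · exact ⟨s, ⟨hs.1, h⟩, rfl, rfl⟩
    · exact ⟨0, ⟨le_rfl, hL⟩, by rw [h, circlePt_self hL, circlePt_zero], by rw [h, h0]⟩
  have hinj := circlePt_injOn hL 0
  rw [zero_add] at hinj
  obtain ⟨γ, hγ, hγΓ⟩ := exists_continuousOn_factor isCompact_Icc
    (continuous_circlePt L).continuousOn hΓ fun s hs t ht hst => by
      obtain ⟨s', hs', h1, h2⟩ := hfib s hs
      obtain ⟨t', ht', h3, h4⟩ := hfib t ht
      have := hinj hs' ht' (by rw [h1, h3, hst])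
      rw [← h2, ← h4, this]
  have him := circlePt_image_Icc hL 0
  rw [zero_add] at him
  rw [him] at hγ
  obtain ⟨h, h1, h2, h3, h4⟩ := schoenflies hγ fun z hz w hw hzw => by
    obtain ⟨s, hs, rfl⟩ := exists_circlePt hL 0 hz
    obtain ⟨t, ht, rfl⟩ := exists_circlePt hL 0 hw
    rw [zero_add] at hs ht
    rw [hγΓ _ (Ico_subset_Icc_self hs), hγΓ _ (Ico_subset_Icc_self ht)] at hzw
    rw [hi hs ht hzw]
  exact ⟨h, ⟨h1, h2, h4⟩, fun t ht => by rw [h3 (circlePt_mem_sphere L t), hγΓ t ht]⟩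

/-- A crosscut of a disc, joining the boundary points with parameters `0` and `j`. -/
structure IsCrosscut (l j m : ℝ) (h : ℂ → ℂ) (k : ℝ → ℂ) : Prop where
  continuousOn : ContinuousOn k (Icc 0 m)
  injOn : InjOn k (Icc 0 m)
  source : k 0 = h (circlePt l 0)
  target : k m = h (circlePt l j)
  interior : ∀ t ∈ Ioo 0 m, k t ∈ h '' ball 0 1

/-- The two discs into which a crosscut divides a disc, with their boundary parametrizations. -/
structure IsCut (l j m : ℝ) (h : ℂ → ℂ) (k : ℝ → ℂ) (h₁ h₂ : ℂ → ℂ) : Prop where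
  left : IsDisc h₁
  right : IsDisc h₂
  left_arc : ∀ t ∈ Icc 0 j, h₁ (circlePt (j + m) t) = h (circlePt l t)
  left_cut : ∀ t ∈ Icc 0 m, h₁ (circlePt (j + m) (j + m - t)) = k t
  right_arc : ∀ t ∈ Icc 0 (l - j), h₂ (circlePt (l - j + m) t) = h (circlePt l (j + t))
  right_cut : ∀ t ∈ Icc 0 m, h₂ (circlePt (l - j + m) (l - j + t)) = k t
  tiling : IsTiling h h₁ h₂

section Cut
variable {l j m : ℝ} {h h₁ h₂ : ℂ → ℂ} {k : ℝ → ℂ}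

/-- A loop made of an arc of the boundary and a crosscut. -/
lemma exists_isDisc_of_arc_of_cut {a m : ℝ} {u v : ℝ → ℂ} (ha : 0 < a) (hm : 0 < m)
    (hu : ContinuousOn u (Icc 0 a)) (hui : InjOn u (Icc 0 a)) (hv : ContinuousOn v (Icc 0 m))
    (hvi : InjOn v (Icc 0 m)) (h1 : u a = v 0) (h2 : v m = u 0)
    (hd : ∀ s ∈ Icc 0 a, ∀ t ∈ Ioo 0 m, u s ≠ v t) :
    ∃ f, IsDisc f ∧ (∀ t ∈ Icc 0 a, f (circlePt (a + m) t) = u t) ∧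
      ∀ t ∈ Icc 0 m, f (circlePt (a + m) (a + t)) = v t := by
  have hΓ : ContinuousOn (fun t => if t ≤ a then u t else v (t - a)) (Icc 0 (a + m)) := by
    refine ContinuousOn.if ?_ ?_ ?_
    · rintro t ⟨-, ht⟩
      have ht' : t = a := by
        have : t ∈ frontier (Iic a) := ht
        simpa using this
      subst ht'
      simpa using h1
    · refine hu.mono ?_
      rintro t ⟨ht, h'⟩
      exact ⟨ht.1, by simpa using (show t ∈ closure (Iic a) from h')⟩
    · refine hv.comp (by fun_prop) ?_
      rintro t ⟨ht, h'⟩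
      have : t ∈ Ici a := by
        have h' : t ∈ closure {x | ¬ x ≤ a} := h'
        simp only [not_le] at h'
        rw [← closure_Ioi a]
        exact h'
      exact ⟨by linarith [mem_Ici.1 this], by linarith [ht.2]⟩
  have hΓi : InjOn (fun t => if t ≤ a then u t else v (t - a)) (Ico 0 (a + m)) := by
    intro s hs t ht hst
    simp only at hst
    split_ifs at hst with hsa hta hta
    · exact hui ⟨hs.1, hsa⟩ ⟨ht.1, hta⟩ hst
    · grind
    · grind
    · have := hvi ⟨by linarith, by linarith [hs.2]⟩ ⟨by linarith, by linarith [ht.2]⟩ hst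
      linarith
  obtain ⟨f, hf, hfΓ⟩ := exists_isDisc_of_loop (by positivity) hΓ hΓi (by simp [hm, ha.le, h2])
  refine ⟨f, hf, fun t ht => ?_, fun t ht => ?_⟩
  · rw [hfΓ t ⟨ht.1, by linarith [ht.2]⟩, if_pos ht.2]
  · grind

/-- The boundary curve of a disc with a two-part boundary parametrization. -/
lemma image_sphere_of_parts {a m : ℝ} {f : ℂ → ℂ} {u v : ℝ → ℂ} (ha : 0 < a) (hm : 0 < m)
    (h1 : ∀ t ∈ Icc 0 a, f (circlePt (a + m) t) = u t)
    (h2 : ∀ t ∈ Icc 0 m, f (circlePt (a + m) (a + t)) = v t) :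
    f '' sphere 0 1 = u '' Icc 0 a ∪ v '' Icc 0 m := by
  rw [← circlePt_image_Icc (by positivity : 0 < a + m) 0, zero_add]
  ext w
  constructor
  · rintro ⟨_, ⟨t, ht, rfl⟩, rfl⟩
    rcases le_total t a with h | h
    · exact Or.inl ⟨t, ⟨ht.1, h⟩, (h1 t ⟨ht.1, h⟩).symm⟩
    · have ht' : t - a ∈ Icc 0 m := ⟨by linarith, by linarith [ht.2]⟩
      refine Or.inr ⟨t - a, ht', ?_⟩
      rw [← h2 _ ht', add_sub_cancel]
  · grind

lemma image_reverse {m : ℝ} (k : ℝ → ℂ) : (fun t => k (m - t)) '' Icc 0 m = k '' Icc 0 m := by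
  have : (fun t => k (m - t)) = k ∘ (fun t => m - t) := rfl
  rw [this, image_comp]
  simp

namespace IsCut

lemma left_boundary (hc : IsCut l j m h k h₁ h₂) (hj : 0 < j) (hm : 0 < m) :
    h₁ '' sphere 0 1 = (fun t => h (circlePt l t)) '' Icc 0 j ∪ k '' Icc 0 m := by
  rw [image_sphere_of_parts (v := fun t => k (m - t)) hj hm hc.left_arc fun t ht => ?_,
    image_reverse]
  rw [← hc.left_cut (m - t) ⟨by linarith [ht.2], by linarith [ht.1]⟩]
  congr 2
  ring

lemma right_boundary (hc : IsCut l j m h k h₁ h₂) (hj : j < l) (hm : 0 < m) :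
    h₂ '' sphere 0 1 = (fun t => h (circlePt l t)) '' Icc j l ∪ k '' Icc 0 m := by
  rw [image_sphere_of_parts (sub_pos.2 hj) hm hc.right_arc hc.right_cut]
  congr 1
  have : (fun t => h (circlePt l (j + t))) = (fun t => h (circlePt l t)) ∘ (fun t => j + t) := rfl
  rw [this, image_comp]
  simp

end IsCut

lemma circlePt_injOn_Icc {L a b : ℝ} (hL : 0 < L) (hab : b < a + L) :
    InjOn (circlePt L) (Icc a b) :=
  (circlePt_injOn hL a).mono fun _ ht => mem_Ico.2 ⟨ht.1, ht.2.trans_lt hab⟩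

lemma IsDisc.injOn_circlePt (hh : IsDisc h) {L a b : ℝ} (hL : 0 < L) (hab : b < a + L) :
    InjOn (fun t => h (circlePt L t)) (Icc a b) := fun _ hs _ ht hst =>
  circlePt_injOn_Icc hL hab hs ht
    (hh.injOn (circlePt_mem_closedBall _ _) (circlePt_mem_closedBall _ _) hst)

lemma IsDisc.continuous_circlePt (hh : IsDisc h) (L : ℝ) :
    Continuous (fun t => h (circlePt L t)) :=
  hh.continuousOn.comp_continuous (_root_.continuous_circlePt L) fun t =>
    circlePt_mem_closedBall L t

lemma IsCrosscut.mem_closed (hk : IsCrosscut l j m h k) {t : ℝ} (ht : t ∈ Icc 0 m) :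
    k t ∈ h '' closedBall 0 1 := by
  rcases ht.1.eq_or_lt with h0 | h0
  · rw [← h0, hk.source]; exact ⟨_, circlePt_mem_closedBall _ _, rfl⟩
  rcases ht.2.eq_or_lt with h1 | h1
  · rw [h1, hk.target]; exact ⟨_, circlePt_mem_closedBall _ _, rfl⟩
  · exact IsDisc.ball_subset h (hk.interior t ⟨h0, h1⟩)

lemma IsCrosscut.eq_end_of_mem_boundary (hh : IsDisc h) (hk : IsCrosscut l j m h k) {t : ℝ}
    (ht : t ∈ Icc 0 m) (hb : k t ∈ h '' sphere 0 1) : t = 0 ∨ t = m := by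
  by_contra! hne
  exact hh.disjoint.le_bot ⟨hk.interior t ⟨ht.1.lt_of_ne' hne.1, ht.2.lt_of_ne hne.2⟩, hb⟩

/-- The tiling property holds for all discs bounded by the two halves of a cut disc. -/
lemma isTiling_of_boundary (hh : IsDisc h) (hj : 0 < j) (hjl : j < l) (hm : 0 < m)
    (hk : IsCrosscut l j m h k) (hd₁ : IsDisc h₁) (hd₂ : IsDisc h₂)
    (hb₁ : h₁ '' sphere 0 1 = (fun t => h (circlePt l t)) '' Icc 0 j ∪ k '' Icc 0 m)
    (hb₂ : h₂ '' sphere 0 1 = (fun t => h (circlePt l t)) '' Icc j l ∪ k '' Icc 0 m) :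
    IsTiling h h₁ h₂ := by
  have hl : 0 < l := hj.trans hjl
  have hkm : k '' Icc 0 m ⊆ h '' closedBall 0 1 := by
    rintro _ ⟨t, ht, rfl⟩; exact hk.mem_closed ht
  have harc : ∀ S : Set ℝ, (fun t => h (circlePt l t)) '' S ⊆ h '' sphere 0 1 := by
    rintro S _ ⟨t, ht, rfl⟩; exact ⟨_, circlePt_mem_sphere _ _, rfl⟩
  have h0 : k 0 ∈ k '' Icc 0 m := ⟨0, ⟨le_rfl, hm.le⟩, rfl⟩
  have h1 : k m ∈ k '' Icc 0 m := ⟨m, ⟨hm.le, le_rfl⟩, rfl⟩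
  have hper : h (circlePt l l) = k 0 := by rw [hk.source, circlePt_self hl, circlePt_zero]
  have hinter : (fun t => h (circlePt l t)) '' Icc 0 j ∩ (fun t => h (circlePt l t)) '' Icc j l
      ⊆ k '' Icc 0 m := by
    rintro _ ⟨⟨s, hs, rfl⟩, ⟨t, ht, hst⟩⟩
    simp only at hst ⊢
    rcases ht.2.eq_or_lt with h' | h'
    · rw [← hst, h', hper]; exact h0
    · have := hh.injOn_circlePt hl (a := 0) (b := max s t) (by
        rw [zero_add]; exact max_lt (hs.2.trans_lt hjl) h') ⟨hs.1, le_max_left _ _⟩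
        ⟨hj.le.trans ht.1, le_max_right _ _⟩ hst.symm
      have : s = j := le_antisymm hs.2 (this ▸ ht.1)
      rw [this, ← hk.target]; exact h1
  have hinter : h₁ '' sphere 0 1 ∩ h₂ '' sphere 0 1 = k '' Icc 0 m := by grind
  refine isTiling_of_theta hh hd₁ hd₂ ?_ ?_ ?_ ?_ ?_ ?_ ?_
  · rw [hinter]
    exact isPreconnected_Icc.image _ hk.continuousOn
  · rw [hb₁]; exact union_subset ((harc _).trans (IsDisc.sphere_subset h)) hkm
  · rw [hb₂]; exact union_subset ((harc _).trans (IsDisc.sphere_subset h)) hkm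
  · rintro _ ⟨z, hz, rfl⟩
    obtain ⟨t, ht, rfl⟩ := exists_circlePt hl 0 hz
    rw [zero_add] at ht
    rcases le_total t j with h' | h'
    · left; rw [hb₁]; exact Or.inl ⟨t, ⟨ht.1, h'⟩, rfl⟩
    · right; rw [hb₂]; exact Or.inl ⟨t, ⟨h', ht.2.le⟩, rfl⟩
  · grind
  · grind
  · intro heq
    have hmem : h (circlePt l (j / 2)) ∈ h₁ '' sphere 0 1 := by grind
    have hmem2 : h (circlePt l (j / 2)) ∈ k '' Icc 0 m := by
      rw [← hinter]; exact ⟨hmem, heq ▸ hmem⟩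
    obtain ⟨t, ht, hkt⟩ := hmem2
    have hi := hh.injOn_circlePt hl (a := 0) (b := j) (by linarith)
    rcases hk.eq_end_of_mem_boundary hh ht (hkt ▸ ⟨_, circlePt_mem_sphere _ _, rfl⟩) with rfl | rfl
    · rw [hk.source] at hkt
      have := hi ⟨le_rfl, hj.le⟩ ⟨by linarith, by linarith⟩ hkt
      linarith
    · rw [hk.target] at hkt
      have := hi ⟨hj.le, le_rfl⟩ ⟨by linarith, by linarith⟩ hkt
      linarith

theorem exists_isCut (hh : IsDisc h) (hj : 0 < j) (hjl : j < l) (hm : 0 < m)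
    (hk : IsCrosscut l j m h k) : ∃ h₁ h₂, IsCut l j m h k h₁ h₂ := by
  have hl : 0 < l := hj.trans hjl
  have hlj : 0 < l - j := sub_pos.2 hjl
  have hdis : ∀ s, ∀ t ∈ Ioo 0 m, h (circlePt l s) ≠ k t := fun s t ht heq =>
    hh.disjoint.le_bot ⟨hk.interior t ht, heq ▸ ⟨_, circlePt_mem_sphere _ _, rfl⟩⟩
  have hrev : MapsTo (fun t => m - t) (Icc 0 m) (Icc 0 m) := fun t ht =>
    ⟨by linarith [ht.2], by linarith [ht.1]⟩
  obtain ⟨h₁, hd₁, ha₁, hc₁⟩ := exists_isDisc_of_arc_of_cut (u := fun t => h (circlePt l t))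
    (v := fun t => k (m - t)) hj hm (hh.continuous_circlePt l).continuousOn
    (hh.injOn_circlePt hl (by linarith)) (hk.continuousOn.comp (by fun_prop) hrev)
    (fun s hs t ht hst => by linarith [hk.injOn (hrev hs) (hrev ht) hst])
    (by simp [hk.target]) (by simp [hk.source])
    fun s _ t ht => hdis s _ ⟨by linarith [ht.2], by linarith [ht.1]⟩
  obtain ⟨h₂, hd₂, ha₂, hc₂⟩ := exists_isDisc_of_arc_of_cut
    (u := fun t => h (circlePt l (j + t))) (v := k) hlj hm
    ((hh.continuous_circlePt l).comp (by fun_prop)).continuousOn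
    (fun s hs t ht hst => by
      have := hh.injOn_circlePt hl (a := j) (b := l) (by linarith)
        ⟨by linarith [hs.1], by linarith [hs.2]⟩ ⟨by linarith [ht.1], by linarith [ht.2]⟩ hst
      linarith) hk.continuousOn hk.injOn
    (by simp only [add_sub_cancel]; rw [hk.source, circlePt_self hl, circlePt_zero])
    (by simp [hk.target]) fun s _ t ht => hdis _ _ ht
  have hb₁ : h₁ '' sphere 0 1 = (fun t => h (circlePt l t)) '' Icc 0 j ∪ k '' Icc 0 m := by
    rw [image_sphere_of_parts hj hm ha₁ hc₁, image_reverse]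
  have hb₂ : h₂ '' sphere 0 1 = (fun t => h (circlePt l t)) '' Icc j l ∪ k '' Icc 0 m := by
    rw [image_sphere_of_parts hlj hm ha₂ hc₂]
    congr 1
    have : (fun t => h (circlePt l (j + t))) = (fun t => h (circlePt l t)) ∘ (fun t => j + t) :=
      rfl
    rw [this, image_comp]
    simp
  refine ⟨h₁, h₂, hd₁, hd₂, ha₁, fun t ht => ?_, ha₂, hc₂,
    isTiling_of_boundary hh hj hjl hm hk hd₁ hd₂ hb₁ hb₂⟩
  have := hc₁ (m - t) (hrev ht)
  rw [sub_sub_cancel] at this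
  rw [← this]
  congr 2
  ring

end Cut

section CutRegions
variable {l j m : ℝ} {h h₁ h₂ : ℂ → ℂ} {k : ℝ → ℂ}

namespace IsCut

lemma cut_mem_left (hc : IsCut l j m h k h₁ h₂) {t : ℝ} (ht : t ∈ Icc 0 m) :
    k t ∈ h₁ '' sphere 0 1 :=
  hc.left_cut t ht ▸ ⟨_, circlePt_mem_sphere _ _, rfl⟩

lemma cut_mem_right (hc : IsCut l j m h k h₁ h₂) {t : ℝ} (ht : t ∈ Icc 0 m) :
    k t ∈ h₂ '' sphere 0 1 :=
  hc.right_cut t ht ▸ ⟨_, circlePt_mem_sphere _ _, rfl⟩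

lemma disjoint_left_right (hc : IsCut l j m h k h₁ h₂) :
    Disjoint (h₁ '' ball 0 1) (h₂ '' closedBall 0 1) := by
  rw [← hc.right.closure_eq]
  exact hc.tiling.disjoint.closure_right hc.left.isOpen

lemma disjoint_right_left (hc : IsCut l j m h k h₁ h₂) :
    Disjoint (h₂ '' ball 0 1) (h₁ '' closedBall 0 1) := by
  rw [← hc.left.closure_eq]
  exact hc.tiling.disjoint.symm.closure_right hc.right.isOpen

lemma mem_cases (hc : IsCut l j m h k h₁ h₂) (hh : IsDisc h) (hk : IsCrosscut l j m h k)
    (hj : 0 < j) (hjl : j < l) (hm : 0 < m) {z : ℂ} (hz : z ∈ h '' ball 0 1) :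
    z ∈ h₁ '' ball 0 1 ∨ z ∈ h₂ '' ball 0 1 ∨ ∃ t ∈ Ioo 0 m, k t = z := by
  have h1 : z ∈ h₁ '' closedBall 0 1 ∪ h₂ '' closedBall 0 1 := by
    rw [hc.tiling.union]; exact IsDisc.ball_subset h hz
  have hns : z ∉ h '' sphere 0 1 := fun h' => hh.disjoint.le_bot ⟨hz, h'⟩
  have key : ∀ S : Set ℝ, z ∈ (fun t => h (circlePt l t)) '' S ∪ k '' Icc 0 m →
      ∃ t ∈ Ioo 0 m, k t = z := by
    rintro S (⟨t, -, rfl⟩ | ⟨t, ht, rfl⟩)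
    · exact (hns ⟨_, circlePt_mem_sphere _ _, rfl⟩).elim
    · refine ⟨t, ⟨ht.1.lt_of_ne' ?_, ht.2.lt_of_ne ?_⟩, rfl⟩
      · rintro rfl; exact hns (hk.source ▸ ⟨_, circlePt_mem_sphere _ _, rfl⟩)
      · rintro rfl; exact hns (hk.target ▸ ⟨_, circlePt_mem_sphere _ _, rfl⟩)
  rw [IsDisc.image_closedBall h₁, IsDisc.image_closedBall h₂, hc.left_boundary hj hm,
    hc.right_boundary hjl hm] at h1
  rcases h1 with (h1 | h1) | (h1 | h1)
  exacts [Or.inl h1, Or.inr (Or.inr (key _ h1)), Or.inr (Or.inl h1), Or.inr (Or.inr (key _ h1))]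

/-- A connected set inside a disc which misses a crosscut lies in one of the pieces. -/
lemma subset_or_subset (hc : IsCut l j m h k h₁ h₂) (hh : IsDisc h) (hk : IsCrosscut l j m h k)
    (hj : 0 < j) (hjl : j < l) (hm : 0 < m) {S : Set ℂ} (hS : IsPreconnected S)
    (hSU : S ⊆ h '' ball 0 1) (hSk : ∀ t ∈ Ioo 0 m, k t ∉ S) :
    S ⊆ h₁ '' ball 0 1 ∨ S ⊆ h₂ '' ball 0 1 := by
  refine hS.subset_or_subset hc.left.isOpen hc.right.isOpen hc.tiling.disjoint fun z hz => ?_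
  rcases hc.mem_cases hh hk hj hjl hm (hSU hz) with h1 | h1 | ⟨t, ht, rfl⟩
  exacts [Or.inl h1, Or.inr h1, (hSk t ht hz).elim]

/-- The left piece is determined by its boundary. -/
lemma left_eq_of_boundary (hc : IsCut l j m h k h₁ h₂) (hh : IsDisc h)
    (hk : IsCrosscut l j m h k) (hj : 0 < j) (hjl : j < l) (hm : 0 < m) {d : ℂ → ℂ}
    (hd : IsDisc d) (hb : d '' sphere 0 1 = h₁ '' sphere 0 1) :
    d '' ball 0 1 = h₁ '' ball 0 1 := by
  have ht := isTiling_of_boundary hh hj hjl hm hk hd hc.right (hb.trans (hc.left_boundary hj hm))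
    (hc.right_boundary hjl hm)
  have hdd : Disjoint (d '' ball 0 1) (h₂ '' closedBall 0 1) := by
    rw [← hc.right.closure_eq]
    exact ht.disjoint.closure_right hd.isOpen
  apply subset_antisymm
  · intro z hz
    rcases hc.mem_cases hh hk hj hjl hm (ht.left_subset hz) with h1 | h1 | ⟨t, h1, rfl⟩
    · exact h1
    · exact (ht.disjoint.le_bot ⟨hz, h1⟩).elim
    · exact (hdd.le_bot ⟨hz, IsDisc.sphere_subset _
        (hc.cut_mem_right (Ioo_subset_Icc_self h1))⟩).elim
  · intro z hz
    have h1 : z ∈ d '' closedBall 0 1 ∪ h₂ '' closedBall 0 1 := by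
      rw [ht.union]; exact IsDisc.ball_subset h (hc.tiling.left_subset hz)
    rw [IsDisc.image_closedBall d, hb] at h1
    rcases h1 with (h1 | h1) | h1
    · exact h1
    · exact (hc.left.disjoint.le_bot ⟨hz, h1⟩).elim
    · exact (hc.disjoint_left_right.le_bot ⟨hz, h1⟩).elim

end IsCut
end CutRegions

/-- A plane drawing: finitely many points, and finitely many arcs joining them, no two of which
have the same ends. -/
structure IsPlane (P : Set ℂ) (E : Set (Set ℂ)) : Prop where
  finite_points : P.Finite
  finite_edges : E.Finite
  arc : ∀ e ∈ E, ∃ p : ℝ → ℂ, ContinuousOn p (Icc 0 1) ∧ InjOn p (Icc 0 1) ∧ p 0 ∈ P ∧ p 1 ∈ P ∧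
    (∀ t ∈ Ioo (0 : ℝ) 1, p t ∉ P) ∧ p '' Icc 0 1 = e
  inter : ∀ e ∈ E, ∀ f ∈ E, e ≠ f → e ∩ f ⊆ P
  simple : ∀ e ∈ E, ∀ f ∈ E, e ∩ P = f ∩ P → e = f

/-- A path between two points which is either an edge of the drawing or does not meet its
edges except in points of the drawing. -/
structure IsSide (P : Set ℂ) (E : Set (Set ℂ)) (p : ℝ → ℂ) : Prop where
  source : p 0 ∈ P
  target : p 1 ∈ P
  interior : ∀ t ∈ Ioo (0 : ℝ) 1, p t ∉ P
  inter : ∀ e ∈ E, e ≠ p '' Icc 0 1 → e ∩ p '' Icc 0 1 ⊆ P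

lemma IsSide.congr {P : Set ℂ} {E : Set (Set ℂ)} {p q : ℝ → ℂ} (hp : IsSide P E p)
    (hpq : EqOn p q (Icc 0 1)) : IsSide P E q := by
  have h0 : (0 : ℝ) ∈ Icc (0 : ℝ) 1 := by simp
  have h1 : (1 : ℝ) ∈ Icc (0 : ℝ) 1 := by simp
  refine ⟨hpq h0 ▸ hp.source, hpq h1 ▸ hp.target, fun t ht => ?_, ?_⟩
  · rw [← hpq (Ioo_subset_Icc_self ht)]; exact hp.interior t ht
  · rw [← hpq.image_eq]; exact hp.inter

lemma IsSide.reverse {P : Set ℂ} {E : Set (Set ℂ)} {p : ℝ → ℂ} (hp : IsSide P E p) :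
    IsSide P E (fun t => p (1 - t)) := by
  refine ⟨by simpa using hp.target, by simpa using hp.source,
    fun t ht => hp.interior _ ⟨by linarith [ht.2], by linarith [ht.1]⟩, ?_⟩
  rw [image_reverse]
  exact hp.inter

lemma IsPlane.isSide {P : Set ℂ} {E : Set (Set ℂ)} (hP : IsPlane P E) {p : ℝ → ℂ} (h0 : p 0 ∈ P)
    (h1 : p 1 ∈ P) (hi : ∀ t ∈ Ioo (0 : ℝ) 1, p t ∉ P) (he : p '' Icc 0 1 ∈ E) : IsSide P E p :=
  ⟨h0, h1, hi, fun f hf hne => hP.inter f hf _ he hne⟩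

/-- The side of a disc between the boundary parameters `i` and `i + 1`, as a path. -/
noncomputable def sidePath (l : ℕ) (h : ℂ → ℂ) (i : ℕ) : ℝ → ℂ := fun t => h (circlePt l (i + t))

/-- The side of a disc between the boundary parameters `i` and `i + 1`. -/
noncomputable def side (l : ℕ) (h : ℂ → ℂ) (i : ℕ) : Set ℂ := sidePath l h i '' Icc 0 1

/-- A drawing with a distinguished disc whose boundary is an `l`-gon of sides. -/
structure IsFrame (P : Set ℂ) (E : Set (Set ℂ)) (l : ℕ) (h : ℂ → ℂ) : Prop where
  plane : IsPlane P E
  disc : IsDisc h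
  two_le : 2 ≤ l
  isSide : ∀ i < l, IsSide P E (sidePath l h i)

/-- The edges of a drawing which meet a given region. -/
def innerEdges (E : Set (Set ℂ)) (U : Set ℂ) : Set (Set ℂ) := {e | e ∈ E ∧ (e ∩ U).Nonempty}

lemma innerEdges_mono {E : Set (Set ℂ)} {U V : Set ℂ} (hUV : U ⊆ V) : innerEdges E U ⊆ innerEdges E V :=
  fun _ he => ⟨he.1, he.2.mono (inter_subset_inter_right _ hUV)⟩

lemma IsPlane.exists_notMem {P : Set ℂ} {E : Set (Set ℂ)} (hP : IsPlane P E) {U e : Set ℂ}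
    (hU : IsOpen U) (he : e ∈ innerEdges E U) : ∃ z ∈ e, z ∈ U ∧ z ∉ P := by
  obtain ⟨p, hpc, -, -, -, hpP, rfl⟩ := hP.arc e he.1
  obtain ⟨_, ⟨t, ht, rfl⟩, hz⟩ := he.2
  have h1 : p ⁻¹' U ∈ 𝓝[Icc 0 1] t := hpc t ht (hU.mem_nhds hz)
  obtain ⟨V, hV, hVt, hVU⟩ := mem_nhdsWithin.1 h1
  have h2 : t ∈ closure (Ioo (0 : ℝ) 1) := by rwa [closure_Ioo zero_ne_one]
  obtain ⟨s, hs, hs'⟩ := mem_closure_iff.1 h2 V hV hVt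
  exact ⟨p s, ⟨s, Ioo_subset_Icc_self hs', rfl⟩, hVU ⟨hs, Ioo_subset_Icc_self hs'⟩, hpP s hs'⟩

section Frame
variable {P : Set ℂ} {E : Set (Set ℂ)} {l : ℕ} {h : ℂ → ℂ}

lemma side_subset_boundary (l : ℕ) (h : ℂ → ℂ) (i : ℕ) : side l h i ⊆ h '' sphere 0 1 := by
  rintro _ ⟨t, -, rfl⟩
  exact ⟨_, circlePt_mem_sphere _ _, rfl⟩

lemma exists_mem_side (hl : 0 < l) {z : ℂ} (hz : z ∈ h '' sphere 0 1) :
    ∃ i < l, z ∈ side l h i := by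
  obtain ⟨w, hw, rfl⟩ := hz
  have hl' : (0 : ℝ) < l := by exact_mod_cast hl
  obtain ⟨t, ht, rfl⟩ := exists_circlePt hl' 0 hw
  rw [zero_add] at ht
  refine ⟨⌊t⌋₊, (Nat.floor_lt ht.1).2 ht.2, t - ⌊t⌋₊, ⟨?_, ?_⟩, ?_⟩
  · linarith [Nat.floor_le ht.1]
  · linarith [Nat.lt_floor_add_one t]
  · simp [sidePath]

namespace IsFrame

lemma pos (hF : IsFrame P E l h) : 0 < l := by have := hF.two_le; omega

lemma posR (hF : IsFrame P E l h) : (0 : ℝ) < l := by exact_mod_cast hF.pos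

lemma notMem_of_mem_side (hF : IsFrame P E l h) {i : ℕ} {z : ℂ} (hz : z ∈ side l h i) :
    z ∉ h '' ball 0 1 := fun h' => hF.disc.disjoint.le_bot ⟨h', side_subset_boundary l h i hz⟩

/-- Edges meet the boundary of a frame only in points of the drawing, unless they are sides. -/
lemma mem_of_mem_inner (hF : IsFrame P E l h) {e : Set ℂ} (he : e ∈ innerEdges E (h '' ball 0 1))
    {z : ℂ} (hz : z ∈ e) (hzb : z ∈ h '' sphere 0 1) : z ∈ P := by
  obtain ⟨i, hi, hzi⟩ := exists_mem_side hF.pos hzb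
  refine (hF.isSide i hi).inter e he.1 ?_ ⟨hz, hzi⟩
  rintro rfl
  obtain ⟨y, hy, hy'⟩ := he.2
  exact hF.notMem_of_mem_side (i := i) hy hy'

lemma inner_path (hF : IsFrame P E l h) {p : ℝ → ℂ} (hp : ContinuousOn p (Icc 0 1))
    (hpP : ∀ t ∈ Ioo (0 : ℝ) 1, p t ∉ P) (h0 : p 0 ∈ P) (h1 : p 1 ∈ P)
    (he : p '' Icc 0 1 ∈ innerEdges E (h '' ball 0 1)) {t : ℝ} (ht : t ∈ Ioo (0 : ℝ) 1) :
    p t ∈ h '' ball 0 1 := by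
  obtain ⟨_, ⟨s, hs, rfl⟩, hsU, hsP⟩ := hF.plane.exists_notMem hF.disc.isOpen he
  have hs' : s ∈ Ioo (0 : ℝ) 1 := by grind
  by_contra hn
  have hpre : IsPreconnected (p '' Ioo 0 1) :=
    isPreconnected_Ioo.image _ (hp.mono Ioo_subset_Icc_self)
  obtain ⟨_, ⟨r, hr, rfl⟩, hrf⟩ := hpre.nonempty_inter_frontier ⟨_, ⟨s, hs', rfl⟩, hsU⟩
    ⟨_, ⟨t, ht, rfl⟩, hn⟩
  rw [hF.disc.frontier_eq] at hrf
  exact hpP r hr (hF.mem_of_mem_inner he ⟨r, Ioo_subset_Icc_self hr, rfl⟩ hrf)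

lemma inner_subset (hF : IsFrame P E l h) {e : Set ℂ} (he : e ∈ innerEdges E (h '' ball 0 1)) :
    e ⊆ h '' closedBall 0 1 := by
  obtain ⟨p, hpc, -, h0, h1, hpP, rfl⟩ := hF.plane.arc e he.1
  rw [← hF.disc.closure_eq]
  rw [← closure_Ioo zero_ne_one] at hpc ⊢
  refine hpc.image_closure.trans (closure_mono ?_)
  rintro _ ⟨t, ht, rfl⟩
  rw [closure_Ioo zero_ne_one] at hpc
  exact hF.inner_path hpc hpP h0 h1 he ht

lemma root_mem (hF : IsFrame P E l h) {i : ℕ} (hi : i < l) : h (circlePt l i) ∈ P := by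
  simpa [sidePath] using (hF.isSide i hi).source

lemma one_mem (hF : IsFrame P E l h) : h 1 ∈ P := by
  simpa [circlePt_zero] using hF.root_mem (i := 0) hF.pos

lemma exists_root (hF : IsFrame P E l h) {z : ℂ} (hzP : z ∈ P) (hz : z ∈ h '' sphere 0 1) :
    ∃ i < l, z = h (circlePt l i) := by
  obtain ⟨i, hi, t, ht, rfl⟩ := exists_mem_side hF.pos hz
  rcases ht.1.eq_or_lt with h0 | h0
  · exact ⟨i, hi, by simp [sidePath, ← h0]⟩
  rcases ht.2.eq_or_lt with h1 | h1
  · by_cases hil : i + 1 < l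
    · exact ⟨i + 1, hil, by simp [sidePath, h1]⟩
    · refine ⟨0, hF.pos, ?_⟩
      have : i + 1 = l := by omega
      have h2 : (i : ℝ) + 1 = l := by exact_mod_cast this
      simp only [sidePath, h1, h2, circlePt_self hF.posR, Nat.cast_zero, circlePt_zero]
  · exact ((hF.isSide i hi).interior t ⟨h0, h1⟩ hzP).elim

end IsFrame
end Frame

/-- The segment of a path between the parameters `s` and `s + 1`. -/
def segPath (k : ℝ → ℂ) (s : ℕ) : ℝ → ℂ := fun t => k (s + t)

/-- A crosscut of a framed disc consisting of `m` sides, which starts at the root `0`, ends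
at the root `j`, and leaves `r` sides to its right. -/
structure IsSplit (P : Set ℂ) (E : Set (Set ℂ)) (j r m : ℕ) (h : ℂ → ℂ) (k : ℝ → ℂ)
    (h₁ h₂ : ℂ → ℂ) : Prop where
  frame : IsFrame P E (j + r) h
  left_pos : 0 < j
  right_pos : 0 < r
  cut_pos : 0 < m
  crosscut : IsCrosscut (j + r) j m h k
  cut : IsCut (j + r) j m h k h₁ h₂
  isSide : ∀ s < m, IsSide P E (segPath k s)

namespace IsSplit
variable {P : Set ℂ} {E : Set (Set ℂ)} {j r m : ℕ} {h h₁ h₂ : ℂ → ℂ} {k : ℝ → ℂ}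

lemma left_posR (hs : IsSplit P E j r m h k h₁ h₂) : (0 : ℝ) < j := by exact_mod_cast hs.left_pos

lemma right_posR (hs : IsSplit P E j r m h k h₁ h₂) : (0 : ℝ) < r := by
  exact_mod_cast hs.right_pos

lemma lt_add (hs : IsSplit P E j r m h k h₁ h₂) : (j : ℝ) < j + r := by
  linarith [hs.right_posR]

lemma cut_posR (hs : IsSplit P E j r m h k h₁ h₂) : (0 : ℝ) < m := by exact_mod_cast hs.cut_pos

lemma eqOn_left_arc (hs : IsSplit P E j r m h k h₁ h₂) {i : ℕ} (hi : i < j) :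
    EqOn (sidePath (j + m) h₁ i) (sidePath (j + r) h i) (Icc 0 1) := by
  intro t ht
  have h1 : (i : ℝ) + 1 ≤ j := by exact_mod_cast hi
  have := hs.cut.left_arc (i + t) ⟨by linarith [ht.1, Nat.cast_nonneg (α := ℝ) i], by linarith [ht.2]⟩
  simpa [sidePath] using this

lemma eqOn_left_cut (hs : IsSplit P E j r m h k h₁ h₂) {s : ℕ} (hsm : s < m) :
    EqOn (sidePath (j + m) h₁ (j + (m - 1 - s))) (fun t => segPath k s (1 - t)) (Icc 0 1) := by
  intro t ht
  have h1 : (s : ℝ) + 1 ≤ m := by exact_mod_cast hsm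
  have h2 : ((m - 1 - s : ℕ) : ℝ) = m - 1 - s := by
    rw [Nat.cast_sub (by omega), Nat.cast_sub (by omega), Nat.cast_one]
  have := hs.cut.left_cut (s + (1 - t))
    ⟨by linarith [ht.2, Nat.cast_nonneg (α := ℝ) s], by linarith [ht.1]⟩
  simp only [segPath, sidePath]
  rw [← this]
  push_cast
  rw [h2]
  congr 2
  ring

lemma eqOn_right_arc (hs : IsSplit P E j r m h k h₁ h₂) {i : ℕ} (hi : i < r) :
    EqOn (sidePath (r + m) h₂ i) (sidePath (j + r) h (j + i)) (Icc 0 1) := by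
  intro t ht
  have h1 : (i : ℝ) + 1 ≤ r := by exact_mod_cast hi
  have := hs.cut.right_arc (i + t) ⟨by linarith [ht.1, Nat.cast_nonneg (α := ℝ) i], by linarith [ht.2]⟩
  rw [add_sub_cancel_left] at this
  simpa [sidePath, add_assoc] using this

lemma eqOn_right_cut (hs : IsSplit P E j r m h k h₁ h₂) {s : ℕ} (hsm : s < m) :
    EqOn (sidePath (r + m) h₂ (r + s)) (segPath k s) (Icc 0 1) := by
  intro t ht
  have h1 : (s : ℝ) + 1 ≤ m := by exact_mod_cast hsm
  have := hs.cut.right_cut (s + t)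
    ⟨by linarith [ht.1, Nat.cast_nonneg (α := ℝ) s], by linarith [ht.2]⟩
  rw [add_sub_cancel_left] at this
  rw [segPath, ← this, sidePath]
  push_cast
  congr 2
  ring

lemma left_side_arc (hs : IsSplit P E j r m h k h₁ h₂) {i : ℕ} (hi : i < j) :
    side (j + m) h₁ i = side (j + r) h i := (hs.eqOn_left_arc hi).image_eq

lemma left_side_cut (hs : IsSplit P E j r m h k h₁ h₂) {s : ℕ} (hsm : s < m) :
    side (j + m) h₁ (j + (m - 1 - s)) = segPath k s '' Icc 0 1 :=
  (hs.eqOn_left_cut hsm).image_eq.trans (image_reverse _)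

lemma right_side_arc (hs : IsSplit P E j r m h k h₁ h₂) {i : ℕ} (hi : i < r) :
    side (r + m) h₂ i = side (j + r) h (j + i) := (hs.eqOn_right_arc hi).image_eq

lemma right_side_cut (hs : IsSplit P E j r m h k h₁ h₂) {s : ℕ} (hsm : s < m) :
    side (r + m) h₂ (r + s) = segPath k s '' Icc 0 1 := (hs.eqOn_right_cut hsm).image_eq

lemma left_frame (hs : IsSplit P E j r m h k h₁ h₂) : IsFrame P E (j + m) h₁ := by
  refine ⟨hs.frame.plane, hs.cut.left, by have := hs.left_pos; have := hs.cut_pos; omega,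
    fun i hi => ?_⟩
  by_cases hij : i < j
  · exact (hs.frame.isSide i (by omega)).congr (hs.eqOn_left_arc hij).symm
  · have h1 : j + (m - 1 - (j + m - 1 - i)) = i := by omega
    have := hs.eqOn_left_cut (s := j + m - 1 - i) (by omega)
    rw [h1] at this
    exact (hs.isSide (j + m - 1 - i) (by omega)).reverse.congr this.symm

lemma right_frame (hs : IsSplit P E j r m h k h₁ h₂) : IsFrame P E (r + m) h₂ := by
  refine ⟨hs.frame.plane, hs.cut.right, by have := hs.right_pos; have := hs.cut_pos; omega,
    fun i hi => ?_⟩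
  by_cases hij : i < r
  · exact (hs.frame.isSide (j + i) (by omega)).congr (hs.eqOn_right_arc hij).symm
  · have h1 : r + (i - r) = i := by omega
    have := hs.eqOn_right_cut (s := i - r) (by omega)
    rw [h1] at this
    exact (hs.isSide (i - r) (by omega)).congr this.symm

lemma mem_cases (hs : IsSplit P E j r m h k h₁ h₂) {z : ℂ} (hz : z ∈ h '' ball 0 1) :
    z ∈ h₁ '' ball 0 1 ∨ z ∈ h₂ '' ball 0 1 ∨ ∃ t ∈ Ioo 0 (m : ℝ), k t = z :=
  hs.cut.mem_cases hs.frame.disc hs.crosscut hs.left_posR hs.lt_add hs.cut_posR hz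

lemma exists_seg {t : ℝ} (ht : t ∈ Ico 0 (m : ℝ)) :
    ∃ s < m, ∃ u ∈ Ico (0 : ℝ) 1, t = s + u :=
  ⟨⌊t⌋₊, (Nat.floor_lt ht.1).2 ht.2, t - ⌊t⌋₊,
    ⟨by linarith [Nat.floor_le ht.1], by linarith [Nat.lt_floor_add_one t]⟩, by ring⟩

lemma cut_mem_iff (hs : IsSplit P E j r m h k h₁ h₂) {s : ℕ} (hsm : s < m) {u : ℝ}
    (hu : u ∈ Ico (0 : ℝ) 1) : k (s + u) ∈ P ↔ u = 0 := by
  refine ⟨fun hk => ?_, fun h0 => ?_⟩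
  · by_contra h0
    exact (hs.isSide s hsm).interior u ⟨hu.1.lt_of_ne' h0, hu.2⟩ hk
  · rw [h0]; exact (hs.isSide s hsm).source

lemma seg_mem (hs : IsSplit P E j r m h k h₁ h₂) {s : ℕ} (hsm : s < m) {u : ℝ}
    (hu : u ∈ Ioo (0 : ℝ) 1) : segPath k s u ∈ h '' ball 0 1 := by
  have h1 : (s : ℝ) + 1 ≤ m := by exact_mod_cast hsm
  exact hs.crosscut.interior _
    ⟨by linarith [hu.1, Nat.cast_nonneg (α := ℝ) s], by linarith [hu.2]⟩

/-- The edges inside a split disc lie inside one of the pieces or are segments of the cut. -/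
lemma innerEdges_eq (hs : IsSplit P E j r m h k h₁ h₂) :
    innerEdges E (h '' ball 0 1) = innerEdges E (h₁ '' ball 0 1) ∪ innerEdges E (h₂ '' ball 0 1) ∪
      {e | e ∈ E ∧ ∃ s < m, e = segPath k s '' Icc 0 1} := by
  apply subset_antisymm
  · intro e he
    obtain ⟨z, hze, hzU, hzP⟩ := hs.frame.plane.exists_notMem hs.frame.disc.isOpen he
    rcases hs.mem_cases hzU with h1 | h1 | ⟨t, ht, rfl⟩
    · exact Or.inl (Or.inl ⟨he.1, z, hze, h1⟩)
    · exact Or.inl (Or.inr ⟨he.1, z, hze, h1⟩)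
    · obtain ⟨s, hsm, u, hu, rfl⟩ := exists_seg (Ioo_subset_Ico_self ht)
      refine Or.inr ⟨he.1, s, hsm, ?_⟩
      by_contra hne
      exact hzP ((hs.isSide s hsm).inter e he.1 hne
        ⟨hze, u, Ico_subset_Icc_self hu, rfl⟩)
  · rintro e ((he | he) | ⟨he, s, hsm, rfl⟩)
    · exact innerEdges_mono hs.cut.tiling.left_subset he
    · exact innerEdges_mono hs.cut.tiling.right_subset he
    · exact ⟨he, _, ⟨1 / 2, by norm_num, rfl⟩, hs.seg_mem hsm (by norm_num)⟩

lemma points_eq (hs : IsSplit P E j r m h k h₁ h₂) :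
    P ∩ h '' ball 0 1 = P ∩ h₁ '' ball 0 1 ∪ P ∩ h₂ '' ball 0 1 ∪ P ∩ k '' Ioo 0 (m : ℝ) := by
  apply subset_antisymm
  · rintro z ⟨hzP, hz⟩
    rcases hs.mem_cases hz with h1 | h1 | ⟨t, ht, rfl⟩
    · exact Or.inl (Or.inl ⟨hzP, h1⟩)
    · exact Or.inl (Or.inr ⟨hzP, h1⟩)
    · exact Or.inr ⟨hzP, t, ht, rfl⟩
  · rintro z ((⟨hP, hz⟩ | ⟨hP, hz⟩) | ⟨hP, t, ht, rfl⟩)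
    · exact ⟨hP, hs.cut.tiling.left_subset hz⟩
    · exact ⟨hP, hs.cut.tiling.right_subset hz⟩
    · exact ⟨hP, hs.crosscut.interior t ht⟩

lemma ncard_points (hs : IsSplit P E j r m h k h₁ h₂) :
    (P ∩ h '' ball 0 1).ncard = (P ∩ h₁ '' ball 0 1).ncard + (P ∩ h₂ '' ball 0 1).ncard +
      (P ∩ k '' Ioo 0 (m : ℝ)).ncard := by
  have hf : ∀ S, (P ∩ S).Finite := fun S => hs.frame.plane.finite_points.subset inter_subset_left
  rw [hs.points_eq, ncard_union_eq _ ((hf _).union (hf _)) (hf _), ncard_union_eq _ (hf _) (hf _)]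
  · exact hs.cut.tiling.disjoint.mono inter_subset_right inter_subset_right
  · rw [Set.disjoint_left]
    rintro z (⟨-, hz⟩ | ⟨-, hz⟩) ⟨-, t, ht, rfl⟩
    · exact hs.cut.left.disjoint.le_bot ⟨hz, hs.cut.cut_mem_left (Ioo_subset_Icc_self ht)⟩
    · exact hs.cut.right.disjoint.le_bot ⟨hz, hs.cut.cut_mem_right (Ioo_subset_Icc_self ht)⟩

lemma ncard_points_one (hs : IsSplit P E j r 1 h k h₁ h₂) :
    (P ∩ h '' ball 0 1).ncard = (P ∩ h₁ '' ball 0 1).ncard + (P ∩ h₂ '' ball 0 1).ncard := by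
  have : P ∩ k '' Ioo 0 ((1 : ℕ) : ℝ) = ∅ := by
    rw [eq_empty_iff_forall_notMem]
    rintro _ ⟨hP, t, ht, rfl⟩
    rw [Nat.cast_one] at ht
    exact (hs.isSide 0 one_pos).interior t ht (by simpa [segPath] using hP)
  rw [hs.ncard_points, this, ncard_empty, add_zero]

lemma ncard_points_two (hs : IsSplit P E j r 2 h k h₁ h₂) :
    (P ∩ h '' ball 0 1).ncard =
      (P ∩ h₁ '' ball 0 1).ncard + (P ∩ h₂ '' ball 0 1).ncard + 1 := by
  have : P ∩ k '' Ioo 0 ((2 : ℕ) : ℝ) = {k 1} := by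
    apply subset_antisymm
    · rintro _ ⟨hP, t, ht, rfl⟩
      obtain ⟨s, hsm, u, hu, rfl⟩ := exists_seg (Ioo_subset_Ico_self ht)
      obtain rfl := (hs.cut_mem_iff hsm hu).1 hP
      have h0 : s ≠ 0 := by rintro rfl; simp at ht
      obtain rfl : s = 1 := by omega
      simp
    · rintro _ rfl
      exact ⟨by simpa [segPath] using (hs.isSide 1 one_lt_two).source, 1, by norm_num, rfl⟩
  rw [hs.ncard_points, this, ncard_singleton]

lemma closed_inter (hs : IsSplit P E j r m h k h₁ h₂) {z : ℂ} (h1 : z ∈ h₁ '' closedBall 0 1)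
    (h2 : z ∈ h₂ '' closedBall 0 1) : ∃ t ∈ Icc 0 (m : ℝ), k t = z := by
  have hn1 : z ∉ h₁ '' ball 0 1 := fun h' => hs.cut.disjoint_left_right.le_bot ⟨h', h2⟩
  have hn2 : z ∉ h₂ '' ball 0 1 := fun h' => hs.cut.disjoint_right_left.le_bot ⟨h', h1⟩
  rw [IsDisc.image_closedBall] at h1 h2
  replace h1 := h1.resolve_left hn1
  replace h2 := h2.resolve_left hn2
  rw [hs.cut.left_boundary hs.left_posR hs.cut_posR] at h1
  rw [hs.cut.right_boundary hs.lt_add hs.cut_posR] at h2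
  rcases h1 with ⟨s, hs', rfl⟩ | ⟨t, ht, rfl⟩
  · rcases h2 with ⟨t, ht, hst⟩ | ⟨t, ht, hst⟩
    · have hl : (0 : ℝ) < j + r := by linarith [hs.left_posR, hs.right_posR]
      obtain ⟨n, hn⟩ := (circlePt_eq_iff hl).1 (hs.frame.disc.injOn (circlePt_mem_closedBall _ _)
        (circlePt_mem_closedBall _ _) hst)
      by_cases h0 : s = j
      · exact ⟨m, ⟨hs.cut_posR.le, le_rfl⟩, h0 ▸ hs.crosscut.target⟩
      · have hsj : s < j := hs'.2.lt_of_ne h0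
        have hn0 : (0 : ℝ) < n * (j + r) := by linarith [ht.1]
        have hn1 : 1 ≤ n := by
          have : (0 : ℝ) < n := pos_of_mul_pos_left hn0 hl.le
          exact_mod_cast this
        have hn2 : (1 : ℝ) * (j + r) ≤ n * (j + r) := by gcongr; exact_mod_cast hn1
        have : s = 0 := by linarith [ht.2, hs'.1]
        exact ⟨0, ⟨le_rfl, hs.cut_posR.le⟩, this ▸ hs.crosscut.source⟩
    · exact ⟨t, ht, hst⟩
  · exact ⟨t, ht, rfl⟩

end IsSplit

/-- Two discs with drawings are equivalent if some homeomorphism between them respects the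
boundary parametrisations and the drawings inside. -/
def DiscEquiv (P : Set ℂ) (E : Set (Set ℂ)) (h : ℂ → ℂ) (P' : Set ℂ) (E' : Set (Set ℂ))
    (h' : ℂ → ℂ) : Prop :=
  ∃ ψ : ℂ → ℂ, ContinuousOn ψ (h '' closedBall 0 1) ∧ InjOn ψ (h '' closedBall 0 1) ∧
    (∀ z ∈ sphere (0 : ℂ) 1, ψ (h z) = h' z) ∧ ψ '' (h '' closedBall 0 1) = h' '' closedBall 0 1 ∧
    ψ '' (P ∩ h '' ball 0 1) = P' ∩ h' '' ball 0 1 ∧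
    (fun e => ψ '' e) '' innerEdges E (h '' ball 0 1) = innerEdges E' (h' '' ball 0 1)

/-- Equivalences of the two pieces of split discs can be glued. -/
theorem IsSplit.discEquiv {P P' : Set ℂ} {E E' : Set (Set ℂ)} {j r m : ℕ}
    {h h₁ h₂ h' h₁' h₂' : ℂ → ℂ} {k k' : ℝ → ℂ} (hs : IsSplit P E j r m h k h₁ h₂)
    (hs' : IsSplit P' E' j r m h' k' h₁' h₂')
    (hseg : ∀ s < m, segPath k s '' Icc 0 1 ∈ E ↔ segPath k' s '' Icc 0 1 ∈ E')
    (H1 : DiscEquiv P E h₁ P' E' h₁') (H2 : DiscEquiv P E h₂ P' E' h₂') :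
    DiscEquiv P E h P' E' h' := by
  classical
  obtain ⟨ψ₁, c1, i1, b1, s1, p1, e1⟩ := H1
  obtain ⟨ψ₂, c2, i2, b2, s2, p2, e2⟩ := H2
  have k1 : ∀ t ∈ Icc 0 (m : ℝ), ψ₁ (k t) = k' t := fun t ht => by
    rw [← hs.cut.left_cut t ht, b1 _ (circlePt_mem_sphere _ _), hs'.cut.left_cut t ht]
  have k2 : ∀ t ∈ Icc 0 (m : ℝ), ψ₂ (k t) = k' t := fun t ht => by
    rw [← hs.cut.right_cut t ht, b2 _ (circlePt_mem_sphere _ _), hs'.cut.right_cut t ht]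
  set ψ : ℂ → ℂ := fun z => if z ∈ h₁ '' closedBall 0 1 then ψ₁ z else ψ₂ z with hψ
  have q1 : EqOn ψ ψ₁ (h₁ '' closedBall 0 1) := fun z hz => if_pos hz
  have q2 : EqOn ψ ψ₂ (h₂ '' closedBall 0 1) := by
    intro z hz
    by_cases h1 : z ∈ h₁ '' closedBall 0 1
    · obtain ⟨t, ht, rfl⟩ := hs.closed_inter h1 hz
      rw [q1 h1, k1 t ht, k2 t ht]
    · exact if_neg h1
  have hk : ∀ t ∈ Icc 0 (m : ℝ), ψ (k t) = k' t := fun t ht => by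
    rw [q1 (IsDisc.sphere_subset _ (hs.cut.cut_mem_left ht)), k1 t ht]
  have hU := hs.cut.tiling.union
  have hU' := hs'.cut.tiling.union
  have himg1 : ∀ S ⊆ h₁ '' closedBall 0 1, ψ '' S = ψ₁ '' S := fun S hS =>
    (q1.mono hS).image_eq
  have himg2 : ∀ S ⊆ h₂ '' closedBall 0 1, ψ '' S = ψ₂ '' S := fun S hS =>
    (q2.mono hS).image_eq
  have hcross : ∀ z ∈ h₁ '' closedBall 0 1, ∀ w ∈ h₂ '' closedBall 0 1, ψ₁ z = ψ₂ w → z = w := by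
    intro z hz w hw hzw
    have m1 : ψ₁ z ∈ h₁' '' closedBall 0 1 := s1 ▸ mem_image_of_mem _ hz
    have m2 : ψ₁ z ∈ h₂' '' closedBall 0 1 := by rw [hzw, ← s2]; exact mem_image_of_mem _ hw
    obtain ⟨t, ht, hkt⟩ := hs'.closed_inter m1 m2
    have hz' : z = k t := i1 hz (IsDisc.sphere_subset _ (hs.cut.cut_mem_left ht)) <| by
      rw [k1 t ht, hkt]
    have hw' : w = k t := i2 hw (IsDisc.sphere_subset _ (hs.cut.cut_mem_right ht)) <| by
      rw [k2 t ht, hkt, hzw]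
    rw [hz', hw']
  refine ⟨ψ, ?_, ?_, ?_, ?_, ?_, ?_⟩
  · rw [← hU]
    exact (c1.congr q1).union_of_isClosed (c2.congr q2) hs.cut.left.isCompact.isClosed
      hs.cut.right.isCompact.isClosed
  · rw [← hU]
    rintro z (hz | hz) w (hw | hw) hzw
    · rw [q1 hz, q1 hw] at hzw; exact i1 hz hw hzw
    · rw [q1 hz, q2 hw] at hzw; exact hcross z hz w hw hzw
    · rw [q2 hz, q1 hw] at hzw; exact (hcross w hw z hz hzw.symm).symm
    · rw [q2 hz, q2 hw] at hzw; exact i2 hz hw hzw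
  · intro z hz
    have hl : (0 : ℝ) < j + r := by linarith [hs.left_posR, hs.right_posR]
    obtain ⟨t, ht, rfl⟩ := exists_circlePt hl 0 hz
    rw [zero_add] at ht
    rcases le_total t j with htj | htj
    · have ht' : t ∈ Icc 0 (j : ℝ) := ⟨ht.1, htj⟩
      rw [← hs.cut.left_arc t ht', ← hs'.cut.left_arc t ht',
        q1 ⟨_, circlePt_mem_closedBall _ _, rfl⟩, b1 _ (circlePt_mem_sphere _ _)]
    · have ht' : t - j ∈ Icc 0 ((j : ℝ) + r - j) := ⟨by linarith, by linarith [ht.2]⟩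
      have r1 := hs.cut.right_arc _ ht'
      have r2 := hs'.cut.right_arc _ ht'
      rw [add_sub_cancel] at r1 r2
      rw [← r1, ← r2, q2 ⟨_, circlePt_mem_closedBall _ _, rfl⟩, b2 _ (circlePt_mem_sphere _ _)]
  · rw [← hU, ← hU', image_union, himg1 _ subset_rfl, himg2 _ subset_rfl, s1, s2]
  · have b1' : P ∩ h₁ '' ball 0 1 ⊆ h₁ '' closedBall 0 1 :=
      inter_subset_right.trans (IsDisc.ball_subset h₁)
    have b2' : P ∩ h₂ '' ball 0 1 ⊆ h₂ '' closedBall 0 1 :=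
      inter_subset_right.trans (IsDisc.ball_subset h₂)
    rw [hs.points_eq, hs'.points_eq, image_union, image_union, himg1 _ b1', himg2 _ b2', p1, p2]
    congr 1
    have hpat : ∀ t ∈ Ioo 0 (m : ℝ), k t ∈ P ↔ k' t ∈ P' := by
      intro t ht
      obtain ⟨s, hsm, u, hu, rfl⟩ := exists_seg (Ioo_subset_Ico_self ht)
      rw [hs.cut_mem_iff hsm hu, hs'.cut_mem_iff hsm hu]
    ext w
    constructor
    · grind
    · grind
  · have hsegimg : ∀ s < m, ψ '' (segPath k s '' Icc 0 1) = segPath k' s '' Icc 0 1 := by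
      intro s hsm
      rw [image_image]
      refine image_congr fun t ht => hk _ ?_
      have h1 : (s : ℝ) + 1 ≤ m := by exact_mod_cast hsm
      exact ⟨by linarith [ht.1, Nat.cast_nonneg (α := ℝ) s], by linarith [ht.2]⟩
    rw [hs.innerEdges_eq, hs'.innerEdges_eq, image_union, image_union]
    congr 1
    · rw [← e1, ← e2]
      congr 1
      · exact image_congr fun e he => himg1 e (hs.left_frame.inner_subset he)
      · exact image_congr fun e he => himg2 e (hs.right_frame.inner_subset he)
    · ext e
      constructor
      · grind
      · rintro ⟨he, s, hsm, rfl⟩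
        exact ⟨_, ⟨(hseg s hsm).2 he, s, hsm, rfl⟩, hsegimg s hsm⟩

/-- The boundary parametrisation of a disc, shifted by `i`. -/
noncomputable def shift (l i : ℕ) (h : ℂ → ℂ) : ℂ → ℂ := fun z => h (circlePt l i * z)

section Shift
variable {P P' : Set ℂ} {E E' : Set (Set ℂ)} {l : ℕ} {h h' : ℂ → ℂ}

lemma shift_circlePt (l i : ℕ) (h : ℂ → ℂ) (t : ℝ) :
    shift l i h (circlePt l t) = h (circlePt l (i + t)) := by
  rw [shift, circlePt_add]

lemma circlePt_mod (hl : 0 < l) (a : ℕ) (t : ℝ) :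
    circlePt l ((a % l : ℕ) + t) = circlePt l (a + t) := by
  rw [circlePt_eq_iff (by exact_mod_cast hl)]
  refine ⟨-((a / l : ℕ) : ℤ), ?_⟩
  have : (a : ℝ) = l * (a / l : ℕ) + (a % l : ℕ) := by exact_mod_cast (Nat.div_add_mod a l).symm
  rw [this, Int.cast_neg, Int.cast_natCast]
  ring

lemma sidePath_shift (hl : 0 < l) (i i' : ℕ) (h : ℂ → ℂ) :
    sidePath l (shift l i h) i' = sidePath l h ((i + i') % l) := by
  funext t
  rw [sidePath, sidePath, shift_circlePt, circlePt_mod hl, Nat.cast_add, add_assoc]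

lemma side_shift (hl : 0 < l) (i i' : ℕ) (h : ℂ → ℂ) :
    side l (shift l i h) i' = side l h ((i + i') % l) := by
  rw [side, sidePath_shift hl, side]

lemma shift_ball (hh : IsDisc h) (l i : ℕ) : shift l i h '' ball 0 1 = h '' ball 0 1 :=
  (hh.rotate (norm_circlePt l i)).2.1

lemma shift_closedBall (hh : IsDisc h) (l i : ℕ) :
    shift l i h '' closedBall 0 1 = h '' closedBall 0 1 := (hh.rotate (norm_circlePt l i)).2.2.1

lemma IsFrame.shift (hF : IsFrame P E l h) (i : ℕ) : IsFrame P E l (shift l i h) :=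
  ⟨hF.plane, (hF.disc.rotate (norm_circlePt l i)).1, hF.two_le, fun i' _ =>
    sidePath_shift hF.pos i i' h ▸ hF.isSide _ (Nat.mod_lt _ hF.pos)⟩

lemma DiscEquiv.of_shift (hh : IsDisc h) (hh' : IsDisc h') {i : ℕ}
    (H : DiscEquiv P E (shift l i h) P' E' (shift l i h')) : DiscEquiv P E h P' E' h' := by
  obtain ⟨ψ, c, inj, b, s, p, e⟩ := H
  rw [shift_closedBall hh] at c inj
  rw [shift_closedBall hh, shift_closedBall hh'] at s
  rw [shift_ball hh, shift_ball hh'] at p e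
  refine ⟨ψ, c, inj, fun z hz => ?_, s, p, e⟩
  have h1 : (circlePt l i)⁻¹ * z ∈ sphere (0 : ℂ) 1 := by
    rw [mem_sphere_zero_iff_norm] at hz ⊢
    rw [norm_mul, norm_inv, norm_circlePt, hz, inv_one, one_mul]
  have := b _ h1
  simpa [_root_.shift, mul_inv_cancel_left₀ (circlePt_ne_zero l i)] using this

end Shift

/-- A region contains no part of a drawing. -/
def IsVoid (P : Set ℂ) (E : Set (Set ℂ)) (U : Set ℂ) : Prop := P ∩ U = ∅ ∧ innerEdges E U = ∅

lemma DiscEquiv.of_isVoid {P P' : Set ℂ} {E E' : Set (Set ℂ)} {h h' : ℂ → ℂ} (hh : IsDisc h)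
    (hh' : IsDisc h') (hv : IsVoid P E (h '' ball 0 1)) (hv' : IsVoid P' E' (h' '' ball 0 1)) :
    DiscEquiv P E h P' E' h' := by
  have hmaps : MapsTo (Function.invFunOn h (closedBall 0 1)) (h '' closedBall 0 1)
      (closedBall 0 1) := fun z hz => Function.invFunOn_mem hz
  have hinv : ∀ z ∈ closedBall (0 : ℂ) 1, Function.invFunOn h (closedBall 0 1) (h z) = z :=
    fun z hz => hh.injOn.leftInvOn_invFunOn hz
  refine ⟨h' ∘ Function.invFunOn h (closedBall 0 1),
    hh'.continuousOn.comp hh.continuousOn_inv hmaps, ?_, fun z hz => ?_, ?_, ?_, ?_⟩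
  · rintro _ ⟨z, hz, rfl⟩ _ ⟨w, hw, rfl⟩ hzw
    simp only [Function.comp_apply, hinv z hz, hinv w hw] at hzw
    rw [hh'.injOn hz hw hzw]
  · rw [Function.comp_apply, hinv z (sphere_subset_closedBall hz)]
  · grind
  · rw [hv.1, hv'.1, image_empty]
  · rw [hv.2, hv'.2, image_empty]

lemma IsFrame.exists_isSplit {P : Set ℂ} {E : Set (Set ℂ)} {j r m : ℕ} {h : ℂ → ℂ} {k : ℝ → ℂ}
    (hF : IsFrame P E (j + r) h) (hj : 0 < j) (hr : 0 < r) (hm : 0 < m)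
    (hk : IsCrosscut (j + r) j m h k) (hside : ∀ s < m, IsSide P E (segPath k s)) :
    ∃ h₁ h₂, IsSplit P E j r m h k h₁ h₂ := by
  have hj' : (0 : ℝ) < j := by exact_mod_cast hj
  have hr' : (0 : ℝ) < r := by exact_mod_cast hr
  have hm' : (0 : ℝ) < m := by exact_mod_cast hm
  obtain ⟨h₁, h₂, hc⟩ := exists_isCut hF.disc hj' (by linarith : (j : ℝ) < j + r) hm' hk
  exact ⟨h₁, h₂, hF, hj, hr, hm, hk, hc, hside⟩

/-- An edge inside `U` parallel to `A` encloses points together with `A`. -/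
def IsTight (P : Set ℂ) (E : Set (Set ℂ)) (U A : Set ℂ) : Prop :=
  ∀ e ∈ innerEdges E U, e ∩ P = A ∩ P → ∀ d, IsDisc d → d '' sphere 0 1 = e ∪ A →
    d '' ball 0 1 ⊆ U → (P ∩ d '' ball 0 1).Nonempty

/-- No edge inside `U` contains `v`. -/
def IsFree (E : Set (Set ℂ)) (U : Set ℂ) (v : ℂ) : Prop := ∀ e ∈ innerEdges E U, v ∉ e

lemma IsTight.mono {P : Set ℂ} {E : Set (Set ℂ)} {U V A : Set ℂ} (hV : IsTight P E V A)
    (hUV : U ⊆ V) : IsTight P E U A := fun e he heA d hd hdA hdU =>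
  hV e (innerEdges_mono hUV he) heA d hd hdA (hdU.trans hUV)

lemma IsFree.mono {E : Set (Set ℂ)} {U V : Set ℂ} {v : ℂ} (hV : IsFree E V v)
    (hUV : U ⊆ V) : IsFree E U v := fun e he => hV e (innerEdges_mono hUV he)

lemma IsPlane.isTight_of_mem {P : Set ℂ} {E : Set (Set ℂ)} (hP : IsPlane P E) {U A : Set ℂ}
    (hA : A ∈ E) (hAU : Disjoint A U) : IsTight P E U A := by
  intro e he heA
  rw [hP.simple e he.1 A hA heA] at he
  exact (Set.not_nonempty_iff_eq_empty.2 hAU.inter_eq he.2).elim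

lemma IsFree.isTight {P : Set ℂ} {E : Set (Set ℂ)} {U A : Set ℂ} {v : ℂ} (hv : IsFree E U v)
    (hvA : v ∈ A) (hvP : v ∈ P) : IsTight P E U A := fun e he heA =>
  (hv e he (heA.symm ▸ (⟨hvA, hvP⟩ : v ∈ A ∩ P) : v ∈ e ∩ P).1).elim

/-- A framed disc with `l` sides and `n` inner points, tight at the sides outside `W`,
whose roots in `F` are free. -/
structure IsState (n l : ℕ) (W F : Set ℕ) (P : Set ℂ) (E : Set (Set ℂ)) (h : ℂ → ℂ) : Prop where
  frame : IsFrame P E l h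
  ncard_eq : (P ∩ h '' ball 0 1).ncard = n
  tight : ∀ i < l, i ∉ W → IsTight P E (h '' ball 0 1) (side l h i)
  free : ∀ i < l, i ∈ F → IsFree E (h '' ball 0 1) (h (circlePt l i))

/-- A class of discs with drawings has at most `c` members up to equivalence. -/
def AtMost (S : Set ℂ → Set (Set ℂ) → (ℂ → ℂ) → Prop) (c : ℕ) : Prop :=
  ∃ code : Set ℂ → Set (Set ℂ) → (ℂ → ℂ) → ℕ, (∀ P E h, S P E h → code P E h < c) ∧
    ∀ P E h P' E' h', S P E h → S P' E' h' → code P E h = code P' E' h' → DiscEquiv P E h P' E' h'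

namespace AtMost
variable {S T S₁ S₂ : Set ℂ → Set (Set ℂ) → (ℂ → ℂ) → Prop} {c d : ℕ}

lemma mono (hT : AtMost T c) (hST : ∀ P E h, S P E h → T P E h) (hcd : c ≤ d) : AtMost S d := by
  obtain ⟨f, hf, hf'⟩ := hT
  exact ⟨f, fun P E h hS => (hf P E h (hST _ _ _ hS)).trans_le hcd, fun P E h P' E' h' hS hS' =>
    hf' P E h P' E' h' (hST _ _ _ hS) (hST _ _ _ hS')⟩

lemma or (hS : AtMost S c) (hT : AtMost T d) :
    AtMost (fun P E h => S P E h ∨ T P E h) (c + d) := by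
  classical
  obtain ⟨f, hf, hf'⟩ := hS
  obtain ⟨g, hg, hg'⟩ := hT
  refine ⟨fun P E h => if S P E h then f P E h else c + g P E h, fun P E h hST => ?_,
    fun P E h P' E' h' hST hST' heq => ?_⟩
  · grind
  · grind

lemma of_isEmpty (hS : ∀ P E h, ¬ S P E h) : AtMost S 0 :=
  ⟨fun _ _ _ => 0, fun P E h h' => (hS P E h h').elim, fun P E h _ _ _ h' => (hS P E h h').elim⟩

lemma exists_mem {ι : Type*} (s : Finset ι) {Q : ι → Set ℂ → Set (Set ℂ) → (ℂ → ℂ) → Prop}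
    {b : ι → ℕ} (hQ : ∀ i ∈ s, AtMost (Q i) (b i)) :
    AtMost (fun P E h => ∃ i ∈ s, Q i P E h) (∑ i ∈ s, b i) := by
  classical
  induction s using Finset.induction_on with
  | empty => exact of_isEmpty (by simp)
  | insert a s ha ih =>
    rw [Finset.sum_insert ha]
    refine ((hQ a (Finset.mem_insert_self a s)).or
      (ih fun i hi => hQ i (Finset.mem_insert_of_mem hi))).mono ?_ le_rfl
    rintro P E h ⟨i, hi, hq⟩
    rcases Finset.mem_insert.1 hi with rfl | hi
    exacts [Or.inl hq, Or.inr ⟨i, hi, hq⟩]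

lemma of_equiv (hS : ∀ P E h P' E' h', S P E h → S P' E' h' → DiscEquiv P E h P' E' h') :
    AtMost S 1 :=
  ⟨fun _ _ _ => 0, fun _ _ _ _ => one_pos, fun P E h P' E' h' h1 h2 _ => hS P E h P' E' h' h1 h2⟩

lemma prod (h₁ : AtMost S₁ c) (h₂ : AtMost S₂ d)
    (R : Set ℂ → Set (Set ℂ) → (ℂ → ℂ) → (ℂ → ℂ) → (ℂ → ℂ) → Prop)
    (hR : ∀ P E h, S P E h → ∃ a b, S₁ P E a ∧ S₂ P E b ∧ R P E h a b)
    (hglue : ∀ P E h a b P' E' h' a' b', R P E h a b → R P' E' h' a' b' →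
      DiscEquiv P E a P' E' a' → DiscEquiv P E b P' E' b' → DiscEquiv P E h P' E' h') :
    AtMost S (c * d) := by
  classical
  obtain ⟨f, hf, hf'⟩ := h₁
  obtain ⟨g, hg, hg'⟩ := h₂
  choose! a b ha hb hab using hR
  refine ⟨fun P E h => g P E (b P E h) + d * f P E (a P E h), fun P E h hS => ?_,
    fun P E h P' E' h' hS hS' heq => ?_⟩
  · have h1 := hf _ _ _ (ha P E h hS)
    have h2 := hg _ _ _ (hb P E h hS)
    calc g P E (b P E h) + d * f P E (a P E h) < d + d * f P E (a P E h) := by omega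
      _ = d * (f P E (a P E h) + 1) := by ring
      _ ≤ d * c := Nat.mul_le_mul_left _ h1
      _ = c * d := mul_comm _ _
  · have h2 := hg _ _ _ (hb P E h hS)
    have h2' := hg _ _ _ (hb P' E' h' hS')
    have hd : 0 < d := by omega
    have e1 : g P E (b P E h) = g P' E' (b P' E' h') := by
      have := congrArg (· % d) heq
      simpa [Nat.add_mul_mod_self_left, Nat.mod_eq_of_lt h2, Nat.mod_eq_of_lt h2'] using this
    have e2 : f P E (a P E h) = f P' E' (a P' E' h') := by
      simp only [e1, add_right_inj] at heq
      exact Nat.eq_of_mul_eq_mul_left hd heq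
    exact hglue _ _ _ _ _ _ _ _ _ _ (hab P E h hS) (hab P' E' h' hS')
      (hf' _ _ _ _ _ _ (ha P E h hS) (ha P' E' h' hS') e2)
      (hg' _ _ _ _ _ _ (hb P E h hS) (hb P' E' h' hS') e1)

lemma of_rel (hT : AtMost T c) (R : Set ℂ → Set (Set ℂ) → (ℂ → ℂ) → (ℂ → ℂ) → Prop)
    (hR : ∀ P E h, S P E h → ∃ b, T P E b ∧ R P E h b)
    (hglue : ∀ P E h b P' E' h' b', R P E h b → R P' E' h' b' →
      DiscEquiv P E b P' E' b' → DiscEquiv P E h P' E' h') : AtMost S c := by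
  obtain ⟨g, hg, hg'⟩ := hT
  choose! b hb hab using hR
  exact ⟨fun P E h => g P E (b P E h), fun P E h hS => hg _ _ _ (hb P E h hS),
    fun P E h P' E' h' hS hS' heq => hglue _ _ _ _ _ _ _ _ (hab P E h hS) (hab P' E' h' hS')
      (hg' _ _ _ _ _ _ (hb P E h hS) (hb P' E' h' hS') heq)⟩

end AtMost

section Edges
variable {P : Set ℂ} {E : Set (Set ℂ)} {l : ℕ} {h : ℂ → ℂ}

/-- A parametrisation of an edge of a drawing. -/
structure IsEdgePath (P e : Set ℂ) (p : ℝ → ℂ) : Prop where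
  continuousOn : ContinuousOn p (Icc 0 1)
  injOn : InjOn p (Icc 0 1)
  source : p 0 ∈ P
  target : p 1 ∈ P
  interior : ∀ t ∈ Ioo (0 : ℝ) 1, p t ∉ P
  image_eq : p '' Icc 0 1 = e

lemma IsEdgePath.inter_eq {e : Set ℂ} {p : ℝ → ℂ} (hp : IsEdgePath P e p) :
    e ∩ P = {p 0, p 1} := by
  rw [← hp.image_eq]
  apply subset_antisymm
  · rintro _ ⟨⟨t, ht, rfl⟩, hP⟩
    by_contra hn
    rw [mem_insert_iff, mem_singleton_iff, not_or] at hn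
    refine hp.interior t ⟨ht.1.lt_of_ne' ?_, ht.2.lt_of_ne ?_⟩ hP <;> rintro rfl <;> simp at hn
  · rintro _ (rfl | rfl)
    exacts [⟨⟨0, by simp, rfl⟩, hp.source⟩, ⟨⟨1, by simp, rfl⟩, hp.target⟩]

lemma IsEdgePath.reverse {e : Set ℂ} {p : ℝ → ℂ} (hp : IsEdgePath P e p) :
    IsEdgePath P e (fun t => p (1 - t)) := by
  have hm : MapsTo (fun t : ℝ => 1 - t) (Icc 0 1) (Icc 0 1) := fun t ht =>
    ⟨by linarith [ht.2], by linarith [ht.1]⟩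
  refine ⟨hp.continuousOn.comp (by fun_prop) hm, fun s hs t ht hst => ?_, by simpa using hp.target,
    by simpa using hp.source, fun t ht => hp.interior _ ⟨by linarith [ht.2], by linarith [ht.1]⟩, ?_⟩
  · have := hp.injOn (hm hs) (hm ht) hst
    linarith
  · rw [image_reverse, hp.image_eq]

lemma IsEdgePath.ne {e : Set ℂ} {p : ℝ → ℂ} (hp : IsEdgePath P e p) : p 0 ≠ p 1 := fun h01 => by
  have := hp.injOn (by simp) (by simp) h01
  norm_num at this

lemma IsPlane.exists_isEdgePath (hP : IsPlane P E) {e : Set ℂ} (he : e ∈ E) :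
    ∃ p, IsEdgePath P e p := by
  obtain ⟨p, h1, h2, h3, h4, h5, h6⟩ := hP.arc e he
  exact ⟨p, h1, h2, h3, h4, h5, h6⟩

/-- An edge can be parametrised from any of its ends. -/
lemma IsPlane.exists_isEdgePath_of_mem (hP : IsPlane P E) {e : Set ℂ} (he : e ∈ E) {a : ℂ}
    (hae : a ∈ e) (haP : a ∈ P) : ∃ p, IsEdgePath P e p ∧ p 0 = a := by
  obtain ⟨p, hp⟩ := hP.exists_isEdgePath he
  have : a ∈ e ∩ P := ⟨hae, haP⟩
  rw [hp.inter_eq] at this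
  rcases this with rfl | h1
  · exact ⟨p, hp, rfl⟩
  · rw [mem_singleton_iff] at h1
    exact ⟨_, hp.reverse, by simp [h1]⟩

lemma IsFrame.edgePath_mem (hF : IsFrame P E l h) {e : Set ℂ} {p : ℝ → ℂ} (hp : IsEdgePath P e p)
    (he : e ∈ innerEdges E (h '' ball 0 1)) {t : ℝ} (ht : t ∈ Ioo (0 : ℝ) 1) :
    p t ∈ h '' ball 0 1 :=
  hF.inner_path hp.continuousOn hp.interior hp.source hp.target (hp.image_eq.symm ▸ he) ht

lemma IsPlane.isSide_of_isEdgePath (hP : IsPlane P E) {e : Set ℂ} {p : ℝ → ℂ}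
    (hp : IsEdgePath P e p) (he : e ∈ E) : IsSide P E p :=
  hP.isSide hp.source hp.target hp.interior (hp.image_eq.symm ▸ he)

/-- An edge joining two roots of a frame splits it. -/
lemma IsFrame.exists_isSplit_of_edge {j r : ℕ} (hF : IsFrame P E (j + r) h) (hj : 0 < j)
    (hr : 0 < r) {e : Set ℂ} (he : e ∈ innerEdges E (h '' ball 0 1)) {p : ℝ → ℂ}
    (hp : IsEdgePath P e p) (h0 : p 0 = h (circlePt (j + r : ℕ) 0))
    (h1 : p 1 = h (circlePt (j + r : ℕ) j)) :
    ∃ h₁ h₂, IsSplit P E j r 1 h p h₁ h₂ := by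
  push_cast at h0 h1
  refine hF.exists_isSplit hj hr one_pos ⟨?_, ?_, h0, ?_, ?_⟩ fun s hs => ?_
  · simpa using hp.continuousOn
  · simpa using hp.injOn
  · simpa using h1
  · intro t ht
    exact hF.edgePath_mem hp he (by simpa using ht)
  · obtain rfl : s = 0 := by omega
    have : segPath p 0 = p := by funext t; simp [segPath]
    rw [this]
    exact hF.plane.isSide_of_isEdgePath hp he.1

lemma IsFrame.side_inter (hF : IsFrame P E l h) {i : ℕ} (hi : i < l) :
    side l h i ∩ P = {h (circlePt l i), h (circlePt l (i + 1))} := by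
  have hs := hF.isSide i hi
  apply subset_antisymm
  · rintro _ ⟨⟨t, ht, rfl⟩, hP⟩
    by_contra hn
    rw [mem_insert_iff, mem_singleton_iff, not_or] at hn
    refine hs.interior t ⟨ht.1.lt_of_ne' ?_, ht.2.lt_of_ne ?_⟩ hP <;> rintro rfl <;>
      simp [sidePath] at hn
  · rintro _ (rfl | rfl)
    exacts [⟨⟨0, by simp, by simp [sidePath]⟩, by simpa [sidePath] using hs.source⟩,
      ⟨⟨1, by simp, by simp [sidePath]⟩, by simpa [sidePath] using hs.target⟩]

/-- The edges in a digon without inner points join its two roots. -/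
lemma IsFrame.exists_isEdgePath_of_digon (hF : IsFrame P E 2 h) (h0 : P ∩ h '' ball 0 1 = ∅)
    {e : Set ℂ} (he : e ∈ innerEdges E (h '' ball 0 1)) :
    ∃ p, IsEdgePath P e p ∧ p 0 = h (circlePt (2 : ℕ) 0) ∧ p 1 = h (circlePt (2 : ℕ) 1) := by
  have key : ∀ z ∈ e, z ∈ P → z = h (circlePt (2 : ℕ) 0) ∨ z = h (circlePt (2 : ℕ) 1) := by
    intro z hz hzP
    have h1 := hF.inner_subset he hz
    rw [IsDisc.image_closedBall] at h1
    have h2 := h1.resolve_left fun h' => (h0 ▸ (⟨hzP, h'⟩ : z ∈ P ∩ h '' ball 0 1) : z ∈ (∅ : Set ℂ))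
    obtain ⟨i, hi, rfl⟩ := hF.exists_root hzP h2
    interval_cases i
    · left; simp
    · right; simp
  obtain ⟨p, hp⟩ := hF.plane.exists_isEdgePath he.1
  have m0 : p 0 ∈ e := hp.image_eq ▸ ⟨0, by simp, rfl⟩
  have m1 : p 1 ∈ e := hp.image_eq ▸ ⟨1, by simp, rfl⟩
  rcases key _ m0 hp.source with h1 | h1 <;> rcases key _ m1 hp.target with h2 | h2
  · exact (hp.ne (h1.trans h2.symm)).elim
  · exact ⟨p, hp, h1, h2⟩
  · exact ⟨_, hp.reverse, by simpa using h2, by simpa using h1⟩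
  · exact (hp.ne (h1.trans h2.symm)).elim

end Edges

section Lens
variable {l j m : ℝ} {h h₁ h₂ : ℂ → ℂ} {k : ℝ → ℂ}

/-- The boundary of the right piece of a cut disc does not meet the left piece. -/
lemma IsCut.arc_notMem_left (hc : IsCut l j m h k h₁ h₂) (hh : IsDisc h) (hk : IsCrosscut l j m h k)
    (hj : 0 < j) (hm : 0 < m) {s : ℝ} (hs : s ∈ Ioo j l) : h (circlePt l s) ∉ h₁ '' closedBall 0 1 := by
  have hl : 0 < l := hj.trans (hs.1.trans hs.2)
  have hb : h (circlePt l s) ∈ h '' sphere 0 1 := ⟨_, circlePt_mem_sphere _ _, rfl⟩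
  have hne : ∀ t ∈ Icc 0 j, h (circlePt l t) ≠ h (circlePt l s) := fun t ht heq => by
    have := hh.injOn_circlePt (a := 0) (b := s) hl (by linarith [hs.2])
      ⟨ht.1, ht.2.trans hs.1.le⟩ ⟨hj.le.trans hs.1.le, le_rfl⟩ heq
    linarith [ht.2, hs.1]
  rw [IsDisc.image_closedBall, hc.left_boundary hj hm]
  rintro (h1 | ⟨t, ht, h1⟩ | ⟨t, ht, h1⟩)
  · exact hh.disjoint.le_bot ⟨hc.tiling.left_subset h1, hb⟩
  · exact hne t ht h1
  · rcases hk.eq_end_of_mem_boundary hh ht (h1 ▸ hb) with rfl | rfl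
    · exact hne 0 ⟨le_rfl, hj.le⟩ (hk.source ▸ h1)
    · exact hne j ⟨hj.le, le_rfl⟩ (hk.target ▸ h1)

/-- A closed set missing an open boundary arc can be separated from it by a crosscut. -/
theorem IsDisc.exists_lens (hh : IsDisc h) (hj : 0 < j) (hjl : j < l) (hm : 0 < m) {K : Set ℂ}
    (hK : IsClosed K) (hKa : ∀ t ∈ Ioo 0 j, h (circlePt l t) ∉ K) :
    ∃ k, IsCrosscut l j m h k ∧ (∀ t ∈ Ioo 0 m, k t ∉ K) ∧
      ∀ h₁ h₂, IsCut l j m h k h₁ h₂ → Disjoint (h₁ '' ball 0 1) K := by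
  have hl : 0 < l := hj.trans hjl
  set K' : Set ℂ := (closedBall 0 1 ∩ h ⁻¹' K) ∪ {circlePt l 0, circlePt l j} with hK'
  have hK'c : IsClosed K' :=
    (hh.continuousOn.preimage_isClosed_of_isClosed isClosed_closedBall hK).union (by simp)
  have hK'n : K'.Nonempty := ⟨circlePt l 0, Or.inr (by simp)⟩
  set ε : ℝ → ℝ := fun θ => min (infDist (circlePt l θ) K') 1 / 2 with hε
  have hεc : Continuous ε :=
    (((continuous_infDist_pt K').comp (_root_.continuous_circlePt l)).min continuous_const).div_const 2
  have hε0 : ∀ θ, 0 ≤ ε θ := fun θ => by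
    have : 0 ≤ min (infDist (circlePt l θ) K') 1 := le_min infDist_nonneg zero_le_one
    simp only [hε]; linarith
  have hε1 : ∀ θ, ε θ ≤ 1 / 2 := fun θ => by grind
  have hεpos : ∀ θ ∈ Ioo 0 j, 0 < ε θ := by
    intro θ hθ
    have h1 : circlePt l θ ∉ K' := by
      rintro (h1 | h1 | h1)
      · exact hKa θ hθ h1.2
      · have := circlePt_injOn_Icc (a := 0) (b := j) hl (by linarith) ⟨hθ.1.le, hθ.2.le⟩
          ⟨le_rfl, hj.le⟩ h1
        exact hθ.1.ne' this
      · have := circlePt_injOn_Icc (a := 0) (b := j) hl (by linarith) ⟨hθ.1.le, hθ.2.le⟩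
          ⟨hj.le, le_rfl⟩ h1
        exact hθ.2.ne this
    have h2 := (hK'c.notMem_iff_infDist_pos hK'n).1 h1
    have : 0 < min (infDist (circlePt l θ) K') 1 := lt_min h2 one_pos
    simp only [hε]; linarith
  -- points close to the boundary arc do not lie in the closed set
  have hfar : ∀ θ ∈ Ioo 0 j, ∀ ρ : ℝ, 1 - ε θ ≤ ρ → ρ ≤ 1 → (ρ : ℂ) * circlePt l θ ∉ K' := by
    intro θ hθ ρ h1 h2 hmem
    have h3 : infDist (circlePt l θ) K' ≤ 1 - ρ := by
      refine (infDist_le_dist_of_mem hmem).trans_eq ?_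
      rw [dist_eq_norm, show circlePt l θ - ρ * circlePt l θ = ((1 - ρ : ℝ) : ℂ) * circlePt l θ by
        push_cast; ring, norm_mul, norm_circlePt, Complex.norm_real, mul_one,
        Real.norm_of_nonneg (by linarith)]
    have h4 : min (infDist (circlePt l θ) K') 1 ≤ infDist (circlePt l θ) K' := min_le_left _ _
    have h5 := hεpos θ hθ
    simp only [hε] at h1 h5
    linarith
  have hend0 : ε 0 = 0 := by
    have : infDist (circlePt l 0) K' = 0 := infDist_zero_of_mem (Or.inr (by simp))
    simp [hε, this]
  have hendj : ε j = 0 := by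
    have : infDist (circlePt l j) K' = 0 := infDist_zero_of_mem (Or.inr (by simp))
    simp [hε, this]
  set q : ℝ → ℂ := fun θ => ((1 - ε θ : ℝ) : ℂ) * circlePt l θ with hq
  have hqn : ∀ θ, ‖q θ‖ = 1 - ε θ := fun θ => by
    rw [hq, norm_mul, norm_circlePt, mul_one, Complex.norm_real, Real.norm_of_nonneg]
    linarith [hε1 θ]
  have hqc : Continuous q := by
    have := _root_.continuous_circlePt l
    simp only [hq]
    fun_prop
  have hqD : ∀ θ, q θ ∈ closedBall (0 : ℂ) 1 := fun θ => by
    rw [mem_closedBall_zero_iff, hqn]; linarith [hε0 θ]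
  have hqi : InjOn q (Icc 0 j) := by
    intro s hs t ht hst
    have h1 : 1 - ε s = 1 - ε t := by rw [← hqn, ← hqn, hst]
    have h2 : ((1 - ε t : ℝ) : ℂ) ≠ 0 := by
      exact_mod_cast (by linarith [hε1 t] : (0 : ℝ) < 1 - ε t).ne'
    simp only [hq] at hst
    rw [h1] at hst
    exact circlePt_injOn_Icc hl (by linarith) hs ht (mul_left_cancel₀ h2 hst)
  have hsc : ∀ t ∈ Icc 0 m, j * t / m ∈ Icc 0 j := fun t ht => by
    refine ⟨div_nonneg (mul_nonneg hj.le ht.1) hm.le, ?_⟩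
    rw [div_le_iff₀ hm]
    exact mul_le_mul_of_nonneg_left ht.2 hj.le
  have hsc' : ∀ t ∈ Ioo 0 m, j * t / m ∈ Ioo 0 j := fun t ht => by
    refine ⟨div_pos (mul_pos hj ht.1) hm, ?_⟩
    rw [div_lt_iff₀ hm]
    exact mul_lt_mul_of_pos_left ht.2 hj
  set k : ℝ → ℂ := fun t => h (q (j * t / m)) with hk
  have hkc : IsCrosscut l j m h k := by
    refine ⟨?_, ?_, ?_, ?_, fun t ht => ⟨_, ?_, rfl⟩⟩
    · exact (hh.continuousOn.comp_continuous (hqc.comp (by fun_prop : Continuous fun t : ℝ => j * t / m))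
        fun t => hqD _).continuousOn
    · intro s hs t ht hst
      have := hqi (hsc s hs) (hsc t ht) (hh.injOn (hqD _) (hqD _) hst)
      rw [div_left_inj' hm.ne'] at this
      exact mul_left_cancel₀ hj.ne' this
    · simp [hk, hq, hend0]
    · simp only [hk, hq]
      rw [mul_div_cancel_right₀ _ hm.ne', hendj]
      simp
    · rw [mem_ball_zero_iff, hqn]
      linarith [hεpos _ (hsc' t ht)]
  refine ⟨k, hkc, fun t ht hkt => ?_, fun h₁ h₂ hc => ?_⟩
  · exact hfar _ (hsc' t ht) (1 - ε (j * t / m)) le_rfl (by linarith [hε0 (j * t / m)])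
      (Or.inl ⟨hqD _, hkt⟩)
  -- the region below the radial graph is star-shaped
  set S : Set ℂ := {z | z ∈ ball (0 : ℂ) 1 ∧ ∀ θ ∈ Ioo 0 j, ∀ ρ : ℝ, z = ρ * circlePt l θ → ρ < 1 - ε θ}
    with hS
  have hSs : StarConvex ℝ (0 : ℂ) S := by
    rw [starConvex_zero_iff]
    rintro z ⟨hz, hz'⟩ a ha0 ha1
    refine ⟨?_, fun θ hθ ρ hρ => ?_⟩
    · rw [mem_ball_zero_iff] at hz ⊢
      rw [norm_smul, Real.norm_of_nonneg ha0]
      nlinarith [norm_nonneg z]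
    · have h2 : 0 < 1 - ε θ := by linarith [hε1 θ]
      rcases ha0.eq_or_lt with rfl | ha
      · rw [zero_smul, zero_eq_mul, or_iff_left (circlePt_ne_zero _ _)] at hρ
        rw [Complex.ofReal_eq_zero.1 hρ]
        exact h2
      · have h3 := hz' θ hθ (ρ / a) (by
          have ha' : (a : ℂ) ≠ 0 := by exact_mod_cast ha.ne'
          rw [Complex.real_smul] at hρ
          push_cast
          rw [div_mul_eq_mul_div, ← hρ]
          field_simp)
        rw [div_lt_iff₀ ha] at h3
        nlinarith
  have hS0 : (0 : ℂ) ∈ S := ⟨by simp, fun θ hθ ρ hρ => by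
    rw [zero_eq_mul, or_iff_left (circlePt_ne_zero _ _)] at hρ
    rw [Complex.ofReal_eq_zero.1 hρ]
    linarith [hε1 θ]⟩
  have hSc : IsPreconnected (h '' S) :=
    ((hSs.isPathConnected hS0).isConnected.isPreconnected).image _
      (hh.continuousOn.mono fun z hz => ball_subset_closedBall hz.1)
  have hSU : h '' S ⊆ h '' ball 0 1 := image_mono fun z hz => hz.1
  have hSk : ∀ t ∈ Ioo 0 m, k t ∉ h '' S := by
    rintro t ht ⟨z, hz, hzk⟩
    have := hh.injOn (ball_subset_closedBall hz.1) (hqD _) hzk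
    exact (hz.2 _ (hsc' t ht) _ this).ne rfl
  have hnot : ¬ h '' S ⊆ h₁ '' ball 0 1 := by
    intro hsub
    have hs : (j + l) / 2 ∈ Ioo j l := ⟨by linarith, by linarith⟩
    refine hc.arc_notMem_left hh hkc hj hm hs ?_
    have hclos : h '' closure S ⊆ h₁ '' closedBall 0 1 := by
      refine (ContinuousOn.image_closure ?_).trans (closure_minimal
        (hsub.trans (IsDisc.ball_subset _)) hc.left.isCompact.isClosed)
      refine hh.continuousOn.mono (closure_minimal (fun z hz => ball_subset_closedBall hz.1)
        isClosed_closedBall)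
    refine hclos ⟨_, ?_, rfl⟩
    have hseg : ∀ x ∈ Ioo (0 : ℝ) 1, (x : ℂ) * circlePt l ((j + l) / 2) ∈ S := by
      intro x hx
      refine ⟨?_, fun θ hθ ρ hρ => ?_⟩
      · rw [mem_ball_zero_iff, norm_mul, norm_circlePt, mul_one, Complex.norm_real,
          Real.norm_of_nonneg hx.1.le]
        exact hx.2
      · by_contra! hge
        have hρ0 : 0 < ρ := by linarith [hε1 θ]
        have h1 : x = ρ := by
          have := congrArg norm hρ
          rwa [norm_mul, norm_mul, norm_circlePt, norm_circlePt, mul_one, mul_one, Complex.norm_real,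
            Complex.norm_real, Real.norm_of_nonneg hx.1.le, Real.norm_of_nonneg hρ0.le] at this
        rw [← h1] at hρ
        have h2 := mul_left_cancel₀ (by exact_mod_cast hx.1.ne' : (x : ℂ) ≠ 0) hρ
        have h3 := circlePt_injOn hl 0 (mem_Ico.2 ⟨by linarith, by linarith⟩)
          (mem_Ico.2 ⟨hθ.1.le, by linarith [hθ.2]⟩) h2
        linarith [hθ.2]
    have hlim : Tendsto (fun x : ℝ => (x : ℂ) * circlePt l ((j + l) / 2)) (𝓝[<] 1)
        (𝓝 (circlePt l ((j + l) / 2))) := by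
      have : Continuous fun x : ℝ => (x : ℂ) * circlePt l ((j + l) / 2) := by fun_prop
      have h1 := this.tendsto 1
      simp only [Complex.ofReal_one, one_mul] at h1
      exact h1.mono_left nhdsWithin_le_nhds
    exact mem_closure_of_tendsto hlim (by
      filter_upwards [Ioo_mem_nhdsLT (zero_lt_one' ℝ)] with x hx using hseg x hx)
  have hdisj : h '' S ⊆ h₂ '' ball 0 1 :=
    (hc.subset_or_subset hh hkc hj hjl hm hSc hSU hSk).resolve_left hnot
  rw [disjoint_left]
  intro w hw hwK
  obtain ⟨z, hz, rfl⟩ := hc.tiling.left_subset hw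
  have hzS : z ∉ S := fun hzS => hc.tiling.disjoint.le_bot ⟨hw, hdisj ⟨z, hzS, rfl⟩⟩
  have hzS' : ∃ θ ∈ Ioo 0 j, ∃ ρ : ℝ, z = ρ * circlePt l θ ∧ 1 - ε θ ≤ ρ := by
    by_contra! hcon
    exact hzS ⟨hz, hcon⟩
  obtain ⟨θ, hθ, ρ, rfl, hρ⟩ := hzS'
  refine hfar θ hθ ρ hρ ?_ (Or.inl ⟨ball_subset_closedBall hz, hwK⟩)
  rw [mem_ball_zero_iff, norm_mul, norm_circlePt, mul_one, Complex.norm_real] at hz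
  exact (le_abs_self ρ).trans hz.le

end Lens

section FreeRoot
variable {P : Set ℂ} {E : Set (Set ℂ)} {h : ℂ → ℂ}

/-- A path which avoids the drawing in its interior is a side. -/
lemma isSide_of_avoid {p : ℝ → ℂ} (h0 : p 0 ∈ P) (h1 : p 1 ∈ P)
    (hP : ∀ t ∈ Ioo (0 : ℝ) 1, p t ∉ P) (hE : ∀ e ∈ E, ∀ t ∈ Ioo (0 : ℝ) 1, p t ∉ e) :
    IsSide P E p := by
  refine ⟨h0, h1, hP, ?_⟩
  rintro e he - _ ⟨hz, t, ht, rfl⟩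
  by_contra hn
  refine hE e he t ⟨ht.1.lt_of_ne' ?_, ht.2.lt_of_ne ?_⟩ hz <;> rintro rfl <;> exact hn ‹_›

lemma image_notMem_of_avoid {p : ℝ → ℂ} (hE : ∀ e ∈ E, ∀ t ∈ Ioo (0 : ℝ) 1, p t ∉ e) :
    p '' Icc 0 1 ∉ E := fun he =>
  hE _ he (1 / 2) ⟨by norm_num, by norm_num⟩ ⟨1 / 2, ⟨by norm_num, by norm_num⟩, rfl⟩

lemma IsPlane.isClosed_edge (hP : IsPlane P E) {e : Set ℂ} (he : e ∈ E) : IsClosed e := by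
  obtain ⟨p, hp⟩ := hP.exists_isEdgePath he
  rw [← hp.image_eq]
  exact (isCompact_Icc.image_of_continuousOn hp.continuousOn).isClosed

lemma IsPlane.isClosed_union (hP : IsPlane P E) {Q : Set ℂ} (hQ : Q ⊆ P) {F : Set (Set ℂ)}
    (hF : F ⊆ E) : IsClosed (Q ∪ ⋃ e ∈ F, e) :=
  (hP.finite_points.subset hQ).isClosed.union ((hP.finite_edges.subset hF).isClosed_biUnion
    fun _ he => hP.isClosed_edge (hF he))

lemma IsFrame.side_notMem {l i : ℕ} (hF : IsFrame P E l h) (hi : i < l) {t : ℝ}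
    (ht : t ∈ Ioo (0 : ℝ) 1) : h (circlePt l (i + t)) ∉ P := (hF.isSide i hi).interior t ht

/-- A free root is cut off by an empty triangle. -/
theorem IsFrame.exists_isSplit_of_isFree {r : ℕ} (hr : 0 < r) (hF : IsFrame P E (2 + r) h)
    (hfree : IsFree E (h '' ball 0 1) (h (circlePt (2 + r : ℕ) 1))) :
    ∃ k h₁ h₂, IsSplit P E 2 r 1 h k h₁ h₂ ∧ IsVoid P E (h₁ '' ball 0 1) ∧
      segPath k 0 '' Icc 0 1 ∉ E := by
  set v := h (circlePt (2 + r : ℕ) 1) with hv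
  have hr' : (0 : ℝ) < r := by exact_mod_cast hr
  have hvb : v ∈ h '' sphere 0 1 := ⟨_, circlePt_mem_sphere _ _, rfl⟩
  set K : Set ℂ := P \ {v} ∪ ⋃ e ∈ innerEdges E (h '' ball 0 1), e with hK
  have hKc : IsClosed K := hF.plane.isClosed_union sdiff_subset fun e he => he.1
  have hKe : ∀ e ∈ E, ∀ z ∈ e, z ∈ h '' ball 0 1 → z ∈ K := fun e he z hz hzU =>
    Or.inr (mem_iUnion₂.2 ⟨e, ⟨he, z, hz, hzU⟩, hz⟩)
  have hKP : ∀ z ∈ P, z ∈ h '' ball 0 1 → z ∈ K := fun z hz hzU =>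
    Or.inl ⟨hz, fun hzv => hF.disc.disjoint.le_bot ⟨hzU, (show z = v from hzv) ▸ hvb⟩⟩
  have hKa : ∀ t ∈ Ioo (0 : ℝ) (2 : ℕ), h (circlePt ((2 : ℕ) + r) t) ∉ K := by
    intro t ht
    have hb : h (circlePt ((2 : ℕ) + r) t) ∈ h '' sphere 0 1 := ⟨_, circlePt_mem_sphere _ _, rfl⟩
    have hP : t ≠ 1 → h (circlePt ((2 : ℕ) + r) t) ∉ P := by
      intro h1
      rcases h1.lt_or_gt with h1 | h1
      · have := hF.side_notMem (i := 0) (by omega) (t := t) ⟨ht.1, h1⟩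
        simpa using this
      · have := hF.side_notMem (i := 1) (by omega) (t := t - 1)
          ⟨by linarith, by linarith [show t < 2 by simpa using ht.2]⟩
        simpa using this
    rintro (h1 | h1)
    · grind
    · obtain ⟨e, he, hze⟩ := mem_iUnion₂.1 h1
      by_cases ht1 : t = 1
      · refine hfree e he ?_
        rw [ht1] at hze
        simpa [hv] using hze
      · exact hP ht1 (hF.mem_of_mem_inner he hze hb)
  obtain ⟨k, hk, hkK, hkc⟩ := hF.disc.exists_lens (l := (2 : ℕ) + r) (j := (2 : ℕ)) (m := (1 : ℕ))
    (by simp) (by simpa using hr') (by simp) hKc hKa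
  have hseg : segPath k 0 = k := by funext t; simp [segPath]
  have hkU : ∀ t ∈ Ioo (0 : ℝ) 1, k t ∈ h '' ball 0 1 := fun t ht => hk.interior t (by simpa using ht)
  have hkP : ∀ t ∈ Ioo (0 : ℝ) 1, k t ∉ P := fun t ht hP =>
    hkK t (by simpa using ht) (hKP _ hP (hkU t ht))
  have hkE : ∀ e ∈ E, ∀ t ∈ Ioo (0 : ℝ) 1, k t ∉ e := fun e he t ht hE =>
    hkK t (by simpa using ht) (hKe e he _ hE (hkU t ht))
  have hk0 : k 0 ∈ P := by
    rw [hk.source]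
    simpa using hF.root_mem (i := 0) (by omega)
  have hk1 : k 1 ∈ P := by
    have h1 := hk.target
    rw [Nat.cast_one] at h1
    rw [h1]
    simpa using hF.root_mem (i := 2) (by omega)
  obtain ⟨h₁, h₂, hs⟩ := hF.exists_isSplit two_pos hr one_pos hk fun s hs => by
    obtain rfl : s = 0 := by omega
    rw [hseg]
    exact isSide_of_avoid hk0 hk1 hkP hkE
  have hd := hkc h₁ h₂ hs.cut
  refine ⟨k, h₁, h₂, hs, ⟨?_, ?_⟩, by rw [hseg]; exact image_notMem_of_avoid hkE⟩
  · rw [eq_empty_iff_forall_notMem]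
    exact fun z hz => hd.le_bot ⟨hz.2, hKP z hz.1 (hs.cut.tiling.left_subset hz.2)⟩
  · rw [eq_empty_iff_forall_notMem]
    rintro e ⟨he, z, hze, hz⟩
    exact hd.le_bot ⟨hz, hKe e he z hze (hs.cut.tiling.left_subset hz)⟩

end FreeRoot

/-- The concatenation of a path `u` up to the parameter `a` and a path `v`. -/
noncomputable def joinPath (a : ℝ) (u v : ℝ → ℂ) : ℝ → ℂ := fun t => if t ≤ a then u t else v (t - a)

section JoinPath
variable {a b : ℝ} {u v : ℝ → ℂ}

lemma joinPath_of_le {t : ℝ} (ht : t ≤ a) : joinPath a u v t = u t := if_pos ht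

lemma joinPath_add (h : u a = v 0) {t : ℝ} (ht : 0 ≤ t) : joinPath a u v (a + t) = v t := by
  rcases ht.eq_or_lt with rfl | ht
  · rw [add_zero, joinPath_of_le le_rfl, h]
  · rw [joinPath, if_neg (by linarith), add_sub_cancel_left]

lemma joinPath_of_ge (h : u a = v 0) {t : ℝ} (ht : a ≤ t) : joinPath a u v t = v (t - a) := by
  have := joinPath_add h (sub_nonneg.2 ht)
  rwa [add_sub_cancel] at this

lemma continuousOn_joinPath (hb : 0 ≤ b) (ha : 0 ≤ a) (h : u a = v 0) (hu : ContinuousOn u (Icc 0 a))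
    (hv : ContinuousOn v (Icc 0 b)) : ContinuousOn (joinPath a u v) (Icc 0 (a + b)) := by
  have h1 : ContinuousOn (joinPath a u v) (Icc 0 a) := hu.congr fun t ht => joinPath_of_le ht.2
  have h2 : ContinuousOn (joinPath a u v) (Icc a (a + b)) := by
    refine ContinuousOn.congr (f := fun t => v (t - a)) (hv.comp (by fun_prop) fun t ht => ?_)
      fun t ht => joinPath_of_ge h ht.1
    exact ⟨by linarith [ht.1], by linarith [ht.2]⟩
  rw [← Icc_union_Icc_eq_Icc ha (by linarith : a ≤ a + b)]
  exact h1.union_of_isClosed h2 isClosed_Icc isClosed_Icc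

lemma injOn_joinPath (h : u a = v 0) (hu : InjOn u (Icc 0 a))
    (hv : InjOn v (Icc 0 b)) (hd : ∀ s ∈ Icc 0 a, ∀ t ∈ Ioc 0 b, u s ≠ v t) :
    InjOn (joinPath a u v) (Icc 0 (a + b)) := by
  have key : ∀ s ∈ Icc 0 (a + b), ∀ t ∈ Icc 0 (a + b), s ≤ t →
      joinPath a u v s = joinPath a u v t → s = t := by
    intro s hs t ht hst heq
    rcases le_or_gt t a with hta | hta
    · rw [joinPath_of_le hta, joinPath_of_le (hst.trans hta)] at heq
      exact hu ⟨hs.1, hst.trans hta⟩ ⟨ht.1, hta⟩ heq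
    · rw [joinPath_of_ge h hta.le] at heq
      rcases le_or_gt s a with hsa | hsa
      · rw [joinPath_of_le hsa] at heq
        exact (hd s ⟨hs.1, hsa⟩ _ ⟨by linarith, by linarith [ht.2]⟩ heq).elim
      · rw [joinPath_of_ge h hsa.le] at heq
        have := hv ⟨by linarith, by linarith [hs.2]⟩ ⟨by linarith, by linarith [ht.2]⟩ heq
        linarith
  intro s hs t ht heq
  rcases le_total s t with hst | hst
  · exact key s hs t ht hst heq
  · exact (key t ht s hs hst heq.symm).symm

end JoinPath

section Extension

/-- A path in the punctured plane ending at the origin has a continuous square root. -/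
lemma exists_sqrt_path {σ : ℝ → ℂ} (hσ : ContinuousOn σ (Icc 0 1)) (h0 : ∀ t ∈ Ico (0 : ℝ) 1, σ t ≠ 0)
    (h1 : σ 1 = 0) : ∃ w : ℝ → ℂ, ContinuousOn w (Icc 0 1) ∧ ∀ t ∈ Icc (0 : ℝ) 1, w t ^ 2 = σ t := by
  have hU : Convex ℝ {z : ℂ | z.re < 1} := convex_halfSpace_re_lt 1
  have hcl : ∀ z : ℂ, z.re < 1 → max 0 z.re ∈ Ico (0 : ℝ) 1 := fun z hz =>
    ⟨le_max_left _ _, max_lt one_pos hz⟩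
  obtain ⟨F, hF, hFe⟩ := hasLogOn_of_convex (g := fun z => σ (max 0 z.re)) hU ⟨0, by simp⟩
    (isOpen_lt Complex.continuous_re continuous_const)
    (hσ.comp (by fun_prop) fun z hz => Ico_subset_Icc_self (hcl z hz)) fun z hz => h0 _ (hcl z hz)
  have hsq : ∀ t ∈ Ico (0 : ℝ) 1, Complex.exp (F t / 2) ^ 2 = σ t := by
    intro t ht
    rw [← Complex.exp_nat_mul, show ((2 : ℕ) : ℂ) * (F t / 2) = F t by push_cast; ring, hFe t (by simpa using ht.2)]
    simp [ht.1]
  refine ⟨fun t => if t < 1 then Complex.exp (F t / 2) else 0, fun t ht => ?_, fun t ht => ?_⟩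
  · rcases ht.2.lt_or_eq with ht1 | rfl
    · have h2 : ContinuousAt F (t : ℂ) := hF.continuousAt
        ((isOpen_lt Complex.continuous_re continuous_const).mem_nhds (by simpa using ht1))
      have h3 : ContinuousAt (fun t : ℝ => Complex.exp (F t / 2)) t :=
        Complex.continuous_exp.continuousAt.comp
          ((h2.comp Complex.continuous_ofReal.continuousAt).div_const 2)
      refine (h3.congr ?_).continuousWithinAt
      filter_upwards [Iio_mem_nhds ht1] with s hs
      exact (if_pos hs).symm
    · have hn : ∀ s ∈ Icc (0 : ℝ) 1, ‖if s < 1 then Complex.exp (F s / 2) else 0‖ = √‖σ s‖ := by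
        intro s hs
        split_ifs with h2
        · rw [← hsq s ⟨hs.1, h2⟩, norm_pow, Real.sqrt_sq (norm_nonneg _)]
        · rw [hs.2.antisymm (not_lt.1 h2), h1]; simp
      rw [ContinuousWithinAt, if_neg (lt_irrefl _), tendsto_zero_iff_norm_tendsto_zero]
      have h4 : Tendsto (fun s => √‖σ s‖) (𝓝[Icc 0 1] 1) (𝓝 0) := by
        have := (hσ 1 ht).norm.sqrt
        rw [ContinuousWithinAt, h1] at this
        simpa using this
      refine h4.congr' ?_
      filter_upwards [self_mem_nhdsWithin] with s hs using (hn s hs).symm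
  · dsimp only
    split_ifs with h2
    · exact hsq t ⟨ht.1, h2⟩
    · rw [ht.2.antisymm (not_lt.1 h2), h1]; simp

lemma IsDisc.neg {h : ℂ → ℂ} (hh : IsDisc h) : IsDisc (fun z => - h z) := by
  refine ⟨hh.continuousOn.neg, fun z hz w hw hzw => hh.injOn hz hw (neg_injective hzw), ?_⟩
  have : (fun z => - h z) '' ball 0 1 = Neg.neg '' (h '' ball 0 1) := by rw [image_image]
  rw [this]
  exact (Homeomorph.neg ℂ).isOpenMap _ hh.isOpen

lemma isDisc_mul {c : ℂ} (hc : ‖c‖ = 1) : IsDisc (fun z => c * z) ∧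
    (fun z => c * z) '' ball 0 1 = ball 0 1 ∧ (fun z => c * z) '' sphere 0 1 = sphere 0 1 := by
  have hid : IsDisc (fun z => z) :=
    ⟨continuousOn_id, injOn_id _, by simp only [image_id']; exact isOpen_ball⟩
  obtain ⟨h1, h2, -, h4⟩ := hid.rotate hc
  rw [image_id'] at h2 h4
  exact ⟨h1, h2, h4⟩

lemma circlePt_two_one : circlePt 2 1 = -1 := by
  rw [circlePt, ← Complex.exp_pi_mul_I]
  congr 1
  push_cast
  ring

lemma circlePt_two_sq (t : ℝ) : circlePt 2 t ^ 2 = circlePt 1 t := by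
  rw [circlePt, circlePt, ← Complex.exp_nat_mul]
  congr 1
  push_cast
  ring

/-- An arc from the boundary of the unit disc to the centre extends to a crosscut with any given end. -/
lemma exists_extension_zero {σ : ℝ → ℂ} (hσ : ContinuousOn σ (Icc 0 1)) (hi : InjOn σ (Icc 0 1))
    (h0 : ‖σ 0‖ = 1) (hσb : ∀ t ∈ Ioc (0 : ℝ) 1, ‖σ t‖ < 1) (h1 : σ 1 = 0) {e : ℂ} (he : ‖e‖ = 1)
    (hne : e ≠ σ 0) : ∃ ρ : ℝ → ℂ, ContinuousOn ρ (Icc 0 1) ∧ InjOn ρ (Icc 0 1) ∧ ρ 0 = 0 ∧ ρ 1 = e ∧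
      (∀ t ∈ Ico (0 : ℝ) 1, ‖ρ t‖ < 1) ∧ ∀ s ∈ Icc (0 : ℝ) 1, ∀ t ∈ Ioc (0 : ℝ) 1, σ s ≠ ρ t := by
  have m1 : (1 : ℝ) ∈ Icc (0 : ℝ) 1 := by simp
  have m0 : (0 : ℝ) ∈ Icc (0 : ℝ) 1 := by simp
  obtain ⟨w, hw, hws⟩ := exists_sqrt_path hσ
    (fun t ht h' => ht.2.ne (hi (Ico_subset_Icc_self ht) m1 (h'.trans h1.symm))) h1
  have hwi : InjOn w (Icc 0 1) := fun s hs t ht hst => hi hs ht (by rw [← hws s hs, ← hws t ht, hst])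
  have hw1 : w 1 = 0 := by simpa [h1] using hws 1 m1
  have hwn : ∀ t ∈ Icc (0 : ℝ) 1, ‖w t‖ ^ 2 = ‖σ t‖ := fun t ht => by rw [← norm_pow, hws t ht]
  have hw0 : ‖w 0‖ = 1 := by
    have := hwn 0 m0
    rw [h0] at this
    exact (pow_eq_one_iff_of_nonneg (norm_nonneg _) two_ne_zero).1 this
  have hwb : ∀ t ∈ Ioc (0 : ℝ) 1, ‖w t‖ < 1 := fun t ht => by
    have := hσb t ht
    rw [← hwn t (Ioc_subset_Icc_self ht)] at this
    exact (sq_lt_one_iff₀ (norm_nonneg _)).1 this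
  obtain ⟨hd, hdb, hds⟩ := isDisc_mul hw0
  -- the double lift is a crosscut
  set v : ℝ → ℂ := fun t => - w (1 - t) with hv
  have hrev : ∀ t ∈ Icc (0 : ℝ) 1, 1 - t ∈ Icc (0 : ℝ) 1 := fun _ =>
      Set.Icc.one_sub_mem
  have hjoin : w 1 = v 0 := by simp [hv, hw1]
  set κ := joinPath 1 w v with hκ
  have hκ1 : ∀ t ≤ 1, κ t = w t := fun t ht => joinPath_of_le ht
  have hκ2 : ∀ t, 1 ≤ t → κ t = - w (2 - t) := fun t ht => by
    rw [hκ, joinPath_of_ge hjoin ht, hv]; dsimp only; congr 2; ring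
  have hpm : ∀ s ∈ Icc (0 : ℝ) 1, ∀ t ∈ Icc (0 : ℝ) 1, w s = - w t → s = 1 ∧ t = 1 := by
    intro s hs t ht hst
    obtain rfl : s = t := hi hs ht (by rw [← hws s hs, ← hws t ht, hst, neg_sq])
    have : w s = 0 := by linear_combination hst / 2
    have := hwi hs m1 (this.trans hw1.symm)
    exact ⟨this, this⟩
  have hk : IsCrosscut 2 1 2 (fun z => w 0 * z) κ := by
    refine ⟨?_, ?_, ?_, ?_, fun t ht => ?_⟩
    · rw [show (2 : ℝ) = 1 + 1 by norm_num]
      exact continuousOn_joinPath zero_le_one zero_le_one hjoin hw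
        (hw.comp (by fun_prop) hrev).neg
    · have := injOn_joinPath (a := 1) (b := 1) hjoin hwi
        (fun s hs t ht hst => by
          have := hwi (hrev s hs) (hrev t ht) (neg_injective hst); linarith)
        (fun s hs t ht hst => by
          have := (hpm s hs _ (hrev t (Ioc_subset_Icc_self ht)) hst).2; linarith [ht.1])
      rwa [show (1 : ℝ) + 1 = 2 by norm_num] at this
    · rw [hκ1 0 zero_le_one, circlePt_zero, mul_one]
    · rw [hκ2 2 one_le_two, circlePt_two_one]; simp
    · rw [hdb, mem_ball_zero_iff]
      rcases le_total t 1 with h | h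
      · rw [hκ1 t h]; exact hwb t ⟨ht.1, h⟩
      · rw [hκ2 t h, norm_neg]; exact hwb _ ⟨by linarith [ht.2], by linarith⟩
  obtain ⟨h₁, h₂, hc⟩ := exists_isCut hd one_pos one_lt_two two_pos hk
  have hκneg : ∀ t ∈ Icc (0 : ℝ) 2, - κ t = κ (2 - t) := by
    intro t ht
    rcases le_total t 1 with h | h
    · rw [hκ1 t h, hκ2 _ (by linarith)]; simp
    · rw [hκ2 t h, hκ1 _ (by linarith), neg_neg]
  have hU : Disjoint (h₁ '' ball 0 1) ((fun z => - h₁ z) '' ball 0 1) := by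
    refine hc.tiling.disjoint.mono_right ?_
    refine hc.right.ball_subset_of_frontier hc.left.neg.isOpen hc.left.neg.isBounded ?_
    rw [hc.left.neg.frontier_eq]
    refine subset_trans ?_ (IsDisc.sphere_subset h₂)
    rw [hc.right_boundary one_lt_two two_pos]
    rintro _ ⟨z, hz, rfl⟩
    have hz' : h₁ z ∈ h₁ '' sphere 0 1 := ⟨z, hz, rfl⟩
    rw [hc.left_boundary one_pos two_pos] at hz'
    rcases hz' with ⟨t, ht, hzt⟩ | ⟨t, ht, hzt⟩
    · refine Or.inl ⟨1 + t, ⟨by linarith [ht.1], by linarith [ht.2]⟩, ?_⟩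
      dsimp only at hzt ⊢
      rw [← hzt, circlePt_add, circlePt_two_one]; ring
    · exact Or.inr ⟨2 - t, ⟨by linarith [ht.2], by linarith [ht.1]⟩, by rw [← hκneg t ht, hzt]⟩
  have hκU : ∀ t ∈ Icc (0 : ℝ) 2, κ t ∉ h₁ '' ball 0 1 := fun t ht hmem =>
    hc.left.disjoint.le_bot ⟨hmem, by rw [hc.left_boundary one_pos two_pos]; exact Or.inr ⟨t, ht, rfl⟩⟩
  have hwU : ∀ t ∈ Icc (0 : ℝ) 1, w t ∉ h₁ '' ball 0 1 := fun t ht => by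
    rw [← hκ1 t ht.2]; exact hκU t ⟨ht.1, by linarith [ht.2]⟩
  have hwU' : ∀ t ∈ Icc (0 : ℝ) 1, - w t ∉ h₁ '' ball 0 1 := fun t ht => by
    have := hκU (2 - t) ⟨by linarith [ht.2], by linarith [ht.1]⟩
    rwa [hκ2 _ (by linarith [ht.2]), sub_sub_cancel] at this
  have hUb : ∀ z ∈ h₁ '' ball 0 1, ‖z‖ < 1 := fun z hz => by
    have := hc.tiling.left_subset hz
    rwa [hdb, mem_ball_zero_iff] at this
  -- the end of the extension on the half circle
  obtain ⟨τ, hτ, hτe⟩ := exists_circlePt one_pos 0 (z := e / σ 0) (by simp [he, h0])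
  have hσ0 : σ 0 ≠ 0 := fun h => by simp [h] at h0
  have hτ0 : τ ≠ 0 := fun h => hne (by
    rw [h, circlePt_zero, eq_comm, div_eq_one_iff_eq hσ0] at hτe; exact hτe)
  have hτ' : τ ∈ Ioo (0 : ℝ) 1 := ⟨hτ.1.lt_of_ne' hτ0, by simpa using hτ.2⟩
  set p : ℂ := circlePt 3 2 with hp
  set q : ℂ := circlePt 3 τ with hq
  have hhp : h₁ p = 0 := by
    have := hc.left_cut 1 (by simp)
    rw [hκ1 1 le_rfl, hw1] at this
    rw [← this, hp]; norm_num
  have hhq : h₁ q = w 0 * circlePt 2 τ := by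
    have := hc.left_arc τ ⟨hτ'.1.le, hτ'.2.le⟩
    rw [← this, hq]; norm_num
  have hpq : p ≠ q := fun h => by
    have h2 := congrArg norm (hhp.symm.trans (h ▸ hhq))
    rw [norm_mul, norm_circlePt, hw0] at h2
    simp at h2
  set c : ℝ → ℂ := fun t => (1 - t : ℝ) • p + t • q with hc'
  have hcc : Continuous c := by simp only [hc']; fun_prop
  have hci : Function.Injective c := by
    intro s t hst
    have h2 : ((s - t : ℝ) : ℂ) * (q - p) = 0 := by
      simp only [hc', Complex.real_smul] at hst
      push_cast at hst ⊢
      linear_combination hst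
    rcases mul_eq_zero.1 h2 with h3 | h3
    · have : s - t = 0 := by exact_mod_cast h3
      linarith
    · exact (hpq (sub_eq_zero.1 h3).symm).elim
  have hcb : ∀ t ∈ Ioo (0 : ℝ) 1, c t ∈ ball (0 : ℂ) 1 := by
    intro t ht
    have := (strictConvex_closedBall ℝ (0 : ℂ) 1) (circlePt_mem_closedBall 3 2)
      (circlePt_mem_closedBall 3 τ) hpq (by linarith [ht.2] : 0 < 1 - t) ht.1 (by ring)
    rwa [interior_closedBall _ one_ne_zero] at this
  have hc0 : c 0 = p := by simp [hc']
  have hc1 : c 1 = q := by simp [hc']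
  have hcD : ∀ t ∈ Icc (0 : ℝ) 1, c t ∈ closedBall (0 : ℂ) 1 := by
    intro t ht
    rcases ht.1.eq_or_lt with rfl | h2
    · rw [hc0]; exact circlePt_mem_closedBall _ _
    rcases ht.2.eq_or_lt with rfl | h3
    · rw [hc1]; exact circlePt_mem_closedBall _ _
    exact ball_subset_closedBall (hcb t ⟨h2, h3⟩)
  have hlt : ∀ t ∈ Ico (0 : ℝ) 1, ‖h₁ (c t)‖ < 1 := by
    intro t ht
    rcases ht.1.eq_or_lt with rfl | h2
    · rw [hc0, hhp]; simp
    · exact hUb _ ⟨_, hcb t ⟨h2, ht.2⟩, rfl⟩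
  have hn1 : ‖h₁ (c 1)‖ = 1 := by rw [hc1, hhq, norm_mul, norm_circlePt, hw0, mul_one]
  have hends : ∀ t ∈ Icc (0 : ℝ) 1, t = 0 ∨ t = 1 ∨ t ∈ Ioo (0 : ℝ) 1 := fun t ht => by
    rcases ht.1.eq_or_lt with h2 | h2
    · exact Or.inl h2.symm
    rcases ht.2.eq_or_lt with h3 | h3
    · exact Or.inr (Or.inl h3)
    · exact Or.inr (Or.inr ⟨h2, h3⟩)
  refine ⟨fun t => h₁ (c t) ^ 2, ?_, ?_, ?_, ?_, ?_, ?_⟩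
  · exact (hc.left.continuousOn.comp hcc.continuousOn hcD).pow 2
  · intro s hs t ht hst
    rcases sq_eq_sq_iff_eq_or_eq_neg.1 hst with h2 | h2
    · exact hci (hc.left.injOn (hcD s hs) (hcD t ht) h2)
    have hz : ∀ t ∈ Icc (0 : ℝ) 1, h₁ (c t) = 0 → t = 0 := fun t ht h3 =>
      hci (hc.left.injOn (hcD t ht) (hcD 0 m0) (by rw [h3, hc0, hhp]))
    have hnn : ‖h₁ (c s)‖ = ‖h₁ (c t)‖ := by rw [h2, norm_neg]
    rcases hends s hs with rfl | rfl | hs'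
    · rw [hc0, hhp, eq_comm, neg_eq_zero] at h2
      exact (hz t ht h2).symm
    · rcases ht.2.eq_or_lt with h3 | h3
      · exact h3.symm
      · rw [hn1] at hnn
        exact ((hlt t ⟨ht.1, h3⟩).ne hnn.symm).elim
    · rcases hends t ht with rfl | rfl | ht'
      · rw [hc0, hhp, neg_zero] at h2
        exact hz s hs h2
      · rw [hn1] at hnn
        exact ((hlt s ⟨hs.1, hs'.2⟩).ne hnn).elim
      · exact (hU.le_bot ⟨⟨_, hcb s hs', rfl⟩, ⟨_, hcb t ht', h2.symm⟩⟩).elim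
  · simp [hc0, hhp]
  · dsimp only
    rw [hc1, hhq, mul_pow, circlePt_two_sq, hτe, hws 0 m0, mul_div_cancel₀ _ hσ0]
  · intro t ht
    rw [norm_pow]
    exact pow_lt_one₀ (norm_nonneg _) (hlt t ht) two_ne_zero
  · intro s hs t ht hst
    rcases ht.2.eq_or_lt with rfl | h3
    · dsimp only at hst
      rw [hc1, hhq, mul_pow, circlePt_two_sq, hτe, hws 0 m0, mul_div_cancel₀ _ hσ0] at hst
      rcases hs.1.eq_or_lt with rfl | h4
      · exact hne hst.symm
      · exact (hσb s ⟨h4, hs.2⟩).ne (hst ▸ he)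
    · have hmem : h₁ (c t) ∈ h₁ '' ball 0 1 := ⟨_, hcb t ⟨ht.1, h3⟩, rfl⟩
      rw [← hws s hs] at hst
      rcases sq_eq_sq_iff_eq_or_eq_neg.1 hst with h2 | h2
      · exact hwU s hs (h2 ▸ hmem)
      · exact hwU' s hs (by rw [h2, neg_neg]; exact hmem)

/-- An arc from the boundary of the unit disc to an inner point extends to a crosscut with any
given end. -/
lemma exists_extension {σ : ℝ → ℂ} (hσ : ContinuousOn σ (Icc 0 1)) (hi : InjOn σ (Icc 0 1))
    (h0 : ‖σ 0‖ = 1) (hσb : ∀ t ∈ Ioc (0 : ℝ) 1, ‖σ t‖ < 1) {e : ℂ} (he : ‖e‖ = 1)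
    (hne : e ≠ σ 0) : ∃ ρ : ℝ → ℂ, ContinuousOn ρ (Icc 0 1) ∧ InjOn ρ (Icc 0 1) ∧ ρ 0 = σ 1 ∧ ρ 1 = e ∧
      (∀ t ∈ Ico (0 : ℝ) 1, ‖ρ t‖ < 1) ∧ ∀ s ∈ Icc (0 : ℝ) 1, ∀ t ∈ Ioc (0 : ℝ) 1, σ s ≠ ρ t := by
  set x := σ 1 with hx
  have hxb : ‖x‖ < 1 := hσb 1 (by simp)
  have hxb' : ‖-x‖ < 1 := by rwa [norm_neg]
  have hσD : ∀ t ∈ Icc (0 : ℝ) 1, ‖σ t‖ ≤ 1 := fun t ht => by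
    rcases ht.1.eq_or_lt with rfl | h
    · exact h0.le
    · exact (hσb t ⟨h, ht.2⟩).le
  have hcont : ∀ w : ℂ, ‖w‖ < 1 → ContinuousOn (discMap w) (closedBall 0 1) := fun w hw z hz =>
    (hasDerivAt_discMap hw (mem_closedBall_zero_iff.1 hz)).continuousAt.continuousWithinAt
  have hinv : ∀ z : ℂ, ‖z‖ ≤ 1 → discMap x (discMap (-x) z) = z := fun z hz => by
    simpa using discMap_neg_discMap hxb' hz
  obtain ⟨ρ, hρ, hρi, hρ0, hρ1, hρb, hρd⟩ := exists_extension_zero (σ := fun t => discMap x (σ t))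
    (e := discMap x e) ((hcont x hxb).comp hσ fun t ht => mem_closedBall_zero_iff.2 (hσD t ht))
    (fun s hs t ht hst => hi hs ht (injOn_discMap hxb (mem_closedBall_zero_iff.2 (hσD s hs))
      (mem_closedBall_zero_iff.2 (hσD t ht)) hst))
    (norm_discMap_eq hxb h0) (fun t ht => norm_discMap_lt hxb (hσb t ht)) (by simp [discMap, hx])
    (norm_discMap_eq hxb he) (fun h => hne (injOn_discMap hxb (mem_closedBall_zero_iff.2 he.le)
      (mem_closedBall_zero_iff.2 h0.le) h))
  have hρD : ∀ t ∈ Icc (0 : ℝ) 1, ‖ρ t‖ ≤ 1 := fun t ht => by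
    rcases ht.2.eq_or_lt with rfl | h
    · rw [hρ1]; exact (norm_discMap_eq hxb he).le
    · exact (hρb t ⟨ht.1, h⟩).le
  refine ⟨fun t => discMap (-x) (ρ t), ?_, ?_, ?_, ?_, ?_, ?_⟩
  · exact (hcont _ hxb').comp hρ fun t ht => mem_closedBall_zero_iff.2 (hρD t ht)
  · exact fun s hs t ht hst => hρi hs ht (injOn_discMap hxb' (mem_closedBall_zero_iff.2 (hρD s hs))
      (mem_closedBall_zero_iff.2 (hρD t ht)) hst)
  · simp [discMap, hρ0]
  · dsimp only
    rw [hρ1]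
    exact discMap_neg_discMap hxb he.le
  · exact fun t ht => norm_discMap_lt hxb' (hρb t ht)
  · intro s hs t ht hst
    exact hρd s hs t ht (by rw [hst]; exact hinv _ (hρD t (Ioc_subset_Icc_self ht)))

/-- An arc from the boundary of a disc to an inner point extends to a crosscut with any given
end. -/
theorem IsDisc.exists_crosscut {h : ℂ → ℂ} (hh : IsDisc h) {l s : ℝ} (hs : s ∈ Ioo 0 l) {σ : ℝ → ℂ}
    (hσ : ContinuousOn σ (Icc 0 1)) (hi : InjOn σ (Icc 0 1)) (h0 : σ 0 = h (circlePt l 0))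
    (hσU : ∀ t ∈ Ioc (0 : ℝ) 1, σ t ∈ h '' ball 0 1) :
    ∃ k, IsCrosscut l s 2 h k ∧ ∀ t ≤ 1, k t = σ t := by
  have hl : 0 < l := hs.1.trans hs.2
  set g := Function.invFunOn h (closedBall 0 1) with hg
  have hgh : ∀ z ∈ closedBall (0 : ℂ) 1, g (h z) = z := fun z hz => hh.injOn.leftInvOn_invFunOn hz
  have hσD : ∀ t ∈ Icc (0 : ℝ) 1, σ t ∈ h '' closedBall 0 1 := fun t ht => by
    rcases ht.1.eq_or_lt with rfl | h1
    · rw [h0]; exact ⟨_, circlePt_mem_closedBall _ _, rfl⟩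
    · exact IsDisc.ball_subset h (hσU t ⟨h1, ht.2⟩)
  have hhg : ∀ z ∈ h '' closedBall 0 1, h (g z) = z := fun z hz => Function.invFunOn_eq hz
  have hg0 : g (σ 0) = 1 := by rw [h0, hgh _ (circlePt_mem_closedBall _ _), circlePt_zero]
  obtain ⟨ρ, hρ, hρi, hρ0, hρ1, hρb, hρd⟩ := exists_extension (σ := fun t => g (σ t))
    (e := circlePt l s) (hh.continuousOn_inv.comp hσ hσD)
    (fun s hs t ht hst => hi hs ht (by rw [← hhg _ (hσD s hs), ← hhg _ (hσD t ht)]; exact congrArg h hst))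
    (by simp [hg0]) (fun t ht => by
      obtain ⟨z, hz, hzt⟩ := hσU t ht
      rw [← hzt, hgh z (ball_subset_closedBall hz)]
      exact mem_ball_zero_iff.1 hz) (norm_circlePt _ _)
    (fun h1 => by
      rw [hg0, ← circlePt_zero l] at h1
      have := circlePt_injOn hl 0 (mem_Ico.2 ⟨hs.1.le, by linarith [hs.2]⟩)
        (mem_Ico.2 ⟨le_rfl, by linarith⟩) h1
      exact hs.1.ne' this)
  have hρD : ∀ t ∈ Icc (0 : ℝ) 1, ρ t ∈ closedBall (0 : ℂ) 1 := fun t ht => by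
    rw [mem_closedBall_zero_iff]
    rcases ht.2.eq_or_lt with rfl | h1
    · rw [hρ1, norm_circlePt]
    · exact (hρb t ⟨ht.1, h1⟩).le
  have hjoin : σ 1 = h (ρ 0) := by rw [hρ0, hhg _ (hσD 1 (by simp))]
  refine ⟨joinPath 1 σ (fun t => h (ρ t)), ⟨?_, ?_, ?_, ?_, fun t ht => ?_⟩, fun t ht =>
    joinPath_of_le ht⟩
  · rw [show (2 : ℝ) = 1 + 1 by norm_num]
    exact continuousOn_joinPath zero_le_one zero_le_one hjoin hσ (hh.continuousOn.comp hρ hρD)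
  · have := injOn_joinPath (a := 1) (b := 1) (v := fun t => h (ρ t)) hjoin hi
      (fun s hs t ht hst => hρi hs ht (hh.injOn (hρD s hs) (hρD t ht) hst))
      (fun s hs t ht hst => hρd s hs t ht (by
        rw [hst]; exact hgh _ (hρD t (Ioc_subset_Icc_self ht))))
    rwa [show (1 : ℝ) + 1 = 2 by norm_num] at this
  · rw [joinPath_of_le zero_le_one, h0]
  · rw [joinPath_of_ge hjoin one_le_two, show (2 : ℝ) - 1 = 1 by norm_num, hρ1]
  · rcases le_total t 1 with h1 | h1
    · rw [joinPath_of_le h1]; exact hσU t ⟨ht.1, h1⟩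
    · rw [joinPath_of_ge hjoin h1]
      exact ⟨_, mem_ball_zero_iff.2 (hρb _ ⟨by linarith, by linarith [ht.2]⟩), rfl⟩

end Extension

/-- The chord of the unit circle between the parameters `s` and `-s`. -/
noncomputable def chord (l s y : ℝ) : ℂ := (1 - y : ℝ) • circlePt l s + y • circlePt l (-s)

section Chord
variable {l s : ℝ}

lemma continuous_chord (l s : ℝ) : Continuous (chord l s) := by unfold chord; fun_prop

lemma chord_zero (l s : ℝ) : chord l s 0 = circlePt l s := by simp [chord]

lemma chord_one (l s : ℝ) : chord l s 1 = circlePt l (-s) := by simp [chord]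

lemma circlePt_ne_neg (hs : 0 < s) (hsl : 2 * s < l) : circlePt l s ≠ circlePt l (-s) := fun h => by
  have := circlePt_injOn (by linarith) (-s) (mem_Ico.2 ⟨by linarith, by linarith⟩)
    (mem_Ico.2 ⟨le_rfl, by linarith⟩) h
  linarith

lemma chord_injective (hs : 0 < s) (hsl : 2 * s < l) : Function.Injective (chord l s) := by
  intro y y' hyy
  have h2 : ((y - y' : ℝ) : ℂ) * (circlePt l (-s) - circlePt l s) = 0 := by
    simp only [chord, Complex.real_smul] at hyy
    push_cast at hyy ⊢
    linear_combination hyy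
  rcases mul_eq_zero.1 h2 with h3 | h3
  · have : y - y' = 0 := by exact_mod_cast h3
    linarith
  · exact (circlePt_ne_neg hs hsl (sub_eq_zero.1 h3).symm).elim

lemma chord_mem_closedBall (l s : ℝ) {y : ℝ} (hy : y ∈ Icc (0 : ℝ) 1) :
    chord l s y ∈ closedBall (0 : ℂ) 1 :=
  convex_closedBall 0 1 (circlePt_mem_closedBall l s) (circlePt_mem_closedBall l (-s))
    (by linarith [hy.2]) hy.1 (by ring)

lemma chord_mem_ball (hs : 0 < s) (hsl : 2 * s < l) {y : ℝ} (hy : y ∈ Ioo (0 : ℝ) 1) :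
    chord l s y ∈ ball (0 : ℂ) 1 := by
  have := (strictConvex_closedBall ℝ (0 : ℂ) 1) (circlePt_mem_closedBall l s)
    (circlePt_mem_closedBall l (-s)) (circlePt_ne_neg hs hsl) (by linarith [hy.2] : 0 < 1 - y) hy.1
    (by ring)
  rwa [interior_closedBall _ one_ne_zero] at this

lemma eventually_chord_mem (l : ℝ) {V : Set ℂ} (hV : V ∈ 𝓝 1) :
    ∀ᶠ s in 𝓝[>] (0 : ℝ), ∀ y ∈ Icc (0 : ℝ) 1, chord l s y ∈ V := by
  obtain ⟨δ, hδ, hδV⟩ := Metric.mem_nhds_iff.1 hV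
  have h1 : Tendsto (circlePt l) (𝓝 0) (𝓝 1) := by
    have := (_root_.continuous_circlePt l).tendsto 0
    rwa [circlePt_zero] at this
  have h2 : Tendsto (fun s => circlePt l (-s)) (𝓝 0) (𝓝 1) :=
    h1.comp (by simpa using (continuous_neg (G := ℝ)).tendsto 0)
  have h3 := (h1.eventually (ball_mem_nhds _ hδ)).and (h2.eventually (ball_mem_nhds _ hδ))
  filter_upwards [nhdsWithin_le_nhds h3] with s hs y hy
  exact hδV (convex_ball 1 δ hs.1 hs.2 (by linarith [hy.2]) hy.1 (by ring))

/-- A disc maps short chords into neighbourhoods of its root. -/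
lemma IsDisc.eventually_chord_mem {h : ℂ → ℂ} (hh : IsDisc h) (l : ℝ) {V : Set ℂ}
    (hV : V ∈ 𝓝 (h 1)) : ∀ᶠ s in 𝓝[>] (0 : ℝ), ∀ y ∈ Icc (0 : ℝ) 1, h (chord l s y) ∈ V := by
  have h1 : h ⁻¹' V ∈ 𝓝[closedBall 0 1] 1 := hh.continuousOn 1 (by simp) hV
  obtain ⟨W, hW, hWV⟩ := mem_nhdsWithin_iff_exists_mem_nhds_inter.1 h1
  filter_upwards [_root_.eventually_chord_mem l hW] with s hs y hy
  exact hWV ⟨hs y hy, chord_mem_closedBall l s hy⟩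

lemma exists_chord_eq (hs : 0 < s) (hsl : 2 * s < l) {z : ℂ} (hz : ‖z‖ ≤ 1)
    (hre : z.re = (circlePt l s).re) : ∃ y ∈ Icc (0 : ℝ) 1, chord l s y = z := by
  have hl : 0 < l := by linarith
  have hc : circlePt l (-s) = (starRingEnd ℂ) (circlePt l s) := by
    rw [circlePt, circlePt, ← Complex.exp_conj]
    congr 1
    simp [neg_div, map_ofNat]
  set c := circlePt l s with hcs
  have hn : c.re ^ 2 + c.im ^ 2 = 1 := by
    have := norm_circlePt l s
    rw [← hcs, ← sq_eq_sq₀ (norm_nonneg _) zero_le_one, ← Complex.normSq_eq_norm_sq,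
      Complex.normSq_apply] at this
    linarith
  have hzn : z.re ^ 2 + z.im ^ 2 ≤ 1 := by
    rw [← sq_le_sq₀ (norm_nonneg _) zero_le_one, ← Complex.normSq_eq_norm_sq,
      Complex.normSq_apply] at hz
    linarith
  have hpos : 0 < c.im := by
    rw [hcs, circlePt, Complex.exp_ofReal_mul_I_im]
    apply Real.sin_pos_of_pos_of_lt_pi
    · have := Real.pi_pos
      positivity
    · have := Real.pi_pos
      rw [div_mul_eq_mul_div, div_lt_iff₀ hl]
      nlinarith
  have habs : |z.im| ≤ c.im := by
    rw [← abs_of_pos hpos, ← sq_le_sq]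
    rw [hre] at hzn
    linarith
  obtain ⟨h1, h2⟩ := abs_le.1 habs
  refine ⟨(1 - z.im / c.im) / 2, ⟨?_, ?_⟩, ?_⟩
  · have : z.im / c.im ≤ 1 := (div_le_one hpos).2 h2
    linarith
  · have : -1 ≤ z.im / c.im := by rw [le_div_iff₀ hpos]; linarith
    linarith
  · rw [chord, hc]
    apply Complex.ext
    · simp only [Complex.add_re, Complex.smul_re, Complex.conj_re, smul_eq_mul, ← hcs]
      rw [hre]; ring
    · simp only [Complex.add_im, Complex.smul_im, Complex.conj_im, smul_eq_mul, ← hcs]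
      field_simp
      ring

end Chord

section Corner
variable {l j m : ℝ} {h h₁ h₂ : ℂ → ℂ} {k : ℝ → ℂ}

/-- The boundary of the left piece of a cut disc does not meet the right piece. -/
lemma IsCut.arc_notMem_right (hc : IsCut l j m h k h₁ h₂) (hh : IsDisc h)
    (hk : IsCrosscut l j m h k) (hjl : j < l) (hm : 0 < m) {s : ℝ} (hs : s ∈ Ioo 0 j) :
    h (circlePt l s) ∉ h₂ '' closedBall 0 1 := by
  have hl : 0 < l := hs.1.trans (hs.2.trans hjl)
  have hb : h (circlePt l s) ∈ h '' sphere 0 1 := ⟨_, circlePt_mem_sphere _ _, rfl⟩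
  have hne : ∀ t ∈ Icc j l, h (circlePt l t) ≠ h (circlePt l s) := fun t ht heq => by
    have := hh.injOn_circlePt (a := s) (b := l) hl (by linarith [hs.1])
      ⟨hs.2.le.trans ht.1, ht.2⟩ ⟨le_rfl, by linarith [hs.2]⟩ heq
    linarith [ht.1, hs.2]
  rw [IsDisc.image_closedBall, hc.right_boundary hjl hm]
  rintro (h1 | ⟨t, ht, h1⟩ | ⟨t, ht, h1⟩)
  · exact hh.disjoint.le_bot ⟨hc.tiling.right_subset h1, hb⟩
  · exact hne t ht h1
  · rcases hk.eq_end_of_mem_boundary hh ht (h1 ▸ hb) with rfl | rfl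
    · exact hne l ⟨hjl.le, le_rfl⟩ (by rw [circlePt_self hl, ← circlePt_zero l, ← hk.source, h1])
    · exact hne j ⟨le_rfl, hjl.le⟩ (hk.target ▸ h1)

lemma IsDisc.subset_closedBall_of_boundary {d : ℂ → ℂ} (hd : IsDisc d) {a : ℂ} {ε : ℝ} (hε : 0 < ε)
    (hb : d '' sphere 0 1 ⊆ closedBall a ε) : d '' ball 0 1 ⊆ closedBall a ε := by
  have hεc : (ε : ℂ) ≠ 0 := by exact_mod_cast hε.ne'
  let φ : ℂ ≃ₜ ℂ := (Homeomorph.mulLeft₀ (ε : ℂ) hεc).trans (Homeomorph.addLeft a)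
  have hφ : ∀ z, φ z = a + ε * z := fun z => rfl
  have hD : IsDisc φ := ⟨φ.continuous.continuousOn, φ.injective.injOn, φ.isOpenMap _ isOpen_ball⟩
  have himg : φ '' closedBall 0 1 = closedBall a ε := by
    ext w
    constructor
    · rintro ⟨z, hz, rfl⟩
      rw [mem_closedBall_zero_iff] at hz
      rw [hφ, mem_closedBall_iff_norm, add_sub_cancel_left, norm_mul, Complex.norm_real,
        Real.norm_of_nonneg hε.le]
      nlinarith
    · intro hw
      refine ⟨(w - a) / ε, ?_, ?_⟩
      · rw [mem_closedBall_zero_iff, norm_div, Complex.norm_real, Real.norm_of_nonneg hε.le,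
          div_le_one hε]
        exact mem_closedBall_iff_norm.1 hw
      · rw [hφ, mul_div_cancel₀ _ hεc, add_sub_cancel]
  rw [← himg] at hb ⊢
  exact (hD.ball_subset_of_frontier hd.isOpen hd.isBounded (hd.frontier_eq ▸ hb)).trans
    (IsDisc.ball_subset φ)

/-- If a crosscut is the first among several arcs to be met by arbitrarily short chords, then no
other of these arcs starts to its left. -/
lemma IsCut.notMem_of_frequently (hc : IsCut l j m h k h₁ h₂) (hh : IsDisc h)
    (hk : IsCrosscut l j m h k) (hj : 0 < j) (hjl : j < l) (hm : 0 < m) {f : ℝ → ℂ}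
    (hf : ContinuousOn f (Icc 0 1)) (hf0 : f 0 = h 1)
    (hfirst : ∃ᶠ s in 𝓝[>] (0 : ℝ), ∃ y ∈ Ioo (0 : ℝ) 1, h (chord l s y) ∈ k '' Icc 0 m ∧
      ∀ y' ∈ Ioo 0 y, h (chord l s y') ∉ k '' Icc 0 m ∧ h (chord l s y') ∉ f '' Icc 0 1)
    (hfU : ∀ t ∈ Ioc (0 : ℝ) 1, f t ∈ h₁ '' ball 0 1) : False := by
  have hl : 0 < l := hj.trans hjl
  have hab : h 1 ∈ h '' sphere 0 1 := ⟨1, by simp, rfl⟩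
  have hf1 : f 1 ≠ h 1 := fun h1 =>
    hh.disjoint.le_bot ⟨hc.tiling.left_subset (hfU 1 (by simp)), h1 ▸ hab⟩
  set ε := dist (f 1) (h 1) / 2 with hε
  have hε0 : 0 < ε := half_pos (dist_pos.2 hf1)
  have hB : closedBall (h 1) ε ∈ 𝓝 (h 1) := closedBall_mem_nhds _ hε0
  have hk0 : k 0 = h 1 := by rw [hk.source, circlePt_zero]
  -- the beginning of the crosscut is close to the root
  obtain ⟨δ, hδ, hδB⟩ : ∃ δ > 0, ∀ t ∈ Icc 0 m, t < δ → k t ∈ closedBall (h 1) ε := by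
    have : k ⁻¹' closedBall (h 1) ε ∈ 𝓝[Icc 0 m] 0 :=
      hk.continuousOn 0 ⟨le_rfl, hm.le⟩ (by rw [hk0]; exact hB)
    obtain ⟨δ, hδ, hδB⟩ := Metric.mem_nhdsWithin_iff.1 this
    refine ⟨δ, hδ, fun t ht htδ => hδB ⟨?_, ht⟩⟩
    rw [mem_ball_zero_iff, Real.norm_of_nonneg ht.1]
    exact htδ
  have hfar : (k '' Icc δ m)ᶜ ∈ 𝓝 (h 1) := by
    refine (IsCompact.isClosed (isCompact_Icc.image_of_continuousOn
      (hk.continuousOn.mono (Icc_subset_Icc_left hδ.le)))).isOpen_compl.mem_nhds ?_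
    rintro ⟨t, ht, hkt⟩
    have := hk.injOn ⟨hδ.le.trans ht.1, ht.2⟩ ⟨le_rfl, hm.le⟩ (hkt.trans hk0.symm)
    linarith [ht.1]
  have harc : ∀ᶠ s in 𝓝[>] (0 : ℝ), ∀ t ∈ Icc 0 s, h (circlePt l t) ∈ closedBall (h 1) ε := by
    have h1 := (hh.continuous_circlePt l).tendsto 0
    simp only [circlePt_zero] at h1
    obtain ⟨η, hη, hηB⟩ := Metric.mem_nhds_iff.1 (h1 hB)
    filter_upwards [Ioo_mem_nhdsGT hη] with s hs t ht
    refine hηB ?_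
    rw [mem_ball_zero_iff, Real.norm_of_nonneg ht.1]
    exact ht.2.trans_lt hs.2
  obtain ⟨s, ⟨y, hy, hyk, hyf⟩, hch, hchk, harc, hs, hsj⟩ := (hfirst.and_eventually
    ((hh.eventually_chord_mem l hB).and ((hh.eventually_chord_mem l hfar).and (harc.and
      (Ioo_mem_nhdsGT (lt_min hj (half_pos hl))))))).exists
  have hsl : 2 * s < l := by linarith [hsj.trans_le (min_le_right _ _)]
  replace hsj : s < j := hsj.trans_le (min_le_left _ _)
  obtain ⟨t₀, ht₀, hkt⟩ := hyk
  have hyU := chord_mem_ball hs hsl hy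
  have ht₀U : k t₀ ∈ h '' ball 0 1 := hkt ▸ ⟨_, hyU, rfl⟩
  have ht₀' : t₀ ∈ Ioo 0 m := by
    refine ⟨ht₀.1.lt_of_ne' ?_, ht₀.2.lt_of_ne ?_⟩ <;> rintro rfl
    · rw [hk.source] at ht₀U
      exact hh.disjoint.le_bot ⟨ht₀U, ⟨_, circlePt_mem_sphere _ _, rfl⟩⟩
    · rw [hk.target] at ht₀U
      exact hh.disjoint.le_bot ⟨ht₀U, ⟨_, circlePt_mem_sphere _ _, rfl⟩⟩
  have ht₀δ : t₀ < δ := by grind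
  -- the beginning of the chord is a crosscut of the left piece
  have hyI : ∀ τ ∈ Icc (0 : ℝ) 1, τ * y ∈ Icc (0 : ℝ) 1 := fun τ hτ =>
    ⟨mul_nonneg hτ.1 hy.1.le, by nlinarith [hτ.1, hτ.2, hy.1, hy.2]⟩
  have hyI' : ∀ τ ∈ Ioo (0 : ℝ) 1, τ * y ∈ Ioo (0 : ℝ) y := fun τ hτ =>
    ⟨mul_pos hτ.1 hy.1, by nlinarith [hτ.2, hy.1]⟩
  set γ : ℝ → ℂ := fun τ => h (chord l s (τ * y)) with hγ
  have hγc : ContinuousOn γ (Icc 0 1) :=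
    hh.continuousOn.comp ((continuous_chord l s).comp (by fun_prop)).continuousOn
      fun τ hτ => chord_mem_closedBall l s (hyI τ hτ)
  have hγi : InjOn γ (Icc 0 1) := fun τ hτ τ' hτ' heq => by
    have := chord_injective hs hsl (hh.injOn (chord_mem_closedBall l s (hyI τ hτ))
      (chord_mem_closedBall l s (hyI τ' hτ')) heq)
    exact mul_right_cancel₀ hy.1.ne' this
  have hγ0 : γ 0 = h (circlePt l s) := by simp [hγ, chord_zero]
  have hγ1 : γ 1 = k t₀ := by simp [hγ, hkt]
  have hγU : γ '' Ioo 0 1 ⊆ h '' ball 0 1 := by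
    rintro _ ⟨τ, hτ, rfl⟩
    exact ⟨_, chord_mem_ball hs hsl ⟨(hyI' τ hτ).1, (hyI' τ hτ).2.trans hy.2⟩, rfl⟩
  have hcl : ∀ {u : ℝ → ℂ}, ContinuousOn u (Icc 0 1) → u 0 ∈ closure (u '' Ioo 0 1) := fun hu => by
    rw [← closure_Ioo zero_ne_one] at hu
    refine hu.image_closure ⟨0, ?_, rfl⟩
    rw [closure_Ioo zero_ne_one]
    simp
  have hγL : γ '' Ioo 0 1 ⊆ h₁ '' ball 0 1 := by
    refine (hc.subset_or_subset hh hk hj hjl hm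
      (isPreconnected_Ioo.image _ (hγc.mono Ioo_subset_Icc_self)) hγU ?_).resolve_right ?_
    · grind
    · intro hsub
      refine hc.arc_notMem_right hh hk hjl hm ⟨hs, hsj⟩ ?_
      rw [← hγ0, ← hc.right.closure_eq]
      exact closure_mono hsub (hcl hγc)
  set L := j + m with hL
  have hL0 : 0 < L := by positivity
  obtain ⟨hH, hHb, -, -⟩ := hc.left.rotate (norm_circlePt L (-t₀))
  set H : ℂ → ℂ := fun z => h₁ (circlePt L (-t₀) * z) with hHdef
  have hHt : ∀ t, H (circlePt L t) = h₁ (circlePt L (t - t₀)) := fun t => by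
    rw [hHdef]; dsimp only; rw [← circlePt_add]; congr 2; ring
  have hHk : ∀ t ∈ Icc 0 t₀, H (circlePt L t) = k (t₀ - t) := fun t ht => by
    rw [hHt, ← hc.left_cut (t₀ - t) ⟨by linarith [ht.2], by linarith [ht.1, ht₀.2]⟩,
      ← circlePt_add_self hL0 (t - t₀)]
    congr 2
    rw [hL]; ring
  have hHa : ∀ t ∈ Icc t₀ (t₀ + s), H (circlePt L t) = h (circlePt l (t - t₀)) := fun t ht => by
    rw [hHt, ← hc.left_arc (t - t₀) ⟨by linarith [ht.1], by linarith [ht.2]⟩]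
  have hj' : 0 < t₀ + s := by linarith [ht₀'.1]
  have hjL' : t₀ + s < L := by linarith [ht₀'.2]
  have hγk : IsCrosscut L (t₀ + s) 1 H (fun τ => γ (1 - τ)) := by
    have hrev : ∀ t ∈ Icc (0 : ℝ) 1, 1 - t ∈ Icc (0 : ℝ) 1 := fun _ =>
      Set.Icc.one_sub_mem
    refine ⟨hγc.comp (by fun_prop) hrev, fun τ hτ τ' hτ' heq => ?_, ?_, ?_, fun τ hτ => ?_⟩
    · linarith [hγi (hrev τ hτ) (hrev τ' hτ') heq]
    · rw [sub_zero, hγ1, hHk 0 ⟨le_rfl, ht₀.1⟩, sub_zero]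
    · grind
    · grind
  obtain ⟨O, O', hO⟩ := exists_isCut hH hj' hjL' one_pos hγk
  have hOB : O '' ball 0 1 ⊆ closedBall (h 1) ε := by
    refine hO.left.subset_closedBall_of_boundary hε0 ?_
    rw [hO.left_boundary hj' one_pos]
    rintro _ (⟨t, ht, rfl⟩ | ⟨τ, hτ, rfl⟩)
    · dsimp only
      rcases le_total t t₀ with h1 | h1
      · rw [hHk t ⟨ht.1, h1⟩]
        exact hδB _ ⟨by linarith, by linarith [ht.1, ht₀.2]⟩ (by linarith [ht.1])
      · grind
    · grind
  have hfO : f '' Ioc 0 1 ⊆ O '' ball 0 1 := by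
    refine (hO.subset_or_subset hH hγk hj' hjL' one_pos
      (isPreconnected_Ioc.image _ (hf.mono Ioc_subset_Icc_self)) ?_ ?_).resolve_right ?_
    · rw [hHb]
      rintro _ ⟨t, ht, rfl⟩
      exact hfU t ht
    · grind
    · intro hsub
      refine hO.arc_notMem_right hH hγk hjL' one_pos (s := t₀) ⟨ht₀'.1, by linarith⟩ ?_
      rw [hHk t₀ ⟨ht₀.1, le_rfl⟩, sub_self, hk0, ← hf0, ← hO.right.closure_eq]
      exact closure_mono ((image_mono Ioo_subset_Ioc_self).trans hsub) (hcl hf)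
  have h1 := mem_closedBall.1 (hOB (hfO ⟨1, by simp, rfl⟩))
  linarith

end Corner

section Path
variable {P : Set ℂ} {E : Set (Set ℂ)} {h h₁ h₂ : ℂ → ℂ} {σ k : ℝ → ℂ} {r : ℕ} {s : ℝ}

/-- A path from the root `0` to an inner point, with no edge leaving the root to its left,
forms an empty triangle together with the side `0` and a further crosscut. -/
lemma IsFrame.exists_isSplit_of_path (hF : IsFrame P E (1 + r) h) (hσ : ContinuousOn σ (Icc 0 1))
    (hi : InjOn σ (Icc 0 1)) (h0 : σ 0 = h 1) (hσU : ∀ t ∈ Ioc (0 : ℝ) 1, σ t ∈ h '' ball 0 1)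
    (hside : IsSide P E σ) (hs : s ∈ Ioo (r : ℝ) (1 + r))
    (hkσ : ∀ t ≤ 1, k t = σ t) (hc : IsCut (1 + r) s 2 h k h₁ h₂)
    (hgerm : ∀ f ∈ innerEdges E (h '' ball 0 1), f ≠ σ '' Icc 0 1 →
      h 1 ∉ closure ((f ∩ h₁ '' closedBall 0 1) \ {h 1})) :
    ∃ k h₁ h₂, IsSplit P E 1 r 2 h k h₁ h₂ ∧ IsVoid P E (h₁ '' ball 0 1) ∧
      segPath k 0 '' Icc 0 1 = σ '' Icc 0 1 ∧ segPath k 1 '' Icc 0 1 ∉ E := by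
  have hr : 0 < r := by have := hF.two_le; omega
  have hr1 : (1 : ℝ) ≤ r := by exact_mod_cast hr
  have hs1 : 1 < s := hr1.trans_lt hs.1
  have hsl : 0 < s + 2 := by linarith
  set a := h 1 with ha
  have hab : a ∈ h '' sphere 0 1 := ⟨1, by simp, rfl⟩
  have hb : ∀ t, h (circlePt (1 + r) t) ∈ h '' sphere 0 1 := fun t =>
    ⟨_, circlePt_mem_sphere _ _, rfl⟩
  have hU : ∀ z ∈ h '' ball 0 1, z ∉ h '' sphere 0 1 := fun z hz hz' =>
    hF.disc.disjoint.le_bot ⟨hz, hz'⟩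
  have hside0 : ∀ t ∈ Ioo (0 : ℝ) 1, h (circlePt (1 + r) t) ∉ P := fun t ht => by
    simpa using hF.side_notMem (i := 0) (by omega) ht
  have hroot1 : h (circlePt (1 + r) 1) ∈ P := by simpa using hF.root_mem (i := 1) (by omega)
  have hne1 : h (circlePt (1 + r) 1) ≠ a := by
    rw [ha, ← circlePt_zero (1 + r)]
    intro h1
    have := hF.disc.injOn_circlePt (L := 1 + r) (a := 0) (b := 1) (by linarith) (by linarith)
      (right_mem_Icc.2 zero_le_one) (left_mem_Icc.2 zero_le_one) h1
    norm_num at this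
  obtain ⟨hg, hgb, hgc, hgs⟩ := hc.left.rotate (norm_circlePt (s + 2) (s + 1))
  set g : ℂ → ℂ := fun z => h₁ (circlePt (s + 2) (s + 1) * z) with hgd
  have hgσ : ∀ u ∈ Icc (0 : ℝ) 1, g (circlePt (s + 2) u) = σ (1 - u) := by
    intro u hu
    rw [hgd, ← hkσ _ (by linarith [hu.1]), ← hc.left_cut _ ⟨by linarith [hu.2], by linarith [hu.1]⟩]
    dsimp only
    rw [← circlePt_add]
    congr 2
    ring
  have hga : ∀ u ∈ Icc (1 : ℝ) 2, g (circlePt (s + 2) u) = h (circlePt (1 + r) (u - 1)) := by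
    intro u hu
    rw [← hc.left_arc _ ⟨by linarith [hu.1], by linarith [hu.2]⟩, hgd]
    dsimp only
    rw [← circlePt_add, ← circlePt_add_self hsl (u - 1)]
    congr 2
    ring
  -- the obstacles for the crosscut
  set N := innerEdges E (h '' ball 0 1) \ {σ '' Icc 0 1} with hN
  set K : Set ℂ := P \ {a} ∪ ⋃ f ∈ N, closure ((f ∩ h₁ '' closedBall 0 1) \ {a}) with hK
  have hKc : IsClosed K := by
    refine (hF.plane.finite_points.subset sdiff_subset).isClosed.union ?_
    exact (hF.plane.finite_edges.subset fun f hf => hf.1.1).isClosed_biUnion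
      fun f _ => isClosed_closure
  have hcl : ∀ f ∈ N, closure ((f ∩ h₁ '' closedBall 0 1) \ {a}) ⊆ f := fun f hf =>
    closure_minimal (fun z hz => hz.1.1) (hF.plane.isClosed_edge hf.1.1)
  have hKP : ∀ z ∈ P, z ∈ h₁ '' ball 0 1 → z ∈ K := fun z hz hzU =>
    Or.inl ⟨hz, fun h1 => hU z (hc.tiling.left_subset hzU) ((show z = a from h1) ▸ hab)⟩
  have hKe : ∀ e ∈ E, ∀ z ∈ e, z ∈ h₁ '' ball 0 1 → z ∈ K := by
    intro e he z hz hzU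
    refine Or.inr (mem_iUnion₂.2 ⟨e, ⟨⟨he, z, hz, hc.tiling.left_subset hzU⟩, ?_⟩, subset_closure
      ⟨⟨hz, IsDisc.ball_subset _ hzU⟩, fun h1 =>
        hU z (hc.tiling.left_subset hzU) ((show z = a from h1) ▸ hab)⟩⟩)
    rintro rfl
    obtain ⟨t, ht, rfl⟩ := hz
    refine hc.left.disjoint.le_bot ⟨hzU, ?_⟩
    rw [← hkσ t ht.2]
    exact hc.cut_mem_left ⟨ht.1, by linarith [ht.2]⟩
  have hKa : ∀ u ∈ Ioo (0 : ℝ) 2, g (circlePt (s + 2) u) ∉ K := by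
    intro u hu
    rcases lt_trichotomy u 1 with hu1 | rfl | hu1
    · rw [hgσ u ⟨hu.1.le, hu1.le⟩]
      have hP := hside.interior (1 - u) ⟨by linarith, by linarith [hu.1]⟩
      rintro (h1 | h1)
      · exact hP h1.1
      · obtain ⟨f, hf, hz⟩ := mem_iUnion₂.1 h1
        exact hP (hside.inter f hf.1.1 hf.2 ⟨hcl f hf hz, _, ⟨by linarith, by linarith [hu.1]⟩, rfl⟩)
    · rw [hga 1 (by norm_num), sub_self, circlePt_zero, ← ha]
      rintro (h1 | h1)
      · exact h1.2 rfl
      · obtain ⟨f, hf, hz⟩ := mem_iUnion₂.1 h1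
        exact hgerm f hf.1 hf.2 hz
    · rw [hga u ⟨hu1.le, hu.2.le⟩]
      have hP := hside0 (u - 1) ⟨by linarith, by linarith [hu.2]⟩
      rintro (h1 | h1)
      · exact hP h1.1
      · obtain ⟨f, hf, hz⟩ := mem_iUnion₂.1 h1
        exact hP (hF.mem_of_mem_inner hf.1 (hcl f hf hz) (hb _))
  obtain ⟨τ, hτ, hτK, hτc⟩ := hg.exists_lens (l := s + 2) (j := 2) (m := 1) two_pos (by linarith)
    one_pos hKc hKa
  obtain ⟨d₁, d₂, hd⟩ := exists_isCut hg two_pos (by linarith) one_pos hτ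
  have hτU : ∀ t ∈ Ioo (0 : ℝ) 1, τ t ∈ h₁ '' ball 0 1 := fun t ht => hgb ▸ hτ.interior t ht
  have hτ0 : σ 1 = τ 0 := by rw [hτ.source, hgσ 0 (by norm_num), sub_zero]
  have hτ1 : τ 1 = h (circlePt (1 + r) 1) := by
    rw [hτ.target, hga 2 (by norm_num)]
    norm_num
  have hk₁ : IsCrosscut (1 + r) 1 2 h (joinPath 1 σ τ) := by
    refine ⟨?_, ?_, ?_, ?_, ?_⟩
    · have := continuousOn_joinPath zero_le_one zero_le_one hτ0 hσ hτ.continuousOn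
      rwa [one_add_one_eq_two] at this
    · have := injOn_joinPath hτ0 hi hτ.injOn fun u hu t ht hut => ?_
      · rwa [one_add_one_eq_two] at this
      · rcases ht.2.eq_or_lt with rfl | ht1
        · grind
        · refine hc.left.disjoint.le_bot ⟨hτU t ⟨ht.1, ht1⟩, ?_⟩
          rw [← hut, ← hkσ u hu.2]
          exact hc.cut_mem_left ⟨hu.1, by linarith [hu.2]⟩
    · rw [joinPath_of_le zero_le_one, h0, circlePt_zero]
    · rw [joinPath_of_ge hτ0 one_le_two, ← hτ1]
      norm_num
    · intro t ht
      rcases le_or_gt t 1 with h1 | h1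
      · rw [joinPath_of_le h1]
        exact hσU t ⟨ht.1, h1⟩
      · rw [joinPath_of_ge hτ0 h1.le]
        exact hc.tiling.left_subset (hτU _ ⟨by linarith, by linarith [ht.2]⟩)
  have hτP : ∀ t ∈ Ioo (0 : ℝ) 1, τ t ∉ P := fun t ht hP => hτK t ht (hKP _ hP (hτU t ht))
  have hτE : ∀ e ∈ E, ∀ t ∈ Ioo (0 : ℝ) 1, τ t ∉ e := fun e he t ht hE =>
    hτK t ht (hKe e he _ hE (hτU t ht))
  have hseg0 : EqOn σ (segPath (joinPath 1 σ τ) 0) (Icc 0 1) := fun t ht => by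
    simp [segPath, joinPath_of_le ht.2]
  have hseg1 : EqOn τ (segPath (joinPath 1 σ τ) 1) (Icc 0 1) := fun t ht => by
    simp [segPath, joinPath_add hτ0 ht.1]
  obtain ⟨c₁, c₂, hsp⟩ := hF.exists_isSplit (j := 1) (m := 2) one_pos hr two_pos (by simpa using hk₁)
    (by
      intro i hi
      interval_cases i
      · exact hside.congr hseg0
      · exact (isSide_of_avoid (hτ0 ▸ hside.target) (hτ1 ▸ hroot1) hτP hτE).congr hseg1)
  refine ⟨_, c₁, c₂, hsp, ?_, (hseg0.image_eq).symm, ?_⟩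
  · have hcut : IsCut (1 + r) 1 2 h (joinPath 1 σ τ) c₁ c₂ := by simpa using hsp.cut
    have hball := hcut.left_eq_of_boundary hF.disc hk₁ one_pos (by linarith) two_pos hd.left (by
      rw [hd.left_boundary two_pos one_pos, hcut.left_boundary one_pos two_pos]
      have e1 : Icc (0 : ℝ) 2 = Icc 0 1 ∪ Icc 1 2 :=
        (Icc_union_Icc_eq_Icc zero_le_one one_le_two).symm
      have e2 : (fun t => g (circlePt (s + 2) t)) '' Icc 0 1 = σ '' Icc 0 1 := by
        rw [← image_reverse σ]
        exact image_congr hgσ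
      have e3 : (fun t => g (circlePt (s + 2) t)) '' Icc 1 2 =
          (fun t => h (circlePt (1 + r) t)) '' Icc 0 1 := by
        rw [image_congr hga, ← image_image (fun t => h (circlePt (1 + r) t)) (fun u => u - 1),
          image_sub_const_Icc]
        norm_num
      have e4 : joinPath 1 σ τ '' Icc 0 1 = σ '' Icc 0 1 :=
        image_congr fun t ht => joinPath_of_le ht.2
      have e5 : joinPath 1 σ τ '' Icc 1 2 = τ '' Icc 0 1 := by
        rw [image_congr fun t ht => joinPath_of_ge hτ0 ht.1, ← image_image τ (fun u => u - 1),
          image_sub_const_Icc]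
        norm_num
      rw [e1, image_union, image_union, e2, e3, e4, e5, union_comm (σ '' _), union_assoc])
    have hdK := hτc d₁ d₂ hd
    have hdU : d₁ '' ball 0 1 ⊆ h₁ '' ball 0 1 := hgb ▸ hd.tiling.left_subset
    rw [hball] at hdK hdU
    refine ⟨eq_empty_iff_forall_notMem.2 fun z hz => ?_, eq_empty_iff_forall_notMem.2 ?_⟩
    · exact hdK.le_bot ⟨hz.2, hKP z hz.1 (hdU hz.2)⟩
    · rintro e ⟨he, z, hze, hzU⟩
      exact hdK.le_bot ⟨hzU, hKe e he z hze (hdU hzU)⟩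
  · rw [← hseg1.image_eq]
    exact image_notMem_of_avoid hτE

end Path

section FirstEdge
variable {P : Set ℂ} {E : Set (Set ℂ)} {h : ℂ → ℂ} {l : ℕ}

/-- Some edge at the root `0` is the first one to be met by arbitrarily short chords. -/
lemma IsFrame.exists_first_edge (hF : IsFrame P E l h)
    (hfree : ¬ IsFree E (h '' ball 0 1) (h 1)) :
    ∃ e ∈ innerEdges E (h '' ball 0 1), h 1 ∈ e ∧ ∃ᶠ s in 𝓝[>] (0 : ℝ), ∃ y ∈ Ioo (0 : ℝ) 1,
      h (chord l s y) ∈ e ∧ ∀ y' ∈ Ioo 0 y, ∀ f ∈ innerEdges E (h '' ball 0 1), h 1 ∈ f →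
        h (chord l s y') ∉ f := by
  set N := {e | e ∈ innerEdges E (h '' ball 0 1) ∧ h 1 ∈ e} with hN
  have hNfin : N.Finite := hF.plane.finite_edges.subset fun e he => he.1.1
  obtain ⟨e₀, he₀⟩ : N.Nonempty := by
    simp only [IsFree, not_forall, not_not] at hfree
    obtain ⟨e, he, h1⟩ := hfree
    exact ⟨e, he, h1⟩
  by_contra! hcon
  have hev := (eventually_all_finite hNfin).2 fun e he => hcon e he.1 he.2
  have hl2 : (2 : ℝ) ≤ l := by exact_mod_cast hF.two_le
  have h1P := hF.one_mem
  obtain ⟨p, hp, hp0⟩ := hF.plane.exists_isEdgePath_of_mem he₀.1.1 he₀.2 h1P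
  have hpe : ∀ t ∈ Icc (0 : ℝ) 1, p t ∈ e₀ := fun t ht => hp.image_eq ▸ ⟨t, ht, rfl⟩
  have hpD : MapsTo p (Icc 0 1) (h '' closedBall 0 1) := fun t ht =>
    hF.inner_subset he₀.1 (hpe t ht)
  set q : ℝ → ℂ := fun t => Function.invFunOn h (closedBall 0 1) (p t) with hq
  have hqc : ContinuousOn q (Icc 0 1) := hF.disc.continuousOn_inv.comp hp.continuousOn hpD
  have hqm : ∀ t ∈ Icc (0 : ℝ) 1, ‖q t‖ ≤ 1 := fun t ht =>
    mem_closedBall_zero_iff.1 (IsDisc.inv_mem (hpD ht))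
  have hqp : ∀ t ∈ Icc (0 : ℝ) 1, h (q t) = p t := fun t ht => IsDisc.apply_inv (hpD ht)
  have hq0 : q 0 = 1 := by rw [hq]; dsimp only; rw [hp0, hF.disc.inv_apply (by simp)]
  have hq1 : (q 1).re < 1 := by
    refine ((Complex.re_le_norm _).trans (hqm 1 (by simp))).lt_of_ne fun h1 => hp.ne ?_
    have hn := hqm 1 (by simp)
    rw [← sq_le_sq₀ (norm_nonneg _) zero_le_one, ← Complex.normSq_eq_norm_sq,
      Complex.normSq_apply, h1] at hn
    have him : (q 1).im = 0 := by nlinarith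
    rw [← hqp 1 (by simp), hp0, show q 1 = 1 from Complex.ext h1 him]
  have hre : ∀ᶠ s in 𝓝[>] (0 : ℝ), (q 1).re < (circlePt l s).re := by
    have h1 := (Complex.continuous_re.comp (continuous_circlePt l)).tendsto 0
    simp only [Function.comp_apply, circlePt_zero, Complex.one_re] at h1
    exact nhdsWithin_le_nhds (h1.eventually (lt_mem_nhds hq1))
  obtain ⟨s, hs, hsre, hs0, hs1⟩ := (hev.and (hre.and (Ioo_mem_nhdsGT one_pos))).exists
  obtain ⟨t, ht, hts⟩ := intermediate_value_Icc' zero_le_one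
    (Complex.continuous_re.comp_continuousOn hqc) (show (circlePt l s).re ∈ _ from ⟨hsre.le, by
      simp only [Function.comp_apply, hq0, Complex.one_re]
      exact (Complex.re_le_norm _).trans (norm_circlePt _ _).le⟩)
  obtain ⟨y₀, hy₀, hyt⟩ := exists_chord_eq hs0 (by linarith) (hqm t ht) hts
  set Y := Icc (0 : ℝ) 1 ∩ (fun y => h (chord l s y)) ⁻¹' ⋃ e ∈ N, e with hY
  have hYc : IsCompact Y := by
    refine isCompact_Icc.of_isClosed_subset (ContinuousOn.preimage_isClosed_of_isClosed ?_
      isClosed_Icc (hNfin.isClosed_biUnion fun e he => hF.plane.isClosed_edge he.1.1))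
      inter_subset_left
    exact hF.disc.continuousOn.comp (continuous_chord l s).continuousOn
      fun y hy => chord_mem_closedBall l s hy
  obtain ⟨y, ⟨hy, hye⟩, hmin⟩ := hYc.exists_isLeast ⟨y₀, hy₀, mem_iUnion₂.2
    ⟨e₀, he₀, by simpa [hyt, hqp t ht] using hpe t ht⟩⟩
  obtain ⟨e, he, hye⟩ := mem_iUnion₂.1 hye
  dsimp only at hye
  have hy0 : y ≠ 0 := by
    rintro rfl
    rw [chord_zero] at hye
    refine hF.side_notMem hF.pos ⟨hs0, hs1⟩ ?_
    simpa using hF.mem_of_mem_inner he.1 hye ⟨_, circlePt_mem_sphere _ _, rfl⟩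
  have hy1 : y ≠ 1 := by
    rintro rfl
    rw [chord_one, ← circlePt_add_self (by linarith)] at hye
    refine hF.side_notMem (i := l - 1) (t := 1 - s) (by have := hF.pos; omega)
      ⟨by linarith, by linarith⟩ ?_
    have := hF.mem_of_mem_inner he.1 hye ⟨_, circlePt_mem_sphere _ _, rfl⟩
    rw [Nat.cast_sub hF.pos]
    convert this using 3
    push_cast
    ring
  obtain ⟨y', hy', f, hf, h1f, hyf⟩ := hs e he y ⟨hy.1.lt_of_ne' hy0, hy.2.lt_of_ne hy1⟩ hye
  exact (hmin ⟨⟨hy'.1.le, (hy'.2.trans_le hy.2).le⟩, mem_iUnion₂.2 ⟨f, ⟨hf, h1f⟩, hyf⟩⟩).not_gt hy'.2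

lemma IsCrosscut.compl_image_mem_nhds {L j m : ℝ} {k : ℝ → ℂ} (hk : IsCrosscut L j m h k) {s t : ℝ}
    (hs : 0 ≤ s) (hst : s < t) (ht : t ≤ m) : (k '' Icc t m)ᶜ ∈ 𝓝 (k s) := by
  refine (isCompact_Icc.image_of_continuousOn
    (hk.continuousOn.mono (Icc_subset_Icc_left (hs.trans hst.le)))).isClosed.isOpen_compl.mem_nhds ?_
  rintro ⟨u, hu, hku⟩
  exact (hst.trans_le hu.1).ne' (hk.injOn ⟨(hs.trans hst.le).trans hu.1, hu.2⟩
    ⟨hs, hst.le.trans ht⟩ hku)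

/-- No inner edge at the root `0` starts to the left of a crosscut along the first edge. -/
lemma IsFrame.not_left_of_first (hF : IsFrame P E l h) {e f : Set ℂ} {p k φ : ℝ → ℂ} {j m : ℝ}
    {h₁ h₂ : ℂ → ℂ} (hfirst : ∃ᶠ s in 𝓝[>] (0 : ℝ), ∃ y ∈ Ioo (0 : ℝ) 1, h (chord l s y) ∈ e ∧
      ∀ y' ∈ Ioo 0 y, ∀ f ∈ innerEdges E (h '' ball 0 1), h 1 ∈ f → h (chord l s y') ∉ f)
    (he : e ∈ innerEdges E (h '' ball 0 1)) (h1e : h 1 ∈ e) (hp : p '' Icc 0 1 = e)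
    (hk : IsCrosscut l j m h k) (hm : 1 ≤ m) (hkp : ∀ t ≤ 1, k t = p t)
    (hc : IsCut l j m h k h₁ h₂) (hj : 0 < j) (hjl : j < l)
    (hf : f ∈ innerEdges E (h '' ball 0 1)) (h1f : h 1 ∈ f) (hφ : ContinuousOn φ (Icc 0 1))
    (hφ0 : φ 0 = h 1) (hφf : φ '' Icc 0 1 ⊆ f) (hφU : ∀ t ∈ Ioc (0 : ℝ) 1, φ t ∈ h₁ '' ball 0 1) :
    False := by
  have hke : k '' Icc 0 1 = e := by rw [← hp]; exact image_congr fun t ht => hkp t ht.2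
  have hfar : (k '' Icc 1 m)ᶜ ∈ 𝓝 (h 1) := by
    simpa [hk.source, circlePt_zero] using hk.compl_image_mem_nhds le_rfl one_pos hm
  refine hc.notMem_of_frequently hF.disc hk hj hjl (by linarith) hφ hφ0 ?_ hφU
  refine (hfirst.and_eventually (hF.disc.eventually_chord_mem l hfar)).mono ?_
  rintro s ⟨⟨y, hy, hye, hy'⟩, hs⟩
  rw [← Icc_union_Icc_eq_Icc zero_le_one hm, image_union, hke]
  refine ⟨y, hy, Or.inl hye, fun y' h' => ⟨?_, fun h'' => hy' y' h' f hf h1f (hφf h'')⟩⟩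
  rintro (h'' | h'')
  · exact hy' y' h' e he h1e h''
  · exact hs y' ⟨h'.1.le, (h'.2.trans hy.2).le⟩ h''

/-- At a root which is not free, the first edge is a chord or the side of an empty triangle. -/
theorem IsFrame.exists_isSplit_of_not_isFree {r : ℕ} (hF : IsFrame P E (1 + r) h)
    (hfree : ¬ IsFree E (h '' ball 0 1) (h (circlePt (1 + r : ℕ) 0))) :
    (∃ j r' k h₁ h₂, j + r' = 1 + r ∧ IsSplit P E j r' 1 h k h₁ h₂ ∧ segPath k 0 '' Icc 0 1 ∈ E ∧
      IsFree E (h₁ '' ball 0 1) (h (circlePt (1 + r : ℕ) 0))) ∨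
    ∃ k h₁ h₂, IsSplit P E 1 r 2 h k h₁ h₂ ∧ IsVoid P E (h₁ '' ball 0 1) ∧
      segPath k 0 '' Icc 0 1 ∈ E ∧ segPath k 1 '' Icc 0 1 ∉ E := by
  rw [circlePt_zero] at hfree ⊢
  obtain ⟨e, he, h1e, hfirst⟩ := hF.exists_first_edge hfree
  have h1P := hF.one_mem
  obtain ⟨p, hp, hp0⟩ := hF.plane.exists_isEdgePath_of_mem he.1 h1e h1P
  have hp1 : p 1 ∈ h '' closedBall 0 1 := hF.inner_subset he (hp.image_eq ▸ ⟨1, by simp, rfl⟩)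
  have hr : 0 < r := by have := hF.two_le; omega
  have hr' : (1 : ℝ) ≤ r := by exact_mod_cast hr
  rw [IsDisc.image_closedBall h, union_comm] at hp1
  rcases hp1 with hp1 | hp1
  · obtain ⟨j, hj, hpj⟩ := hF.exists_root hp.target hp1
    have hj0 : 0 < j := by
      refine Nat.pos_of_ne_zero ?_
      rintro rfl
      exact hp.ne (by rw [hp0, hpj, Nat.cast_zero, circlePt_zero])
    obtain ⟨r', hr''⟩ := Nat.exists_eq_add_of_lt hj
    replace hr'' : 1 + r = j + (r' + 1) := by omega
    rw [hr''] at hF hfirst hpj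
    obtain ⟨h₁, h₂, hsp⟩ := hF.exists_isSplit_of_edge hj0 (by omega) he hp
      (by rw [hp0, circlePt_zero]) hpj
    have hseg : segPath p 0 = p := by funext t; simp [segPath]
    refine Or.inl ⟨j, r' + 1, p, h₁, h₂, hr''.symm, hsp, ?_, fun f hf h1f => ?_⟩
    · rw [hseg, hp.image_eq]
      exact he.1
    · obtain ⟨φ, hφ, hφ0⟩ := hF.plane.exists_isEdgePath_of_mem hf.1 h1f h1P
      have hmaps : MapsTo (fun t : ℝ => t / 2) (Icc 0 1) (Icc 0 1) := fun t ht =>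
        ⟨by linarith [ht.1], by linarith [ht.1, ht.2]⟩
      refine hF.not_left_of_first hfirst he h1e hp.image_eq (by simpa using hsp.crosscut) le_rfl
        (fun _ _ => rfl) (by simpa using hsp.cut) (by exact_mod_cast hj0) (by simp; positivity)
        (innerEdges_mono hsp.cut.tiling.left_subset hf) h1f
        (φ := fun t => φ (t / 2)) (hφ.continuousOn.comp (by fun_prop) hmaps) (by simpa using hφ0)
        ?_ fun t ht => hsp.left_frame.edgePath_mem hφ hf ⟨by linarith [ht.1], by linarith [ht.2]⟩
      rintro _ ⟨t, ht, rfl⟩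
      exact hφ.image_eq ▸ ⟨_, hmaps ht, rfl⟩
  · have hpU : ∀ t ∈ Ioc (0 : ℝ) 1, p t ∈ h '' ball 0 1 := fun t ht => by
      rcases ht.2.eq_or_lt with rfl | h1
      · exact hp1
      · exact hF.edgePath_mem hp he ⟨ht.1, h1⟩
    have hs : (r + 1 / 2 : ℝ) ∈ Ioo (0 : ℝ) (1 + r) := ⟨by linarith, by linarith⟩
    obtain ⟨k, hk, hkp⟩ := hF.disc.exists_crosscut hs hp.continuousOn hp.injOn
      (by rw [hp0, circlePt_zero]) hpU
    obtain ⟨h₁, h₂, hc⟩ := exists_isCut hF.disc hs.1 hs.2 two_pos hk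
    suffices hgerm : ∀ f ∈ innerEdges E (h '' ball 0 1), f ≠ p '' Icc 0 1 →
        h 1 ∉ closure ((f ∩ h₁ '' closedBall 0 1) \ {h 1}) by
      obtain ⟨k', h₁', h₂', hsp, hv, h0, h1⟩ := hF.exists_isSplit_of_path hp.continuousOn hp.injOn
        hp0 hpU (hF.plane.isSide_of_isEdgePath hp he.1) (s := r + 1 / 2)
        ⟨by linarith, by linarith⟩ hkp hc hgerm
      exact Or.inr ⟨k', h₁', h₂', hsp, hv, by rw [h0, hp.image_eq]; exact he.1, h1⟩
    intro f hf hfe hcl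
    rw [hp.image_eq] at hfe
    have h1f : h 1 ∈ f :=
      closure_minimal (fun z hz => hz.1.1) (hF.plane.isClosed_edge hf.1) hcl
    obtain ⟨φ, hφ, hφ0⟩ := hF.plane.exists_isEdgePath_of_mem hf.1 h1f h1P
    -- an initial part of the other edge avoids the crosscut
    have hfar : (k '' Icc 1 2)ᶜ ∈ 𝓝 (φ 0) := by
      simpa [hφ0, hk.source, circlePt_zero] using hk.compl_image_mem_nhds le_rfl one_pos one_le_two
    obtain ⟨δ, hδ, hδk⟩ := Metric.mem_nhdsWithin_iff.1 (hφ.continuousOn 0 (by simp) hfar)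
    set η := min (δ / 2) (1 / 2) with hη
    have hη0 : 0 < η := lt_min (half_pos hδ) (by norm_num)
    have hηδ : η < δ := (min_le_left _ _).trans_lt (half_lt_self hδ)
    have hη1 : η < 1 := (min_le_right _ _).trans_lt (by norm_num)
    have hφU : φ '' Ioc 0 η ⊆ h '' ball 0 1 := by
      rintro _ ⟨t, ht, rfl⟩
      exact hF.edgePath_mem hφ hf ⟨ht.1, by linarith [ht.2]⟩
    have hφk : ∀ t ∈ Ioo (0 : ℝ) 2, k t ∉ φ '' Ioc 0 η := by
      rintro t ht ⟨u, hu, huk⟩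
      have hu1 : u ∈ Ioo (0 : ℝ) 1 := ⟨hu.1, by linarith [hu.2]⟩
      rcases le_or_gt t 1 with h1 | h1
      · refine hφ.interior u hu1 (hF.plane.inter f hf.1 e he.1 hfe ⟨?_, ?_⟩)
        · exact hφ.image_eq ▸ ⟨u, Ioo_subset_Icc_self hu1, rfl⟩
        · rw [huk, hkp t h1, ← hp.image_eq]
          exact ⟨t, ⟨ht.1.le, h1⟩, rfl⟩
      · refine hδk ⟨?_, Ioo_subset_Icc_self hu1⟩ ⟨t, ⟨h1.le, ht.2.le⟩, huk.symm⟩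
        rw [mem_ball_zero_iff, Real.norm_of_nonneg hu.1.le]
        linarith [hu.2]
    have hconn : IsPreconnected (φ '' Ioc 0 η) := isPreconnected_Ioc.image _
      (hφ.continuousOn.mono fun t ht => ⟨ht.1.le, by linarith [ht.2]⟩)
    rcases hc.subset_or_subset hF.disc hk hs.1 hs.2 two_pos hconn hφU hφk with hsub | hsub
    · have hmaps : MapsTo (fun t : ℝ => t * η) (Icc 0 1) (Icc 0 1) := fun t ht =>
        ⟨mul_nonneg ht.1 hη0.le, by nlinarith [ht.1, ht.2]⟩
      refine hF.not_left_of_first hfirst he h1e hp.image_eq (j := r + 1 / 2) (m := 2) (k := k)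
        (by simpa using hk) one_le_two hkp
        (by simpa using hc) hs.1 (by simpa using hs.2) hf h1f (φ := fun t => φ (t * η))
        (hφ.continuousOn.comp (by fun_prop) hmaps) (by simpa using hφ0) ?_
        fun t ht => hsub ⟨_, ⟨mul_pos ht.1 hη0, by nlinarith [ht.2]⟩, rfl⟩
      rintro _ ⟨t, ht, rfl⟩
      exact hφ.image_eq ▸ ⟨_, hmaps ht, rfl⟩
    · have hsub' : (f ∩ h₁ '' closedBall 0 1) \ {h 1} ⊆ φ '' Icc η 1 := by
        rintro z ⟨⟨hzf, hz1⟩, hza⟩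
        obtain ⟨t, ht, rfl⟩ := hφ.image_eq ▸ hzf
        refine ⟨t, ⟨?_, ht.2⟩, rfl⟩
        by_contra! htη
        have ht0 : 0 < t := ht.1.lt_of_ne' fun h0 => hza (by rw [h0, hφ0]; rfl)
        exact hc.disjoint_right_left.le_bot ⟨hsub ⟨t, ⟨ht0, htη.le⟩, rfl⟩, hz1⟩
      obtain ⟨t, ht, hta⟩ := closure_minimal hsub' (isCompact_Icc.image_of_continuousOn
        (hφ.continuousOn.mono (Icc_subset_Icc_left hη0.le))).isClosed hcl
      have := hφ.injOn ⟨hη0.le.trans ht.1, ht.2⟩ (left_mem_Icc.2 zero_le_one) (hta.trans hφ0.symm)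
      linarith [ht.1]

end FirstEdge

section Spoke
variable {P : Set ℂ} {E : Set (Set ℂ)} {h : ℂ → ℂ}

/-- A free root can be joined to an inner point by a path avoiding all edges. -/
lemma IsFrame.exists_spoke (hF : IsFrame P E 2 h) (hfree : IsFree E (h '' ball 0 1) (h 1))
    (hP : (P ∩ h '' ball 0 1).Nonempty) :
    ∃ σ : ℝ → ℂ, ContinuousOn σ (Icc 0 1) ∧ InjOn σ (Icc 0 1) ∧ σ 0 = h 1 ∧ σ 1 ∈ P ∧
      (∀ t ∈ Ioc (0 : ℝ) 1, σ t ∈ h '' ball 0 1) ∧ (∀ t ∈ Ioo (0 : ℝ) 1, σ t ∉ P) ∧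
      ∀ e ∈ E, ∀ t ∈ Ioo (0 : ℝ) 1, σ t ∉ e := by
  have hab : h 1 ∈ h '' sphere 0 1 := ⟨1, by simp, rfl⟩
  set K : Set ℂ := P \ {h 1} ∪ ⋃ e ∈ innerEdges E (h '' ball 0 1), e with hK
  have hKc : IsClosed K := hF.plane.isClosed_union sdiff_subset fun e he => he.1
  have hKe : ∀ e ∈ E, ∀ z ∈ e, z ∈ h '' ball 0 1 → z ∈ K := fun e he z hz hzU =>
    Or.inr (mem_iUnion₂.2 ⟨e, ⟨he, z, hz, hzU⟩, hz⟩)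
  have hPU : ∀ z ∈ P, z ∈ h '' ball 0 1 → z ∈ P \ {h 1} := fun z hz hzU =>
    ⟨hz, fun h1 => hF.disc.disjoint.le_bot ⟨hzU, (show z = h 1 from h1) ▸ hab⟩⟩
  have hKa : h 1 ∉ K := by
    rintro (h1 | h1)
    · exact h1.2 rfl
    · obtain ⟨e, he, h1⟩ := mem_iUnion₂.1 h1
      exact hfree e he h1
  -- a segment from the root to its first obstacle
  obtain ⟨_, hx, z, hz, rfl⟩ := hP
  rw [mem_ball_zero_iff] at hz
  set c : ℝ → ℂ := fun t => (1 - t : ℝ) • (1 : ℂ) + t • z with hc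
  have hcc : Continuous c := by fun_prop
  have hcb : ∀ t ∈ Ioc (0 : ℝ) 1, c t ∈ ball (0 : ℂ) 1 := by
    intro t ht
    rw [mem_ball_zero_iff]
    calc ‖c t‖ ≤ ‖(1 - t : ℝ) • (1 : ℂ)‖ + ‖t • z‖ := norm_add_le _ _
      _ = (1 - t) + t * ‖z‖ := by
        rw [norm_smul, norm_smul, norm_one, Real.norm_of_nonneg (by linarith [ht.2]),
          Real.norm_of_nonneg ht.1.le, mul_one]
      _ < 1 := by nlinarith [ht.1]
  have hc0 : c 0 = 1 := by simp [hc]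
  have hcB : MapsTo c (Icc 0 1) (closedBall 0 1) := by
    intro t ht
    rcases ht.1.eq_or_lt with rfl | h0
    · simp [hc0]
    · exact ball_subset_closedBall (hcb t ⟨h0, ht.2⟩)
  have hci : Function.Injective c := by
    intro t t' htt
    have h1 : ((t - t' : ℝ) : ℂ) * (z - 1) = 0 := by
      simp only [hc, Complex.real_smul] at htt
      push_cast at htt ⊢
      linear_combination htt
    rcases mul_eq_zero.1 h1 with h1 | h1
    · exact sub_eq_zero.1 (by exact_mod_cast h1)
    · rw [sub_eq_zero.1 h1, norm_one] at hz
      exact absurd hz (lt_irrefl _)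
  have hhc : ContinuousOn (fun t => h (c t)) (Icc 0 1) :=
    hF.disc.continuousOn.comp hcc.continuousOn hcB
  have hTc : IsCompact (Icc (0 : ℝ) 1 ∩ (fun t => h (c t)) ⁻¹' K) :=
    isCompact_Icc.of_isClosed_subset (hhc.preimage_isClosed_of_isClosed isClosed_Icc hKc)
      inter_subset_left
  obtain ⟨t₀, ⟨ht₀, hq⟩, hmin⟩ := hTc.exists_isLeast ⟨1, by simp, by
    have h1 : c 1 = z := by simp [hc]
    rw [mem_preimage, h1]
    exact Or.inl (hPU _ hx ⟨z, by simpa using hz, rfl⟩)⟩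
  have ht₀' : 0 < t₀ := by
    refine ht₀.1.lt_of_ne' ?_
    rintro rfl
    exact hKa (by simpa [hc0] using hq)
  set u : ℝ → ℂ := fun t => h (c (t * t₀)) with hu
  have hmaps : MapsTo (fun t : ℝ => t * t₀) (Icc 0 1) (Icc 0 1) := fun t ht =>
    ⟨mul_nonneg ht.1 ht₀.1, mul_le_one₀ ht.2 ht₀.1 ht₀.2⟩
  have huc : ContinuousOn u (Icc 0 1) := hhc.comp (by fun_prop) hmaps
  have hui : InjOn u (Icc 0 1) := fun t ht t' ht' htt =>
    mul_right_cancel₀ ht₀'.ne' (hci (hF.disc.injOn (hcB (hmaps ht)) (hcB (hmaps ht')) htt))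
  have hu0 : u 0 = h 1 := by simp [hu, hc0]
  have huU : ∀ t ∈ Ioc (0 : ℝ) 1, u t ∈ h '' ball 0 1 := fun t ht =>
    ⟨_, hcb _ ⟨mul_pos ht.1 ht₀', (hmaps ⟨ht.1.le, ht.2⟩).2⟩, rfl⟩
  have huK : ∀ t ∈ Ico (0 : ℝ) 1, u t ∉ K := fun t ht htK =>
    (hmin ⟨hmaps ⟨ht.1, ht.2.le⟩, htK⟩).not_gt (by nlinarith [ht.2])
  replace hq : u 1 ∈ K := by simpa [hu] using hq
  by_cases hqP : u 1 ∈ P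
  · exact ⟨u, huc, hui, hu0, hqP, huU, fun t ht htP => huK t ⟨ht.1.le, ht.2⟩
      (Or.inl (hPU _ htP (huU t ⟨ht.1, ht.2.le⟩))), fun e he t ht hte => huK t ⟨ht.1.le, ht.2⟩
      (hKe e he _ hte (huU t ⟨ht.1, ht.2.le⟩))⟩
  obtain ⟨e, he, hqe⟩ : ∃ e ∈ innerEdges E (h '' ball 0 1), u 1 ∈ e := by
    rcases hq with hq | hq
    · exact absurd hq.1 hqP
    · simpa using hq
  -- the obstacle is an edge, one of whose ends is an inner point
  obtain ⟨p, hp, hp1⟩ : ∃ p, IsEdgePath P e p ∧ p 1 ∈ h '' ball 0 1 := by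
    obtain ⟨p, hp⟩ := hF.plane.exists_isEdgePath he.1
    have hend : ∀ t ∈ Icc (0 : ℝ) 1, p t ∈ P → p t ∉ h '' ball 0 1 → p t = h (circlePt 2 1) := by
      intro t ht htP htU
      have hte : p t ∈ e := hp.image_eq ▸ ⟨t, ht, rfl⟩
      have htD := hF.inner_subset he hte
      rw [IsDisc.image_closedBall h] at htD
      obtain ⟨i, hi, hti⟩ := hF.exists_root htP (htD.resolve_left htU)
      interval_cases i
      · refine absurd hte ?_
        rw [hti, Nat.cast_zero, circlePt_zero]
        exact hfree e he
      · simpa using hti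
    by_cases h1 : p 1 ∈ h '' ball 0 1
    · exact ⟨p, hp, h1⟩
    · refine ⟨_, hp.reverse, ?_⟩
      by_contra h0
      rw [sub_self] at h0
      exact hp.ne (by rw [hend 0 (by simp) hp.source h0, hend 1 (by simp) hp.target h1])
  have hpe : ∀ t ∈ Icc (0 : ℝ) 1, p t ∈ e := fun t ht => hp.image_eq ▸ ⟨t, ht, rfl⟩
  obtain ⟨b, hb, hbq⟩ := hp.image_eq ▸ hqe
  have hb0 : 0 < b := hb.1.lt_of_ne' fun h0 => hqP (by rw [← hbq, h0]; exact hp.source)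
  have hb1 : b < 1 := hb.2.lt_of_ne fun h0 => hqP (by rw [← hbq, h0]; exact hp.target)
  set v : ℝ → ℂ := fun t => p (b + (1 - b) * t) with hv
  have hmv : MapsTo (fun t : ℝ => b + (1 - b) * t) (Icc 0 1) (Icc b 1) := fun t ht =>
    ⟨by nlinarith [ht.1], by nlinarith [ht.2]⟩
  have hmv' : MapsTo (fun t : ℝ => b + (1 - b) * t) (Icc 0 1) (Icc 0 1) :=
    hmv.mono_right (Icc_subset_Icc_left hb.1)
  have huv : u 1 = v 0 := by simp [hv, hbq]
  have hvc : ContinuousOn v (Icc 0 1) := hp.continuousOn.comp (by fun_prop) hmv'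
  have hvi : InjOn v (Icc 0 1) := fun t ht t' ht' htt => by
    have := hp.injOn (hmv' ht) (hmv' ht') htt
    exact mul_left_cancel₀ (sub_pos.2 hb1).ne' (add_left_cancel this)
  have hvU : ∀ t ∈ Icc (0 : ℝ) 1, v t ∈ h '' ball 0 1 := by
    intro t ht
    rcases ht.2.eq_or_lt with rfl | h1
    · simpa [hv] using hp1
    · exact hF.edgePath_mem hp he ⟨hb0.trans_le (hmv ht).1, by nlinarith⟩
  have hvK : ∀ t ∈ Icc (0 : ℝ) 1, v t ∈ K := fun t ht => hKe e he.1 _ (hpe _ (hmv' ht)) (hvU t ht)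
  set ρ : ℝ → ℂ := fun t => joinPath 1 u v (2 * t) with hρ
  have hρu : ∀ t ≤ 1 / 2, ρ t = u (2 * t) := fun t ht => joinPath_of_le (by linarith)
  have hρv : ∀ t ≥ 1 / 2, ρ t = v (2 * t - 1) := fun t ht => joinPath_of_ge huv (by linarith)
  have hm2 : MapsTo (fun t : ℝ => 2 * t) (Icc 0 1) (Icc 0 (1 + 1)) := fun t ht =>
    ⟨by linarith [ht.1], by linarith [ht.2]⟩
  have hρc : ContinuousOn ρ (Icc 0 1) :=
    (continuousOn_joinPath zero_le_one zero_le_one huv huc hvc).comp (by fun_prop) hm2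
  have hρi : InjOn ρ (Icc 0 1) := by
    have hj : InjOn (joinPath 1 u v) (Icc 0 (1 + 1)) := by
      refine injOn_joinPath huv hui hvi fun s hs t ht hst => ?_
      rcases hs.2.eq_or_lt with rfl | hs1
      · have := hvi (left_mem_Icc.2 zero_le_one) ⟨ht.1.le, ht.2⟩ (huv.symm.trans hst)
        exact ht.1.ne this
      · exact huK s ⟨hs.1, hs1⟩ (hst ▸ hvK t ⟨ht.1.le, ht.2⟩)
    intro t ht t' ht' htt
    linarith [hj (hm2 ht) (hm2 ht') htt]
  have hρ0 : ρ 0 = h 1 := by rw [hρu 0 (by norm_num), mul_zero, hu0]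
  have hρ1 : ρ 1 = p 1 := by
    rw [hρv 1 (by norm_num), hv]
    norm_num
  have hρU : ∀ t ∈ Ioc (0 : ℝ) 1, ρ t ∈ h '' ball 0 1 := by
    intro t ht
    rcases le_total t (1 / 2) with h1 | h1
    · rw [hρu t h1]
      exact huU _ ⟨by linarith [ht.1], by linarith⟩
    · rw [hρv t h1]
      exact hvU _ ⟨by linarith, by linarith [ht.2]⟩
  have hpρ : ∀ w ∈ Icc b 1, ∃ t ∈ Icc (0 : ℝ) 1, ρ t = p w := by
    intro w hw
    have hb' : 0 < 1 - b := sub_pos.2 hb1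
    have h0 : 0 ≤ (w - b) / (1 - b) := div_nonneg (by linarith [hw.1]) hb'.le
    have h1 : (w - b) / (1 - b) ≤ 1 := (div_le_one hb').2 (by linarith [hw.2])
    refine ⟨(1 + (w - b) / (1 - b)) / 2, ⟨by linarith, by linarith⟩, ?_⟩
    rw [hρv _ (by linarith), hv]
    dsimp only
    congr 1
    field_simp
    ring
  obtain ⟨k, hk, hkρ⟩ := hF.disc.exists_crosscut (l := 2) (s := 1) ⟨one_pos, one_lt_two⟩ hρc hρi
    (by rw [hρ0, circlePt_zero]) hρU
  obtain ⟨h₁, h₂, hcut⟩ := exists_isCut hF.disc one_pos one_lt_two two_pos hk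
  -- the rest of the edge starts on one side of the crosscut
  have hfar : (k '' Icc 1 2)ᶜ ∈ 𝓝 (p b) := by
    convert hk.compl_image_mem_nhds one_half_pos.le one_half_lt_one one_le_two using 2
    rw [hbq, hkρ _ (by norm_num), hρu _ le_rfl]
    norm_num
  obtain ⟨δ, hδ, hδk⟩ := Metric.mem_nhdsWithin_iff.1 (hp.continuousOn b hb hfar)
  obtain ⟨b', hb', hbb⟩ := exists_between (max_lt hb0 (sub_lt_self b hδ))
  obtain ⟨hb'0, hb'δ⟩ := max_lt_iff.1 hb'
  have hGU : p '' Ioo b' b ⊆ h '' ball 0 1 := by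
    rintro _ ⟨w, hw, rfl⟩
    exact hF.edgePath_mem hp he ⟨hb'0.trans hw.1, hw.2.trans hb1⟩
  have hGk : ∀ t ∈ Ioo (0 : ℝ) 2, k t ∉ p '' Ioo b' b := by
    rintro t ht ⟨w, hw, hwk⟩
    have hw1 : w ∈ Icc (0 : ℝ) 1 := ⟨(hb'0.trans hw.1).le, (hw.2.trans hb1).le⟩
    rcases le_or_gt t 1 with h1 | h1
    · rw [hkρ t h1] at hwk
      rcases lt_or_ge t (1 / 2) with h2 | h2
      · rw [hρu t h2.le] at hwk
        refine huK (2 * t) ⟨by linarith [ht.1], by linarith⟩ ?_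
        rw [← hwk]
        exact hKe e he.1 _ (hpe w hw1) (hGU ⟨w, hw, rfl⟩)
      · rw [hρv t h2] at hwk
        have ht2 : 2 * t - 1 ∈ Icc (0 : ℝ) 1 := ⟨by linarith, by linarith⟩
        have := hp.injOn hw1 (hmv' ht2) hwk
        linarith [(hmv ht2).1, hw.2]
    · refine hδk ⟨?_, hw1⟩ ⟨t, ⟨h1.le, ht.2.le⟩, hwk.symm⟩
      rw [mem_ball, Real.dist_eq, abs_lt]
      constructor <;> linarith [hw.1, hw.2]
  have key : ∀ (g : ℂ → ℂ) (κ : ℝ → ℂ) (L : ℝ), IsDisc g → 1 < L → g '' ball 0 1 ⊆ h '' ball 0 1 →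
      (∀ t ∈ Icc (0 : ℝ) 1, g (circlePt L t) = κ t) → (∀ t ∈ Ioo (0 : ℝ) 1, κ t ∈ ρ '' Ioo 0 1) →
      (∀ t ∈ Icc (0 : ℝ) 1, k t ∉ g '' ball 0 1) → Disjoint (g '' ball 0 1) (p '' Ioo b' b) →
      ∃ τ, ContinuousOn τ (Icc 0 1) ∧ InjOn τ (Icc 0 1) ∧ τ 0 = κ 0 ∧ τ 1 = κ 1 ∧
        (∀ t ∈ Ioo (0 : ℝ) 1, τ t ∈ h '' ball 0 1) ∧ (∀ t ∈ Ioo (0 : ℝ) 1, τ t ∉ P) ∧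
        ∀ e ∈ E, ∀ t ∈ Ioo (0 : ℝ) 1, τ t ∉ e := by
    intro g κ L hg hL hgU hgκ hκ hgk hgG
    have hQ := (hF.plane.isClosed_union (Q := P \ {h 1}) sdiff_subset
      (F := innerEdges E (h '' ball 0 1) \ {e}) fun f hf => hf.1.1).union
      (isCompact_Icc.image_of_continuousOn (hp.continuousOn.mono
        (Icc_subset_Icc le_rfl (hbb.trans hb1).le : Icc 0 b' ⊆ _))).isClosed
    obtain ⟨τ, hτ, hτK, -⟩ := hg.exists_lens one_pos hL one_pos hQ fun t ht => by
      rw [hgκ t (Ioo_subset_Icc_self ht)]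
      obtain ⟨t', ht', htt⟩ := hκ t ht
      rw [← htt]
      rcases lt_or_ge t' (1 / 2) with h2 | h2
      · rw [hρu t' h2.le]
        have := huK (2 * t') ⟨by linarith [ht'.1], by linarith⟩
        rintro ((h1 | h1) | ⟨w, hw, hwu⟩)
        · exact this (Or.inl h1)
        · obtain ⟨f, hf, h1⟩ := mem_iUnion₂.1 h1
          exact this (Or.inr (mem_iUnion₂.2 ⟨f, hf.1, h1⟩))
        · exact this (Or.inr (mem_iUnion₂.2 ⟨e, he, hwu ▸ hpe w ⟨hw.1, by linarith [hw.2]⟩⟩))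
      · rw [hρv t' h2]
        have ht2 : 2 * t' - 1 ∈ Icc (0 : ℝ) 1 := ⟨by linarith, by linarith [ht'.2]⟩
        have hvP : v (2 * t' - 1) ∉ P := hp.interior _ ⟨hb0.trans_le (hmv ht2).1, by
          nlinarith [ht'.2]⟩
        rintro ((h1 | h1) | ⟨w, hw, hwu⟩)
        · exact hvP h1.1
        · obtain ⟨f, hf, h1⟩ := mem_iUnion₂.1 h1
          exact hvP (hF.plane.inter f hf.1.1 e he.1 hf.2 ⟨h1, hpe _ (hmv' ht2)⟩)
        · have := hp.injOn ⟨hw.1, by linarith [hw.2]⟩ (hmv' ht2) hwu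
          linarith [(hmv ht2).1, hw.2]
    have hτU : ∀ t ∈ Ioo (0 : ℝ) 1, τ t ∈ h '' ball 0 1 := fun t ht => hgU (hτ.interior t ht)
    refine ⟨τ, hτ.continuousOn, hτ.injOn, by rw [hτ.source, hgκ 0 (by simp)],
      by rw [hτ.target, hgκ 1 (by simp)], hτU, fun t ht htP => ?_, fun f hf t ht htf => ?_⟩
    · exact hτK t ht (Or.inl (Or.inl (hPU _ htP (hτU t ht))))
    · by_cases hfe : f = e
      · rw [hfe, ← hp.image_eq] at htf
        obtain ⟨w, hw, hwt⟩ := htf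
        rcases le_or_gt w b' with h1 | h1
        · exact hτK t ht (Or.inr ⟨w, ⟨hw.1, h1⟩, hwt⟩)
        rcases lt_or_ge w b with h2 | h2
        · exact hgG.le_bot ⟨hτ.interior t ht, w, ⟨h1, h2⟩, hwt⟩
        · obtain ⟨t', ht', htw⟩ := hpρ w ⟨h2, hw.2⟩
          refine hgk t' ht' ?_
          rw [hkρ t' ht'.2, htw, hwt]
          exact hτ.interior t ht
      · exact hτK t ht (Or.inl (Or.inr (mem_iUnion₂.2 ⟨f, ⟨⟨hf, _, htf, hτU t ht⟩, hfe⟩, htf⟩)))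
  have hIoc : ∀ τ : ℝ → ℂ, τ 1 = p 1 → (∀ t ∈ Ioo (0 : ℝ) 1, τ t ∈ h '' ball 0 1) →
      ∀ t ∈ Ioc (0 : ℝ) 1, τ t ∈ h '' ball 0 1 := fun τ hτ1 hτ t ht => by
    rcases ht.2.eq_or_lt with rfl | h1
    · exact hτ1 ▸ hp1
    · exact hτ t ⟨ht.1, h1⟩
  rcases hcut.subset_or_subset hF.disc hk one_pos one_lt_two two_pos (isPreconnected_Ioo.image _
    (hp.continuousOn.mono fun w hw => ⟨(hb'0.trans hw.1).le, (hw.2.trans hb1).le⟩)) hGU hGk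
    with hsub | hsub
  · obtain ⟨hg, hgb, -, -⟩ := hcut.right.rotate (norm_circlePt (2 - 1 + 2) (2 - 1))
    obtain ⟨τ, hτ, hτi, hτ0, hτ1, hτU, hτP, hτE⟩ := key _ ρ (2 - 1 + 2) hg (by norm_num)
      (hgb ▸ hcut.tiling.right_subset) (fun t ht => by
        rw [← circlePt_add, hcut.right_cut t ⟨ht.1, by linarith [ht.2]⟩, hkρ t ht.2])
      (fun t ht => ⟨t, ht, rfl⟩) (fun t ht htg => hcut.right.disjoint.le_bot
        ⟨hgb ▸ htg, hcut.cut_mem_right ⟨ht.1, by linarith [ht.2]⟩⟩)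
      (hgb ▸ hcut.tiling.disjoint.symm.mono_right hsub)
    exact ⟨τ, hτ, hτi, hτ0.trans hρ0, by rw [hτ1, hρ1]; exact hp.target,
      hIoc τ (hτ1.trans hρ1) hτU, hτP, hτE⟩
  · obtain ⟨hg, hgb, -, -⟩ := hcut.left.rotate (norm_circlePt (1 + 2) (1 + 1))
    obtain ⟨τ, hτ, hτi, hτ0, hτ1, hτU, hτP, hτE⟩ := key _ (fun t => ρ (1 - t)) (1 + 2) hg
      (by norm_num) (hgb ▸ hcut.tiling.left_subset) (fun t ht => by
        rw [← circlePt_add, ← hkρ _ (by linarith [ht.1]),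
          ← hcut.left_cut _ ⟨by linarith [ht.2], by linarith [ht.1]⟩]
        congr 2
        ring)
      (fun t ht => ⟨1 - t, ⟨by linarith [ht.2], by linarith [ht.1]⟩, rfl⟩)
      (fun t ht htg => hcut.left.disjoint.le_bot
        ⟨hgb ▸ htg, hcut.cut_mem_left ⟨ht.1, by linarith [ht.2]⟩⟩)
      (hgb ▸ hcut.tiling.disjoint.mono_right hsub)
    have hrev : MapsTo (fun t : ℝ => 1 - t) (Icc 0 1) (Icc 0 1) := fun t ht =>
      ⟨by linarith [ht.2], by linarith [ht.1]⟩
    have hrev' : MapsTo (fun t : ℝ => 1 - t) (Ioo 0 1) (Ioo 0 1) := fun t ht =>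
      ⟨by linarith [ht.2], by linarith [ht.1]⟩
    have hτ1' : τ (1 - 1) = p 1 := by simpa [hρ1] using hτ0
    refine ⟨fun t => τ (1 - t), hτ.comp (by fun_prop) hrev, fun t ht t' ht' htt => ?_, ?_, ?_,
      hIoc _ hτ1' fun t ht => hτU _ (hrev' ht), fun t ht => hτP _ (hrev' ht),
      fun f hf t ht => hτE f hf _ (hrev' ht)⟩
    · linarith [hτi (hrev ht) (hrev ht') htt]
    · simpa [hρ0] using hτ1
    · change τ (1 - 1) ∈ P
      rw [hτ1']
      exact hp.target

/-- A digon with a free root contains an empty triangle whose sides are not edges. -/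
theorem IsFrame.exists_isSplit_of_digon (hF : IsFrame P E (1 + 1) h)
    (hfree : IsFree E (h '' ball 0 1) (h (circlePt (1 + 1 : ℕ) 0)))
    (hP : (P ∩ h '' ball 0 1).Nonempty) :
    ∃ k h₁ h₂, IsSplit P E 1 1 2 h k h₁ h₂ ∧ IsVoid P E (h₁ '' ball 0 1) ∧
      segPath k 0 '' Icc 0 1 ∉ E ∧ segPath k 1 '' Icc 0 1 ∉ E := by
  rw [circlePt_zero] at hfree
  obtain ⟨σ, hσ, hσi, hσ0, hσ1, hσU, hσP, hσE⟩ := hF.exists_spoke hfree hP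
  obtain ⟨k, hk, hkσ⟩ := hF.disc.exists_crosscut (l := 1 + (1 : ℕ)) (s := 3 / 2) (by norm_num) hσ hσi
    (by rw [hσ0, circlePt_zero]) hσU
  obtain ⟨h₁, h₂, hc⟩ := exists_isCut hF.disc (by norm_num) (by norm_num) two_pos hk
  have h1P := hF.one_mem
  obtain ⟨k', h₁', h₂', hsp, hv, h0, h1⟩ := hF.exists_isSplit_of_path hσ hσi hσ0 hσU
    (isSide_of_avoid (hσ0 ▸ h1P) hσ1 hσP hσE) (by norm_num) hkσ hc fun f hf _ hcl => hfree f hf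
      (closure_minimal (fun z hz => hz.1.1) (hF.plane.isClosed_edge hf.1) hcl)
  exact ⟨k', h₁', h₂', hsp, hv, by rw [h0]; exact image_notMem_of_avoid hσE, h1⟩

end Spoke

section Pieces
variable {P : Set ℂ} {E : Set (Set ℂ)} {j r m : ℕ} {h h₁ h₂ : ℂ → ℂ} {k : ℝ → ℂ}

lemma IsSplit.left_root (hs : IsSplit P E j r m h k h₁ h₂) {i : ℕ} (hi : i ≤ j) :
    h₁ (circlePt (j + m : ℕ) i) = h (circlePt (j + r : ℕ) i) := by
  push_cast
  exact hs.cut.left_arc i ⟨Nat.cast_nonneg i, by exact_mod_cast hi⟩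

lemma IsSplit.right_root (hs : IsSplit P E j r m h k h₁ h₂) {i : ℕ} (hi : i ≤ r) :
    h₂ (circlePt (r + m : ℕ) i) = h (circlePt (j + r : ℕ) (j + i)) := by
  have := hs.cut.right_arc i ⟨Nat.cast_nonneg i, by
    rw [add_sub_cancel_left]; exact_mod_cast hi⟩
  rw [add_sub_cancel_left] at this
  push_cast
  exact this

lemma IsSplit.left_tight (hs : IsSplit P E j r m h k h₁ h₂)
    {i : ℕ} (hi : i < j) (ht : IsTight P E (h '' ball 0 1) (side (j + r) h i)) :
    IsTight P E (h₁ '' ball 0 1) (side (j + m) h₁ i) := by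
  rw [hs.left_side_arc hi]
  exact ht.mono hs.cut.tiling.left_subset

lemma IsSplit.right_tight (hs : IsSplit P E j r m h k h₁ h₂)
    {i : ℕ} (hi : i < r) (ht : IsTight P E (h '' ball 0 1) (side (j + r) h (j + i))) :
    IsTight P E (h₂ '' ball 0 1) (side (r + m) h₂ i) := by
  rw [hs.right_side_arc hi]
  exact ht.mono hs.cut.tiling.right_subset

lemma IsFrame.isTight_of_mem {l i : ℕ} (hF : IsFrame P E l h) (hE : side l h i ∈ E) :
    IsTight P E (h '' ball 0 1) (side l h i) :=
  hF.plane.isTight_of_mem hE (Set.disjoint_left.2 fun _ => hF.notMem_of_mem_side)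

lemma segPath_zero (k : ℝ → ℂ) : segPath k 0 = k := by funext t; simp [segPath]

lemma IsFrame.isVoid_of_isTight (hF : IsFrame P E 2 h) (h0 : P ∩ h '' ball 0 1 = ∅)
    (ht : IsTight P E (h '' ball 0 1) (side 2 h 0)) : IsVoid P E (h '' ball 0 1) := by
  refine ⟨h0, eq_empty_iff_forall_notMem.2 fun e he => ?_⟩
  obtain ⟨p, hp, hp0, hp1⟩ := hF.exists_isEdgePath_of_digon h0 he
  obtain ⟨h₁, h₂, hs⟩ := IsFrame.exists_isSplit_of_edge (j := 1) (r := 1) hF one_pos one_pos he hp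
    hp0 (by simpa using hp1)
  have hep : e ∩ P = side 2 h 0 ∩ P := by
    rw [hp.inter_eq, hF.side_inter two_pos, hp0, hp1]
    simp
  have hside : (fun t => h (circlePt ((1 : ℕ) + (1 : ℕ)) t)) '' Icc 0 ((1 : ℕ) : ℝ) = side 2 h 0 := by
    rw [Nat.cast_one, one_add_one_eq_two]
    refine image_congr fun t _ => ?_
    simp [sidePath]
  have hb : h₁ '' sphere 0 1 = e ∪ side 2 h 0 := by
    rw [hs.cut.left_boundary hs.left_posR hs.cut_posR, hside, union_comm, Nat.cast_one, hp.image_eq]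
  obtain ⟨z, hz⟩ := ht e he hep h₁ hs.cut.left hb hs.cut.tiling.left_subset
  have : z ∈ P ∩ h '' ball 0 1 := ⟨hz.1, hs.cut.tiling.left_subset hz.2⟩
  rw [h0] at this
  exact this

end Pieces

lemma atMost_digon_zero (F : Set ℕ) : AtMost (IsState 0 2 ∅ F) 1 := by
  refine AtMost.of_equiv fun P E h P' E' h' hS hS' => ?_
  have key : ∀ {P E h}, IsState 0 2 ∅ F P E h → IsVoid P E (h '' ball 0 1) := by
    intro P E h hS
    refine hS.frame.isVoid_of_isTight ?_ (hS.tight 0 two_pos (by simp))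
    exact (ncard_eq_zero (hS.frame.plane.finite_points.subset inter_subset_left)).1 hS.ncard_eq
  exact DiscEquiv.of_isVoid hS.frame.disc hS'.frame.disc (key hS) (key hS')

/-- Dropping tightness at the last side at most doubles the number of discs. -/
lemma AtMost.weaken {n l c : ℕ} {F : Set ℕ} (hc : AtMost (IsState n l ∅ F) c) :
    AtMost (IsState n l {l - 1} F) (2 * c) := by
  rw [two_mul]
  set R : Set ℂ → Set (Set ℂ) → (ℂ → ℂ) → (ℂ → ℂ) → Prop := fun P E h b =>
    ∃ r, r + 1 = l ∧ IsDisc h ∧ ∃ k h₁, IsSplit P E 1 r 1 (shift l (l - 1) h) k h₁ b ∧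
      segPath k 0 '' Icc 0 1 ∈ E ∧ IsVoid P E (h₁ '' ball 0 1)
  have hglue : AtMost (fun P E h => ∃ b, IsState n l ∅ F P E b ∧ R P E h b) c := by
    refine hc.of_rel R (fun P E h h' => h') ?_
    rintro P E h b P' E' h' b' ⟨r, hr, hh, k, h₁, hs, hk, hv⟩ ⟨r', hr', hh', k', h₁', hs', hk', hv'⟩ H
    obtain rfl : r = r' := by omega
    refine DiscEquiv.of_shift hh hh' (hs.discEquiv hs' (fun s hsm => ?_)
      (DiscEquiv.of_isVoid hs.cut.left hs'.cut.left hv hv') H)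
    obtain rfl : s = 0 := by omega
    exact iff_of_true hk hk'
  refine (hc.or hglue).mono (fun P E h hS => ?_) le_rfl
  have hl := hS.frame.two_le
  obtain ⟨r, rfl⟩ : ∃ r, l = r + 1 := ⟨l - 1, by omega⟩
  rw [Nat.add_sub_cancel] at hS
  by_cases ht : IsTight P E (h '' ball 0 1) (side (r + 1) h r)
  · left
    refine ⟨hS.frame, hS.ncard_eq, fun i hi _ => ?_, hS.free⟩
    by_cases hir : i = r
    · rw [hir]; exact ht
    · exact hS.tight i hi hir
  right
  have hF := hS.frame
  obtain ⟨e, he, heA, d, hd, hdb, hdU, hdP⟩ : ∃ e ∈ innerEdges E (h '' ball 0 1),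
      e ∩ P = side (r + 1) h r ∩ P ∧ ∃ d, IsDisc d ∧ d '' sphere 0 1 = e ∪ side (r + 1) h r ∧
      d '' ball 0 1 ⊆ h '' ball 0 1 ∧ ¬ (P ∩ d '' ball 0 1).Nonempty := by
    simpa only [IsTight, not_forall, exists_prop] using ht
  set g := shift (r + 1) r h with hg
  have hFg : IsFrame P E (1 + r) g := by rw [add_comm]; exact hF.shift r
  have hgU : g '' ball 0 1 = h '' ball 0 1 := shift_ball hF.disc _ _
  have hg0 : g (circlePt (1 + r : ℕ) 0) = h (circlePt (r + 1 : ℕ) r) := by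
    rw [add_comm, hg, shift_circlePt, add_zero]
  have hg1 : g (circlePt (1 + r : ℕ) 1) = h (circlePt (r + 1 : ℕ) (r + 1)) := by
    rw [add_comm, hg, shift_circlePt]
  have hinter := heA.trans (hF.side_inter (i := r) (by omega))
  rw [← hg0, ← hg1] at hinter
  have hm0 : g (circlePt (1 + r : ℕ) 0) ∈ e ∩ P := hinter ▸ Or.inl rfl
  obtain ⟨p, hp, hp0⟩ := hF.plane.exists_isEdgePath_of_mem he.1 hm0.1 hm0.2
  have hp1 : p 1 = g (circlePt (1 + r : ℕ) 1) := by
    have : p 1 ∈ e ∩ P := hp.inter_eq ▸ Or.inr rfl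
    rw [hinter] at this
    rcases this with h' | h'
    · exact (hp.ne (hp0.trans h'.symm)).elim
    · exact h'
  have heg : e ∈ innerEdges E (g '' ball 0 1) := hgU.symm ▸ he
  obtain ⟨h₁, h₂, hs⟩ := hFg.exists_isSplit_of_edge one_pos (by omega) heg hp hp0
    (by rw [hp1, Nat.cast_one])
  have hside : (fun t => g (circlePt ((1 : ℕ) + (r : ℝ)) t)) '' Icc 0 ((1 : ℕ) : ℝ)
      = side (r + 1) h r := by
    rw [Nat.cast_one]
    refine image_congr fun t _ => ?_
    rw [sidePath, ← shift_circlePt (r + 1) r h, hg, Nat.cast_add, Nat.cast_one,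
      add_comm (1 : ℝ)]
  have hb : d '' sphere 0 1 = h₁ '' sphere 0 1 := by
    rw [hs.cut.left_boundary hs.left_posR hs.cut_posR, hside, hdb, union_comm, Nat.cast_one,
      hp.image_eq]
  have hball := hs.cut.left_eq_of_boundary hFg.disc hs.crosscut hs.left_posR hs.lt_add hs.cut_posR
    hd hb
  have hP0 : P ∩ h₁ '' ball 0 1 = ∅ := by rw [← hball]; exact not_nonempty_iff_eq_empty.1 hdP
  have hseg : segPath p 0 '' Icc 0 1 = e := by rw [segPath_zero, hp.image_eq]
  have hcut0 : side (1 + 1) h₁ 1 = e := by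
    simpa [hseg] using hs.left_side_cut (s := 0) one_pos
  have hvoid : IsVoid P E (h₁ '' ball 0 1) := by
    refine ⟨hP0, eq_empty_iff_forall_notMem.2 fun f hf => ?_⟩
    have hF1 : IsFrame P E 2 h₁ := hs.left_frame
    obtain ⟨q, hq, hq0, hq1⟩ := hF1.exists_isEdgePath_of_digon hP0 hf
    have hfe : f = e := by
      refine hF.plane.simple f hf.1 e he.1 ?_
      rw [hq.inter_eq, ← hcut0, hF1.side_inter one_lt_two, hq0, hq1, pair_comm]
      have h2 : circlePt (2 : ℕ) ((1 : ℕ) + 1) = circlePt (2 : ℕ) 0 := by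
        rw [circlePt_zero, Nat.cast_one, one_add_one_eq_two, Nat.cast_ofNat]
        exact circlePt_self two_pos
      rw [h2, Nat.cast_one]
    obtain ⟨z, hz, hz'⟩ := hf.2
    rw [hfe, ← hcut0] at hz
    exact hF1.notMem_of_mem_side hz hz'
  refine ⟨h₂, ⟨hs.right_frame, ?_, fun i hi _ => ?_, fun i hi hiF => ?_⟩, ?_⟩
  · have := hs.ncard_points_one
    rw [hP0, ncard_empty, zero_add, hgU, hS.ncard_eq] at this
    exact this.symm
  · by_cases hir : i < r
    · refine hs.right_tight hir ?_
      rw [hgU, add_comm 1 r, hg, side_shift (by omega), ← add_assoc, Nat.add_mod_left,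
        Nat.mod_eq_of_lt hi]
      exact hS.tight i hi (by rw [mem_singleton_iff]; omega)
    · obtain rfl : i = r := by omega
      refine hs.right_frame.isTight_of_mem ?_
      have := hs.right_side_cut (s := 0) one_pos
      rw [add_zero] at this
      rw [this, hseg]
      exact he.1
  · have h1 := hs.right_root (i := i) (by omega)
    have h2 : g (circlePt (1 + r : ℕ) ((1 : ℕ) + i)) = h (circlePt (r + 1 : ℕ) i) := by
      rw [add_comm 1 r, hg, shift_circlePt]
      have h3 : (r : ℝ) + ((1 : ℕ) + i) = i + (r + 1 : ℕ) := by push_cast; ring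
      rw [h3, circlePt_add_self]
      positivity
    rw [h1, h2]
    refine (hS.free i hi hiF).mono ?_
    rw [← hgU]
    exact hs.cut.tiling.right_subset
  · exact ⟨r, rfl, hF.disc, p, h₁, hs, hseg ▸ he.1, hvoid⟩

lemma shift_zero (l : ℕ) (h : ℂ → ℂ) : shift l 0 h = h := by
  funext z
  simp [shift, circlePt_zero]

/-- Counting discs which can be split into an empty piece and a piece from a bounded class. -/
lemma AtMost.of_isVoid {S T : Set ℂ → Set (Set ℂ) → (ℂ → ℂ) → Prop} {c j r m i : ℕ} {Q : ℕ → Prop}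
    (hT : AtMost T c) (hS : ∀ P E h, S P E h → IsDisc h ∧ ∃ k h₁ h₂,
      IsSplit P E j r m (shift (j + r) i h) k h₁ h₂ ∧ IsVoid P E (h₁ '' ball 0 1) ∧
      (∀ s < m, segPath k s '' Icc 0 1 ∈ E ↔ Q s) ∧ T P E h₂) : AtMost S c := by
  refine hT.of_rel (fun P E h b => IsDisc h ∧ ∃ k h₁,
    IsSplit P E j r m (shift (j + r) i h) k h₁ b ∧ IsVoid P E (h₁ '' ball 0 1) ∧
      ∀ s < m, segPath k s '' Icc 0 1 ∈ E ↔ Q s) (fun P E h hs => ?_) ?_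
  · grind
  · rintro P E h b P' E' h' b' ⟨hd, k, h₁, hs, hv, hQ⟩ ⟨hd', k', h₁', hs', hv', hQ'⟩ H
    exact DiscEquiv.of_shift hd hd' (hs.discEquiv hs'
      (fun s hsm => (hQ s hsm).trans (hQ' s hsm).symm)
      (DiscEquiv.of_isVoid hs.cut.left hs'.cut.left hv hv') H)

/-- Discs with a free root. -/
lemma AtMost.free {n r c : ℕ} (hr : 0 < r) (hc : AtMost (IsState n (r + 1) ∅ ∅) c) :
    AtMost (IsState n (2 + r) ∅ {0}) (2 * c) := by
  refine hc.weaken.of_isVoid (j := 2) (r := r) (m := 1) (i := r + 1) (Q := fun _ => False)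
    fun P E h hS => ⟨hS.frame.disc, ?_⟩
  have hF := hS.frame.shift (r + 1)
  have hU := shift_ball hS.frame.disc (2 + r) (r + 1)
  have hfree : IsFree E (shift (2 + r) (r + 1) h '' ball 0 1)
      (shift (2 + r) (r + 1) h (circlePt (2 + r : ℕ) 1)) := by
    have h1 : ((r + 1 : ℕ) : ℝ) + 1 = (0 : ℕ) + (2 + r : ℕ) := by push_cast; ring
    rw [hU, shift_circlePt, h1, circlePt_add_self (by positivity)]
    exact hS.free 0 (by omega) rfl
  obtain ⟨k, h₁, h₂, hs, hv, hk⟩ := hF.exists_isSplit_of_isFree hr hfree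
  refine ⟨k, h₁, h₂, hs, hv, fun s hsm => ?_, hs.right_frame, ?_, fun i hi hiW => ?_, by simp⟩
  · obtain rfl : s = 0 := by omega
    exact iff_false_intro hk
  · have := hs.ncard_points_one
    rw [hv.1, ncard_empty, zero_add, hU, hS.ncard_eq] at this
    exact this.symm
  · have hir : i < r := by
      rw [mem_singleton_iff] at hiW
      omega
    refine hs.right_tight hir ?_
    rw [hU, side_shift (by omega)]
    exact hS.tight _ (Nat.mod_lt _ (by omega)) (by simp)

/-- Digons with a free root. -/
lemma AtMost.free_digon {n c : ℕ} (hc : AtMost (IsState n 2 ∅ ∅) c) :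
    AtMost (IsState (n + 1) 2 ∅ {0}) (4 * c) := by
  have h3 : AtMost (IsState n 3 ∅ {1}) (2 * c) := by
    have hA : AtMost (IsState n 3 ∅ {0}) (2 * c) := AtMost.free (r := 1) one_pos hc
    refine hA.of_rel (fun P E h b => IsDisc h ∧ b = shift 3 1 h)
      (fun P E h hS => ⟨shift 3 1 h, ⟨hS.frame.shift 1, ?_, fun i hi _ => ?_, ?_⟩, hS.frame.disc, rfl⟩) ?_
    · rw [shift_ball hS.frame.disc]; exact hS.ncard_eq
    · rw [shift_ball hS.frame.disc, side_shift three_pos]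
      exact hS.tight _ (Nat.mod_lt _ three_pos) (by simp)
    · rintro i - rfl
      rw [shift_ball hS.frame.disc, shift_circlePt]
      simpa using hS.free 1 (by omega) rfl
    · rintro P E h _ P' E' h' _ ⟨hd, rfl⟩ ⟨hd', rfl⟩ H
      exact DiscEquiv.of_shift hd hd' H
  have h4 : AtMost (IsState n 3 {2} {1}) (4 * c) := by
    have := h3.weaken
    rwa [← mul_assoc] at this
  refine h4.of_isVoid (j := 1) (r := 1) (m := 2) (i := 0) (Q := fun _ => False)
    fun P E h hS => ⟨hS.frame.disc, ?_⟩
  rw [shift_zero]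
  have hfree : IsFree E (h '' ball 0 1) (h (circlePt (1 + 1 : ℕ) 0)) := by
    simpa using hS.free 0 (by omega) rfl
  have hne : (P ∩ h '' ball 0 1).Nonempty := by
    apply nonempty_of_ncard_ne_zero
    rw [hS.ncard_eq]
    omega
  obtain ⟨k, h₁, h₂, hs, hv, hk0, hk1⟩ :=
    IsFrame.exists_isSplit_of_digon (h := h) hS.frame hfree hne
  have hroot : h₂ (circlePt (1 + 2 : ℕ) 1) = h (circlePt (1 + 1 : ℕ) 0) := by
    have := hs.right_root (i := 1) le_rfl
    rw [Nat.cast_one] at this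
    have h2 : (1 : ℝ) + 1 = ((1 + 1 : ℕ) : ℝ) := by push_cast; ring
    rw [this, circlePt_zero, h2, circlePt_self (by positivity)]
  have hfree2 : IsFree E (h₂ '' ball 0 1) (h₂ (circlePt (1 + 2 : ℕ) 1)) := by
    rw [hroot]
    exact hfree.mono hs.cut.tiling.right_subset
  refine ⟨k, h₁, h₂, hs, hv, fun s hsm => ?_, hs.right_frame, ?_, fun i hi hiW => ?_, ?_⟩
  · grind
  · have := hs.ncard_points_two
    rw [hv.1, ncard_empty, zero_add, hS.ncard_eq] at this
    omega
  · obtain rfl | rfl : i = 0 ∨ i = 1 := by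
      rw [mem_singleton_iff] at hiW
      omega
    · exact hs.right_tight one_pos (hS.tight 1 (by omega) (by simp))
    · refine hfree2.isTight ⟨0, by simp, by simp [sidePath]⟩ ?_
      have := hs.right_frame.root_mem (i := 1) (by omega)
      rwa [Nat.cast_one] at this
  · rintro i - rfl
    rw [Nat.cast_one]
    exact hfree2

/-- Discs in which the root `0` is joined to an inner point before anything else. -/
lemma AtMost.triangle {n r c : ℕ} (hc : AtMost (IsState n (r + 2) ∅ ∅) c) :
    AtMost (fun P E h => IsState (n + 1) (1 + r) ∅ ∅ P E h ∧ ∃ k h₁ h₂,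
      IsSplit P E 1 r 2 h k h₁ h₂ ∧ IsVoid P E (h₁ '' ball 0 1) ∧
      segPath k 0 '' Icc 0 1 ∈ E ∧ segPath k 1 '' Icc 0 1 ∉ E) (2 * c) := by
  refine hc.weaken.of_isVoid (j := 1) (r := r) (m := 2) (i := 0) (Q := fun s => s = 0) ?_
  rintro P E h ⟨hS, k, h₁, h₂, hs, hv, hk0, hk1⟩
  refine ⟨hS.frame.disc, k, h₁, h₂, (shift_zero (1 + r) h).symm ▸ hs, hv, fun s hsm => ?_,
    hs.right_frame, ?_, fun i hi hiW => ?_, by simp⟩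
  · grind
  · have := hs.ncard_points_two
    rw [hv.1, ncard_empty, zero_add, hS.ncard_eq] at this
    omega
  · rw [mem_singleton_iff] at hiW
    by_cases hir : i < r
    · exact hs.right_tight hir (hS.tight (1 + i) (by omega) (by simp))
    · obtain rfl : i = r := by omega
      refine hs.right_frame.isTight_of_mem ?_
      have := hs.right_side_cut (s := 0) two_pos
      rw [add_zero] at this
      rw [this]
      exact hk0

/-- Discs in which the root `0` is joined to the root `j` before anything else. -/
lemma AtMost.chord {n₁ n₂ j r c d : ℕ} (hc : AtMost (IsState n₁ (j + 1) ∅ {0}) c)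
    (hd : AtMost (IsState n₂ (r + 1) ∅ ∅) d) :
    AtMost (fun P E h => ∃ k h₁ h₂, IsSplit P E j r 1 h k h₁ h₂ ∧ segPath k 0 '' Icc 0 1 ∈ E ∧
      IsState n₁ (j + 1) ∅ {0} P E h₁ ∧ IsState n₂ (r + 1) ∅ ∅ P E h₂) (c * d) := by
  refine hc.prod hd (fun P E h a b => ∃ k, IsSplit P E j r 1 h k a b ∧ segPath k 0 '' Icc 0 1 ∈ E)
    ?_ ?_
  · grind
  · rintro P E h a b P' E' h' a' b' ⟨k, hs, hk⟩ ⟨k', hs', hk'⟩ H1 H2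
    refine hs.discEquiv hs' (fun s hsm => ?_) H1 H2
    obtain rfl : s = 0 := by omega
    exact iff_of_true hk hk'

lemma IsState.chord {n j r : ℕ} {P : Set ℂ} {E : Set (Set ℂ)} {h h₁ h₂ : ℂ → ℂ} {k : ℝ → ℂ}
    (hS : IsState n (j + r) ∅ ∅ P E h) (hs : IsSplit P E j r 1 h k h₁ h₂)
    (hk : segPath k 0 '' Icc 0 1 ∈ E)
    (hfree : IsFree E (h₁ '' ball 0 1) (h (circlePt (j + r : ℕ) 0))) :
    ∃ n₁ n₂, n₁ + n₂ = n ∧ (j = 1 → n₁ ≠ 0) ∧ (r = 1 → n₂ ≠ 0) ∧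
      IsState n₁ (j + 1) ∅ {0} P E h₁ ∧ IsState n₂ (r + 1) ∅ ∅ P E h₂ := by
  have hfin : ∀ U, (P ∩ U).Finite := fun U => hS.frame.plane.finite_points.subset inter_subset_left
  have hinner : segPath k 0 '' Icc 0 1 ∈ innerEdges E (h '' ball 0 1) :=
    ⟨hk, _, ⟨1 / 2, by norm_num, rfl⟩, hs.seg_mem one_pos (by norm_num)⟩
  have hkimg : k '' Icc 0 ((1 : ℕ) : ℝ) = segPath k 0 '' Icc 0 1 := by rw [segPath_zero, Nat.cast_one]
  have hcut1 := hs.left_side_cut (s := 0) one_pos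
  have hcut2 := hs.right_side_cut (s := 0) one_pos
  simp only [Nat.sub_self, add_zero] at hcut1 hcut2
  refine ⟨_, _, hs.ncard_points_one.symm.trans hS.ncard_eq, ?_, ?_,
    ⟨hs.left_frame, rfl, fun i hi _ => ?_, ?_⟩, hs.right_frame, rfl, fun i hi _ => ?_, by simp⟩
  · rintro rfl
    refine ((ncard_pos (hfin _)).2 (hS.tight 0 (by omega) (by simp) _ hinner ?_ h₁ hs.cut.left ?_
      hs.cut.tiling.left_subset)).ne'
    · rw [← hcut1, hs.left_frame.side_inter (by omega), hS.frame.side_inter (by omega), pair_comm]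
      congr 2
      · have : (((1 : ℕ) : ℝ) + 1) = (0 : ℕ) + (1 + 1 : ℕ) := by push_cast; ring
        rw [this, circlePt_add_self (by positivity), hs.left_root (i := 0) (by omega)]
      · rw [hs.left_root (i := 1) (by omega)]
        simp
    · rw [hs.cut.left_boundary hs.left_posR hs.cut_posR, hkimg, union_comm]
      congr 1
      rw [Nat.cast_one]
      refine image_congr fun t _ => ?_
      simp [sidePath]
  · rintro rfl
    refine ((ncard_pos (hfin _)).2 (hS.tight j (by omega) (by simp) _ hinner ?_ h₂ hs.cut.right ?_
      hs.cut.tiling.right_subset)).ne'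
    · rw [← hcut2, hs.right_frame.side_inter (by omega), hS.frame.side_inter (by omega), pair_comm]
      congr 2
      · have : (((1 : ℕ) : ℝ) + 1) = (0 : ℕ) + (1 + 1 : ℕ) := by push_cast; ring
        rw [this, circlePt_add_self (by positivity), hs.right_root (i := 0) (by omega)]
        simp
      · rw [hs.right_root (i := 1) (by omega)]
        simp
    · rw [hs.cut.right_boundary hs.lt_add hs.cut_posR, hkimg, union_comm]
      congr 1
      rw [side]
      have : sidePath (j + 1) h j = (fun t => h (circlePt ((j : ℝ) + (1 : ℕ)) t)) ∘ (fun t => j + t) := by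
        funext t
        simp [sidePath]
      rw [this, image_comp]
      simp [add_comm]
  · by_cases hij : i < j
    · exact hs.left_tight hij (hS.tight i (by omega) (by simp))
    · obtain rfl : i = j := by omega
      exact hs.left_frame.isTight_of_mem (hcut1 ▸ hk)
  · rintro i - rfl
    rw [hs.left_root (i := 0) (by omega), Nat.cast_zero]
    exact hfree
  · by_cases hir : i < r
    · exact hs.right_tight hir (hS.tight (j + i) (by omega) (by simp))
    · obtain rfl : i = r := by omega
      exact hs.right_frame.isTight_of_mem (hcut2 ▸ hk)

/-- The recursion for the number of discs with `1 + r` sides and `n` inner points. -/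
theorem atMost_isState {n r : ℕ} {a b : ℕ → ℕ → ℕ}
    (hb : AtMost (IsState n (1 + r) ∅ {0}) (b n (1 + r)))
    (hB : ∀ n', n = n' + 1 → AtMost (IsState n' (r + 2) ∅ ∅) (a n' (r + 2)))
    (hC : ∀ x < r, ∀ y ≤ n, ¬ (x = 0 ∧ y = 0) → ¬ (x + 1 = r ∧ y = n) →
      AtMost (IsState y (x + 2) ∅ {0}) (b y (x + 2)) ∧
      AtMost (IsState (n - y) (r - x + 1) ∅ ∅) (a (n - y) (r - x + 1))) :
    AtMost (IsState n (1 + r) ∅ ∅) (b n (1 + r) + (if n = 0 then 0 else 2 * a (n - 1) (r + 2)) +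
      ∑ x ∈ Finset.range r, ∑ y ∈ Finset.range (n + 1),
        if (x = 0 ∧ y = 0) ∨ (x + 1 = r ∧ y = n) then 0
        else b y (x + 2) * a (n - y) (r - x + 1)) := by
  set Q₁ : Set ℂ → Set (Set ℂ) → (ℂ → ℂ) → Prop := fun P E h => IsState n (1 + r) ∅ ∅ P E h ∧
    ∃ k h₁ h₂, IsSplit P E 1 r 2 h k h₁ h₂ ∧ IsVoid P E (h₁ '' ball 0 1) ∧
      segPath k 0 '' Icc 0 1 ∈ E ∧ segPath k 1 '' Icc 0 1 ∉ E
  have h1 : AtMost Q₁ (if n = 0 then 0 else 2 * a (n - 1) (r + 2)) := by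
    split_ifs with h0
    · refine AtMost.of_isEmpty ?_
      rintro P E h ⟨hS, k, h₁, h₂, hs, -⟩
      have := hs.ncard_points_two
      rw [hS.ncard_eq] at this
      omega
    · obtain ⟨n', rfl⟩ := Nat.exists_eq_succ_of_ne_zero h0
      exact (hB n' rfl).triangle
  set Q₂ : ℕ → ℕ → Set ℂ → Set (Set ℂ) → (ℂ → ℂ) → Prop := fun x y P E h =>
    ¬ ((x = 0 ∧ y = 0) ∨ (x + 1 = r ∧ y = n)) ∧ ∃ k h₁ h₂, IsSplit P E (x + 1) (r - x) 1 h k h₁ h₂ ∧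
      segPath k 0 '' Icc 0 1 ∈ E ∧ IsState y (x + 1 + 1) ∅ {0} P E h₁ ∧
      IsState (n - y) (r - x + 1) ∅ ∅ P E h₂
  have h2 : ∀ x ∈ Finset.range r, ∀ y ∈ Finset.range (n + 1), AtMost (Q₂ x y)
      (if (x = 0 ∧ y = 0) ∨ (x + 1 = r ∧ y = n) then 0 else b y (x + 2) * a (n - y) (r - x + 1)) := by
    intro x hx y hy
    rw [Finset.mem_range] at hx hy
    split_ifs with h0
    · exact AtMost.of_isEmpty fun P E h hq => hq.1 h0
    · rw [not_or] at h0
      obtain ⟨hc, hd⟩ := hC x hx y (by omega) h0.1 h0.2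
      exact (hc.chord hd).mono (fun P E h hq => hq.2) le_rfl
  refine ((hb.or h1).or (AtMost.exists_mem (Finset.range r) fun x hx =>
    AtMost.exists_mem (Finset.range (n + 1)) fun y hy => h2 x hx y hy)).mono
    (fun P E h hS => ?_) le_rfl
  by_cases hfree : IsFree E (h '' ball 0 1) (h (circlePt (1 + r : ℕ) 0))
  · left; left
    refine ⟨hS.frame, hS.ncard_eq, hS.tight, ?_⟩
    rintro i - rfl
    simpa using hfree
  rcases hS.frame.exists_isSplit_of_not_isFree hfree with
    ⟨j, r', k, h₁, h₂, hjr, hs, hk, hf⟩ | hB'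
  · right
    rw [← hjr] at hS hf
    obtain ⟨n₁, n₂, hn, hn1, hn2, hS₁, hS₂⟩ := hS.chord hs hk hf
    have hj := hs.left_pos
    have hr' := hs.right_pos
    obtain ⟨x, rfl⟩ : ∃ x, j = x + 1 := ⟨j - 1, by omega⟩
    have e1 : r - x = r' := by omega
    have e2 : n - n₁ = n₂ := by omega
    refine ⟨x, Finset.mem_range.2 (by omega), n₁, Finset.mem_range.2 (by omega), ?_, k, h₁, h₂, ?_⟩
    · grind
    · rw [e1, e2]
      exact ⟨hs, hk, hS₁, hS₂⟩
  · left; right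
    exact ⟨hS, hB'⟩

/-! ### The numerical recursion -/

lemma sum_range_conv_le {f g : ℕ → ℝ} (hf : ∀ n, 0 ≤ f n) (hg : ∀ n, 0 ≤ g n) (K : ℕ) :
    ∑ n ∈ Finset.range K, ∑ y ∈ Finset.range (n + 1), f y * g (n - y) ≤
      (∑ n ∈ Finset.range K, f n) * ∑ n ∈ Finset.range K, g n := by
  rw [Finset.sum_range_diag_flip K fun y z => f y * g z, Finset.sum_mul_sum]
  refine Finset.sum_le_sum fun i _ => Finset.sum_le_sum_of_subset_of_nonneg
    (Finset.range_mono (Nat.sub_le _ _)) fun j _ _ => mul_nonneg (hf _) (hg _)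

/-- A supersolution of the recursion at `1 / 75`. -/
noncomputable def superSol (m : ℕ) : ℝ := (1 / 75) * (75 / 13) ^ (m + 2) * (4 * catalan m - catalan (m + 1))

lemma succ_catalan_le (m : ℕ) : (catalan (m + 1) : ℝ) ≤ 4 * catalan m := by
  have h1 := succ_mul_catalan_eq_centralBinom m
  have h2 := succ_mul_catalan_eq_centralBinom (m + 1)
  have h3 := Nat.succ_mul_centralBinom_succ m
  have h4 : (m + 2) * catalan (m + 1) ≤ (m + 2) * (4 * catalan m) := by
    rw [← h1] at h3
    rw [← h2] at h3
    have : (m + 1) * ((m + 2) * catalan (m + 1)) ≤ (m + 1) * ((m + 2) * (4 * catalan m)) := by grind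
    exact Nat.le_of_mul_le_mul_left this (Nat.succ_pos m)
  exact_mod_cast Nat.le_of_mul_le_mul_left h4 (by omega)

lemma superSol_nonneg (m : ℕ) : 0 ≤ superSol m :=
  mul_nonneg (by positivity) (sub_nonneg.2 (succ_catalan_le m))

lemma catalan_conv (m : ℕ) : ∑ x ∈ Finset.range (m + 1), (catalan x : ℝ) * catalan (m - x) =
    catalan (m + 1) := by
  rw [catalan_succ, Finset.sum_range]
  push_cast
  rfl

lemma superSol_conv (m : ℕ) : ∑ x ∈ Finset.range (m + 1), superSol x * superSol (m - x) =
    (1 / 75) ^ 2 * (75 / 13) ^ (m + 4) * (24 * catalan (m + 1) - 10 * catalan (m + 2) + catalan (m + 3)) := by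
  have h1 := catalan_conv m
  have h2 := catalan_conv (m + 1)
  have h3 := catalan_conv (m + 1)
  have h4 := catalan_conv (m + 2)
  rw [Finset.sum_range_succ] at h2
  rw [Finset.sum_range_succ'] at h3
  rw [Finset.sum_range_succ, Finset.sum_range_succ'] at h4
  simp only [Nat.sub_self, catalan_zero, Nat.cast_one, mul_one, one_mul, Nat.sub_zero,
    Nat.add_sub_add_right] at h2 h3 h4
  have : ∀ x ∈ Finset.range (m + 1), superSol x * superSol (m - x) =
      (1 / 75) ^ 2 * (75 / 13) ^ (m + 4) * (16 * ((catalan x : ℝ) * catalan (m - x)) -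
        4 * ((catalan x : ℝ) * catalan (m + 1 - x)) -
        4 * ((catalan (x + 1) : ℝ) * catalan (m - x)) + (catalan (x + 1) : ℝ) * catalan (m + 1 - x)) := by
    intro x hx
    rw [Finset.mem_range] at hx
    have e : m - x + 1 = m + 1 - x := by omega
    have e2 : (75 / 13 : ℝ) ^ (m + 4) = (75 / 13) ^ (x + 2) * (75 / 13) ^ (m - x + 2) := by
      rw [← pow_add]; congr 1; omega
    rw [superSol, superSol, e, e2]
    ring
  rw [Finset.sum_congr rfl this, ← Finset.mul_sum]
  simp only [Finset.sum_add_distrib, Finset.sum_sub_distrib, ← Finset.mul_sum]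
  have e : ∀ x ∈ Finset.range (m + 1), (catalan (x + 1) : ℝ) * catalan (m + 2 - (x + 1)) =
      (catalan (x + 1) : ℝ) * catalan (m + 1 - x) := fun x _ => by
    rw [show m + 2 - (x + 1) = m + 1 - x by omega]
  rw [Finset.sum_congr rfl e] at h4
  congr 1
  linear_combination 16 * h1 - 4 * h2 - 4 * h3 + h4

lemma superSol_succ (m : ℕ) : 2 * (1 / 75) * superSol (m + 2) + 4 * (1 / 75) * superSol 0 * superSol (m + 1) +
    2 * ∑ x ∈ Finset.range (m + 1), superSol x * superSol (m - x) ≤ superSol (m + 1) := by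
  have h0 : superSol 0 = 225 / 169 := by norm_num [superSol, catalan_one]
  have hc := superSol_nonneg (m + 1)
  rw [superSol_conv, h0]
  have : 2 * (1 / 75) * superSol (m + 2) + 2 * ((1 / 75) ^ 2 * (75 / 13) ^ (m + 4) * (24 * catalan (m + 1) -
      10 * catalan (m + 2) + catalan (m + 3))) = 12 / 13 * superSol (m + 1) := by
    simp only [superSol, pow_add]
    ring
  linarith

lemma superSol_zero : 1 + 2 * (1 / 75) * superSol 1 + 4 * (1 / 75) * superSol 0 * superSol 0 ≤ superSol 0 := by
  norm_num [superSol, catalan_one, catalan_two]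

/-- Solutions of the recursion grow at most like `75 ^ n`. -/
theorem sum_le_superSol {a : ℕ → ℕ → ℝ} (h0 : ∀ n m, 0 ≤ a n m)
    (ha : ∀ n m, a n m ≤ (if m = 0 ∧ n = 0 then 1 else 0) + (if n = 0 then 0 else 2 * a (n - 1) (m + 1)) +
      ∑ y ∈ Finset.range n, 4 * a y 0 * a (n - 1 - y) m +
      ∑ x ∈ Finset.range m, ∑ y ∈ Finset.range (n + 1), 2 * a y x * a (n - y) (m - 1 - x)) (K m : ℕ) :
    ∑ n ∈ Finset.range K, a n m * (1 / 75) ^ n ≤ superSol m := by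
  induction K generalizing m with
  | zero => simpa using superSol_nonneg m
  | succ K ihK =>
  induction m using Nat.strong_induction_on with
  | _ m ihm =>
  set z : ℝ := 1 / 75 with hz
  have hz0 : 0 < z := by norm_num [hz]
  set S : ℕ → ℕ → ℝ := fun K m => ∑ n ∈ Finset.range K, a n m * z ^ n with hS
  have hw : ∀ n m, 0 ≤ a n m * z ^ n := fun n m => mul_nonneg (h0 n m) (pow_nonneg hz0.le n)
  have hS0 : ∀ K m, 0 ≤ S K m := fun K m => Finset.sum_nonneg fun n _ => hw n m
  have key : S (K + 1) m ≤ (if m = 0 then 1 else 0) + 2 * z * S K (m + 1) + 4 * z * (S K 0 * S K m) +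
      2 * ∑ x ∈ Finset.range m, S (K + 1) x * S (K + 1) (m - 1 - x) := by
    have t1 : ∑ n ∈ Finset.range (K + 1), (if m = 0 ∧ n = 0 then 1 else 0) * z ^ n =
        if m = 0 then 1 else 0 := by
      rw [Finset.sum_range_succ']
      simp
    have t2 : ∑ n ∈ Finset.range (K + 1), (if n = 0 then 0 else 2 * a (n - 1) (m + 1)) * z ^ n =
        2 * z * S K (m + 1) := by
      rw [Finset.sum_range_succ', hS, Finset.mul_sum]
      simp only [Nat.add_eq_zero_iff, one_ne_zero, and_false, if_false, Nat.add_sub_cancel, if_true,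
        zero_mul, add_zero]
      exact Finset.sum_congr rfl fun n _ => by ring
    have t3 : ∑ n ∈ Finset.range (K + 1), (∑ y ∈ Finset.range n, 4 * a y 0 * a (n - 1 - y) m) * z ^ n ≤
        4 * z * (S K 0 * S K m) := by
      rw [Finset.sum_range_succ']
      have := sum_range_conv_le (fun n => hw n 0) (fun n => hw n m) K
      refine le_trans (le_of_eq ?_) (mul_le_mul_of_nonneg_left this (by positivity : 0 ≤ 4 * z))
      simp only [Finset.range_zero, Finset.sum_empty, zero_mul, add_zero, Nat.add_sub_cancel]
      rw [Finset.mul_sum]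
      refine Finset.sum_congr rfl fun n _ => ?_
      rw [Finset.sum_mul, Finset.mul_sum]
      refine Finset.sum_congr rfl fun y hy => ?_
      rw [Finset.mem_range] at hy
      rw [show z ^ (n + 1) = z * (z ^ y * z ^ (n - y)) by rw [← pow_add, ← pow_succ']; congr 1; omega]
      ring
    have t4 : ∑ n ∈ Finset.range (K + 1), (∑ x ∈ Finset.range m, ∑ y ∈ Finset.range (n + 1),
        2 * a y x * a (n - y) (m - 1 - x)) * z ^ n ≤
        2 * ∑ x ∈ Finset.range m, S (K + 1) x * S (K + 1) (m - 1 - x) := by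
      simp only [Finset.sum_mul]
      rw [Finset.sum_comm, Finset.mul_sum]
      refine Finset.sum_le_sum fun x _ => ?_
      have := sum_range_conv_le (fun n => hw n x) (fun n => hw n (m - 1 - x)) (K + 1)
      refine le_trans (le_of_eq ?_) (mul_le_mul_of_nonneg_left this zero_le_two)
      rw [Finset.mul_sum]
      refine Finset.sum_congr rfl fun n _ => ?_
      rw [Finset.mul_sum]
      refine Finset.sum_congr rfl fun y hy => ?_
      rw [Finset.mem_range] at hy
      rw [show z ^ n = z ^ y * z ^ (n - y) by rw [← pow_add]; congr 1; omega]
      ring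
    calc S (K + 1) m ≤ ∑ n ∈ Finset.range (K + 1), ((if m = 0 ∧ n = 0 then 1 else 0) +
          (if n = 0 then 0 else 2 * a (n - 1) (m + 1)) +
          ∑ y ∈ Finset.range n, 4 * a y 0 * a (n - 1 - y) m + ∑ x ∈ Finset.range m,
            ∑ y ∈ Finset.range (n + 1), 2 * a y x * a (n - y) (m - 1 - x)) * z ^ n :=
        Finset.sum_le_sum fun n _ => mul_le_mul_of_nonneg_right (ha n m) (pow_nonneg hz0.le n)
      _ ≤ _ := by
        simp only [add_mul, Finset.sum_add_distrib]
        rw [t1, t2]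
        exact add_le_add (add_le_add le_rfl t3) t4
  refine key.trans ?_
  have e1 : 2 * z * S K (m + 1) ≤ 2 * z * superSol (m + 1) :=
    mul_le_mul_of_nonneg_left (ihK _) (by positivity)
  have e2 : 4 * z * (S K 0 * S K m) ≤ 4 * z * (superSol 0 * superSol m) :=
    mul_le_mul_of_nonneg_left (mul_le_mul (ihK 0) (ihK m) (hS0 K m) (superSol_nonneg 0)) (by positivity)
  have e3 : ∑ x ∈ Finset.range m, S (K + 1) x * S (K + 1) (m - 1 - x) ≤
      ∑ x ∈ Finset.range m, superSol x * superSol (m - 1 - x) := by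
    refine Finset.sum_le_sum fun x hx => ?_
    rw [Finset.mem_range] at hx
    exact mul_le_mul (ihm x hx) (ihm _ (by omega)) (hS0 _ _) (superSol_nonneg x)
  rcases m with _ | m
  · have := superSol_zero
    rw [← hz] at this
    simp only [Finset.range_zero, Finset.sum_empty, if_true] at *
    linarith
  · have := superSol_succ m
    rw [← hz] at this
    simp only [Nat.add_eq_zero_iff, one_ne_zero, and_false, if_false, Nat.add_sub_cancel] at *
    linarith

/-! ### Counting discs -/

/-- The least positive bound for the number of classes of discs with `l` sides and `n` inner points. -/
noncomputable def stateCount (n l : ℕ) : ℕ := sInf {c | AtMost (IsState n l ∅ ∅) c ∧ 1 ≤ c}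

/-- A bound for the number of classes of discs with a free root. -/
noncomputable def freeCount (n l : ℕ) : ℕ :=
  if l = 2 then (if n = 0 then 1 else 4 * stateCount (n - 1) 2) else 2 * stateCount n (l - 1)

lemma one_le_of_atMost {n l c : ℕ} (h : AtMost (IsState n l ∅ ∅) c) (hc : 1 ≤ c) :
    AtMost (IsState n l ∅ ∅) (stateCount n l) ∧ 1 ≤ stateCount n l ∧ stateCount n l ≤ c :=
  ⟨(Nat.sInf_mem (s := {c | AtMost (IsState n l ∅ ∅) c ∧ 1 ≤ c}) ⟨c, h, hc⟩).1,
    (Nat.sInf_mem (s := {c | AtMost (IsState n l ∅ ∅) c ∧ 1 ≤ c}) ⟨c, h, hc⟩).2,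
    Nat.sInf_le ⟨h, hc⟩⟩

/-- The right hand side of the recursion. -/
noncomputable def recBound (n r : ℕ) : ℕ :=
  freeCount n (1 + r) + (if n = 0 then 0 else 2 * stateCount (n - 1) (r + 2)) +
      ∑ x ∈ Finset.range r, ∑ y ∈ Finset.range (n + 1),
        if (x = 0 ∧ y = 0) ∨ (x + 1 = r ∧ y = n) then 0
        else freeCount y (x + 2) * stateCount (n - y) (r - x + 1)

lemma atMost_free {n l : ℕ} (hl : 2 ≤ l)
    (h : ∀ n' l', 2 ≤ l' → n' < n ∨ (n' = n ∧ l' < l) →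
      AtMost (IsState n' l' ∅ ∅) (stateCount n' l') ∧ 1 ≤ stateCount n' l') :
    AtMost (IsState n l ∅ {0}) (freeCount n l) ∧ 1 ≤ freeCount n l := by
  rw [freeCount]
  split_ifs with h1 h2
  · subst h1 h2
    exact ⟨atMost_digon_zero _, le_rfl⟩
  · subst h1
    obtain ⟨n', rfl⟩ := Nat.exists_eq_succ_of_ne_zero h2
    obtain ⟨ha, hb⟩ := h n' 2 le_rfl (Or.inl (by omega))
    exact ⟨ha.free_digon, by simp only [Nat.succ_eq_add_one, Nat.add_sub_cancel]; omega⟩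
  · obtain ⟨r, rfl⟩ : ∃ r, l = 2 + r := ⟨l - 2, by omega⟩
    have e : 2 + r - 1 = r + 1 := by omega
    rw [e]
    obtain ⟨ha, hb⟩ := h n (r + 1) (by omega) (Or.inr ⟨rfl, by omega⟩)
    exact ⟨ha.free (by omega), by omega⟩

lemma atMost_stateCount (n r : ℕ) : AtMost (IsState n (r + 2) ∅ ∅) (stateCount n (r + 2)) ∧
    1 ≤ stateCount n (r + 2) ∧ stateCount n (r + 2) ≤ recBound n (r + 1) := by
  induction n using Nat.strong_induction_on generalizing r with
  | _ n ihn =>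
  induction r using Nat.strong_induction_on with
  | _ r ihr =>
  have H : ∀ n' l', 2 ≤ l' → n' < n ∨ (n' = n ∧ l' < r + 2) →
      AtMost (IsState n' l' ∅ ∅) (stateCount n' l') ∧ 1 ≤ stateCount n' l' := by
    intro n' l' hl' hh
    obtain ⟨x, rfl⟩ : ∃ x, l' = x + 2 := ⟨l' - 2, by omega⟩
    rcases hh with hh | ⟨rfl, hh⟩
    · exact ⟨(ihn n' hh x).1, (ihn n' hh x).2.1⟩
    · exact ⟨(ihr x (by omega)).1, (ihr x (by omega)).2.1⟩
  have e : 1 + (r + 1) = r + 2 := by omega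
  have hb := atMost_free (n := n) (l := 1 + (r + 1)) (by omega) fun n' l' hl' hh => H n' l' hl' (by omega)
  have hrec := atMost_isState (n := n) (r := r + 1) (a := stateCount) (b := freeCount) hb.1
    (fun n' hn' => (H n' (r + 1 + 2) (by omega) (Or.inl (by omega))).1)
    (fun x hx y hy h1 h2 => ⟨(atMost_free (by omega) fun n' l' hl' hh => H n' l' hl' (by omega)).1,
      (H _ _ (by omega) (by omega)).1⟩)
  rw [e] at hrec
  have hpos : 1 ≤ recBound n (r + 1) := by
    rw [recBound]
    have := hb.2
    omega
  rw [recBound, e] at *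
  exact one_le_of_atMost hrec hpos

lemma stateCount_le (n m : ℕ) : stateCount n (m + 2) ≤ (if m = 0 ∧ n = 0 then 1 else 0) +
      (if n = 0 then 0 else 2 * stateCount (n - 1) (m + 1 + 2)) +
      ∑ y ∈ Finset.range n, 4 * stateCount y 2 * stateCount (n - 1 - y) (m + 2) +
      ∑ x ∈ Finset.range m, ∑ y ∈ Finset.range (n + 1),
        2 * stateCount y (x + 2) * stateCount (n - y) (m - 1 - x + 2) := by
  set f : ℕ → ℕ → ℕ := fun x y =>
    if x = 0 ∧ y = 0 then 0 else freeCount y (x + 2) * stateCount (n - y) (m + 1 - x + 1) with hf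
  have h1 : ∑ x ∈ Finset.range (m + 1), ∑ y ∈ Finset.range (n + 1), f x y =
      ∑ y ∈ Finset.range n, 4 * stateCount y 2 * stateCount (n - 1 - y) (m + 2) +
      ∑ x ∈ Finset.range m, ∑ y ∈ Finset.range (n + 1),
        2 * stateCount y (x + 2) * stateCount (n - y) (m - 1 - x + 2) := by
    rw [Finset.sum_range_succ', add_comm]
    congr 1
    · rw [Finset.sum_range_succ']
      simp only [hf, and_self, if_true, add_zero, Nat.add_eq_zero_iff, one_ne_zero, and_false, if_false]
      refine Finset.sum_congr rfl fun y _ => ?_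
      rw [freeCount]
      simp only [zero_add, if_true, Nat.add_eq_zero_iff, one_ne_zero, and_false, if_false,
        Nat.add_sub_cancel, Nat.sub_zero]
      rw [show n - 1 - y = n - (y + 1) by omega]
    · refine Finset.sum_congr rfl fun x hx => Finset.sum_congr rfl fun y _ => ?_
      rw [Finset.mem_range] at hx
      simp only [hf, Nat.add_eq_zero_iff, one_ne_zero, and_false, false_and, if_false]
      rw [freeCount, if_neg (by omega)]
      rw [show x + 1 + 2 - 1 = x + 2 by omega, show m + 1 - (x + 1) + 1 = m - 1 - x + 2 by omega]
  have h2 : freeCount n (1 + (m + 1)) + ∑ x ∈ Finset.range (m + 1), ∑ y ∈ Finset.range (n + 1),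
      (if (x = 0 ∧ y = 0) ∨ (x + 1 = m + 1 ∧ y = n) then 0
        else freeCount y (x + 2) * stateCount (n - y) (m + 1 - x + 1)) ≤
      (if m = 0 ∧ n = 0 then 1 else 0) + ∑ x ∈ Finset.range (m + 1), ∑ y ∈ Finset.range (n + 1), f x y := by
    have h3 : freeCount n (m + 2) ≤ (if m = 0 ∧ n = 0 then 1 else 0) + f m n := by
      simp only [hf]
      split_ifs with h
      · rw [h.1, h.2]
        simp [freeCount]
      · have : 1 ≤ stateCount 0 2 := (atMost_stateCount 0 0).2.1
        rw [Nat.sub_self, show m + 1 - m + 1 = 2 by omega]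
        nlinarith [Nat.zero_le (freeCount n (m + 2))]
    have h4 : f m n = ∑ x ∈ Finset.range (m + 1), ∑ y ∈ Finset.range (n + 1),
        if x = m ∧ y = n then f x y else 0 := by
      rw [Finset.sum_eq_single m, Finset.sum_eq_single n]
      · simp
      · intro y _ hy
        simp [hy]
      · simp
      · intro x _ hx
        simp [hx]
      · simp
    rw [show 1 + (m + 1) = m + 2 by omega]
    refine (add_le_add_left h3 _).trans ?_
    rw [add_assoc, h4, ← Finset.sum_add_distrib]
    refine add_le_add_right (Finset.sum_le_sum fun x _ => ?_) _
    rw [← Finset.sum_add_distrib]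
    refine Finset.sum_le_sum fun y _ => ?_
    by_cases h5 : x = m ∧ y = n
    · simp [h5]
    · simp [h5, hf]
  have := (atMost_stateCount n m).2.2
  rw [recBound] at this
  omega

/-- The number of classes of digons with a free root and `k` inner points. -/
theorem atMost_pow (k : ℕ) : ∃ c : ℕ, AtMost (IsState k 2 ∅ {0}) c ∧ (c : ℝ) ≤ 75 ^ k := by
  refine ⟨freeCount k 2, (atMost_free le_rfl fun n' l' hl' _ => ?_).1, ?_⟩
  · obtain ⟨x, rfl⟩ : ∃ x, l' = x + 2 := ⟨l' - 2, by omega⟩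
    exact ⟨(atMost_stateCount n' x).1, (atMost_stateCount n' x).2.1⟩
  rw [freeCount, if_pos rfl]
  split_ifs with hk
  · simp [hk]
  obtain ⟨n, rfl⟩ := Nat.exists_eq_succ_of_ne_zero hk
  have h1 := sum_le_superSol (a := fun n m => (stateCount n (m + 2) : ℝ)) (fun _ _ => Nat.cast_nonneg _)
    (fun n m => by exact_mod_cast stateCount_le n m) (n + 1) 0
  have h2 : (stateCount n 2 : ℝ) * (1 / 75) ^ n ≤ superSol 0 :=
    le_trans (Finset.single_le_sum (f := fun n => (stateCount n 2 : ℝ) * (1 / 75) ^ n)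
      (fun i _ => by positivity) (Finset.self_mem_range_succ n)) h1
  have h0 : superSol 0 = 225 / 169 := by norm_num [superSol, catalan_one]
  rw [h0, one_div, inv_pow, ← div_eq_mul_inv, div_le_iff₀ (by positivity)] at h2
  simp only [Nat.succ_eq_add_one, Nat.add_sub_cancel, pow_succ]
  push_cast
  nlinarith [pow_pos (by norm_num : (0 : ℝ) < 75) n]

lemma seventyFive_le : (75 : ℝ) ≤ 2 ^ (6.24 : ℝ) := by
  have h : (75 : ℝ) ^ (25 : ℕ) ≤ (2 ^ (6.24 : ℝ)) ^ (25 : ℕ) := by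
    rw [← Real.rpow_mul_natCast zero_le_two]
    have : (6.24 : ℝ) * (25 : ℕ) = (156 : ℕ) := by norm_num
    rw [this, Real.rpow_natCast]
    norm_num
  exact le_of_pow_le_pow_left₀ (by norm_num) (by positivity) h

section Start

open OnePoint

/-- The sphere is the one-point compactification of the plane, with any given point at infinity. -/
lemma exists_onePoint_homeomorph (x : Sphere2) : ∃ θ : OnePoint ℂ ≃ₜ Sphere2, θ ∞ = x := by
  have hx : ‖(x : EuclideanSpace ℝ (Fin 3))‖ = 1 := norm_eq_of_mem_sphere x
  have : Fact (Module.finrank ℝ (EuclideanSpace ℝ (Fin 3)) = 2 + 1) := ⟨by simp⟩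
  have hV : Module.finrank ℝ ℂ = Module.finrank ℝ (ℝ ∙ (x : EuclideanSpace ℝ (Fin 3)))ᗮ := by
    rw [Complex.finrank_real_complex, Submodule.finrank_orthogonal_span_singleton (n := 2)]
    exact fun h => by simp [h] at hx
  obtain ⟨e⟩ := FiniteDimensional.nonempty_continuousLinearEquiv_of_finrank_eq hV
  exact ⟨e.toHomeomorph.onePointCongr.trans (onePointHyperplaneHomeoUnitSphere hx), rfl⟩

lemma interior_eq_empty_of_injOn {A : Set Sphere2} {q : Sphere2 → ℝ} (hq : ContinuousOn q A)
    (hi : InjOn q A) : interior A = ∅ := by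
  by_contra hne
  rw [← ne_eq, ← nonempty_iff_ne_empty] at hne
  obtain ⟨θ, -⟩ := exists_onePoint_homeomorph hne.some
  have ho : IsOpen ((fun z : ℂ => θ z) ⁻¹' interior A) :=
    isOpen_interior.preimage (θ.continuous.comp continuous_coe)
  obtain ⟨a, ha⟩ := (θ.surjective.denseRange.comp (denseRange_coe (X := ℂ)) θ.continuous).exists_mem_open
    isOpen_interior hne
  obtain ⟨r, hr, hrA⟩ := Metric.isOpen_iff.1 ho a ha
  have hm : MapsTo (fun z : ℂ => θ ((a + (r / 2 : ℝ) * z : ℂ) : OnePoint ℂ)) (sphere 0 1) A := fun z hz => by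
    refine interior_subset (hrA ?_)
    have : ‖z‖ = 1 := by simpa using hz
    simp [this, abs_of_pos hr, hr]
  refine not_injOn_circle (hq.comp (θ.continuous.comp
    (continuous_coe.comp (by fun_prop))).continuousOn hm) fun z hz w hw h => ?_
  simpa [hr.ne'] using θ.injective (hi (hm hz) (hm hw) h)

variable {V : Type*} [Fintype V] {G : SimpleGraph V}

lemma SphereEmbedding.exists_notMem_image (D : SphereEmbedding G) :
    IsClosed D.image ∧ ∃ x, x ∉ D.image := by
  have harc : ∀ e ∈ G.edgeSet, IsClosed (D.arc e) ∧ interior (D.arc e) = ∅ := fun e he => by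
    induction e with | _ v w
    obtain ⟨f, hf, hfi, -, -, hA⟩ := D.arc_isArc _ he v w rfl
    rw [← hA]
    exact ⟨(isCompact_Icc.image_of_continuousOn hf).isClosed,
      interior_eq_empty_of_injOn (continuousOn_invFunOn isCompact_Icc hf hfi)
      hfi.bijOn_image.invOn_invFunOn.2.injOn⟩
  refine ⟨(finite_range _).isClosed.union ((toFinite _).isClosed_biUnion fun e he => (harc e he).1), ?_⟩
  by_contra! hall
  have : Nonempty Sphere2 := ⟨⟨EuclideanSpace.single 0 1, by simp⟩⟩
  obtain ⟨i, hi⟩ := nonempty_interior_of_iUnion_of_closed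
    (f := Sum.elim (fun v => {D.pos v}) fun e : G.edgeSet => D.arc e)
    (by rintro (v | e); exacts [isClosed_singleton, (harc e e.2).1])
    (eq_univ_of_forall fun x => by
      rcases hall x with ⟨v, rfl⟩ | h
      · exact mem_iUnion.2 ⟨.inl v, rfl⟩
      · obtain ⟨e, he, hx⟩ := mem_iUnion₂.1 h
        exact mem_iUnion.2 ⟨.inr ⟨e, he⟩, hx⟩)
  refine hi.ne_empty ?_
  rcases i with v | e
  · exact interior_eq_empty_of_injOn continuousOn_const (q := fun _ => 0) (injOn_singleton _ _)
  · exact (harc e e.2).2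

/-- A chart of the sphere whose unit disc contains the given drawing. -/
lemma SphereEmbedding.exists_chart (D : SphereEmbedding G) :
    ∃ θ : OnePoint ℂ ≃ₜ Sphere2, D.image ⊆ (fun z : ℂ => θ z) '' ball 0 1 := by
  obtain ⟨hcl, x, hx⟩ := D.exists_notMem_image
  obtain ⟨θ, rfl⟩ := exists_onePoint_homeomorph x
  set K : Set ℂ := (fun z : ℂ => θ z) ⁻¹' D.image with hK
  have hKi : (↑) '' K = θ ⁻¹' D.image := by
    ext p
    induction p with
    | infty => simpa using hx
    | coe z => simp [hK]
  have hKc : IsCompact K := (isClosed_image_coe.1 (hKi ▸ hcl.preimage θ.continuous)).2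
  obtain ⟨R, hR, hKR⟩ := hKc.isBounded.subset_ball_lt 0 0
  have hR' : (R : ℂ) ≠ 0 := by exact_mod_cast hR.ne'
  refine ⟨(Homeomorph.mulLeft₀ (R : ℂ) hR').onePointCongr.trans θ, fun y hy => ?_⟩
  obtain ⟨z, hz, hzy⟩ := hKi.symm.subset (show θ.symm y ∈ _ by simpa using hy)
  refine ⟨z / R, ?_, ?_⟩
  · have : ‖z‖ < R := by simpa using hKR hz
    simp [abs_of_pos hR, div_lt_one hR, this]
  · change θ ((R * (z / R) : ℂ) : OnePoint ℂ) = y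
    rw [mul_div_cancel₀ _ hR', hzy, θ.apply_symm_apply]

end Start

section Transport

open OnePoint

variable {V : Type*} {G : SimpleGraph V} {D D' : SphereEmbedding G}
  {θ θ' : OnePoint ℂ ≃ₜ Sphere2}

lemma SphereEmbedding.pos_mem_arc (D : SphereEmbedding G) {e : Sym2 V} (he : e ∈ G.edgeSet) {v : V}
    (hv : v ∈ e) : D.pos v ∈ D.arc e := by
  obtain ⟨w, rfl⟩ := hv
  obtain ⟨f, -, -, h0, -, hA⟩ := D.arc_isArc _ he v w rfl
  exact hA ▸ ⟨0, by simp, h0⟩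

/-- The points of a drawing in a chart, with two points added on the unit circle. -/
def SphereEmbedding.planePoints (D : SphereEmbedding G) (θ : OnePoint ℂ ≃ₜ Sphere2) : Set ℂ :=
  (fun z : ℂ => θ z) ⁻¹' range D.pos ∪ {1, -1}

/-- The edges of a drawing in a chart. -/
def SphereEmbedding.planeEdges (D : SphereEmbedding G) (θ : OnePoint ℂ ≃ₜ Sphere2) : Set (Set ℂ) :=
  (fun e => (fun z : ℂ => θ z) ⁻¹' D.arc e) '' G.edgeSet

lemma isOpenEmbedding_chart (θ : OnePoint ℂ ≃ₜ Sphere2) : IsOpenEmbedding fun z : ℂ => θ z :=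
  θ.isOpenEmbedding.comp isOpenEmbedding_coe

lemma SphereEmbedding.mem_ball_of_arc (hθ : D.image ⊆ (fun z : ℂ => θ z) '' ball 0 1) {e : Sym2 V}
    (he : e ∈ G.edgeSet) {z : ℂ} (hz : θ z ∈ D.arc e) : z ∈ ball (0 : ℂ) 1 :=
  (isOpenEmbedding_chart θ).injective.mem_set_image.1 (hθ (.inr (mem_iUnion₂.2 ⟨e, he, hz⟩)))

lemma SphereEmbedding.mem_ball_of_pos (hθ : D.image ⊆ (fun z : ℂ => θ z) '' ball 0 1) {z : ℂ}
    (hz : θ z ∈ range D.pos) : z ∈ ball (0 : ℂ) 1 :=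
  (isOpenEmbedding_chart θ).injective.mem_set_image.1 (hθ (.inl hz))

lemma SphereEmbedding.planePoints_inter_ball (hθ : D.image ⊆ (fun z : ℂ => θ z) '' ball 0 1) :
    D.planePoints θ ∩ id '' ball 0 1 = (fun z : ℂ => θ z) ⁻¹' range D.pos := by
  rw [image_id]
  refine Subset.antisymm ?_ fun z hz => ⟨.inl hz, mem_ball_of_pos hθ hz⟩
  rintro z ⟨hz | rfl | rfl, hz'⟩
  exacts [hz, by simp at hz', by simp at hz']

variable [Fintype V]

/-- A homeomorphism matching the vertices and edges of two drawings is an equivalence. -/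
lemma SphereEmbedding.equivEmb_of_image_eq (φ : Sphere2 ≃ₜ Sphere2)
    (hV : ∀ v, ∃ w, φ (D.pos v) = D'.pos w)
    (hE : ∀ e ∈ G.edgeSet, ∃ e' ∈ G.edgeSet, φ '' D.arc e = D'.arc e')
    (hE' : ∀ e' ∈ G.edgeSet, ∃ e ∈ G.edgeSet, φ '' D.arc e = D'.arc e') :
    SphereEmbedding.EquivEmb D D' := by
  choose σ hσ using hV
  have hinj : Function.Injective σ := fun v w h =>
    D.pos_inj (φ.injective (by rw [hσ, hσ, h]))
  have hmap : ∀ e ∈ G.edgeSet, ∀ e' ∈ G.edgeSet, φ '' D.arc e = D'.arc e' → e' = e.map σ := by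
    intro e he e' he' h
    have hmem : ∀ v ∈ e, σ v ∈ e' := fun v hv => D'.arc_vertex e' he' _
      (h ▸ ⟨_, D.pos_mem_arc he hv, hσ v⟩)
    induction e with | _ v w
    exact (Sym2.mem_and_mem_iff fun h => G.ne_of_adj he (hinj h)).1
      ⟨hmem v (by simp), hmem w (by simp)⟩
  refine ⟨φ, ⟨Equiv.ofBijective σ hinj.bijective_of_finite, fun {v w} => ⟨fun h => ?_, fun h => ?_⟩⟩,
    hσ, fun e he => ?_⟩
  · obtain ⟨e, he, h'⟩ := hE' s(σ v, σ w) h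
    have := hmap e he _ h h'
    rw [← Sym2.map_mk] at this
    exact (Sym2.map.injective hinj this ▸ he :)
  · obtain ⟨e', he', h'⟩ := hE s(v, w) h
    exact (hmap _ h e' he' h' ▸ he' :)
  · obtain ⟨e', he', h'⟩ := hE e he
    exact h'.trans (congrArg _ (hmap e he e' he' h'))

lemma SphereEmbedding.isPlane (hθ : D.image ⊆ (fun z : ℂ => θ z) '' ball 0 1) :
    IsPlane (D.planePoints θ) (D.planeEdges θ) := by
  have hg := isOpenEmbedding_chart θ
  have hP : ∀ {z : ℂ}, z ∈ ball (0 : ℂ) 1 → z ∈ D.planePoints θ → θ z ∈ range D.pos := fun hz hzP =>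
    (planePoints_inter_ball hθ).subset ⟨hzP, by simpa using hz⟩
  refine ⟨((finite_range _).preimage hg.injective.injOn).union (by simp), (toFinite _).image _, ?_, ?_, ?_⟩
  · rintro _ ⟨e, he, rfl⟩
    induction e with | _ v w
    obtain ⟨f, hf, hfi, h0, h1, hA⟩ := D.arc_isArc _ he v w rfl
    have hfA : ∀ t ∈ Icc (0 : ℝ) 1, f t ∈ D.arc s(v, w) := fun t ht => hA ▸ mem_image_of_mem _ ht
    have hex : ∀ t ∈ Icc (0 : ℝ) 1, ∃ z : ℂ, θ z = f t := fun t ht => by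
      obtain ⟨z, -, hz⟩ := hθ (.inr (mem_iUnion₂.2 ⟨_, he, hfA t ht⟩))
      exact ⟨z, hz⟩
    choose! p hp using hex
    refine ⟨p, (hg.isEmbedding.continuousOn_iff).2 (hf.congr hp), fun s hs t ht h =>
      hfi hs ht (by rw [← hp s hs, ← hp t ht, h]), .inl ⟨v, ?_⟩, .inl ⟨w, ?_⟩, fun t ht htP => ?_, ?_⟩
    · exact h0.symm.trans (hp 0 (by simp)).symm
    · exact h1.symm.trans (hp 1 (by simp)).symm
    · have ht' := Ioo_subset_Icc_self ht
      have hfe : θ (p t) ∈ D.arc s(v, w) := hp t ht' ▸ hfA t ht'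
      obtain ⟨u, hu⟩ := hP (mem_ball_of_arc hθ he hfe) htP
      rcases Sym2.mem_iff.1 (D.arc_vertex _ he u (hu ▸ hfe)) with rfl | rfl
      · exact ht.1.ne (hfi (by simp) ht' (by rw [h0, hu, hp t ht']))
      · exact ht.2.ne' (hfi (by simp) ht' (by rw [h1, hu, hp t ht']))
    · ext z
      rw [mem_preimage, ← hA]
      constructor
      · rintro ⟨t, ht, rfl⟩
        exact ⟨t, ht, (hp t ht).symm⟩
      · rintro ⟨t, ht, h⟩
        exact ⟨t, ht, hg.injective ((hp t ht).trans h)⟩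
  · rintro _ ⟨e, he, rfl⟩ _ ⟨f, hf, rfl⟩ hef z hz
    obtain ⟨v, -, -, hv⟩ := D.arc_inter e he f hf (fun h => hef (by rw [h])) hz
    exact .inl ⟨v, hv⟩
  · rintro _ ⟨e, he, rfl⟩ _ ⟨f, hf, rfl⟩ hef
    have hmem : ∀ v ∈ e, v ∈ f := fun v hv => by
      obtain ⟨z, -, hz : θ z = _⟩ := hθ (.inl ⟨v, rfl⟩)
      have h := hef.subset (⟨by simpa [hz] using D.pos_mem_arc he hv, .inl ⟨v, hz.symm⟩⟩ :
        z ∈ _ ∩ D.planePoints θ)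
      exact D.arc_vertex f hf v (hz ▸ h.1)
    induction e with | _ v w
    rw [(Sym2.mem_and_mem_iff (G.ne_of_adj he)).1 ⟨hmem v (by simp), hmem w (by simp)⟩]

lemma SphereEmbedding.isState (hθ : D.image ⊆ (fun z : ℂ => θ z) '' ball 0 1) :
    IsState (Fintype.card V) 2 ∅ {0} (D.planePoints θ) (D.planeEdges θ) id := by
  have hE : ∀ e ∈ D.planeEdges θ, ∀ t, circlePt 2 t ∉ e := by
    rintro _ ⟨e, he, rfl⟩ t ht
    simpa [norm_circlePt] using mem_ball_of_arc hθ he ht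
  have hP0 : circlePt 2 0 ∈ D.planePoints θ := .inr (by simp [circlePt_zero])
  have hP1 : circlePt 2 1 ∈ D.planePoints θ := .inr (by simp [circlePt_two_one])
  have hP2 : circlePt 2 2 ∈ D.planePoints θ := .inr (by simp [circlePt_self])
  have hfree : ∀ t, IsFree (D.planeEdges θ) (id '' ball 0 1) (circlePt 2 t) := fun t e he => hE e he.1 t
  refine ⟨⟨isPlane hθ, ⟨continuousOn_id, injOn_id _, by simp⟩, le_rfl, fun i hi =>
    isSide_of_avoid ?_ ?_ (fun t ht htP => ?_) fun e he t _ => hE e he _⟩, ?_, fun i hi _ => ?_,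
    fun i _ _ => hfree i⟩
  · interval_cases i <;> simpa [sidePath]
  · interval_cases i <;> simpa [sidePath, one_add_one_eq_two]
  · rcases htP with h | h
    · simpa [sidePath, norm_circlePt] using mem_ball_of_pos hθ h
    · have : ∃ j : ℕ, circlePt 2 (i + t) = circlePt 2 j := by
        rcases h with h | h
        · exact ⟨0, by simpa [sidePath, circlePt_zero] using h⟩
        · exact ⟨1, by simpa [sidePath, circlePt_two_one] using h⟩
      obtain ⟨j, hj⟩ := this
      obtain ⟨n, hn⟩ := (circlePt_eq_iff two_pos).1 hj
      have ht' : t = (j + n * 2 - i : ℤ) := by push_cast; linarith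
      have h1 : (0 : ℝ) < (j + n * 2 - i : ℤ) := ht' ▸ ht.1
      have h2 : ((j + n * 2 - i : ℤ) : ℝ) < (1 : ℤ) := by exact_mod_cast ht' ▸ ht.2
      rw [Int.cast_pos] at h1
      rw [Int.cast_lt] at h2
      omega
  · rw [planePoints_inter_ball hθ, ← ncard_image_of_injective _ (isOpenEmbedding_chart θ).injective,
      image_preimage_eq_of_subset fun x hx => ?_, ← image_univ, ncard_image_of_injective _ D.pos_inj,
      ncard_univ, Nat.card_eq_fintype_card]
    obtain ⟨z, -, hz⟩ := hθ (.inl hx)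
    exact ⟨z, hz⟩
  · refine (hfree i).isTight ⟨0, by simp, by simp [sidePath]⟩ ?_
    interval_cases i <;> simpa

/-- A homeomorphism of the closed unit disc which fixes the boundary extends to the sphere. -/
lemma exists_homeomorph_extend {ψ : ℂ → ℂ} (hc : ContinuousOn ψ (closedBall 0 1))
    (hi : InjOn ψ (closedBall 0 1)) (hb : ∀ z ∈ sphere (0 : ℂ) 1, ψ z = z)
    (hs : ψ '' closedBall 0 1 = closedBall 0 1) :
    ∃ Φ : OnePoint ℂ ≃ₜ OnePoint ℂ, ∀ z ∈ closedBall (0 : ℂ) 1, Φ z = ψ z := by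
  classical
  set Ψ : ℂ → ℂ := fun z => if z ∈ closedBall (0 : ℂ) 1 then ψ z else z with hΨ
  have h1 : EqOn Ψ ψ (closedBall 0 1) := fun z hz => if_pos hz
  have h2 : ∀ z ∉ closedBall (0 : ℂ) 1, Ψ z = z := fun z hz => if_neg hz
  have hmem : ∀ z, Ψ z ∈ closedBall (0 : ℂ) 1 ↔ z ∈ closedBall (0 : ℂ) 1 := fun z => by
    by_cases hz : z ∈ closedBall (0 : ℂ) 1
    · simp only [hz, iff_true, h1 hz]
      exact hs.subset ⟨z, hz, rfl⟩
    · rw [h2 z hz]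
  have hcont : Continuous Ψ := by
    refine continuous_if (fun z hz => hb z ?_) ?_ continuousOn_id
    · exact frontier_closedBall (0 : ℂ) one_ne_zero ▸ hz
    · exact (isClosed_closedBall (x := (0 : ℂ))).closure_eq.symm ▸ hc
  have hbij : Function.Bijective Ψ := by
    refine ⟨fun z w h => ?_, fun w => ?_⟩
    · by_cases hz : z ∈ closedBall (0 : ℂ) 1
      · have hw := (hmem w).1 (h ▸ (hmem z).2 hz)
        exact hi hz hw (by rw [← h1 hz, ← h1 hw, h])
      · grind
    · by_cases hw : w ∈ closedBall (0 : ℂ) 1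
      · obtain ⟨z, hz, rfl⟩ := hs.symm.subset hw
        exact ⟨z, h1 hz⟩
      · exact ⟨w, h2 w hw⟩
  have htop : Tendsto Ψ (coclosedCompact ℂ) (coclosedCompact ℂ) := by
    rw [coclosedCompact_eq_cocompact]
    exact tendsto_id.congr' (mem_of_superset (isCompact_closedBall (0 : ℂ) 1).compl_mem_cocompact
      fun z hz => (h2 z hz).symm)
  refine ⟨Continuous.homeoOfEquivCompactToT2 (f := (Equiv.optionCongr (Equiv.ofBijective Ψ hbij) :
    OnePoint ℂ ≃ OnePoint ℂ)) (continuous_map hcont htop), fun z hz => ?_⟩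
  exact congrArg _ (h1 hz)

lemma SphereEmbedding.equivEmb_of_discEquiv (hθ : D.image ⊆ (fun z : ℂ => θ z) '' ball 0 1)
    (hθ' : D'.image ⊆ (fun z : ℂ => θ' z) '' ball 0 1)
    (H : DiscEquiv (D.planePoints θ) (D.planeEdges θ) id (D'.planePoints θ') (D'.planeEdges θ') id) :
    SphereEmbedding.EquivEmb D D' := by
  obtain ⟨ψ, hc, hi, hb, hs, hP, hE⟩ := H
  rw [planePoints_inter_ball hθ, planePoints_inter_ball hθ'] at hP
  have hin : ∀ {D : SphereEmbedding G} {θ : OnePoint ℂ ≃ₜ Sphere2},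
      D.image ⊆ (fun z : ℂ => θ z) '' ball 0 1 →
      innerEdges (D.planeEdges θ) (id '' ball 0 1) = D.planeEdges θ ∧ ∀ e ∈ G.edgeSet,
        (fun z : ℂ => θ z) '' ((fun z : ℂ => θ z) ⁻¹' D.arc e) = D.arc e := by
    intro D θ hθ
    have hsub : ∀ e ∈ G.edgeSet,
        (fun z : ℂ => θ z) '' ((fun z : ℂ => θ z) ⁻¹' D.arc e) = D.arc e := fun e he =>
      image_preimage_eq_of_subset fun x hx =>
        image_subset_range _ _ (hθ (.inr (mem_iUnion₂.2 ⟨e, he, hx⟩)))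
    refine ⟨Subset.antisymm (fun e he => he.1) ?_, hsub⟩
    rintro _ ⟨e, he, rfl⟩
    refine ⟨⟨e, he, rfl⟩, ?_⟩
    induction e with | _ v w
    obtain ⟨z, hz, -⟩ := (hsub _ he).symm.subset (D.pos_mem_arc he (Sym2.mem_mk_left v w))
    exact ⟨z, hz, by simpa using mem_ball_of_arc hθ he hz⟩
  rw [(hin hθ).1, (hin hθ').1] at hE
  rw [image_id] at hc hi hs
  obtain ⟨Φ, hΦ⟩ := exists_homeomorph_extend hc hi hb hs
  have hφ : ∀ z ∈ closedBall (0 : ℂ) 1, (θ.symm.trans (Φ.trans θ')) (θ z) = θ' (ψ z) := fun z hz => by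
    simp [hΦ z hz]
  have hφE : ∀ e ∈ G.edgeSet, ∀ e' ∈ G.edgeSet, ψ '' ((fun z : ℂ => θ z) ⁻¹' D.arc e) =
      (fun z : ℂ => θ' z) ⁻¹' D'.arc e' → (θ.symm.trans (Φ.trans θ')) '' D.arc e = D'.arc e' := by
    intro e he e' he' h
    rw [← (hin hθ).2 e he, ← (hin hθ').2 e' he', ← h, image_image, image_image]
    exact image_congr fun z hz => hφ z (ball_subset_closedBall (mem_ball_of_arc hθ he hz))
  refine equivEmb_of_image_eq (θ.symm.trans (Φ.trans θ')) (fun v => ?_) (fun e he => ?_) fun e' he' => ?_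
  · obtain ⟨z, hz, hzv : θ z = _⟩ := hθ (.inl ⟨v, rfl⟩)
    obtain ⟨w, hw⟩ := hP.subset ⟨z, ⟨v, hzv.symm⟩, rfl⟩
    exact ⟨w, by rw [← hzv, hφ z (ball_subset_closedBall hz), hw]⟩
  · obtain ⟨e', he', h⟩ := hE.subset ⟨_, ⟨e, he, rfl⟩, rfl⟩
    exact ⟨e', he', hφE e he e' he' h.symm⟩
  · obtain ⟨_, ⟨e, he, rfl⟩, h⟩ := hE.symm.subset ⟨e', he', rfl⟩
    exact ⟨e, he, hφE e he e' he' h⟩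

end Transport

/-- Every planar graph on `k` vertices has at most `2 ^ (6.24 k)` embeddings in the
sphere up to homeomorphism. -/
theorem stmt11 {V : Type*} [Fintype V] (G : SimpleGraph V) (k : ℕ)
    (hk : Fintype.card V = k) (hpl : G.IsPlanar) :
    (Nat.card (Quot (@SphereEmbedding.EquivEmb V G)) : ℝ) ≤ 2 ^ ((6.24 : ℝ) * k) := by
  obtain ⟨c, ⟨code, hlt, hcode⟩, hc⟩ := atMost_pow k
  choose θ hθ using fun D : SphereEmbedding G => D.exists_chart
  have hS := fun D => hk ▸ SphereEmbedding.isState (hθ D)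
  have hcard : Nat.card (Quot (@SphereEmbedding.EquivEmb V G)) ≤ c := by
    rw [← Nat.card_fin c]
    refine Nat.card_le_card_of_injective (fun q => ⟨_, hlt _ _ _ (hS q.out)⟩) fun q q' h => ?_
    rw [← q.out_eq, ← q'.out_eq]
    exact Quot.sound (SphereEmbedding.equivEmb_of_discEquiv (hθ _) (hθ _)
      (hcode _ _ _ _ _ _ (hS _) (hS _) (Fin.mk.inj h)))
  calc (Nat.card (Quot (@SphereEmbedding.EquivEmb V G)) : ℝ) ≤ c := by exact_mod_cast hcard
    _ ≤ 75 ^ k := hc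
    _ ≤ (2 ^ (6.24 : ℝ)) ^ k := pow_le_pow_left₀ (by norm_num) seventyFive_le k
    _ = 2 ^ ((6.24 : ℝ) * k) := (Real.rpow_mul_natCast zero_le_two _ _).symm

end
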